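/- Let χ be a Hecke character, let s = σ+it with σ > 1 and t ∈ ℝ, and for r > 0 set N_χ(r;s) := #{ρ = β+iγ : 0 < β < 1, L(ρ,χ)=0, |s−ρ| ≤ r} (zeros counted with multiplicity). Then for 0 < r ≤ 1, N_χ(r;s) ≤ { 4 log D_K + 2 log N𝔣_χ + 2 n_K log(|t|+3) + 2 n_K + 4 + 4δ(χ) } · r + 4 + 4δ(χ). -/

import Mathlib

open scoped BigOperators
open Complex NumberField Filter Topology

noncomputable section

namespace RTZ

/-- The degree `n_K = [K : ℚ]` of a number field. -/
def nK (K : Type*) [Field K] [NumberField K] : ℕ := Module.finrank ℚ K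

/-- The absolute value `D_K` of the discriminant of `K`. -/
def DK (K : Type*) [Field K] [NumberField K] : ℕ := (NumberField.discr K).natAbs

/-- An algebraic integer is totally positive if it is positive under every real embedding. -/
def TotPos (K : Type*) [Field K] [NumberField K] (α : 𝓞 K) : Prop :=
  ∀ φ : K →+* ℝ, 0 < φ (algebraMap (𝓞 K) K α)

/-- A Hecke (narrow ray class) character modulo `𝔮`, regarded as a function on integral
ideals extended by zero: it is completely multiplicative, vanishes on ideals not coprime
to `𝔮`, has modulus one on ideals coprime to `𝔮`, and is trivial on principal ideals
generated by totally positive elements `α ≡ 1 (mod 𝔮)`. -/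
structure HeckeChar (K : Type*) [Field K] [NumberField K] (𝔮 : Ideal (𝓞 K)) where
  toFun : Ideal (𝓞 K) → ℂ
  map_mul' : ∀ 𝔞 𝔟 : Ideal (𝓞 K), toFun (𝔞 * 𝔟) = toFun 𝔞 * toFun 𝔟
  eq_zero' : ∀ 𝔞 : Ideal (𝓞 K), ¬ IsCoprime 𝔞 𝔮 → toFun 𝔞 = 0
  norm_one' : ∀ 𝔞 : Ideal (𝓞 K), IsCoprime 𝔞 𝔮 → ‖toFun 𝔞‖ = 1
  ray_one' : ∀ α : 𝓞 K, TotPos K α → α - 1 ∈ 𝔮 → toFun (Ideal.span {α}) = 1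

variable {K : Type*} [Field K] [NumberField K]

/-- The trivial (principal) Hecke character condition. -/
def IsTrivialChar {𝔮 : Ideal (𝓞 K)} (χ : HeckeChar K 𝔮) : Prop :=
  ∀ 𝔞, IsCoprime 𝔞 𝔮 → χ.toFun 𝔞 = 1

open scoped Classical in
/-- `δ(χ)`: the indicator of the trivial character. -/
def delta {𝔮 : Ideal (𝓞 K)} (χ : HeckeChar K 𝔮) : ℝ :=
  if IsTrivialChar χ then 1 else 0

/-- `χ' (mod 𝔣)` induces `χ (mod 𝔮)`: `𝔣 ∣ 𝔮` and the two characters agree on ideals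
coprime to `𝔮`. -/
def Induces {𝔣 𝔮 : Ideal (𝓞 K)} (χ' : HeckeChar K 𝔣) (χ : HeckeChar K 𝔮) : Prop :=
  𝔮 ≤ 𝔣 ∧ ∀ 𝔞, IsCoprime 𝔞 𝔮 → χ.toFun 𝔞 = χ'.toFun 𝔞

/-- `𝔣` is the conductor `𝔣_χ` of `χ`: `χ` is induced from a character mod `𝔣`, and `𝔣`
divides every modulus from which `χ` is induced. -/
def IsConductor {𝔮 : Ideal (𝓞 K)} (χ : HeckeChar K 𝔮) (𝔣 : Ideal (𝓞 K)) : Prop :=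
  (∃ χ' : HeckeChar K 𝔣, Induces χ' χ) ∧
    ∀ 𝔣' : Ideal (𝓞 K), (∃ χ' : HeckeChar K 𝔣', Induces χ' χ) → 𝔣' ≤ 𝔣

/-- A Hecke character is primitive if its conductor equals its modulus. -/
def IsPrimitiveChar {𝔮 : Ideal (𝓞 K)} (χ : HeckeChar K 𝔮) : Prop := IsConductor χ 𝔮

/-- Two integral ideals lie in the same narrow ray class mod `𝔮`: `(α)𝔞 = (β)𝔟` for some
totally positive `α, β ≡ 1 (mod 𝔮)`. -/
def rayEquiv (𝔮 𝔞 𝔟 : Ideal (𝓞 K)) : Prop :=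
  ∃ α β : 𝓞 K, TotPos K α ∧ TotPos K β ∧ α - 1 ∈ 𝔮 ∧ β - 1 ∈ 𝔮 ∧
    Ideal.span {α} * 𝔞 = Ideal.span {β} * 𝔟

/-- A congruence class group `H (mod 𝔮)`: a subgroup of `I(𝔮)` containing `P_𝔮`, described
by the set of integral ideals whose narrow ray class lies in the subgroup. -/
structure CongClassGroup (K : Type*) [Field K] [NumberField K] (𝔮 : Ideal (𝓞 K)) where
  mem : Ideal (𝓞 K) → Prop
  coprime' : ∀ 𝔞, mem 𝔞 → IsCoprime 𝔞 𝔮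
  princ_mem' : ∀ α : 𝓞 K, TotPos K α → α - 1 ∈ 𝔮 → mem (Ideal.span {α})
  mul_mem' : ∀ 𝔞 𝔟, mem 𝔞 → mem 𝔟 → mem (𝔞 * 𝔟)
  class_mem' : ∀ 𝔞 𝔟, IsCoprime 𝔟 𝔮 → rayEquiv 𝔮 𝔞 𝔟 → mem 𝔞 → mem 𝔟

/-- `χ(H) = 1`: the character is trivial on the congruence class group `H`. -/
def CharTrivOn {𝔮 : Ideal (𝓞 K)} (χ : HeckeChar K 𝔮) (H : CongClassGroup K 𝔮) : Prop :=
  ∀ 𝔞, H.mem 𝔞 → χ.toFun 𝔞 = 1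

/-- The coset of `H` in `I(𝔮)` determined by an integral ideal `𝔞₀`. -/
def coset {𝔮 : Ideal (𝓞 K)} (H : CongClassGroup K 𝔮) (𝔞₀ : Ideal (𝓞 K)) :
    Set (Ideal (𝓞 K)) :=
  {𝔞 | ∃ 𝔥, H.mem 𝔥 ∧ rayEquiv 𝔮 (𝔞₀ * 𝔥) 𝔞}

/-- `h_H = [I(𝔮) : H]`, the number of cosets of `H`. -/
def hH {𝔮 : Ideal (𝓞 K)} (H : CongClassGroup K 𝔮) : ℕ :=
  Nat.card {C : Set (Ideal (𝓞 K)) // ∃ 𝔞₀, IsCoprime 𝔞₀ 𝔮 ∧ C = coset H 𝔞₀}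

/-- `Q = Q_H = max { N𝔣_χ : χ (mod 𝔮), χ(H) = 1 }`. -/
def QH {𝔮 : Ideal (𝓞 K)} (H : CongClassGroup K 𝔮) : ℕ :=
  sSup {n | ∃ (χ : HeckeChar K 𝔮) (𝔣 : Ideal (𝓞 K)),
    CharTrivOn χ H ∧ IsConductor χ 𝔣 ∧ n = Ideal.absNorm 𝔣}

/-- `𝔣_H = lcm { 𝔣_χ : χ(H) = 1 }` (the lcm of ideals is their infimum). -/
def fH {𝔮 : Ideal (𝓞 K)} (H : CongClassGroup K 𝔮) : Ideal (𝓞 K) :=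
  sInf {𝔣 | ∃ χ : HeckeChar K 𝔮, CharTrivOn χ H ∧ IsConductor χ 𝔣}

/-- A congruence class group `H (mod 𝔮)` is primitive if `𝔮 = 𝔣_H`. -/
def IsPrimitiveCCG {𝔮 : Ideal (𝓞 K)} (H : CongClassGroup K 𝔮) : Prop := 𝔮 = fH H

/-- The Dirichlet series `Σ_𝔫 χ(𝔫) N𝔫^{-s}` of a Hecke character. -/
def LSer {𝔮 : Ideal (𝓞 K)} (χ : HeckeChar K 𝔮) (s : ℂ) : ℂ :=
  ∑' 𝔞 : {I : Ideal (𝓞 K) // I ≠ ⊥}, χ.toFun 𝔞.1 * (Ideal.absNorm 𝔞.1 : ℂ) ^ (-s)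

/-- `L` is "the" Hecke `L`-function of `χ`: analytic away from `s = 1` and given by the
Dirichlet series on `Re s > 1` (this determines `L` away from `s = 1`). -/
def IsLFun {𝔮 : Ideal (𝓞 K)} (χ : HeckeChar K 𝔮) (L : ℂ → ℂ) : Prop :=
  (∀ s : ℂ, s ≠ 1 → DifferentiableAt ℂ L s) ∧ ∀ s : ℂ, 1 < s.re → L s = LSer χ s

/-- The Dedekind zeta series of `K`. -/
def zetaSer (K : Type*) [Field K] [NumberField K] (s : ℂ) : ℂ :=
  ∑' 𝔞 : {I : Ideal (𝓞 K) // I ≠ ⊥}, (Ideal.absNorm 𝔞.1 : ℂ) ^ (-s)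

/-- `Z` is "the" Dedekind zeta function of `K`. -/
def IsZetaFun (K : Type*) [Field K] [NumberField K] (Z : ℂ → ℂ) : Prop :=
  (∀ s : ℂ, s ≠ 1 → DifferentiableAt ℂ Z s) ∧ ∀ s : ℂ, 1 < s.re → Z s = zetaSer K s

/-- `L` vanishes at `ρ` to order at least `m`. -/
def ZeroOrderAtLeast (L : ℂ → ℂ) (ρ : ℂ) (m : ℕ) : Prop :=
  ∃ g : ℂ → ℂ, AnalyticAt ℂ g ρ ∧ ∀ᶠ z in nhds ρ, L z = (z - ρ) ^ m * g z

/-- `L` vanishes at `ρ` to order exactly `m`. -/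
def ZeroOrderExact (L : ℂ → ℂ) (ρ : ℂ) (m : ℕ) : Prop :=
  ∃ g : ℂ → ℂ, AnalyticAt ℂ g ρ ∧ g ρ ≠ 0 ∧ ∀ᶠ z in nhds ρ, L z = (z - ρ) ^ m * g z

open scoped Classical in
/-- The von Mangoldt function `Λ_K` of the field `K`. -/
def ΛK (K : Type*) [Field K] [NumberField K] (𝔫 : Ideal (𝓞 K)) : ℝ :=
  if h : ∃ (𝔭 : Ideal (𝓞 K)) (k : ℕ), 𝔭.IsPrime ∧ 𝔭 ≠ ⊥ ∧ 1 ≤ k ∧ 𝔫 = 𝔭 ^ k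
  then Real.log (Ideal.absNorm h.choose) else 0

/-- The residue `κ_K` of `ζ_K` at `s = 1`, characterized as a limit of the real Dirichlet
series. -/
def IsResidue (K : Type*) [Field K] [NumberField K] (κ : ℝ) : Prop :=
  Filter.Tendsto (fun σ : ℝ => (σ - 1) *
      ∑' 𝔞 : {I : Ideal (𝓞 K) // I ≠ ⊥}, (Ideal.absNorm 𝔞.1 : ℝ) ^ (-σ))
    (nhdsWithin 1 (Set.Ioi 1)) (nhds κ)

/-- `γ_K`, the Euler–Kronecker constant: `ζ_K(s) - κ_K/(s-1) → κ_K γ_K` as `s → 1⁺`. -/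
def IsEulerKronecker (K : Type*) [Field K] [NumberField K] (κ γK : ℝ) : Prop :=
  Filter.Tendsto (fun σ : ℝ =>
      (∑' 𝔞 : {I : Ideal (𝓞 K) // I ≠ ⊥}, (Ideal.absNorm 𝔞.1 : ℝ) ^ (-σ)) - κ / (σ - 1))
    (nhdsWithin 1 (Set.Ioi 1)) (nhds (κ * γK))

section Disc
open Metric

/-- A zero of a holomorphic function that is not identically zero can be divided out. -/
theorem exists_factor_zero {f : ℂ → ℂ} {R : ℝ} (hf : DifferentiableOn ℂ f (ball 0 R))
    (h0 : f 0 ≠ 0) {a : ℂ} (ha : a ∈ ball (0 : ℂ) R) :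
    ∃ (k : ℕ) (g : ℂ → ℂ), DifferentiableOn ℂ g (ball 0 R) ∧ g a ≠ 0 ∧
      ∀ z, f z = (z - a) ^ k * g z := by
  have hR : (0 : ℝ) < R := lt_of_le_of_lt (norm_nonneg a) (by simpa using ha)
  have hopen : IsOpen (ball (0 : ℂ) R) := isOpen_ball
  have hfa : AnalyticOnNhd ℂ f (ball 0 R) := hf.analyticOnNhd hopen
  obtain ⟨p, hp⟩ := hfa a ha
  have hp0 : p ≠ 0 := by
    rintro rfl
    have := hfa.eqOn_zero_of_preconnected_of_eventuallyEq_zero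
      (convex_ball (0 : ℂ) R).isPreconnected ha hp.eventually_eq_zero
    exact h0 (this (mem_ball_self hR))
  have hdiff : ∀ k : ℕ, DifferentiableOn ℂ ((Function.swap dslope a)^[k] f) (ball 0 R) := by
    intro k
    induction k with
    | zero => simpa using hf
    | succ k ih =>
      rw [Function.iterate_succ_apply']
      exact (Complex.differentiableOn_dslope (hopen.mem_nhds ha)).2 ih
  exact ⟨p.order, _, hdiff _, hp.iterate_dslope_fslope_ne_zero hp0,
    fun z => by simpa using hp.eq_pow_order_mul_iterate_dslope z⟩

/-- Finitely many zeros of a holomorphic function can be divided out. -/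
theorem exists_factor_zeros {f : ℂ → ℂ} {R : ℝ} (hf : DifferentiableOn ℂ f (ball 0 R))
    (h0 : f 0 ≠ 0) (Z : Finset ℂ) (hZ : ∀ a ∈ Z, a ∈ ball (0 : ℂ) R) :
    ∃ (k : ℂ → ℕ) (g : ℂ → ℂ), DifferentiableOn ℂ g (ball 0 R) ∧ (∀ a ∈ Z, g a ≠ 0) ∧
      ∀ z, f z = (∏ a ∈ Z, (z - a) ^ k a) * g z := by
  classical
  induction Z using Finset.induction_on with
  | empty => exact ⟨0, f, hf, by simp, by simp⟩
  | insert a Z haZ ih =>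
    obtain ⟨k, g, hg, hgZ, hfg⟩ := ih fun b hb => hZ b (Finset.mem_insert_of_mem hb)
    have hg0 : g 0 ≠ 0 := fun h => h0 (by rw [hfg, h, mul_zero])
    obtain ⟨j, q, hq, hqa, hgq⟩ := exists_factor_zero hg hg0 (hZ a (Finset.mem_insert_self _ _))
    refine ⟨Function.update k a j, q, hq, ?_, fun z => ?_⟩
    · intro b hb
      rcases Finset.mem_insert.1 hb with rfl | hb
      · exact hqa
      · intro h
        exact hgZ b hb (by rw [hgq, h, mul_zero])
    · rw [Finset.prod_insert haZ, hfg, hgq z, Function.update_self]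
      have : ∏ x ∈ Z, (z - x) ^ Function.update k a j x = ∏ x ∈ Z, (z - x) ^ k x :=
        Finset.prod_congr rfl fun x hx => by
          rw [Function.update_of_ne (ne_of_mem_of_not_mem hx haZ)]
      rw [this]; ring

/-- The zeros of a holomorphic function in a smaller closed disc are finite in number. -/
theorem finite_zeros_closedBall {f : ℂ → ℂ} {R ρ : ℝ} (hf : DifferentiableOn ℂ f (ball 0 R))
    (h0 : f 0 ≠ 0) (hρ : ρ < R) : {z | z ∈ closedBall (0 : ℂ) ρ ∧ f z = 0}.Finite := by
  by_contra hinf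
  have hsub : closedBall (0 : ℂ) ρ ⊆ ball 0 R := closedBall_subset_ball hρ
  obtain ⟨x, hx, hacc⟩ := Set.Infinite.exists_accPt_of_subset_isCompact hinf
    (isCompact_closedBall (0 : ℂ) ρ) (fun z hz => hz.1)
  have hfreq : ∃ᶠ z in 𝓝[≠] x, f z = 0 :=
    (accPt_iff_frequently_nhdsNE.1 hacc).mono fun z hz => hz.2
  have hR : (0 : ℝ) < R := lt_of_le_of_lt (norm_nonneg x) (by simpa using hsub hx)
  exact h0 ((hf.analyticOnNhd isOpen_ball).eqOn_zero_of_preconnected_of_frequently_eq_zero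
    (convex_ball (0 : ℂ) R).isPreconnected (hsub hx) hfreq (mem_ball_self hR))

/-- A zero-free holomorphic function on a disc has a holomorphic logarithm. -/
theorem exists_log_norm_eq_re {G : ℂ → ℂ} {R : ℝ} (hR : 0 < R)
    (hG : DifferentiableOn ℂ G (ball 0 R)) (hG0 : ∀ z ∈ ball (0 : ℂ) R, G z ≠ 0) :
    ∃ H : ℂ → ℂ, DifferentiableOn ℂ H (ball 0 R) ∧ deriv H 0 = deriv G 0 / G 0 ∧
      ∀ z ∈ ball (0 : ℂ) R, Real.log ‖G z‖ = (H z).re := by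
  have hopen : IsOpen (ball (0 : ℂ) R) := isOpen_ball
  have hmem : (0 : ℂ) ∈ ball (0 : ℂ) R := mem_ball_self hR
  have hd : DifferentiableOn ℂ (fun z => deriv G z / G z) (ball 0 R) :=
    (hG.deriv hopen).div hG hG0
  obtain ⟨h, hh0, hh⟩ := hd.isExactOn_ball.with_val_at 0 0
  have hconst : ∀ z ∈ ball (0 : ℂ) R, G z * cexp (-h z) = G 0 := by
    have hder : ∀ z ∈ ball (0 : ℂ) R, HasDerivAt (fun z => G z * cexp (-h z)) 0 z := by
      intro z hz
      have h1 := ((hG z hz).differentiableAt (hopen.mem_nhds hz)).hasDerivAt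
      refine (h1.mul (hh z hz).neg.cexp).congr_deriv ?_
      have e : G z * (deriv G z / G z) = deriv G z := mul_div_cancel₀ _ (hG0 z hz)
      linear_combination -cexp (-h z) * e
    intro z hz
    have := IsOpen.is_const_of_deriv_eq_zero (𝕜 := ℂ) hopen
      (convex_ball (0 : ℂ) R).isPreconnected
      (f := fun z => G z * cexp (-h z)) (fun z hz => (hder z hz).differentiableAt.differentiableWithinAt)
      (fun z hz => (hder z hz).deriv) hz hmem
    simpa [hh0] using this
  refine ⟨fun z => h z + (Real.log ‖G 0‖ : ℝ), fun z hz => ?_, ?_, fun z hz => ?_⟩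
  · exact ((hh z hz).differentiableAt.add_const _).differentiableWithinAt
  · simpa using (hh 0 hmem).deriv
  · have h1 : G z = G 0 * cexp (h z) := by
      rw [← hconst z hz, mul_assoc, ← Complex.exp_add]; simp
    rw [h1, norm_mul, Complex.norm_exp, Real.log_mul (norm_ne_zero_iff.2 (hG0 0 hmem))
      (Real.exp_ne_zero _), Real.log_exp]
    simp [add_comm]

/-- The first Fourier coefficient of `log |G|` on a circle, for zero-free `G`. -/
theorem integral_log_norm_mul_cos {G : ℂ → ℂ} {R ρ : ℝ} (hρ : 0 < ρ) (hρR : ρ < R)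
    (hG : DifferentiableOn ℂ G (ball 0 R)) (hG0 : ∀ z ∈ ball (0 : ℂ) R, G z ≠ 0) :
    ∫ θ in (0 : ℝ)..2 * Real.pi, Real.log ‖G (circleMap 0 ρ θ)‖ * Real.cos θ =
      Real.pi * ρ * (deriv G 0 / G 0).re := by
  obtain ⟨H, hH, hH', hlog⟩ := exists_log_norm_eq_re (hρ.trans hρR) hG hG0
  have hsub : closedBall (0 : ℂ) ρ ⊆ ball 0 R := closedBall_subset_ball hρR
  have h1 := (hH.mono hsub).deriv_eq_smul_circleIntegral hρ
  have h2 : (∮ z in C(0, ρ), H z) = 0 := by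
    apply Complex.circleIntegral_eq_zero_of_differentiable_on_off_countable hρ.le
      Set.countable_empty ((hH.mono hsub).continuousOn)
    intro z hz
    exact (hH z (ball_subset_ball hρR.le hz.1)).differentiableAt
      (isOpen_ball.mem_nhds (ball_subset_ball hρR.le hz.1))
  have hcm : ∀ θ : ℝ, circleMap 0 ρ θ ∈ ball (0 : ℂ) R := fun θ =>
    hsub (circleMap_mem_closedBall 0 hρ.le θ)
  have hHc : Continuous fun θ : ℝ => H (circleMap 0 ρ θ) :=
    hH.continuousOn.comp_continuous (continuous_circleMap 0 ρ) hcm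
  have hρ' : (ρ : ℂ) ≠ 0 := by exact_mod_cast hρ.ne'
  have e1 : ∫ θ in (0 : ℝ)..2 * Real.pi, cexp (-(θ * I)) * H (circleMap 0 ρ θ) =
      2 * Real.pi * ρ * deriv H 0 := by
    have : (∮ z in C(0, ρ), (1 / (z - 0) ^ 2) • H z) =
        I / ρ * ∫ θ in (0 : ℝ)..2 * Real.pi, cexp (-(θ * I)) * H (circleMap 0 ρ θ) := by
      rw [circleIntegral, ← intervalIntegral.integral_const_mul]
      apply intervalIntegral.integral_congr
      intro θ _
      simp only [deriv_circleMap, circleMap, sub_zero, zero_add, smul_eq_mul, Complex.exp_neg]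
      field_simp [Complex.exp_ne_zero]
    rw [this] at h1
    have hI : I / (ρ : ℂ) ≠ 0 := div_ne_zero I_ne_zero hρ'
    apply mul_left_cancel₀ hI
    rw [h1, smul_eq_mul]
    field_simp
  have e2 : ∫ θ in (0 : ℝ)..2 * Real.pi, cexp (θ * I) * H (circleMap 0 ρ θ) = 0 := by
    have : (∮ z in C(0, ρ), H z) =
        (I * ρ) * ∫ θ in (0 : ℝ)..2 * Real.pi, cexp (θ * I) * H (circleMap 0 ρ θ) := by
      rw [circleIntegral, ← intervalIntegral.integral_const_mul]
      apply intervalIntegral.integral_congr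
      intro θ _
      simp only [deriv_circleMap, circleMap, zero_add, smul_eq_mul]
      ring
    rw [this] at h2
    exact (mul_eq_zero.1 h2).resolve_left (mul_ne_zero I_ne_zero hρ')
  have e3 : ∫ θ in (0 : ℝ)..2 * Real.pi, (Real.cos θ : ℂ) * H (circleMap 0 ρ θ) =
      Real.pi * ρ * deriv H 0 := by
    have i1 : IntervalIntegrable (fun θ : ℝ => cexp (-(θ * I)) * H (circleMap 0 ρ θ))
      MeasureTheory.volume 0 (2 * Real.pi) :=
      (Continuous.mul (by fun_prop) hHc).intervalIntegrable _ _
    have i2 : IntervalIntegrable (fun θ : ℝ => cexp (θ * I) * H (circleMap 0 ρ θ))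
      MeasureTheory.volume 0 (2 * Real.pi) :=
      (Continuous.mul (by fun_prop) hHc).intervalIntegrable _ _
    have := intervalIntegral.integral_add i1 i2
    rw [e1, e2] at this
    have h3 : ∫ θ in (0 : ℝ)..2 * Real.pi, (Real.cos θ : ℂ) * H (circleMap 0 ρ θ) =
        (1 / 2) * ∫ θ in (0 : ℝ)..2 * Real.pi,
          (cexp (-(θ * I)) * H (circleMap 0 ρ θ) + cexp (θ * I) * H (circleMap 0 ρ θ)) := by
      rw [← intervalIntegral.integral_const_mul]
      apply intervalIntegral.integral_congr
      intro θ _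
      simp only [Complex.ofReal_cos, Complex.cos, neg_mul]
      ring
    rw [h3, this]; ring
  have e4 := congrArg Complex.re e3
  have h5 : (∫ θ in (0 : ℝ)..2 * Real.pi, (Real.cos θ : ℂ) * H (circleMap 0 ρ θ)).re =
      ∫ θ in (0 : ℝ)..2 * Real.pi, ((Real.cos θ : ℂ) * H (circleMap 0 ρ θ)).re :=
    (Complex.reCLM.intervalIntegral_comp_comm
      ((Continuous.mul (by fun_prop) hHc).intervalIntegrable _ _)).symm
  rw [h5, hH'] at e4
  have h6 : ((Real.pi : ℂ) * ρ * (deriv G 0 / G 0)).re = Real.pi * ρ * (deriv G 0 / G 0).re := by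
    rw [← Complex.ofReal_mul, Complex.re_ofReal_mul]
  rw [← h6, ← e4]
  apply intervalIntegral.integral_congr
  intro θ _
  simp only [Complex.re_ofReal_mul, hlog _ (hcm θ)]
  ring

end Disc

section Disc
open Metric

theorem norm_blaschke_denom {a z : ℂ} {ρ : ℝ} (hρ : 0 < ρ) (hz : ‖z‖ = ρ) :
    ‖(ρ : ℂ) - (starRingEnd ℂ) a * z / ρ‖ = ‖z - a‖ := by
  have hρ' : (ρ : ℂ) ≠ 0 := by exact_mod_cast hρ.ne'
  have h1 : (starRingEnd ℂ) z * z = (ρ : ℂ) ^ 2 := by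
    rw [mul_comm, Complex.mul_conj, Complex.normSq_eq_norm_sq, hz]; push_cast; rfl
  have h2 : (ρ : ℂ) - (starRingEnd ℂ) a * z / ρ = (starRingEnd ℂ) (z - a) * z / ρ := by
    field_simp
    rw [map_sub]
    linear_combination -h1
  rw [h2, norm_div, norm_mul, hz, RCLike.norm_conj]
  simp [abs_of_pos hρ, hρ.ne']

theorem le_of_zeroOrderAtLeast {f q : ℂ → ℂ} {a : ℂ} {m k : ℕ} (h : ZeroOrderAtLeast f a m)
    (hq : AnalyticAt ℂ q a) (hqa : q a ≠ 0) (hf : ∀ z, f z = (z - a) ^ k * q z) : m ≤ k := by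
  obtain ⟨g, hg, hfg⟩ := h
  have hfa : AnalyticAt ℂ f a := by
    have : f = fun z => (z - a) ^ k * q z := funext hf
    rw [this]; fun_prop
  have h1 : (m : ℕ∞) ≤ analyticOrderAt f a :=
    (natCast_le_analyticOrderAt hfa).2 ⟨g, hg, by simpa using hfg⟩
  have h2 : analyticOrderAt f a = k :=
    hfa.analyticOrderAt_eq_natCast.2 ⟨q, hq, hqa, Eventually.of_forall fun z => by simpa using hf z⟩
  rw [h2] at h1
  exact_mod_cast h1

/-- The weight with which a zero at `c - w` enters the logarithmic derivative at the centre `c` of a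
disc of radius `R`. -/
def discWeight (R : ℝ) (w : ℂ) : ℝ := (w⁻¹).re - w.re / R ^ 2

theorem discWeight_nonneg {R : ℝ} {w : ℂ} (hw0 : w ≠ 0) (hw : ‖w‖ ≤ R) (hre : 0 ≤ w.re) :
    0 ≤ discWeight R w := by
  have h1 : 0 < ‖w‖ := norm_pos_iff.2 hw0
  rw [discWeight, Complex.inv_re, Complex.normSq_eq_norm_sq, sub_nonneg]
  exact div_le_div_of_nonneg_left hre (by positivity) (by gcongr)

/-- Jensen-type formula for the logarithmic derivative at the centre of a disc. -/
theorem sum_discWeight_le_of_sphere {f : ℂ → ℂ} {R ρ : ℝ} (hρ : 0 < ρ) (hρR : ρ < R)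
    (hf : DifferentiableOn ℂ f (ball 0 R)) (h0 : f 0 ≠ 0) (hs : ∀ z, ‖z‖ = ρ → f z ≠ 0)
    (hre : ∀ z ∈ ball (0 : ℂ) R, f z = 0 → z.re ≤ 0) (S : Finset ℂ) (m : ℂ → ℕ)
    (hS : ∀ a ∈ S, a ∈ ball (0 : ℂ) ρ ∧ f a = 0 ∧ ZeroOrderAtLeast f a (m a)) :
    ∑ a ∈ S, (m a : ℝ) * discWeight ρ (-a) ≤ (deriv f 0 / f 0).re -
      1 / (Real.pi * ρ) * ∫ θ in (0 : ℝ)..2 * Real.pi,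
        Real.log ‖f (circleMap 0 ρ θ)‖ * Real.cos θ := by
  have hfin := finite_zeros_closedBall hf h0 hρR
  set Z := hfin.toFinset with hZdef
  have hZmem : ∀ a, a ∈ Z ↔ ‖a‖ ≤ ρ ∧ f a = 0 := fun a => by simp [hZdef]
  have hZlt : ∀ a ∈ Z, ‖a‖ < ρ := fun a ha =>
    lt_of_le_of_ne ((hZmem a).1 ha).1 fun h => hs a h ((hZmem a).1 ha).2
  have hZne : ∀ a ∈ Z, a ≠ 0 := by
    rintro a ha rfl
    exact h0 ((hZmem 0).1 ha).2
  have hopen : IsOpen (ball (0 : ℂ) R) := isOpen_ball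
  have hR : 0 < R := hρ.trans hρR
  have hρ' : (ρ : ℂ) ≠ 0 := by exact_mod_cast hρ.ne'
  obtain ⟨k, g, hg, hgZ, hfg⟩ := exists_factor_zeros hf h0 Z fun a ha => by
    simpa using (hZlt a ha).trans hρR
  set B : ℂ → ℂ → ℂ := fun a z => (ρ : ℂ) - (starRingEnd ℂ) a * z / ρ with hB
  set G : ℂ → ℂ := fun z => (∏ a ∈ Z, B a z ^ k a) * g z with hG
  have hBd : ∀ a, Differentiable ℂ (B a) := fun a => by simp only [hB]; fun_prop
  have hGd : DifferentiableOn ℂ G (ball 0 R) :=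
    (DifferentiableOn.fun_finsetProd fun a _ => ((hBd a).pow _).differentiableOn).mul hg
  have hB0 : ∀ a ∈ Z, ∀ z, ‖z‖ ≤ ρ → B a z ≠ 0 := by
    intro a ha z hz h
    have h1 : (starRingEnd ℂ) a * z = (ρ : ℂ) * ρ := by
      have : (ρ : ℂ) = (starRingEnd ℂ) a * z / ρ := sub_eq_zero.1 h
      field_simp at this
      rw [← this]; ring
    have h2 := congrArg norm h1
    rw [norm_mul, norm_mul, RCLike.norm_conj, Complex.norm_of_nonneg hρ.le] at h2
    have := hZlt a ha
    nlinarith [norm_nonneg a, norm_nonneg z]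
  have hg0 : ∀ z, ‖z‖ ≤ ρ → g z ≠ 0 := by
    intro z hz h
    have hfz : f z = 0 := by rw [hfg, h, mul_zero]
    exact hgZ z ((hZmem z).2 ⟨hz, hfz⟩) h
  have hG0 : ∀ z, ‖z‖ ≤ ρ → G z ≠ 0 := fun z hz =>
    mul_ne_zero (Finset.prod_ne_zero_iff.2 fun a ha => pow_ne_zero _ (hB0 a ha z hz)) (hg0 z hz)
  obtain ⟨R', hR', hR'R, hGR'⟩ : ∃ R', ρ < R' ∧ R' ≤ R ∧ ∀ z ∈ ball (0 : ℂ) R', G z ≠ 0 := by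
    have ho : IsOpen (ball (0 : ℂ) R ∩ G ⁻¹' {0}ᶜ) :=
      hGd.continuousOn.isOpen_inter_preimage hopen isOpen_compl_singleton
    obtain ⟨δ, hδ, hsub⟩ := (isCompact_closedBall (0 : ℂ) ρ).exists_thickening_subset_open ho
      fun z hz => ⟨closedBall_subset_ball hρR hz, hG0 z (by simpa using hz)⟩
    rw [thickening_closedBall hδ hρ.le] at hsub
    exact ⟨min (δ + ρ) R, lt_min (by linarith) hρR, min_le_right _ _, fun z hz =>
      (hsub (ball_subset_ball (min_le_left _ _) hz)).2⟩
  have hint := integral_log_norm_mul_cos hρ hR' (hGd.mono (ball_subset_ball hR'R)) hGR'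
  have hnorm : ∀ z, ‖z‖ = ρ → ‖G z‖ = ‖f z‖ := by
    intro z hz
    rw [hfg, hG]
    simp only [norm_mul, norm_prod, norm_pow]
    congr 1
    exact Finset.prod_congr rfl fun a _ => by rw [hB, norm_blaschke_denom hρ hz]
  have hint' : ∫ θ in (0 : ℝ)..2 * Real.pi, Real.log ‖f (circleMap 0 ρ θ)‖ * Real.cos θ =
      Real.pi * ρ * (deriv G 0 / G 0).re := by
    rw [← hint]
    apply intervalIntegral.integral_congr
    intro θ _
    simp only
    rw [hnorm _ (by simp [abs_of_pos hρ])]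
  have hg00 : g 0 ≠ 0 := hg0 0 (by simpa using hρ.le)
  have hgd0 : DifferentiableAt ℂ g 0 := (hg 0 (mem_ball_self hR)).differentiableAt
    (hopen.mem_nhds (mem_ball_self hR))
  have hlf : deriv f 0 / f 0 = (∑ a ∈ Z, (k a : ℂ) * (-a)⁻¹) + deriv g 0 / g 0 := by
    have hfe : f = fun z => (∏ a ∈ Z, (z - a) ^ k a) * g z := funext hfg
    have hne : ∀ a ∈ Z, ((0 : ℂ) - a) ^ k a ≠ 0 := fun a ha =>
      pow_ne_zero _ (by simpa using hZne a ha)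
    rw [← logDeriv_apply f, ← logDeriv_apply g, hfe,
      logDeriv_mul 0 (Finset.prod_ne_zero_iff.2 hne) hg00 (by fun_prop) hgd0]
    congr 1
    rw [logDeriv_prod hne (fun a _ => by fun_prop)]
    refine Finset.sum_congr rfl fun a _ => ?_
    rw [logDeriv_fun_pow (by fun_prop), logDeriv_apply]
    simp
  have hlG : deriv G 0 / G 0 =
      (∑ a ∈ Z, (k a : ℂ) * (-(starRingEnd ℂ) a / (ρ : ℂ) ^ 2)) + deriv g 0 / g 0 := by
    have hBp : ∀ a, DifferentiableAt ℂ (fun z => B a z ^ k a) 0 := fun a => (hBd a 0).fun_pow _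
    have hne : ∀ a ∈ Z, B a 0 ^ k a ≠ 0 := fun a ha =>
      pow_ne_zero _ (hB0 a ha 0 (by simpa using hρ.le))
    rw [← logDeriv_apply G, ← logDeriv_apply g, hG,
      logDeriv_mul 0 (Finset.prod_ne_zero_iff.2 hne) hg00
        (DifferentiableAt.fun_finsetProd fun a _ => hBp a) hgd0]
    congr 1
    rw [logDeriv_prod hne (fun a _ => hBp a)]
    refine Finset.sum_congr rfl fun a _ => ?_
    rw [logDeriv_fun_pow ((hBd a) 0), logDeriv_apply]
    congr 1
    have hd : HasDerivAt (B a) (-((starRingEnd ℂ) a / ρ)) 0 := by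
      have := (((hasDerivAt_id (0 : ℂ)).const_mul ((starRingEnd ℂ) a)).div_const (ρ : ℂ)).const_sub
        (ρ : ℂ)
      simpa using this
    rw [hd.deriv, hB]
    simp only [mul_zero, zero_div, sub_zero]
    field_simp
  have hkey : (deriv f 0 / f 0).re - (deriv G 0 / G 0).re =
      ∑ a ∈ Z, (k a : ℝ) * discWeight ρ (-a) := by
    rw [hlf, hlG, ← Complex.sub_re, add_sub_add_right_eq_sub, ← Finset.sum_sub_distrib,
      Complex.re_sum]
    refine Finset.sum_congr rfl fun a _ => ?_
    rw [← mul_sub, ← Complex.ofReal_natCast, Complex.re_ofReal_mul, discWeight, Complex.sub_re]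
    congr 2
    rw [← Complex.ofReal_pow, Complex.div_ofReal_re]
    simp
  have hπ := Real.pi_pos
  rw [hint', ← mul_assoc, one_div_mul_cancel (by positivity), one_mul, hkey]
  have hw : ∀ a ∈ Z, 0 ≤ discWeight ρ (-a) := fun a ha =>
    discWeight_nonneg (neg_ne_zero.2 (hZne a ha)) (by simpa using (hZlt a ha).le) (by
      simpa using hre a (by simpa using (hZlt a ha).trans hρR) ((hZmem a).1 ha).2)
  have hSZ : S ⊆ Z := fun a ha =>
    (hZmem a).2 ⟨by simpa using (mem_ball_zero_iff.1 (hS a ha).1).le, (hS a ha).2.1⟩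
  refine le_trans (Finset.sum_le_sum fun a ha => ?_)
    (Finset.sum_le_sum_of_subset_of_nonneg hSZ fun a ha _ => mul_nonneg (Nat.cast_nonneg _) (hw a ha))
  refine mul_le_mul_of_nonneg_right ?_ (hw a (hSZ ha))
  have haZ := hSZ ha
  have hamem : a ∈ ball (0 : ℂ) R := by simpa using (hZlt a haZ).trans hρR
  have : m a ≤ k a := by
    classical
    refine le_of_zeroOrderAtLeast (hS a ha).2.2
      (q := fun z => (∏ b ∈ Z.erase a, (z - b) ^ k b) * g z) ?_ ?_ fun z => ?_
    · exact (by fun_prop : AnalyticAt ℂ (fun z => ∏ b ∈ Z.erase a, (z - b) ^ k b) a).mul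
        (hg.analyticAt (hopen.mem_nhds hamem))
    · refine mul_ne_zero (Finset.prod_ne_zero_iff.2 fun b hb => pow_ne_zero _ ?_) (hgZ a haZ)
      exact sub_ne_zero.2 (Finset.ne_of_mem_erase hb).symm
    · rw [← mul_assoc, Finset.mul_prod_erase Z (fun b => (z - b) ^ k b) haZ, hfg]
  exact_mod_cast this

end Disc

section Disc
open Metric

theorem neg_integral_mul_cos_le {φ : ℝ → ℝ} (hφ : Continuous φ)
    (hper : Function.Periodic φ (2 * Real.pi)) {a b κ ρ : ℝ} (hρ : 0 < ρ) (hκ : 0 ≤ κ)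
    (hleft : ∀ θ, Real.cos θ ≤ 0 → φ θ ≤ a + b * (ρ * -Real.cos θ))
    (hright : ∀ θ, 0 < Real.cos θ → -(κ / (ρ * Real.cos θ)) ≤ φ θ) :
    -∫ θ in (0 : ℝ)..2 * Real.pi, φ θ * Real.cos θ ≤
      2 * a + b * ρ * (Real.pi / 2) + κ / ρ * Real.pi := by
  have hπ := Real.pi_pos
  have hper' : Function.Periodic (fun θ => φ θ * Real.cos θ) (2 * Real.pi) := by
    intro θ
    simp only [hper θ, Real.cos_add_two_pi]
  have h1 := hper'.intervalIntegral_add_eq 0 (-(Real.pi / 2))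
  rw [zero_add] at h1
  have hcont : Continuous fun θ => φ θ * Real.cos θ := hφ.mul Real.continuous_cos
  have hsplit := intervalIntegral.integral_add_adjacent_intervals
    (hcont.intervalIntegrable (μ := MeasureTheory.volume) (-(Real.pi / 2)) (Real.pi / 2))
    (hcont.intervalIntegrable (Real.pi / 2) (-(Real.pi / 2) + 2 * Real.pi))
  rw [h1, ← hsplit, neg_add, ← intervalIntegral.integral_neg, ← intervalIntegral.integral_neg]
  have i1 : ∫ θ in -(Real.pi / 2)..Real.pi / 2, -(φ θ * Real.cos θ) ≤
      ∫ _θ in -(Real.pi / 2)..Real.pi / 2, κ / ρ := by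
    refine intervalIntegral.integral_mono_on (by linarith) (hcont.neg.intervalIntegrable _ _)
      (by simp) fun θ hθ => ?_
    rcases (Real.cos_nonneg_of_mem_Icc hθ).eq_or_lt with h | h
    · rw [← h]; simp; positivity
    · have h2 := mul_le_mul_of_nonneg_right (hright θ h) h.le
      have h3 : -(κ / (ρ * Real.cos θ)) * Real.cos θ = -(κ / ρ) := by field_simp
      linarith
  have i2 : ∫ θ in Real.pi / 2..-(Real.pi / 2) + 2 * Real.pi, -(φ θ * Real.cos θ) ≤
      ∫ θ in Real.pi / 2..-(Real.pi / 2) + 2 * Real.pi,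
        (-a * Real.cos θ + b * ρ * Real.cos θ ^ 2) := by
    refine intervalIntegral.integral_mono_on (by linarith) (hcont.neg.intervalIntegrable _ _)
      (Continuous.intervalIntegrable (by fun_prop) _ _) fun θ hθ => ?_
    have h0 : Real.cos θ ≤ 0 := Real.cos_nonpos_of_pi_div_two_le_of_le hθ.1 (by linarith [hθ.2])
    have := mul_le_mul_of_nonneg_right (hleft θ h0) (neg_nonneg.2 h0)
    nlinarith
  have e1 : ∫ _θ in -(Real.pi / 2)..Real.pi / 2, κ / ρ = κ / ρ * Real.pi := by
    rw [intervalIntegral.integral_const, smul_eq_mul]; ring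
  have e2 : ∫ θ in Real.pi / 2..-(Real.pi / 2) + 2 * Real.pi,
        (-a * Real.cos θ + b * ρ * Real.cos θ ^ 2) = 2 * a + b * ρ * (Real.pi / 2) := by
    rw [intervalIntegral.integral_add (Continuous.intervalIntegrable (by fun_prop) _ _)
      (Continuous.intervalIntegrable (by fun_prop) _ _), intervalIntegral.integral_const_mul,
      intervalIntegral.integral_const_mul, integral_cos, integral_cos_sq, Real.sin_add_two_pi,
      Real.cos_add_two_pi, Real.sin_neg, Real.cos_neg, Real.sin_pi_div_two, Real.cos_pi_div_two]
    ring
  linarith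

theorem sum_discWeight_le_zero_center {f : ℂ → ℂ} {R a b κ : ℝ} (hR : 0 < R) (hκ : 0 ≤ κ)
    (hf : DifferentiableOn ℂ f (ball 0 R)) (h0 : f 0 ≠ 0)
    (hleft : ∀ z ∈ ball (0 : ℂ) R, z.re ≤ 0 → ‖f z‖ ≤ Real.exp (a + b * -z.re))
    (hright : ∀ z ∈ ball (0 : ℂ) R, 0 < z.re → Real.exp (-(κ / z.re)) ≤ ‖f z‖)
    (S : Finset ℂ) (m : ℂ → ℕ)
    (hS : ∀ w ∈ S, w ∈ ball (0 : ℂ) R ∧ f w = 0 ∧ ZeroOrderAtLeast f w (m w)) :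
    ∑ w ∈ S, (m w : ℝ) * discWeight R (-w) ≤
      (deriv f 0 / f 0).re + 2 * a / (Real.pi * R) + b / 2 + κ / R ^ 2 := by
  have hπ := Real.pi_pos
  obtain ⟨ρ₀, hρ₀, hρ₀R, hρ₀S⟩ : ∃ ρ₀, 0 < ρ₀ ∧ ρ₀ < R ∧ ∀ w ∈ S, ‖w‖ ≤ ρ₀ := by
    obtain ⟨x, hx⟩ : ∃ x, x ∈ Set.Ioo 0 R ∧ ∀ w ∈ S, ‖w‖ ≤ x := by
      rcases S.eq_empty_or_nonempty with rfl | hne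
      · exact ⟨R / 2, ⟨by linarith, by linarith⟩, by simp⟩
      · obtain ⟨w, hw, hmax⟩ := S.exists_max_image (fun w => ‖w‖) hne
        have : ‖w‖ < R := by simpa using (hS w hw).1
        refine ⟨max ‖w‖ (R / 2), ⟨lt_max_of_lt_right (by linarith), max_lt this (by linarith)⟩,
          fun v hv => (hmax v hv).trans (le_max_left _ _)⟩
    exact ⟨x, hx.1.1, hx.1.2, hx.2⟩
  have hre : ∀ z ∈ ball (0 : ℂ) R, f z = 0 → z.re ≤ 0 := by
    intro z hz hfz
    by_contra! h
    have := hright z hz h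
    rw [hfz, norm_zero] at this
    exact absurd this (not_le.2 (Real.exp_pos _))
  have hmain : ∀ ρ, ρ₀ < ρ → ρ < R → (∀ z, ‖z‖ = ρ → f z ≠ 0) →
      ∑ w ∈ S, (m w : ℝ) * discWeight ρ (-w) ≤
        (deriv f 0 / f 0).re + 2 * a / (Real.pi * ρ) + b / 2 + κ / ρ ^ 2 := by
    intro ρ hρ₁ hρR hs
    have hρ : 0 < ρ := hρ₀.trans hρ₁
    refine (sum_discWeight_le_of_sphere hρ hρR hf h0 hs hre S m fun w hw =>
      ⟨by simpa using (hρ₀S w hw).trans_lt hρ₁, (hS w hw).2⟩).trans ?_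
    have hcm : ∀ θ : ℝ, circleMap 0 ρ θ ∈ ball (0 : ℂ) R := fun θ =>
      closedBall_subset_ball hρR (circleMap_mem_closedBall 0 hρ.le θ)
    have hne : ∀ θ : ℝ, f (circleMap 0 ρ θ) ≠ 0 := fun θ => hs _ (by simp [abs_of_pos hρ])
    have hrec : ∀ θ : ℝ, (circleMap 0 ρ θ).re = ρ * Real.cos θ := fun θ => by
      simp [circleMap, Complex.exp_ofReal_mul_I_re]
    have := neg_integral_mul_cos_le (φ := fun θ => Real.log ‖f (circleMap 0 ρ θ)‖) (a := a) (b := b)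
      ((hf.continuousOn.comp_continuous (continuous_circleMap 0 ρ) hcm).norm.log
        fun θ => norm_ne_zero_iff.2 (hne θ)) (fun θ => by simp only [periodic_circleMap 0 ρ θ])
      hρ hκ (fun θ hθ => ?_) (fun θ hθ => ?_)
    · have h2 := mul_le_mul_of_nonneg_left this (by positivity : 0 ≤ 1 / (Real.pi * ρ))
      have h3 : 1 / (Real.pi * ρ) * (2 * a + b * ρ * (Real.pi / 2) + κ / ρ * Real.pi) =
          2 * a / (Real.pi * ρ) + b / 2 + κ / ρ ^ 2 := by field_simp
      rw [h3] at h2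
      linarith
    · have h1 := hleft _ (hcm θ) (by rw [hrec]; nlinarith)
      rw [hrec] at h1
      have h2 := Real.log_le_log (norm_pos_iff.2 (hne θ)) h1
      rw [Real.log_exp] at h2
      simpa using h2
    · have h1 := hright _ (hcm θ) (by rw [hrec]; positivity)
      rw [hrec] at h1
      have h2 := Real.log_le_log (Real.exp_pos _) h1
      rwa [Real.log_exp] at h2
  have hfreq : ∃ᶠ ρ in 𝓝[<] R, ∑ w ∈ S, (m w : ℝ) * discWeight ρ (-w) ≤
        (deriv f 0 / f 0).re + 2 * a / (Real.pi * ρ) + b / 2 + κ / ρ ^ 2 := by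
    rw [frequently_nhdsWithin_iff, (nhds_basis_Ioo R).frequently_iff]
    rintro ⟨l, u⟩ ⟨hl, hu⟩
    have hl' : max l ρ₀ < R := max_lt hl hρ₀R
    obtain ⟨ρ₁, h1, h1R⟩ := exists_between hl'
    have hfin := (finite_zeros_closedBall hf h0 h1R).image norm
    obtain ⟨ρ, ⟨hρa, hρb⟩, hρn⟩ := ((Set.Ioo_infinite h1).sdiff hfin).nonempty
    refine ⟨ρ, ⟨(le_max_left _ _).trans_lt hρa, hρb.trans (h1R.trans hu)⟩,
      hmain ρ ((le_max_right _ _).trans_lt hρa) (hρb.trans h1R) fun z hz hfz => hρn ?_,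
      hρb.trans h1R⟩
    exact ⟨z, ⟨by simpa [hz] using hρb.le, hfz⟩, hz⟩
  have hRne : R ≠ 0 := hR.ne'
  have hcont : ContinuousAt (fun ρ : ℝ => ∑ w ∈ S, (m w : ℝ) * discWeight ρ (-w) -
      ((deriv f 0 / f 0).re + 2 * a / (Real.pi * ρ) + b / 2 + κ / ρ ^ 2)) R := by
    unfold discWeight
    fun_prop (disch := positivity)
  have := le_of_tendsto_of_frequently (hcont.tendsto.mono_left nhdsWithin_le_nhds)
    (hfreq.mono fun ρ hρ => sub_nonpos.2 hρ)
  exact sub_nonpos.1 this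

/-- The zeros of `f` in a disc are controlled by the logarithmic derivative of `f` at the centre `c`,
an upper bound for `|f|` on the left half and a lower bound on the right half of the disc. -/
theorem sum_discWeight_le {f : ℂ → ℂ} {c : ℂ} {R a b κ : ℝ} (hR : 0 < R) (hκ : 0 ≤ κ)
    (hf : DifferentiableOn ℂ f (ball c R)) (h0 : f c ≠ 0)
    (hleft : ∀ z ∈ ball c R, z.re ≤ c.re → ‖f z‖ ≤ Real.exp (a + b * (c.re - z.re)))
    (hright : ∀ z ∈ ball c R, c.re < z.re → Real.exp (-(κ / (z.re - c.re))) ≤ ‖f z‖)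
    (S : Finset ℂ) (m : ℂ → ℕ)
    (hS : ∀ w ∈ S, w ∈ ball c R ∧ f w = 0 ∧ ZeroOrderAtLeast f w (m w)) :
    ∑ w ∈ S, (m w : ℝ) * discWeight R (c - w) ≤
      (deriv f c / f c).re + 2 * a / (Real.pi * R) + b / 2 + κ / R ^ 2 := by
  have hball : ∀ z, z ∈ ball (0 : ℂ) R ↔ z + c ∈ ball c R := fun z => by simp
  have hd : deriv (fun z => f (z + c)) 0 = deriv f c := by
    rw [deriv_comp_add_const, zero_add]
  have := sum_discWeight_le_zero_center (f := fun z => f (z + c)) (a := a) (b := b) hR hκ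
    (hf.comp (by fun_prop) fun z hz => (hball z).1 hz) (by simpa using h0)
    (fun z hz hre => by simpa using hleft (z + c) ((hball z).1 hz) (by simpa using hre))
    (fun z hz hre => by simpa using hright (z + c) ((hball z).1 hz) (by simpa using hre))
    (S.map ⟨fun w => w - c, sub_left_injective⟩) (fun w => m (w + c)) ?_
  · rw [hd, zero_add, Finset.sum_map] at this
    simpa using this
  · intro w hw
    simp only [Finset.mem_map, Function.Embedding.coeFn_mk] at hw
    obtain ⟨v, hv, rfl⟩ := hw
    obtain ⟨h1, h2, g, hg, hgv⟩ := hS v hv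
    refine ⟨(hball _).2 (by simpa using h1), by simpa using h2, fun z => g (z + c), ?_, ?_⟩
    · exact AnalyticAt.fun_comp (by simpa using hg) (by fun_prop)
    · have ht : Tendsto (fun z : ℂ => z + c) (𝓝 (v - c)) (𝓝 v) := by
        have : ContinuousAt (fun z : ℂ => z + c) (v - c) := by fun_prop
        simpa [ContinuousAt] using this
      filter_upwards [ht.eventually hgv] with z hz
      simp only [sub_add_cancel]
      rw [hz]; congr 2; ring

end Disc

section Euler
open IsDedekindDomain

variable (K : Type*) [Field K] [NumberField K]

/-- The nonzero integral ideals of `K`. -/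
abbrev NzIdeal : Type _ := {I : Ideal (𝓞 K) // I ≠ ⊥}

variable {K}

lemma NzIdeal.absNorm_pos (𝔞 : NzIdeal K) : 0 < Ideal.absNorm 𝔞.1 :=
  Nat.pos_of_ne_zero fun h => 𝔞.2 (Ideal.absNorm_eq_zero_iff.mp h)

lemma summable_card_norm {σ : ℝ} (hσ : 1 < σ) :
    LSeriesSummable (fun n => (Nat.card {I : Ideal (𝓞 K) // Ideal.absNorm I = n} : ℂ)) σ := by
  have h1 := ((Ideal.tendsto_norm_le_div_atTop₀ K).comp tendsto_natCast_atTop_atTop)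
  have h2 : Tendsto (fun n : ℕ => (∑ k ∈ Finset.Icc 1 n,
      (Nat.card {I : Ideal (𝓞 K) // Ideal.absNorm I = k} : ℝ)) / n) atTop
      (𝓝 (dedekindZeta_residue K)) := by
    refine h1.congr fun n ↦ ?_
    simp only [Function.comp_apply, Nat.cast_le, ← Nat.cast_sum]
    congr
    rw [← add_left_inj 1, ← Ideal.card_norm_le_eq_card_norm_le_add_one,
      show Finset.Icc 1 n = Finset.Ioc 0 n from Finset.Icc_succ_left_eq_Ioc _ _,
      show 1 = Nat.card {I : Ideal (𝓞 K) // Ideal.absNorm I = 0} by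
        simp [Ideal.absNorm_eq_zero_iff],
      Finset.sum_Ioc_add_eq_sum_Icc (n.zero_le),
      ← Finset.card_preimage_eq_sum_card_image_eq
        (fun k _ ↦ Ideal.finite_setOfPred_absNorm_eq k)]
    simp [Set.coe_eq_subtype]
  have h3 : (fun n : ℕ => ∑ k ∈ Finset.Icc 1 n,
      (Nat.card {I : Ideal (𝓞 K) // Ideal.absNorm I = k} : ℝ)) =O[atTop]
      fun n => (n : ℝ) ^ (1 : ℝ) := by
    simp only [Real.rpow_one]
    refine (h2.isBigO_one ℝ).mul (Asymptotics.isBigO_refl (fun n : ℕ => (n : ℝ)) atTop)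
      |>.congr' ?_ ?_
    · filter_upwards [eventually_gt_atTop 0] with n hn
      have : (n : ℝ) ≠ 0 := by positivity
      field_simp
    · simp
  exact LSeriesSummable_of_sum_norm_bigO_and_nonneg (r := 1) h3 (fun _ => by positivity)
    zero_le_one (by simpa using hσ)

lemma summable_norm_rpow {σ : ℝ} (hσ : 1 < σ) :
    Summable fun 𝔞 : NzIdeal K => (Ideal.absNorm 𝔞.1 : ℝ) ^ (-σ) := by
  rw [← (Equiv.sigmaFiberEquiv fun 𝔞 : NzIdeal K => Ideal.absNorm 𝔞.1).summable_iff,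
    summable_sigma_of_nonneg (fun _ => by simp; positivity)]
  have hfin : ∀ n : ℕ, Finite {I : Ideal (𝓞 K) // Ideal.absNorm I = n} := fun n =>
    Ideal.finite_setOfPred_absNorm_eq n
  have hinj : ∀ n : ℕ, Function.Injective
      (fun x : {𝔞 : NzIdeal K // Ideal.absNorm 𝔞.1 = n} =>
        (⟨x.1.1, x.2⟩ : {I : Ideal (𝓞 K) // Ideal.absNorm I = n})) := fun n x y h => by
    simpa [Subtype.ext_iff] using h
  have hfin' : ∀ n : ℕ, Finite {𝔞 : NzIdeal K // Ideal.absNorm 𝔞.1 = n} := fun n =>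
    Finite.of_injective _ (hinj n)
  refine ⟨fun n => Summable.of_finite, ?_⟩
  refine Summable.of_nonneg_of_le (fun n => tsum_nonneg fun _ => by simp; positivity) ?_
    (summable_card_norm (K := K) hσ).norm
  intro n
  have : Fintype {𝔞 : NzIdeal K // Ideal.absNorm 𝔞.1 = n} := Fintype.ofFinite _
  have hle : (Fintype.card {𝔞 : NzIdeal K // Ideal.absNorm 𝔞.1 = n} : ℝ) ≤
      Nat.card {I : Ideal (𝓞 K) // Ideal.absNorm I = n} := by
    rw [← Nat.card_eq_fintype_card]
    exact_mod_cast Nat.card_le_card_of_injective _ (hinj n)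
  have hterm : ∀ x : {𝔞 : NzIdeal K // Ideal.absNorm 𝔞.1 = n},
      (Ideal.absNorm x.1.1 : ℝ) ^ (-σ) = (n : ℝ) ^ (-σ) := fun x => by rw [x.2]
  rw [tsum_fintype]
  simp only [Function.comp_apply, Equiv.sigmaFiberEquiv_apply, hterm, Finset.sum_const,
    Finset.card_univ, nsmul_eq_mul]
  rcases Nat.eq_zero_or_pos n with rfl | hn
  · have : IsEmpty {𝔞 : NzIdeal K // Ideal.absNorm 𝔞.1 = 0} :=
      ⟨fun x => x.1.absNorm_pos.ne' x.2⟩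
    simp
  · rw [LSeries.norm_term_eq, if_neg hn.ne', Real.rpow_neg (by positivity)]
    simp only [norm_natCast, ofReal_re, div_eq_mul_inv]
    gcongr

/-- `𝔞 ↦ N𝔞 ^ (-s)` as a multiplicative map. -/
def normHom (K : Type*) [Field K] [NumberField K] (s : ℂ) : Ideal (𝓞 K) →* ℂ where
  toFun 𝔞 := (Ideal.absNorm 𝔞 : ℂ) ^ (-s)
  map_one' := by simp
  map_mul' 𝔞 𝔟 := by rw [map_mul, Nat.cast_mul, natCast_mul_natCast_cpow]

lemma norm_normHom (s : ℂ) (𝔞 : NzIdeal K) :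
    ‖normHom K s 𝔞.1‖ = (Ideal.absNorm 𝔞.1 : ℝ) ^ (-s.re) := by
  change ‖(Ideal.absNorm 𝔞.1 : ℂ) ^ (-s)‖ = _
  rw [norm_natCast_cpow_of_pos 𝔞.absNorm_pos, neg_re]

section Sieve
variable (a : Ideal (𝓞 K) →* ℂ)

open scoped Classical in
/-- The function `a` restricted to the ideals that have no divisor in `T`. -/
def sieve (T : Finset (HeightOneSpectrum (𝓞 K))) (𝔞 : NzIdeal K) : ℂ :=
  if ∀ P ∈ T, ¬ P.asIdeal ∣ 𝔞.1 then a 𝔞.1 else 0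

omit [NumberField K] in
lemma norm_sieve_le (T : Finset (HeightOneSpectrum (𝓞 K))) (𝔞 : NzIdeal K) :
    ‖sieve a T 𝔞‖ ≤ ‖a 𝔞.1‖ := by
  unfold sieve
  split_ifs <;> simp

variable {a}

omit [NumberField K] in
lemma summable_sieve (ha : Summable fun 𝔞 : NzIdeal K => ‖a 𝔞.1‖)
    (T : Finset (HeightOneSpectrum (𝓞 K))) : Summable (sieve a T) :=
  (Summable.of_nonneg_of_le (fun _ => norm_nonneg _) (norm_sieve_le a T) ha).of_norm

/-- Multiplication by a prime ideal. -/
def mulPrime (P : HeightOneSpectrum (𝓞 K)) (𝔞 : NzIdeal K) : NzIdeal K :=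
  ⟨P.asIdeal * 𝔞.1, mul_ne_zero P.ne_bot 𝔞.2⟩

lemma mulPrime_injective (P : HeightOneSpectrum (𝓞 K)) : Function.Injective (mulPrime P) := by
  intro x y h
  have := congrArg Subtype.val h
  exact Subtype.ext (mul_left_cancel₀ (show P.asIdeal ≠ 0 from P.ne_bot) this)

open scoped Classical in
lemma tsum_sieve_insert (ha : Summable fun 𝔞 : NzIdeal K => ‖a 𝔞.1‖)
    {T : Finset (HeightOneSpectrum (𝓞 K))} {P : HeightOneSpectrum (𝓞 K)} (hP : P ∉ T) :
    ∑' 𝔞, sieve a (insert P T) 𝔞 = (1 - a P.asIdeal) * ∑' 𝔞, sieve a T 𝔞 := by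
  have hsum := summable_sieve ha T
  have h1 : ∀ 𝔞, sieve a (insert P T) 𝔞 =
      sieve a T 𝔞 - if P.asIdeal ∣ 𝔞.1 then sieve a T 𝔞 else 0 := by
    intro 𝔞
    simp only [sieve, Finset.forall_mem_insert]
    by_cases h : P.asIdeal ∣ 𝔞.1 <;> simp [h]
  have hs2 : Summable fun 𝔞 : NzIdeal K => if P.asIdeal ∣ 𝔞.1 then sieve a T 𝔞 else 0 := by
    refine Summable.of_norm_bounded ha fun 𝔞 => ?_
    split_ifs
    · exact norm_sieve_le a T 𝔞
    · simp
  have h2 : ∑' 𝔞 : NzIdeal K, (if P.asIdeal ∣ 𝔞.1 then sieve a T 𝔞 else 0) =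
      ∑' 𝔞, a P.asIdeal * sieve a T 𝔞 := by
    rw [← (mulPrime_injective P).tsum_eq]
    · refine tsum_congr fun 𝔞 => ?_
      have : ∀ Q ∈ T, (Q.asIdeal ∣ P.asIdeal * 𝔞.1 ↔ Q.asIdeal ∣ 𝔞.1) := by
        intro Q hQ
        refine ⟨fun h => (Q.prime.dvd_or_dvd h).resolve_left fun h' => ?_,
          fun h => h.mul_left _⟩
        have hle := Ideal.dvd_iff_le.mp h'
        have := P.isMaximal.eq_of_le Q.isPrime.ne_top hle
        exact hP (by rwa [HeightOneSpectrum.ext this])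
      have h3 : (∀ Q ∈ T, ¬ Q.asIdeal ∣ (mulPrime P 𝔞).1) ↔ ∀ Q ∈ T, ¬ Q.asIdeal ∣ 𝔞.1 :=
        forall₂_congr fun Q hQ => not_congr (this Q hQ)
      rw [if_pos (show P.asIdeal ∣ (mulPrime P 𝔞).1 from Dvd.intro _ rfl)]
      simp only [sieve, h3]
      split_ifs
      · exact map_mul a _ _
      · simp
    · intro 𝔞 h𝔞
      have hd : P.asIdeal ∣ 𝔞.1 := by
        by_contra h
        simp [h] at h𝔞
      obtain ⟨𝔟, h𝔟⟩ := hd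
      refine ⟨⟨𝔟, fun h => 𝔞.2 ?_⟩, Subtype.ext h𝔟.symm⟩
      rw [h𝔟, h]
      exact Ideal.mul_bot _
  simp_rw [h1]
  rw [hsum.tsum_sub hs2, h2, tsum_mul_left]
  ring

lemma tsum_sieve (ha : Summable fun 𝔞 : NzIdeal K => ‖a 𝔞.1‖)
    (T : Finset (HeightOneSpectrum (𝓞 K))) :
    ∑' 𝔞, sieve a T 𝔞 = (∏ P ∈ T, (1 - a P.asIdeal)) * ∑' 𝔞 : NzIdeal K, a 𝔞.1 := by
  classical
  induction T using Finset.induction_on with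
  | empty => simp [sieve]
  | insert P T hP ih => rw [tsum_sieve_insert ha hP, ih, Finset.prod_insert hP]; ring

lemma tendsto_prod_mul_tsum (ha : Summable fun 𝔞 : NzIdeal K => ‖a 𝔞.1‖) :
    Tendsto (fun T : Finset (HeightOneSpectrum (𝓞 K)) =>
      (∏ P ∈ T, (1 - a P.asIdeal)) * ∑' 𝔞 : NzIdeal K, a 𝔞.1) atTop (𝓝 1) := by
  classical
  have h1 : ∑' 𝔞 : NzIdeal K, (if 𝔞.1 = ⊤ then (1 : ℂ) else 0) = 1 := by
    rw [tsum_eq_single ⟨⊤, top_ne_bot⟩]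
    · simp
    · intro 𝔞 h
      rw [if_neg fun h' => h (Subtype.ext h')]
  simp_rw [← tsum_sieve ha]
  rw [← h1]
  refine tendsto_tsum_of_dominated_convergence ha (fun 𝔞 => ?_)
    (Eventually.of_forall fun T 𝔞 => norm_sieve_le a T 𝔞)
  by_cases h : 𝔞.1 = ⊤
  · refine tendsto_const_nhds.congr fun T => ?_
    have : ∀ P ∈ T, ¬ P.asIdeal ∣ 𝔞.1 := fun P _ hd =>
      P.isPrime.ne_top (top_le_iff.mp (h ▸ Ideal.dvd_iff_le.mp hd))
    rw [if_pos h, sieve, if_pos this, h]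
    rw [← Ideal.one_eq_top, map_one]
  · obtain ⟨M, hM, hle⟩ := Ideal.exists_le_maximal 𝔞.1 h
    have hM0 : M ≠ ⊥ := fun h0 => 𝔞.2 (le_bot_iff.mp (h0 ▸ hle))
    refine tendsto_const_nhds.congr' ?_
    filter_upwards [eventually_ge_atTop {(⟨M, hM.isPrime, hM0⟩ : HeightOneSpectrum (𝓞 K))}]
      with T hT
    rw [if_neg h, sieve, if_neg]
    push Not
    exact ⟨_, hT (Finset.mem_singleton_self _), Ideal.dvd_iff_le.mpr hle⟩

end Sieve

end Euler

section Euler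
open IsDedekindDomain

lemma sum_rpow_neg_le {σ : ℝ} (hσ : 1 < σ) (N : ℕ) :
    ∑ i ∈ Finset.range N, ((i + 1 : ℕ) : ℝ) ^ (-σ) ≤ 1 + 1 / (σ - 1) := by
  have h0 : 0 < σ - 1 := by linarith
  rcases N with _ | N
  · simp; positivity
  rw [Finset.sum_range_succ']
  have h1 : ∑ i ∈ Finset.range N, (1 + ((i + 1 : ℕ) : ℝ)) ^ (-σ) ≤
      ∫ x in (1 : ℝ)..(1 + N), x ^ (-σ) := by
    refine AntitoneOn.sum_le_integral (f := fun x : ℝ => x ^ (-σ)) (x₀ := 1) ?_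
    intro x hx y hy hxy
    exact Real.rpow_le_rpow_of_nonpos (by linarith [hx.1]) hxy (by linarith)
  rw [integral_rpow (Or.inr ⟨by linarith, by
    rw [Set.uIcc_of_le (by linarith [N.cast_nonneg (α := ℝ)])]; intro h; linarith [h.1]⟩)] at h1
  have h2 : ((1 + (N : ℝ)) ^ (-σ + 1) - 1 ^ (-σ + 1)) / (-σ + 1) ≤ 1 / (σ - 1) := by
    rw [Real.one_rpow, show -σ + 1 = -(σ - 1) by ring, div_neg, ← neg_div]
    gcongr
    have : 0 ≤ (1 + (N : ℝ)) ^ (-(σ - 1)) := by positivity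
    linarith
  have h3 : ∑ i ∈ Finset.range N, ((i + 1 + 1 : ℕ) : ℝ) ^ (-σ) =
      ∑ i ∈ Finset.range N, (1 + ((i + 1 : ℕ) : ℝ)) ^ (-σ) :=
    Finset.sum_congr rfl fun i _ => by push_cast; ring_nf
  rw [h3]
  have h4 : ((0 + 1 : ℕ) : ℝ) ^ (-σ) = 1 := by simp
  rw [h4]
  exact (add_le_add_left (h1.trans h2) 1).trans_eq (add_comm _ _)

/-- `n ↦ n ^ (-σ)` as a multiplicative map. -/
def rpowHom (σ : ℝ) : ℕ →* ℝ where
  toFun n := (n : ℝ) ^ (-σ)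
  map_one' := by simp
  map_mul' m n := by rw [Nat.cast_mul, Real.mul_rpow (by positivity) (by positivity)]

lemma prod_primes_le {σ : ℝ} (hσ : 1 < σ) (T : Finset ℕ) (hT : ∀ p ∈ T, p.Prime) :
    ∏ p ∈ T, (1 - (p : ℝ) ^ (-σ))⁻¹ ≤ 1 + 1 / (σ - 1) := by
  have hs : Summable (rpowHom σ) := Real.summable_nat_rpow.mpr (by linarith)
  have h := EulerProduct.prod_filter_prime_geometric_eq_tsum_factoredNumbers hs T
  rw [Finset.filter_true_of_mem hT] at h
  change ∏ p ∈ T, (1 - rpowHom σ p)⁻¹ ≤ _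
  rw [h]
  refine (Summable.tsum_subtype_le (rpowHom σ) _ (fun n => by
    change 0 ≤ (n : ℝ) ^ (-σ); positivity) hs).trans ?_
  rw [hs.tsum_eq_zero_add, show rpowHom σ 0 = 0 by
    change ((0 : ℕ) : ℝ) ^ (-σ) = 0
    rw [Nat.cast_zero, Real.zero_rpow (by linarith)], zero_add]
  exact ((summable_nat_add_iff 1).mpr hs).tsum_le_of_sum_range_le (sum_rpow_neg_le hσ)

variable {K : Type*} [Field K] [NumberField K]

lemma one_lt_absNorm (P : HeightOneSpectrum (𝓞 K)) : 1 < Ideal.absNorm P.asIdeal := by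
  have h0 : Ideal.absNorm P.asIdeal ≠ 0 := fun h => P.ne_bot (Ideal.absNorm_eq_zero_iff.mp h)
  have h1 : Ideal.absNorm P.asIdeal ≠ 1 := fun h =>
    P.isPrime.ne_top (Ideal.absNorm_eq_one_iff.mp h)
  omega

/-- The rational prime below a prime ideal. -/
def primeBelow (P : HeightOneSpectrum (𝓞 K)) : ℕ := Ideal.absNorm (Ideal.under ℤ P.asIdeal)

omit [NumberField K] in
lemma primeBelow_prime (P : HeightOneSpectrum (𝓞 K)) : (primeBelow P).Prime := by
  have := P.isPrime
  have : NeZero P.asIdeal := ⟨P.ne_bot⟩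
  exact Nat.absNorm_under_prime _

lemma primeBelow_le (P : HeightOneSpectrum (𝓞 K)) : primeBelow P ≤ Ideal.absNorm P.asIdeal :=
  Nat.le_of_dvd (by linarith [one_lt_absNorm P]) (Int.absNorm_under_dvd_absNorm _)

open scoped Classical in
lemma card_primeBelow_le (T : Finset (HeightOneSpectrum (𝓞 K))) (p : ℕ) (hp : p.Prime) :
    (T.filter fun P => primeBelow P = p).card ≤ nK K := by
  set U := T.filter fun P => primeBelow P = p
  have hinj : Set.InjOn (fun P : HeightOneSpectrum (𝓞 K) => P.asIdeal) U :=
    fun _ _ _ _ h => HeightOneSpectrum.ext h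
  have hU : ∀ P ∈ U, primeBelow P = p := fun P hP => (Finset.mem_filter.mp hP).2
  have hdvd : ∏ P ∈ U, P.asIdeal ∣ Ideal.span {(p : 𝓞 K)} := by
    rw [← Finset.prod_image (f := fun I : Ideal (𝓞 K) => I) hinj]
    refine Finset.prod_primes_dvd _ (fun I hI => ?_) (fun I hI => ?_)
    · obtain ⟨P, -, rfl⟩ := Finset.mem_image.mp hI
      exact P.prime
    · obtain ⟨P, hP, rfl⟩ := Finset.mem_image.mp hI
      rw [Ideal.dvd_iff_le, Ideal.span_singleton_le_iff_mem, ← hU P hP]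
      exact Int.absNorm_under_mem _
  have h1 := Nat.le_of_dvd ?_ (map_dvd Ideal.absNorm hdvd)
  · rw [map_prod, Ideal.absNorm_span_natCast] at h1
    have h2 : p ^ U.card ≤ ∏ P ∈ U, Ideal.absNorm P.asIdeal := by
      rw [← Finset.prod_const]
      exact Finset.prod_le_prod' fun P hP => hU P hP ▸ primeBelow_le P
    have h3 := (Nat.pow_le_pow_iff_right hp.one_lt).mp (h2.trans h1)
    rwa [RingOfIntegers.rank] at h3
  · rw [Ideal.absNorm_span_natCast]
    exact pow_pos hp.pos _

variable (K) in
/-- The Dedekind zeta function on the real half-line `σ > 1`. -/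
def zetaR (σ : ℝ) : ℝ := ∑' 𝔞 : NzIdeal K, (Ideal.absNorm 𝔞.1 : ℝ) ^ (-σ)

lemma rpow_neg_lt_one {σ : ℝ} (hσ : 0 < σ) {n : ℕ} (hn : 1 < n) : (n : ℝ) ^ (-σ) < 1 :=
  Real.rpow_lt_one_of_one_lt_of_neg (by exact_mod_cast hn) (by linarith)

lemma tendsto_prod_mul_zetaR {σ : ℝ} (hσ : 1 < σ) :
    Tendsto (fun T : Finset (HeightOneSpectrum (𝓞 K)) =>
      (∏ P ∈ T, (1 - (Ideal.absNorm P.asIdeal : ℝ) ^ (-σ))) * zetaR K σ) atTop (𝓝 1) := by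
  have h := tendsto_prod_mul_tsum (a := normHom K σ)
    (by simpa only [norm_normHom, ofReal_re] using summable_norm_rpow hσ)
  have h1 : ∀ 𝔞 : Ideal (𝓞 K), normHom K σ 𝔞 = ((Ideal.absNorm 𝔞 : ℝ) ^ (-σ) : ℝ) := by
    intro 𝔞
    change (Ideal.absNorm 𝔞 : ℂ) ^ (-σ : ℂ) = _
    rw [ofReal_cpow (by positivity)]
    simp
  simp_rw [h1, ← ofReal_tsum] at h
  have h2 := (continuous_re.tendsto _).comp h
  refine h2.congr fun T => ?_
  rw [Function.comp_apply, zetaR]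
  norm_cast

lemma zetaR_le {σ : ℝ} (hσ : 1 < σ) : zetaR K σ ≤ (1 + 1 / (σ - 1)) ^ nK K := by
  classical
  have h0 : 0 < σ - 1 := by linarith
  refine (ge_of_tendsto' ((tendsto_prod_mul_zetaR (K := K) hσ).mul_const ((1 + 1 / (σ - 1)) ^ nK K))
    (fun T => ?_)).trans_eq (one_mul _)
  have hz : 0 ≤ zetaR K σ := tsum_nonneg fun _ => by positivity
  have hpos : ∀ P : HeightOneSpectrum (𝓞 K), 0 < 1 - (Ideal.absNorm P.asIdeal : ℝ) ^ (-σ) :=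
    fun P => by linarith [rpow_neg_lt_one (by linarith : 0 < σ) (one_lt_absNorm P)]
  suffices h : 1 ≤ (∏ P ∈ T, (1 - (Ideal.absNorm P.asIdeal : ℝ) ^ (-σ))) *
      (1 + 1 / (σ - 1)) ^ nK K by nlinarith
  have hb : ∏ P ∈ T, (1 - (Ideal.absNorm P.asIdeal : ℝ) ^ (-σ))⁻¹ ≤
      (1 + 1 / (σ - 1)) ^ nK K := by
    have hq : ∀ p ∈ T.image primeBelow, p.Prime := by
      intro p hp
      obtain ⟨P, -, rfl⟩ := Finset.mem_image.mp hp
      exact primeBelow_prime P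
    have hp1 : ∀ p ∈ T.image primeBelow, 1 ≤ (1 - (p : ℝ) ^ (-σ))⁻¹ := by
      intro p hp
      have := rpow_neg_lt_one (by linarith : 0 < σ) (hq p hp).one_lt
      rw [one_le_inv₀ (by linarith)]
      linarith [show 0 ≤ (p : ℝ) ^ (-σ) by positivity]
    calc ∏ P ∈ T, (1 - (Ideal.absNorm P.asIdeal : ℝ) ^ (-σ))⁻¹
        ≤ ∏ P ∈ T, (1 - (primeBelow P : ℝ) ^ (-σ))⁻¹ := by
          refine Finset.prod_le_prod (fun P _ => (inv_pos.mpr (hpos P)).le) fun P _ => ?_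
          have := rpow_neg_lt_one (by linarith : 0 < σ) (primeBelow_prime P).one_lt
          refine inv_anti₀ (by linarith) ?_
          have := Real.rpow_le_rpow_of_nonpos
            (show 0 < (primeBelow P : ℝ) by exact_mod_cast (primeBelow_prime P).pos)
            (show (primeBelow P : ℝ) ≤ Ideal.absNorm P.asIdeal by exact_mod_cast primeBelow_le P)
            (show -σ ≤ 0 by linarith)
          linarith
      _ = ∏ p ∈ T.image primeBelow, ((1 - (p : ℝ) ^ (-σ))⁻¹) ^
            (T.filter fun P => primeBelow P = p).card :=
          Finset.prod_comp (fun p : ℕ => (1 - (p : ℝ) ^ (-σ))⁻¹) primeBelow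
      _ ≤ ∏ p ∈ T.image primeBelow, ((1 - (p : ℝ) ^ (-σ))⁻¹) ^ nK K := by
          refine Finset.prod_le_prod (fun p hp => pow_nonneg (by linarith [hp1 p hp]) _)
            fun p hp => ?_
          exact pow_le_pow_right₀ (hp1 p hp) (card_primeBelow_le T p (hq p hp))
      _ = (∏ p ∈ T.image primeBelow, (1 - (p : ℝ) ^ (-σ))⁻¹) ^ nK K := Finset.prod_pow _ _ _
      _ ≤ _ := by
          refine pow_le_pow_left₀ (Finset.prod_nonneg fun p hp => ?_) (prod_primes_le hσ _ hq) _
          linarith [hp1 p hp]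
  calc (1 : ℝ) = (∏ P ∈ T, (1 - (Ideal.absNorm P.asIdeal : ℝ) ^ (-σ))) *
        ∏ P ∈ T, (1 - (Ideal.absNorm P.asIdeal : ℝ) ^ (-σ))⁻¹ := by
        rw [Finset.prod_inv_distrib, mul_inv_cancel₀]
        exact (Finset.prod_pos fun P _ => hpos P).ne'
    _ ≤ _ := by
        gcongr
        exact Finset.prod_nonneg fun P _ => (hpos P).le

end Euler

section Euler
open IsDedekindDomain

variable {K : Type*} [Field K] [NumberField K]

/-- The Dirichlet series of a multiplicative function on ideals. -/
def idealSer (f : Ideal (𝓞 K) →* ℂ) (s : ℂ) : ℂ :=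
  ∑' 𝔞 : NzIdeal K, f 𝔞.1 * (Ideal.absNorm 𝔞.1 : ℂ) ^ (-s)

variable {f : Ideal (𝓞 K) →* ℂ} (hf : ∀ I, ‖f I‖ ≤ 1)
include hf

lemma norm_mul_normHom_le (s : ℂ) (𝔞 : NzIdeal K) :
    ‖(f * normHom K s) 𝔞.1‖ ≤ (Ideal.absNorm 𝔞.1 : ℝ) ^ (-s.re) := by
  rw [MonoidHom.mul_apply, norm_mul, norm_normHom]
  exact mul_le_of_le_one_left (by positivity) (hf _)

lemma summable_norm_idealSer {s : ℂ} (hs : 1 < s.re) :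
    Summable fun 𝔞 : NzIdeal K => ‖(f * normHom K s) 𝔞.1‖ :=
  Summable.of_nonneg_of_le (fun _ => norm_nonneg _) (norm_mul_normHom_le hf s)
    (summable_norm_rpow hs)

lemma norm_idealSer_le {s : ℂ} (hs : 1 < s.re) : ‖idealSer f s‖ ≤ zetaR K s.re :=
  tsum_of_norm_bounded (summable_norm_rpow hs).hasSum (norm_mul_normHom_le hf s)

lemma tendsto_prod_mul_idealSer {s : ℂ} (hs : 1 < s.re) :
    Tendsto (fun T : Finset (HeightOneSpectrum (𝓞 K)) =>
      (∏ P ∈ T, (1 - (f * normHom K s) P.asIdeal)) * idealSer f s) atTop (𝓝 1) :=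
  tendsto_prod_mul_tsum (summable_norm_idealSer hf hs)

lemma tendsto_prod_mul_norm_mul_zetaR {s : ℂ} (hs : 1 < s.re) :
    Tendsto (fun T : Finset (HeightOneSpectrum (𝓞 K)) =>
      (∏ P ∈ T, (‖1 - (f * normHom K s) P.asIdeal‖ *
        (1 - (Ideal.absNorm P.asIdeal : ℝ) ^ (-s.re)))) *
        (‖idealSer f s‖ * zetaR K s.re)) atTop (𝓝 1) := by
  have h := (tendsto_prod_mul_idealSer hf hs).norm.mul (tendsto_prod_mul_zetaR (K := K) hs)
  rw [norm_one, one_mul] at h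
  refine h.congr fun T => ?_
  rw [norm_mul, norm_prod, Finset.prod_mul_distrib]
  ring

omit hf in
lemma norm_one_sub_mul_le {v : ℂ} {x c : ℝ} (hv : ‖v‖ ≤ x) (hx : x ≤ 1) (hc0 : 0 ≤ c)
    (hc1 : c ≤ 1) : ‖1 - v‖ * (1 - x) ≤ ‖1 - c * v‖ * (1 - c * x) := by
  have hx0 : 0 ≤ x := (norm_nonneg v).trans hv
  have h1 : ‖1 - v‖ ≤ ‖1 - c * v‖ + (1 - c) * x := by
    have : 1 - v = (1 - c * v) - ((1 - c : ℝ) : ℂ) * v := by push_cast; ring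
    rw [this]
    refine (norm_sub_le _ _).trans ?_
    rw [norm_mul ((1 - c : ℝ) : ℂ), norm_real, Real.norm_of_nonneg (by linarith)]
    gcongr
  have h2 : 1 - c * x ≤ ‖1 - c * v‖ := by
    have := norm_sub_norm_le (1 : ℂ) (c * v)
    rw [norm_one, norm_mul, norm_real, Real.norm_of_nonneg hc0] at this
    nlinarith
  have h3 : c * x ≤ x := by nlinarith
  nlinarith [mul_nonneg (sub_nonneg.mpr hc1) hx0]

lemma prime_factor_le {s : ℂ} (hs : 1 < s.re) (P : HeightOneSpectrum (𝓞 K)) :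
    ‖1 - (f * normHom K s) P.asIdeal‖ * (1 - (Ideal.absNorm P.asIdeal : ℝ) ^ (-s.re)) ≤ 1 := by
  have h := norm_one_sub_mul_le (norm_mul_normHom_le hf s ⟨P.asIdeal, P.ne_bot⟩)
    (rpow_neg_lt_one (by linarith) (one_lt_absNorm P)).le le_rfl zero_le_one
  simpa using h

lemma one_le_norm_idealSer_mul {s : ℂ} (hs : 1 < s.re) :
    1 ≤ ‖idealSer f s‖ * zetaR K s.re := by
  refine le_of_tendsto' (tendsto_prod_mul_norm_mul_zetaR hf hs) fun T => ?_
  refine mul_le_of_le_one_left (mul_nonneg (norm_nonneg _)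
    (tsum_nonneg fun _ => by positivity)) (Finset.prod_le_one (fun P _ => ?_)
    fun P _ => prime_factor_le hf hs P)
  have := rpow_neg_lt_one (by linarith : 0 < s.re) (one_lt_absNorm P)
  exact mul_nonneg (norm_nonneg _) (by linarith)

lemma zetaR_pos {σ : ℝ} (hσ : 1 < σ) : 0 < zetaR K σ := by
  have h := one_le_norm_idealSer_mul hf (s := σ) (by simpa using hσ)
  rw [ofReal_re] at h
  exact pos_of_mul_pos_right (by linarith) (norm_nonneg _)

lemma idealSer_ne_zero {s : ℂ} (hs : 1 < s.re) : idealSer f s ≠ 0 := by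
  intro h
  have := one_le_norm_idealSer_mul hf hs
  simp [h] at this
  linarith

lemma norm_idealSer_mul_zetaR_antitone {s s' : ℂ} (hs : 1 < s.re) (hre : s.re ≤ s'.re)
    (him : s'.im = s.im) :
    ‖idealSer f s'‖ * zetaR K s'.re ≤ ‖idealSer f s‖ * zetaR K s.re := by
  have hs' : 1 < s'.re := hs.trans_le hre
  have h1 := tendsto_prod_mul_norm_mul_zetaR hf hs
  have h2 := tendsto_prod_mul_norm_mul_zetaR hf hs'
  set A := ‖idealSer f s‖ * zetaR K s.re
  set B := ‖idealSer f s'‖ * zetaR K s'.re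
  have hA : 1 ≤ A := one_le_norm_idealSer_mul hf hs
  have hB : 1 ≤ B := one_le_norm_idealSer_mul hf hs'
  have h3 := h1.mul_const (B / A)
  rw [one_mul] at h3
  have h4 : B / A ≤ 1 := by
    refine le_of_tendsto_of_tendsto' h3 h2 fun T => ?_
    rw [mul_assoc, mul_div_cancel₀ _ (by positivity)]
    refine mul_le_mul_of_nonneg_right (Finset.prod_le_prod (fun P _ => ?_) fun P _ => ?_)
      (by linarith)
    · have := rpow_neg_lt_one (by linarith : 0 < s.re) (one_lt_absNorm P)
      exact mul_nonneg (norm_nonneg _) (by linarith)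
    · have hN : 0 < Ideal.absNorm P.asIdeal := by linarith [one_lt_absNorm P]
      have hN' : (0 : ℝ) < Ideal.absNorm P.asIdeal := by exact_mod_cast hN
      have hc : (Ideal.absNorm P.asIdeal : ℝ) ^ (-(s'.re - s.re)) ≤ 1 :=
        Real.rpow_le_one_of_one_le_of_nonpos (by exact_mod_cast hN) (by linarith)
      have h := norm_one_sub_mul_le (norm_mul_normHom_le hf s ⟨P.asIdeal, P.ne_bot⟩)
        (rpow_neg_lt_one (by linarith) (one_lt_absNorm P)).le
        (show 0 ≤ (Ideal.absNorm P.asIdeal : ℝ) ^ (-(s'.re - s.re)) by positivity) hc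
      have e1 : (Ideal.absNorm P.asIdeal : ℝ) ^ (-(s'.re - s.re)) *
          (Ideal.absNorm P.asIdeal : ℝ) ^ (-s.re) = (Ideal.absNorm P.asIdeal : ℝ) ^ (-s'.re) := by
        rw [← Real.rpow_add hN']; ring_nf
      have e2 : (((Ideal.absNorm P.asIdeal : ℝ) ^ (-(s'.re - s.re)) : ℝ) : ℂ) *
          (f * normHom K s) P.asIdeal = (f * normHom K s') P.asIdeal := by
        have : -s' = ((-(s'.re - s.re) : ℝ) : ℂ) + -s := by
          apply Complex.ext
          · simp only [neg_re, add_re, ofReal_re]; ring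
          · simp [him]
        simp only [MonoidHom.mul_apply]
        change _ = _ * (Ideal.absNorm P.asIdeal : ℂ) ^ (-s')
        rw [this, cpow_add _ _ (by exact_mod_cast hN.ne'), ofReal_cpow hN'.le, ofReal_natCast]
        change _ * (_ * (Ideal.absNorm P.asIdeal : ℂ) ^ (-s)) = _
        ring
      rwa [e1, e2] at h
  rwa [div_le_one (by linarith)] at h4

omit hf in
lemma idealSer_one_ofReal {σ : ℝ} : idealSer (1 : Ideal (𝓞 K) →* ℂ) σ = zetaR K σ := by
  rw [idealSer, zetaR, ofReal_tsum]
  refine tsum_congr fun 𝔞 => ?_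
  rw [MonoidHom.one_apply, one_mul, ofReal_cpow (by positivity), ofReal_natCast, ofReal_neg]

lemma logDeriv_le {L Z : ℂ → ℂ} {s : ℂ} (hs : 1 < s.re) (hL : DifferentiableAt ℂ L s)
    (hZ : DifferentiableAt ℂ Z s.re) (hLs : ∀ z : ℂ, 1 < z.re → L z = idealSer f z)
    (hZs : ∀ z : ℂ, 1 < z.re → Z z = idealSer (1 : Ideal (𝓞 K) →* ℂ) z) :
    (deriv L s / L s).re ≤ -(deriv Z s.re / Z s.re).re := by
  have hss : (s.re : ℂ) + s.im * I = s := re_add_im s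
  have hL' : HasDerivAt (fun x : ℝ => L (x + s.im * I)) (deriv L s) s.re := by
    have h1 : HasDerivAt L (deriv L s) ((s.re : ℂ) + s.im * I) := by
      rw [hss]; exact hL.hasDerivAt
    exact (h1.comp_add_const (s.re : ℂ) (s.im * I)).comp_ofReal
  have hg := hL'.mul hZ.hasDerivAt.comp_ofReal
  rw [hss] at hg
  have hn := hg.norm_sq
  have hL0 : L s ≠ 0 := by rw [hLs s hs]; exact idealSer_ne_zero hf hs
  have hZ0 : Z s.re ≠ 0 := by
    rw [hZs _ (by simpa using hs), idealSer_one_ofReal]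
    exact_mod_cast (zetaR_pos hf hs).ne'
  have hanti : ∀ x : ℝ, s.re < x → ‖L (x + s.im * I) * Z x‖ ^ 2 ≤
      ‖L (s.re + s.im * I) * Z s.re‖ ^ 2 := by
    intro x hx
    have h1 := norm_idealSer_mul_zetaR_antitone hf (s := s) (s' := x + s.im * I) hs
      (by simpa using hx.le) (by simp)
    have hx1 : 1 < x := hs.trans hx
    rw [hss, hLs _ hs, hLs _ (by simpa using hx1), hZs _ (by simpa using hx1),
      hZs _ (by simpa using hs), idealSer_one_ofReal, idealSer_one_ofReal, norm_mul, norm_mul,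
      norm_real, norm_real, Real.norm_of_nonneg (zetaR_pos hf hx1).le,
      Real.norm_of_nonneg (zetaR_pos hf hs).le]
    simp only [add_re, ofReal_re, mul_re, I_re, mul_zero, ofReal_im, I_im, mul_one, sub_self,
      add_zero] at h1
    gcongr
    exact mul_nonneg (norm_nonneg _) (zetaR_pos hf hx1).le
  have hslope := (hasDerivWithinAt_iff_tendsto_slope' (Set.notMem_Ioi.mpr le_rfl)).mp
    (hn.hasDerivWithinAt (s := Set.Ioi s.re))
  simp only [Pi.mul_apply, hss] at hslope
  have hle : 2 * inner ℝ (L s * Z s.re) (deriv L s * Z s.re + L s * deriv Z s.re) ≤ 0 := by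
    refine le_of_tendsto hslope ?_
    filter_upwards [self_mem_nhdsWithin] with x hx
    have hx' : s.re < x := hx
    rw [slope_def_field]
    exact div_nonpos_of_nonpos_of_nonneg (sub_nonpos.mpr (by simpa [hss] using hanti x hx'))
      (by linarith)
  have hre : ((deriv L s * Z s.re + L s * deriv Z s.re) / (L s * Z s.re)).re ≤ 0 := by
    rw [div_eq_mul_inv, inv_def, ← mul_assoc, re_mul_ofReal]
    refine mul_nonpos_of_nonpos_of_nonneg ?_ (inv_nonneg.mpr (normSq_nonneg _))
    rw [Complex.inner] at hle
    linarith
  have e : (deriv L s * Z s.re + L s * deriv Z s.re) / (L s * Z s.re) =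
      deriv L s / L s + deriv Z s.re / Z s.re := by field_simp
  rw [e, add_re] at hre
  linarith

omit hf in
/-- Restricting `f` to ideals prime to a finite set of primes removes Euler factors. -/
lemma idealSer_eq_prod_mul (hf : ∀ I, ‖f I‖ ≤ 1) {g : Ideal (𝓞 K) →* ℂ}
    (T : Finset (HeightOneSpectrum (𝓞 K)))
    (h0 : ∀ 𝔞, (∃ P ∈ T, P.asIdeal ∣ 𝔞) → g 𝔞 = 0)
    (h1 : ∀ 𝔞, (∀ P ∈ T, ¬ P.asIdeal ∣ 𝔞) → g 𝔞 = f 𝔞) {s : ℂ} (hs : 1 < s.re) :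
    idealSer g s = (∏ P ∈ T, (1 - f P.asIdeal * (Ideal.absNorm P.asIdeal : ℂ) ^ (-s))) *
      idealSer f s := by
  have h := tsum_sieve (summable_norm_idealSer hf hs) T
  refine Eq.trans (tsum_congr fun 𝔞 => ?_) h
  unfold sieve
  split_ifs with hc
  · rw [h1 _ hc]; rfl
  · push Not at hc
    rw [h0 _ hc, zero_mul]

end Euler

section Poisson

open MeasureTheory Module

variable {ι : Type*} [Fintype ι]

/-- The vector in `ℝ^ι` attached to an integer vector. -/
def intVec (m : ι → ℤ) : ι → ℝ := fun i => (m i : ℝ)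

theorem norm_intVec (m : ι → ℤ) : ‖intVec m‖ = ‖m‖ := by
  have h : ∀ i, ‖((m i : ℤ) : ℝ)‖₊ = ‖m i‖₊ := fun i => NNReal.eq (Int.norm_eq_abs _).symm
  simp [intVec, Pi.norm_def, h]

theorem summable_intVec : Summable fun m : ι → ℤ =>
    ((1 + ‖intVec m‖) ^ (Fintype.card ι + 1))⁻¹ := by
  classical
  set L : Submodule ℤ (ι → ℝ) := Submodule.span ℤ (Set.range (Pi.basisFun ℝ ι)) with hL
  have hmem : ∀ m : ι → ℤ, intVec m ∈ L := by
    intro m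
    rw [hL, Basis.mem_span_iff_repr_mem]
    intro i
    simp [intVec]
  have hrank : finrank ℤ L = Fintype.card ι := by
    rw [hL, ZLattice.rank ℝ, finrank_fintype_fun_eq_card]
  have h1 : Summable fun z : L => ‖z‖⁻¹ ^ (Fintype.card ι + 1) :=
    ZLattice.summable_norm_pow_inv L _ (by rw [hrank]; exact Nat.lt_succ_self _)
  have hinj : Function.Injective fun m : ι → ℤ => (⟨intVec m, hmem m⟩ : L) := by
    intro a b hab
    have h := congrArg Subtype.val hab
    funext i
    have h' : (a i : ℝ) = b i := congrFun h i
    exact_mod_cast h'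
  have h2 := h1.comp_injective hinj
  refine Summable.of_norm_bounded_eventually h2 ?_
  have : ∀ᶠ m : ι → ℤ in cofinite, m ≠ 0 := by
    simp [Filter.eventually_cofinite]
  filter_upwards [this] with m hm
  have hm' : 0 < ‖intVec m‖ := by
    rw [norm_intVec]; exact norm_pos_iff.mpr hm
  rw [Real.norm_of_nonneg (by positivity)]
  simp only [Function.comp_apply, Submodule.coe_norm, inv_pow]
  gcongr
  linarith

/-- The character `x ↦ e(k·x)` of `ℝ^ι`. -/
def expChar (k : ι → ℤ) (x : ι → ℝ) : ℂ :=
  Complex.exp (2 * Real.pi * Complex.I * ∑ i, (k i : ℂ) * (x i : ℂ))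

theorem mFourier_coe (k : ι → ℤ) (x : ι → ℝ) :
    UnitAddTorus.mFourier k (fun i => (x i : UnitAddCircle)) = expChar k x := by
  simp only [UnitAddTorus.mFourier, ContinuousMap.coe_mk, expChar, fourier_coe_apply,
    ← Complex.exp_sum, Finset.mul_sum]
  congr 1
  refine Finset.sum_congr rfl fun i _ => ?_
  push_cast
  ring

theorem norm_expChar (k : ι → ℤ) (x : ι → ℝ) : ‖expChar k x‖ = 1 := by
  rw [expChar, Complex.norm_exp]
  have : (2 * Real.pi * Complex.I * ∑ i, (k i : ℂ) * (x i : ℂ) : ℂ)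
      = ((2 * Real.pi * ∑ i, (k i : ℝ) * x i : ℝ) : ℂ) * Complex.I := by
    push_cast; ring
  rw [this, Complex.re_ofReal_mul]
  simp

theorem continuous_expChar (k : ι → ℤ) : Continuous (expChar k) := by
  unfold expChar
  fun_prop

theorem expChar_add_intVec (k : ι → ℤ) (x : ι → ℝ) (m : ι → ℤ) :
    expChar k (x + intVec m) = expChar k x := by
  rw [← mFourier_coe, ← mFourier_coe]
  congr 1
  funext i
  simp [intVec]

/-- The unit cube with corner at an integer vector. -/
def unitCube (m : ι → ℤ) : Set (ι → ℝ) := {x | ∀ i, x i ∈ Set.Ioc (m i : ℝ) (m i + 1)}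

theorem measurableSet_unitCube (m : ι → ℤ) : MeasurableSet (unitCube m) := by
  have : unitCube m = Set.univ.pi fun i => Set.Ioc (m i : ℝ) (m i + 1) := by
    ext x; simp [unitCube]
  rw [this]
  exact MeasurableSet.univ_pi fun i => measurableSet_Ioc

omit [Fintype ι] in
theorem iUnion_unitCube : (⋃ m : ι → ℤ, unitCube m) = Set.univ := by
  refine Set.eq_univ_of_forall fun x => Set.mem_iUnion.mpr ⟨fun i => ⌈x i⌉ - 1, fun i => ?_⟩
  have h1 := Int.ceil_lt_add_one (x i)
  have h2 := Int.le_ceil (x i)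
  simp only [Set.mem_Ioc]
  push_cast
  constructor <;> linarith

omit [Fintype ι] in
theorem pairwise_disjoint_unitCube :
    Pairwise (Function.onFun Disjoint (unitCube : (ι → ℤ) → Set (ι → ℝ))) := by
  intro m k hmk
  refine Set.disjoint_left.mpr fun x hm hk => hmk ?_
  funext i
  have h1 := hm i
  have h2 := hk i
  simp only [Set.mem_Ioc] at h1 h2
  have e1 : m i < k i + 1 := by exact_mod_cast (by linarith : (m i : ℝ) < k i + 1)
  have e2 : k i < m i + 1 := by exact_mod_cast (by linarith : (k i : ℝ) < m i + 1)
  omega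

theorem integral_unitCube (G : (ι → ℝ) → ℂ) (m : ι → ℤ) :
    ∫ x in unitCube m, G x = ∫ x in unitCube 0, G (x + intVec m) := by
  have h := (measurePreserving_add_right (volume : Measure (ι → ℝ)) (intVec m)).setIntegral_preimage_emb
    (measurableEmbedding_addRight (intVec m)) G (unitCube m)
  rw [← h]
  congr 2
  ext x
  simp only [unitCube, intVec, Set.mem_preimage, Set.mem_ofPred_eq, Pi.add_apply, Set.mem_Ioc]
  refine forall_congr' fun i => ?_
  simp only [Pi.zero_apply, Int.cast_zero]
  constructor <;> rintro ⟨h1, h2⟩ <;> constructor <;> linarith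

theorem hasSum_integral_unitCube {G : (ι → ℝ) → ℂ} (hG : Integrable G) :
    HasSum (fun m : ι → ℤ => ∫ x in unitCube 0, G (x + intVec m)) (∫ x, G x) := by
  have h := hasSum_integral_iUnion (f := G) (μ := volume) measurableSet_unitCube
    pairwise_disjoint_unitCube hG.integrableOn
  rw [iUnion_unitCube, setIntegral_univ] at h
  exact h.congr_fun fun m => (integral_unitCube G m).symm

variable {F : (ι → ℝ) → ℂ} {C : ℝ}

theorem norm_translate_le (hC : 0 ≤ C)
    (hb : ∀ v, ‖F v‖ ≤ C * ((1 + ‖v‖) ^ (Fintype.card ι + 1))⁻¹) (x : ι → ℝ) (m : ι → ℤ) :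
    ‖F (x + intVec m)‖ ≤ C * (1 + ‖x‖) ^ (Fintype.card ι + 1) *
      ((1 + ‖intVec m‖) ^ (Fintype.card ι + 1))⁻¹ := by
  refine (hb _).trans ?_
  rw [mul_assoc]
  gcongr
  rw [← div_eq_mul_inv, inv_eq_one_div, div_le_div_iff₀ (by positivity) (by positivity), one_mul,
    ← mul_pow]
  gcongr
  have : ‖intVec m‖ ≤ ‖x + intVec m‖ + ‖x‖ := by
    simpa using norm_sub_le (x + intVec m) x
  nlinarith [norm_nonneg x, norm_nonneg (x + intVec m)]

theorem continuous_periodization (hF : Continuous F) (hC : 0 ≤ C)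
    (hb : ∀ v, ‖F v‖ ≤ C * ((1 + ‖v‖) ^ (Fintype.card ι + 1))⁻¹) :
    Continuous fun x => ∑' m : ι → ℤ, F (x + intVec m) := by
  rw [continuous_iff_continuousAt]
  intro x₀
  have h : ContinuousOn (fun x => ∑' m : ι → ℤ, F (x + intVec m)) (Metric.ball x₀ 1) := by
    refine continuousOn_tsum (u := fun m => C * (2 + ‖x₀‖) ^ (Fintype.card ι + 1) *
      ((1 + ‖intVec m‖) ^ (Fintype.card ι + 1))⁻¹) (fun m => by fun_prop)
      (summable_intVec.mul_left _) fun m x hx => ?_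
    refine (norm_translate_le hC hb x m).trans ?_
    have hx' : ‖x - x₀‖ < 1 := by simpa [dist_eq_norm] using hx
    have := norm_sub_norm_le x x₀
    refine mul_le_mul_of_nonneg_right (mul_le_mul_of_nonneg_left
      (pow_le_pow_left₀ (by positivity) ?_ _) hC) (by positivity)
    linarith
  exact h.continuousAt (Metric.ball_mem_nhds x₀ one_pos)

theorem exists_torus_periodization (hF : Continuous F) (hC : 0 ≤ C)
    (hb : ∀ v, ‖F v‖ ≤ C * ((1 + ‖v‖) ^ (Fintype.card ι + 1))⁻¹) :
    ∃ f : C(UnitAddTorus ι, ℂ), ∀ x : ι → ℝ,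
      f (fun i => (x i : UnitAddCircle)) = ∑' m : ι → ℤ, F (x + intVec m) := by
  have hq : IsOpenQuotientMap fun (x : ι → ℝ) (i : ι) => (x i : UnitAddCircle) :=
    IsOpenQuotientMap.piMap fun _ => QuotientAddGroup.isOpenQuotientMap_mk
  have hcompat : ∀ x y : ι → ℝ, (fun i => (x i : UnitAddCircle)) = (fun i => (y i : UnitAddCircle)) →
      ∑' m : ι → ℤ, F (x + intVec m) = ∑' m : ι → ℤ, F (y + intVec m) := by
    intro x y hxy
    have h1 : ∀ i, ∃ k : ℤ, y i = x i + k := by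
      intro i
      have h2 := (QuotientAddGroup.eq (s := AddSubgroup.zmultiples (1 : ℝ))).mp (congrFun hxy i)
      obtain ⟨k, hk⟩ := AddSubgroup.mem_zmultiples_iff.mp h2
      exact ⟨k, by simp at hk; linarith⟩
    choose k hk using h1
    have hy : y = x + intVec k := by
      funext i; simp [intVec, hk]
    rw [hy, ← (Equiv.addLeft k).tsum_eq]
    refine tsum_congr fun m => ?_
    congr 1
    funext i
    simp [intVec, add_assoc]
  refine ⟨⟨fun t => ∑' m : ι → ℤ, F (Function.surjInv hq.surjective t + intVec m), ?_⟩, fun x => ?_⟩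
  · rw [hq.isQuotientMap.continuous_iff]
    refine (continuous_periodization hF hC hb).congr fun x => ?_
    exact hcompat _ _ (Function.surjInv_eq hq.surjective _).symm
  · exact hcompat _ _ (Function.surjInv_eq hq.surjective _)

/-- The Poisson summation formula for the lattice `ℤ^ι` in `ℝ^ι`. -/
theorem hasSum_poisson (hF : Continuous F) (hC : 0 ≤ C) (hint : Integrable F)
    (hb : ∀ v, ‖F v‖ ≤ C * ((1 + ‖v‖) ^ (Fintype.card ι + 1))⁻¹)
    (hs : Summable fun k : ι → ℤ => ∫ v, expChar (-k) v * F v) (x : ι → ℝ) :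
    HasSum (fun k : ι → ℤ => (∫ v, expChar (-k) v * F v) * expChar k x)
      (∑' m : ι → ℤ, F (x + intVec m)) := by
  obtain ⟨f, hf⟩ := exists_torus_periodization hF hC hb
  have hcoef : ∀ k, UnitAddTorus.mFourierCoeff f k = ∫ v, expChar (-k) v * F v := by
    intro k
    have hG : Integrable fun v => expChar (-k) v * F v := by
      refine hint.bdd_mul (c := 1) (continuous_expChar _).aestronglyMeasurable
        (Eventually.of_forall fun v => (norm_expChar _ v).le)
    have h1 := (hasSum_integral_unitCube hG).tsum_eq
    rw [UnitAddTorus.mFourierCoeff_eq_integral f k (0 : ι → ℝ), ← h1]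
    have hcube : {x : ι → ℝ | ∀ i, x i ∈ Set.Ioc ((0 : ι → ℝ) i) ((0 : ι → ℝ) i + 1)}
        = unitCube 0 := by
      ext x; simp [unitCube]
    rw [hcube]
    have hvol : volume (unitCube (0 : ι → ℤ)) = 1 := by
      have : unitCube (0 : ι → ℤ) = Set.univ.pi fun _ => Set.Ioc (0 : ℝ) 1 := by
        ext x; simp [unitCube]
      rw [this, Real.volume_pi_Ioc]; simp
    have hnorm : ∀ v ∈ unitCube (0 : ι → ℤ), ‖v‖ ≤ 1 := by
      intro v hv
      rw [pi_norm_le_iff_of_nonneg zero_le_one]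
      intro i
      have := hv i
      simp only [Pi.zero_apply, Int.cast_zero, Set.mem_Ioc] at this
      rw [Real.norm_of_nonneg this.1.le]
      linarith
    have hbound : ∀ m : ι → ℤ, ∀ v ∈ unitCube (0 : ι → ℤ),
        ‖expChar (-k) (v + intVec m) * F (v + intVec m)‖ ≤
        C * 2 ^ (Fintype.card ι + 1) * ((1 + ‖intVec m‖) ^ (Fintype.card ι + 1))⁻¹ := by
      intro m v hv
      rw [norm_mul, norm_expChar, one_mul]
      refine (norm_translate_le hC hb v m).trans ?_
      have := hnorm v hv
      gcongr
      linarith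
    have hfin : volume (unitCube (0 : ι → ℤ)) < ⊤ := by rw [hvol]; exact ENNReal.one_lt_top
    have : IsFiniteMeasure (volume.restrict (unitCube (0 : ι → ℤ))) :=
      ⟨by rw [Measure.restrict_apply_univ]; exact hfin⟩
    have hkey := hasSum_integral_of_summable_integral_norm (μ := volume.restrict (unitCube (0 : ι → ℤ)))
      (F := fun (m : ι → ℤ) v => expChar (-k) (v + intVec m) * F (v + intVec m)) ?_ ?_
    · rw [hkey.tsum_eq]
      refine setIntegral_congr_fun (measurableSet_unitCube 0) fun v _ => ?_
      simp only [mFourier_coe, hf, smul_eq_mul, expChar_add_intVec, tsum_mul_left]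
    · intro m
      refine Integrable.of_bound (C := C * 2 ^ (Fintype.card ι + 1) *
        ((1 + ‖intVec m‖) ^ (Fintype.card ι + 1))⁻¹) ?_ ?_
      · have := continuous_expChar (-k)
        exact Continuous.aestronglyMeasurable (by fun_prop)
      · exact (ae_restrict_mem (measurableSet_unitCube 0)).mono (hbound m)
    · refine Summable.of_nonneg_of_le (fun m => by positivity) (fun m => ?_)
        (summable_intVec.mul_left (C * 2 ^ (Fintype.card ι + 1)))
      have h2 := norm_setIntegral_le_of_norm_le_const (f := fun v =>
        ‖expChar (-k) (v + intVec m) * F (v + intVec m)‖) hfin (fun v hv => by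
          rw [norm_norm]; exact hbound m v hv)
      rw [Measure.real, hvol, ENNReal.toReal_one, mul_one] at h2
      exact (Real.le_norm_self _).trans h2
  have hs' : Summable (UnitAddTorus.mFourierCoeff f) := by
    refine hs.congr fun k => (hcoef k).symm ▸ rfl
  have h := UnitAddTorus.hasSum_mFourier_series_apply_of_summable hs' fun i => (x i : UnitAddCircle)
  rw [hf] at h
  simpa only [hcoef, mFourier_coe, smul_eq_mul] using h

end Poisson

section Gauss

open MeasureTheory

/-- `e^{-πu²}`, times the linear factor `u` if `p` holds. -/
def realFac (p : Prop) [Decidable p] (u : ℝ) : ℝ :=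
  (if p then u else 1) * Real.exp (-Real.pi * u ^ 2)

/-- The Fourier eigenvalue of `realFac p`. -/
def realEps (p : Prop) [Decidable p] : ℂ := if p then -Complex.I else 1

theorem norm_realEps (p : Prop) [Decidable p] : ‖realEps p‖ = 1 := by
  unfold realEps; split_ifs <;> simp

theorem continuous_realFac (p : Prop) [Decidable p] : Continuous (realFac p) := by
  unfold realFac; split_ifs <;> fun_prop

theorem abs_realFac_le (p : Prop) [Decidable p] (u : ℝ) :
    |realFac p u| ≤ Real.exp (-2 * u ^ 2) := by
  have hpi := Real.pi_gt_three
  have h1 : |if p then u else 1| ≤ Real.exp (u ^ 2) := by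
    have h2 := Real.add_one_le_exp (u ^ 2)
    split_ifs
    · refine le_trans ?_ h2
      rw [abs_le]; constructor <;> nlinarith [sq_nonneg (u - 1), sq_nonneg (u + 1)]
    · rw [abs_one]; nlinarith [sq_nonneg u]
  rw [realFac, abs_mul, Real.abs_exp]
  calc |if p then u else 1| * Real.exp (-Real.pi * u ^ 2)
      ≤ Real.exp (u ^ 2) * Real.exp (-Real.pi * u ^ 2) := by gcongr
    _ = Real.exp ((1 - Real.pi) * u ^ 2) := by rw [← Real.exp_add]; ring_nf
    _ ≤ Real.exp (-2 * u ^ 2) := by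
        refine Real.exp_le_exp.mpr ?_
        nlinarith [sq_nonneg u]

theorem integral_char_mul_realFac (p : Prop) [Decidable p] (ξ : ℝ) :
    ∫ u : ℝ, cexp (-(2 * Real.pi * Complex.I * (u * ξ))) * realFac p u = realEps p * realFac p ξ := by
  have hpi : (0 : ℝ) < (Real.pi : ℂ).re := by simpa using Real.pi_pos
  have hpi0 : (Real.pi : ℂ) ≠ 0 := by exact_mod_cast Real.pi_ne_zero
  set f : ℝ → ℂ := fun u => cexp (-Real.pi * (u : ℂ) ^ 2 + -(2 * Real.pi * Complex.I * ξ) * u + 0) with hf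
  have hfi : Integrable f := integrable_cexp_quadratic hpi _ _
  have hf0 : ∫ u, f u = cexp (-Real.pi * (ξ : ℂ) ^ 2) := by
    have h := integral_cexp_quadratic (b := -Real.pi) (by simpa using Real.pi_pos)
      (-(2 * Real.pi * Complex.I * ξ)) 0
    rw [hf, h]
    rw [neg_neg, div_self hpi0, one_cpow, one_mul]
    congr 1
    field_simp
    ring_nf
    rw [I_sq]; ring
  have hE : ∀ u : ℝ, cexp (-(2 * Real.pi * Complex.I * (u * ξ))) * cexp (-Real.pi * (u : ℂ) ^ 2) = f u := by
    intro u
    rw [hf, ← Complex.exp_add]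
    congr 1; ring
  unfold realFac realEps
  by_cases hp : p
  · simp only [hp, if_true]
    have hufi : Integrable fun u : ℝ => (u : ℂ) * f u := by
      have h := integrable_mul_cexp_neg_mul_sq hpi
      have h2 := h.bdd_mul (c := 1) (f := fun u : ℝ => cexp (-(2 * Real.pi * Complex.I * (u * ξ))))
        (Continuous.aestronglyMeasurable (by fun_prop)) (Eventually.of_forall fun u => by
          have : -(2 * Real.pi * Complex.I * (u * ξ)) = ((-(2 * Real.pi * (u * ξ)) : ℝ) : ℂ) * Complex.I := by
            push_cast; ring
          rw [this, Complex.norm_exp_ofReal_mul_I])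
      refine h2.congr (Eventually.of_forall fun u => ?_)
      simp only [← hE u]; ring
    have hder : ∀ u : ℝ, HasDerivAt f ((-2 * Real.pi) * ((u : ℂ) * f u) +
        (-(2 * Real.pi * Complex.I * ξ)) * f u) u := by
      intro u
      have h1 : HasDerivAt (fun z : ℂ => cexp (-Real.pi * z ^ 2 + -(2 * Real.pi * Complex.I * ξ) * z + 0))
          (cexp (-Real.pi * (u : ℂ) ^ 2 + -(2 * Real.pi * Complex.I * ξ) * u + 0) *
            (-Real.pi * (2 * (u : ℂ)) + -(2 * Real.pi * Complex.I * ξ))) (u : ℂ) := by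
        refine HasDerivAt.cexp ?_
        refine (((((hasDerivAt_id' (u : ℂ)).pow 2).const_mul _).add
          ((hasDerivAt_id' (u : ℂ)).const_mul _)).add_const _).congr_deriv ?_
        norm_num
      refine h1.comp_ofReal.congr_deriv ?_
      rw [hf]; ring
    have h0 := integral_eq_zero_of_hasDerivAt_of_integrable hder
      ((hufi.const_mul _).add (hfi.const_mul _)) hfi
    rw [integral_add (hufi.const_mul _) (hfi.const_mul _), integral_const_mul,
      integral_const_mul, hf0] at h0
    have h3 : ∫ u : ℝ, (u : ℂ) * f u = -Complex.I * ξ * cexp (-Real.pi * (ξ : ℂ) ^ 2) := by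
      have : (-2 * Real.pi : ℂ) ≠ 0 := by simp [hpi0]
      refine mul_left_cancel₀ this ?_
      linear_combination h0
    push_cast
    rw [← mul_assoc, ← h3]
    refine integral_congr_ae (Eventually.of_forall fun u => ?_)
    simp only [← hE u]; ring
  · simp only [hp, if_false]
    push_cast
    simp only [one_mul]
    rw [← hf0]
    exact integral_congr_ae (Eventually.of_forall fun u => hE u)

theorem integral_char_mul_realFac_scale (p : Prop) [Decidable p] (ξ : ℝ) {t : ℝ} (ht : 0 < t) :
    ∫ u : ℝ, cexp (-(2 * Real.pi * Complex.I * (u * ξ))) * realFac p (t * u) =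
      realEps p * (t⁻¹ : ℝ) * realFac p (t⁻¹ * ξ) := by
  have h := MeasureTheory.Measure.integral_comp_mul_left
    (fun u : ℝ => cexp (-(2 * Real.pi * Complex.I * (u * (t⁻¹ * ξ : ℝ)))) * realFac p u) t
  rw [integral_char_mul_realFac, abs_of_pos (inv_pos.mpr ht), Complex.real_smul] at h
  rw [show realEps p * (t⁻¹ : ℝ) * realFac p (t⁻¹ * ξ)
    = (t⁻¹ : ℝ) * (realEps p * realFac p (t⁻¹ * ξ)) by ring, ← h]
  refine integral_congr_ae (Eventually.of_forall fun u => ?_)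
  have ht' : (t : ℂ) ≠ 0 := by exact_mod_cast ht.ne'
  simp only
  congr 3
  push_cast
  field_simp

theorem integral_char_mul_complex (ξ : ℂ) {t : ℝ} (ht : 0 < t) :
    ∫ u : ℂ, cexp (-(2 * Real.pi * Complex.I * ((2 * (u * ξ).re : ℝ) : ℂ))) *
        (Real.exp (-2 * Real.pi * (t * ‖u‖) ^ 2) : ℝ) =
      (2 : ℂ)⁻¹ * ((t⁻¹ ^ 2 : ℝ) : ℂ) * (Real.exp (-2 * Real.pi * (t⁻¹ * ‖ξ‖) ^ 2) : ℝ) := by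
  have hpi0 : (Real.pi : ℂ) ≠ 0 := by exact_mod_cast Real.pi_ne_zero
  have ht' : (t : ℂ) ≠ 0 := by exact_mod_cast ht.ne'
  have h := GaussianFourier.integral_cexp_neg_mul_sq_norm_add (V := ℂ)
    (b := ((2 * Real.pi * t ^ 2 : ℝ) : ℂ)) (by rw [ofReal_re]; positivity)
    (-(4 * Real.pi * Complex.I)) ((starRingEnd ℂ) ξ)
  rw [Complex.finrank_real_complex] at h
  norm_num at h
  have e1 : (Real.pi : ℂ) / (2 * Real.pi * t ^ 2) = 2⁻¹ * ((t⁻¹ ^ 2 : ℝ) : ℂ) := by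
    push_cast; field_simp
  rw [e1] at h
  push_cast at h ⊢
  convert h using 2
  · funext u
    rw [← Complex.exp_add]
    congr 1
    simp only [Complex.mul_re]
    push_cast
    simp
    ring
  · congr 1
    field_simp
    ring_nf
    rw [I_sq]; ring

end Gauss

section MixGauss

open MeasureTheory
open scoped Classical

variable {K : Type*} [Field K] [NumberField K]

open NumberField.mixedEmbedding NumberField.InfinitePlace

/-- The trace form on the mixed space. -/
def trV (v : mixedSpace K) : ℝ := ∑ w, v.1 w + ∑ w, 2 * (v.2 w).re

theorem trV_mixedEmbedding (α : K) : trV (mixedEmbedding K α) = (Algebra.trace ℚ K α : ℚ) := by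
  have h1 : ((Algebra.trace ℚ K α : ℚ) : ℂ) = ∑ φ : K →+* ℂ, φ α := by
    have h := trace_eq_sum_embeddings (K := ℚ) (L := K) ℂ (x := α)
    rw [eq_ratCast] at h
    rw [h]
    exact (Fintype.sum_equiv (RingHom.equivRatAlgHom K ℂ) (fun φ => φ α) (fun φ => φ α)
      fun _ => by simp [RingHom.equivRatAlgHom_apply]).symm
  have h2 : ∑ φ : K →+* ℂ, (φ α).re = ∑ w : InfinitePlace K, (mult w : ℝ) * (w.embedding α).re := by
    rw [← Finset.sum_fiberwise Finset.univ InfinitePlace.mk fun φ : K →+* ℂ => (φ α).re]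
    refine Finset.sum_congr rfl fun w _ => ?_
    have h3 : ∀ φ ∈ ({φ | InfinitePlace.mk φ = w} : Finset (K →+* ℂ)),
        (φ α).re = (w.embedding α).re := by
      intro φ hφ
      have h4 : InfinitePlace.mk φ = w := by simpa using hφ
      rcases embedding_mk_eq φ with h5 | h5
      · rw [← h4, h5]
      · rw [← h4, h5, ComplexEmbedding.conjugate_coe_eq, Complex.conj_re]
    rw [Finset.sum_congr rfl h3, Finset.sum_const, card_filter_mk_eq, nsmul_eq_mul]
  have h3 := congrArg Complex.re h1
  rw [Complex.re_sum, h2, ← Complex.ofReal_ratCast, Complex.ofReal_re] at h3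
  rw [h3, sum_eq_sum_add_sum, trV]
  congr 1
  · refine Finset.sum_congr rfl fun w _ => ?_
    rw [mult_isReal, Nat.cast_one, one_mul, mixedEmbedding_apply_isReal]
    exact (congrArg Complex.re (embedding_of_isReal_apply w.2 α)).symm ▸ rfl
  · refine Finset.sum_congr rfl fun w _ => ?_
    rw [mult_isComplex, mixedEmbedding_apply_isComplex]
    norm_num

/-- The Gaussian on the mixed space, odd at the real places in `S`, with scale `t w` at the
place `w`. -/
def mixGauss (S : Finset {w : InfinitePlace K // IsReal w}) (t : InfinitePlace K → ℝ)
    (v : mixedSpace K) : ℝ :=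
  (∏ w, realFac (w ∈ S) (t w.1 * v.1 w)) *
    ∏ w : {w : InfinitePlace K // IsComplex w}, Real.exp (-2 * Real.pi * (t w.1 * ‖v.2 w‖) ^ 2)

/-- The Fourier eigenvalue of `mixGauss`. -/
def mixEps (S : Finset {w : InfinitePlace K // IsReal w}) : ℂ := ∏ w, realEps (w ∈ S)

theorem norm_mixEps (S : Finset {w : InfinitePlace K // IsReal w}) : ‖mixEps S‖ = 1 := by
  simp [mixEps, norm_realEps]

theorem continuous_mixGauss (S : Finset {w : InfinitePlace K // IsReal w})
    (t : InfinitePlace K → ℝ) : Continuous (mixGauss S t) := by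
  unfold mixGauss
  have := fun w : {w : InfinitePlace K // IsReal w} => continuous_realFac (w ∈ S)
  fun_prop

theorem abs_mixGauss_le (S : Finset {w : InfinitePlace K // IsReal w})
    (t : InfinitePlace K → ℝ) (v : mixedSpace K) :
    |mixGauss S t v| ≤ Real.exp (-2 * ∑ w, (t w * normAtPlace w v) ^ 2) := by
  have hpi := Real.pi_gt_three
  rw [mixGauss, abs_mul, Finset.abs_prod, Finset.abs_prod, Finset.mul_sum, Real.exp_sum,
    prod_eq_prod_mul_prod]
  gcongr with w _ w _
  · refine (abs_realFac_le _ _).trans_eq ?_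
    rw [normAtPlace_apply_of_isReal w.2, mul_pow, mul_pow, Real.norm_eq_abs, sq_abs]
  · rw [Real.abs_exp, normAtPlace_apply_of_isComplex w.2]
    refine Real.exp_le_exp.mpr ?_
    nlinarith [sq_nonneg (t w.1 * ‖v.2 w‖)]

theorem integral_char_mul_mixGauss (S : Finset {w : InfinitePlace K // IsReal w})
    {t : InfinitePlace K → ℝ} (ht : ∀ w, 0 < t w) (ξ : mixedSpace K) :
    ∫ v : mixedSpace K, cexp (-(2 * Real.pi * Complex.I * trV (v * ξ))) * mixGauss S t v =
      mixEps S * (2 : ℂ)⁻¹ ^ nrComplexPlaces K * ((∏ w, (t w)⁻¹ ^ mult w : ℝ) : ℂ) *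
        mixGauss S t⁻¹ ξ := by
  have hfac : ∀ v : mixedSpace K,
      cexp (-(2 * Real.pi * Complex.I * trV (v * ξ))) * mixGauss S t v =
      (∏ w, (cexp (-(2 * Real.pi * Complex.I * (v.1 w * ξ.1 w))) *
        realFac (w ∈ S) (t w.1 * v.1 w))) *
      ∏ w : {w : InfinitePlace K // IsComplex w},
        (cexp (-(2 * Real.pi * Complex.I * ((2 * (v.2 w * ξ.2 w).re : ℝ) : ℂ))) *
        (Real.exp (-2 * Real.pi * (t w.1 * ‖v.2 w‖) ^ 2) : ℝ)) := by
    intro v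
    rw [Finset.prod_mul_distrib, Finset.prod_mul_distrib, ← Complex.exp_sum, ← Complex.exp_sum,
      mul_mul_mul_comm, ← Complex.exp_add, mixGauss]
    push_cast
    congr 2
    rw [trV]
    push_cast
    simp only [Prod.fst_mul, Prod.snd_mul, Pi.mul_apply, Finset.sum_neg_distrib, ← Finset.mul_sum]
    push_cast
    ring
  simp only [hfac]
  have h1 : ∫ x : {w : InfinitePlace K // IsReal w} → ℝ,
      ∏ w, (cexp (-(2 * Real.pi * Complex.I * (x w * ξ.1 w))) *
        realFac (w ∈ S) (t w.1 * x w)) = _ :=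
    integral_fintype_prod_volume_eq_prod fun (w : {w : InfinitePlace K // IsReal w}) (u : ℝ) =>
      (cexp (-(2 * Real.pi * Complex.I * (u * ξ.1 w))) * realFac (w ∈ S) (t w.1 * u) : ℂ)
  have h2 : ∫ x : {w : InfinitePlace K // IsComplex w} → ℂ,
      ∏ w, (cexp (-(2 * Real.pi * Complex.I * ((2 * (x w * ξ.2 w).re : ℝ) : ℂ))) *
        (Real.exp (-2 * Real.pi * (t w.1 * ‖x w‖) ^ 2) : ℝ)) = _ :=
    integral_fintype_prod_volume_eq_prod fun (w : {w : InfinitePlace K // IsComplex w}) (u : ℂ) =>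
      (cexp (-(2 * Real.pi * Complex.I * ((2 * (u * ξ.2 w).re : ℝ) : ℂ))) *
        (Real.exp (-2 * Real.pi * (t w.1 * ‖u‖) ^ 2) : ℝ) : ℂ)
  have h3 := integral_prod_mul (μ := volume) (ν := volume)
    (fun x : {w : InfinitePlace K // IsReal w} → ℝ =>
      ∏ w, (cexp (-(2 * Real.pi * Complex.I * (x w * ξ.1 w))) *
        realFac (w ∈ S) (t w.1 * x w)))
    (fun x : {w : InfinitePlace K // IsComplex w} → ℂ =>
      ∏ w, (cexp (-(2 * Real.pi * Complex.I * ((2 * (x w * ξ.2 w).re : ℝ) : ℂ))) *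
        (Real.exp (-2 * Real.pi * (t w.1 * ‖x w‖) ^ 2) : ℝ)))
  refine h3.trans ?_
  rw [h1, h2]
  simp only [integral_char_mul_realFac_scale _ _ (ht _), integral_char_mul_complex _ (ht _)]
  rw [prod_eq_prod_mul_prod, mixGauss, mixEps]
  simp only [Finset.prod_mul_distrib, Finset.prod_const, Finset.card_univ, mult_isReal,
    mult_isComplex, pow_one, Pi.inv_apply]
  push_cast
  ring

end MixGauss

section Theta

open MeasureTheory Module
open scoped Classical nonZeroDivisors
open NumberField.mixedEmbedding NumberField.InfinitePlace

variable {K : Type*} [Field K] [NumberField K]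

omit [NumberField K] in
theorem exists_place_eq_norm [NumberField K] (v : mixedSpace K) :
    ∃ w, normAtPlace w v = ‖v‖ := by
  rw [norm_eq_sup'_normAtPlace]
  obtain ⟨w, -, hw⟩ := Finset.exists_mem_eq_sup' (s := Finset.univ) Finset.univ_nonempty
    (fun w => normAtPlace w v)
  exact ⟨w, hw.symm⟩

theorem exp_gauss_le {m : ℝ} (hm : 0 ≤ m) {t : InfinitePlace K → ℝ} (ht : ∀ w, m ≤ t w)
    (v : mixedSpace K) :
    Real.exp (-2 * ∑ w, (t w * normAtPlace w v) ^ 2) ≤ Real.exp (-2 * (m * ‖v‖) ^ 2) := by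
  obtain ⟨w, hw⟩ := exists_place_eq_norm v
  have h1 : (t w * normAtPlace w v) ^ 2 ≤ ∑ w, (t w * normAtPlace w v) ^ 2 :=
    Finset.single_le_sum (f := fun w => (t w * normAtPlace w v) ^ 2)
      (fun _ _ => sq_nonneg _) (Finset.mem_univ w)
  have h2 : (m * ‖v‖) ^ 2 ≤ (t w * normAtPlace w v) ^ 2 := by
    rw [hw]; have := ht w; gcongr
  rw [Real.exp_le_exp]
  linarith

theorem summable_norm_mixedEmbedding (J : (FractionalIdeal (𝓞 K)⁰ K)ˣ) (N : ℕ)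
    (hN : nK K < 2 * N) :
    Summable fun α : K => if α ∈ (J : FractionalIdeal (𝓞 K)⁰ K) then
      (‖mixedEmbedding K α‖ ^ (2 * N))⁻¹ else 0 := by
  have hrank : finrank ℤ (mixedEmbedding.idealLattice K J) = nK K := by
    rw [ZLattice.rank ℝ, mixedEmbedding.finrank]; rfl
  have h := ZLattice.summable_norm_pow_inv (mixedEmbedding.idealLattice K J) (2 * N)
    (by rw [hrank]; exact hN)
  have hi : Function.Injective fun x : {α : K // α ∈ (J : FractionalIdeal (𝓞 K)⁰ K)} =>
      (⟨mixedEmbedding K x.1, (mem_idealLattice K J).2 ⟨x.1, x.2, rfl⟩⟩ :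
        mixedEmbedding.idealLattice K J) := by
    intro x y hxy
    exact Subtype.ext (mixedEmbedding_injective K (congrArg Subtype.val hxy))
  have h2 : Summable ((fun α : K => (‖mixedEmbedding K α‖ ^ (2 * N))⁻¹) ∘ ((↑) :
      {α : K | α ∈ (J : FractionalIdeal (𝓞 K)⁰ K)} → K)) :=
    (h.comp_injective hi).congr fun x => inv_pow _ _
  rw [summable_subtype_iff_indicator] at h2
  exact h2.congr fun α => Set.indicator_apply _ _ _

theorem exists_gauss_majorant (J : (FractionalIdeal (𝓞 K)⁰ K)ˣ) (N : ℕ) (hN : nK K < 2 * N) :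
    ∃ B : K → ℝ, (∀ α, 0 ≤ B α) ∧ Summable B ∧
      ∀ α ∈ (J : FractionalIdeal (𝓞 K)⁰ K), α ≠ 0 → ∀ (t : InfinitePlace K → ℝ) (m : ℝ), 0 < m →
        (∀ w, m ≤ t w) → Real.exp (-2 * ∑ w, (t w * normAtPlace w (mixedEmbedding K α)) ^ 2) ≤
          B α * (m ^ (2 * N))⁻¹ := by
  refine ⟨_, fun α => ?_, (summable_norm_mixedEmbedding J N hN).mul_left (N.factorial : ℝ), ?_⟩
  · split_ifs <;> positivity
  · intro α hα h0 t m hm ht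
    have hpos : 0 < ‖mixedEmbedding K α‖ := by
      rw [norm_pos_iff]
      simpa using (mixedEmbedding_injective K).ne h0
    refine (exp_gauss_le hm.le ht _).trans ?_
    simp only [if_pos hα]
    set A := ‖mixedEmbedding K α‖
    have h1 := Real.pow_div_factorial_le_exp ((m * A) ^ 2) (by positivity) N
    have h2 : Real.exp (-2 * (m * A) ^ 2) ≤ (Real.exp ((m * A) ^ 2))⁻¹ := by
      rw [← Real.exp_neg]
      gcongr
      nlinarith [sq_nonneg (m * A)]
    refine h2.trans ((inv_anti₀ (by positivity) h1).trans_eq ?_)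
    rw [← pow_mul, mul_pow]
    field_simp

theorem abs_mixGauss_embedding_le {S : Finset {w : InfinitePlace K // IsReal w}}
    {t : InfinitePlace K → ℝ} {α : K} : |mixGauss S t (mixedEmbedding K α)| ≤
    Real.exp (-2 * ∑ w, (t w * normAtPlace w (mixedEmbedding K α)) ^ 2) :=
  abs_mixGauss_le S t _

/-- Change of variables to the coordinates of a basis. -/
theorem integral_comp_equivFun_symm {ι : Type*} [Fintype ι] {E : Type*} [NormedAddCommGroup E]
    [NormedSpace ℝ E] [MeasurableSpace E] [BorelSpace E] [FiniteDimensional ℝ E]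
    (b : Basis ι ℝ E) (μ : Measure E) [μ.IsAddHaarMeasure] (f : E → ℂ) :
    ∫ v : ι → ℝ, f (b.equivFun.symm v) =
      ((μ.real (ZSpan.fundamentalDomain b))⁻¹ : ℝ) • ∫ x, f x ∂μ := by
  set e : (ι → ℝ) ≃L[ℝ] E := b.equivFun.symm.toContinuousLinearEquiv
  have hmap : (volume.map e).IsAddHaarMeasure := e.isAddHaarMeasure_map volume
  have hD : volume.map e (ZSpan.fundamentalDomain b) = 1 := by
    rw [show volume.map e = volume.map e.toHomeomorph.toMeasurableEquiv from rfl,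
      e.toHomeomorph.toMeasurableEquiv.map_apply]
    have : e.toHomeomorph.toMeasurableEquiv ⁻¹' (ZSpan.fundamentalDomain b) =
        Set.univ.pi fun _ : ι => Set.Ico (0 : ℝ) 1 := by
      ext v
      simp only [Set.mem_preimage, ZSpan.mem_fundamentalDomain, Set.mem_univ_pi]
      refine forall_congr' fun i => ?_
      have : b.repr (e v) i = v i := congrFun (b.equivFun.apply_symm_apply v) i
      exact this ▸ Iff.rfl
    rw [this, Real.volume_pi_Ico]
    simp
  have hsm := Measure.isAddLeftInvariant_eq_smul μ (volume.map e)
  have hc : μ.real (ZSpan.fundamentalDomain b) = Measure.addHaarScalarFactor μ (volume.map e) := by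
    have := congrArg (fun ν : Measure E => ν (ZSpan.fundamentalDomain b)) hsm
    simp only [Measure.smul_apply, hD] at this
    rw [Measure.real, this]
    simp [ENNReal.smul_def]
  have hpos := Measure.addHaarScalarFactor_pos_of_isAddHaarMeasure μ (volume.map e)
  have hint : ∫ x, f x ∂μ = ∫ x, f x ∂(Measure.addHaarScalarFactor μ (volume.map e) • volume.map e) :=
    congrArg (fun ν : Measure E => ∫ x, f x ∂ν) hsm
  have h1 : ∫ v : ι → ℝ, f (b.equivFun.symm v) = ∫ x, f x ∂(volume.map e) :=
    (integral_map_equiv e.toHomeomorph.toMeasurableEquiv f).symm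
  rw [h1, hc, hint, integral_smul_nnreal_measure, NNReal.smul_def, smul_smul, inv_mul_cancel₀, one_smul]
  exact_mod_cast hpos.ne'

end Theta

section Theta

open MeasureTheory Module
open scoped Classical nonZeroDivisors
open NumberField.mixedEmbedding NumberField.InfinitePlace

variable {K : Type*} [Field K] [NumberField K]

/-- The basis of `K` dual to the basis of a fractional ideal for the trace form. -/
def dualBas (J : (FractionalIdeal (𝓞 K)⁰ K)ˣ) : Basis (Free.ChooseBasisIndex ℤ J) ℚ K :=
  (Algebra.traceForm ℚ K).dualBasis (traceForm_nondegenerate ℚ K) (basisOfFractionalIdeal K J)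

/-- The element of the dual lattice with given coordinates. -/
def dualVec (J : (FractionalIdeal (𝓞 K)⁰ K)ˣ) (k : Free.ChooseBasisIndex ℤ J → ℤ) : K :=
  ∑ j, (k j : ℚ) • dualBas J j

theorem trace_dualBas (J : (FractionalIdeal (𝓞 K)⁰ K)ˣ) (i j : Free.ChooseBasisIndex ℤ J) :
    Algebra.trace ℚ K (basisOfFractionalIdeal K J i * dualBas J j) = if i = j then 1 else 0 := by
  have := LinearMap.BilinForm.apply_dualBasis_left (B := Algebra.traceForm ℚ K)
    (hB := traceForm_nondegenerate ℚ K) (b := basisOfFractionalIdeal K J) j i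
  rw [Algebra.traceForm_apply] at this
  rw [mul_comm, dualBas, this]

theorem trace_mul_dualVec (J : (FractionalIdeal (𝓞 K)⁰ K)ˣ) (i : Free.ChooseBasisIndex ℤ J)
    (k : Free.ChooseBasisIndex ℤ J → ℤ) :
    Algebra.trace ℚ K (basisOfFractionalIdeal K J i * dualVec J k) = k i := by
  simp [dualVec, Finset.mul_sum, trace_dualBas]

/-- The lattice dual to a fractional ideal for the trace form. -/
abbrev dualIdeal (J : (FractionalIdeal (𝓞 K)⁰ K)ˣ) : FractionalIdeal (𝓞 K)⁰ K :=
  FractionalIdeal.dual ℤ ℚ (J : FractionalIdeal (𝓞 K)⁰ K)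

theorem dualVec_mem (J : (FractionalIdeal (𝓞 K)⁰ K)ˣ) (k : Free.ChooseBasisIndex ℤ J → ℤ) :
    dualVec J k ∈ dualIdeal J := by
  rw [FractionalIdeal.mem_dual J.ne_zero]
  intro a ha
  have ha' : a ∈ Submodule.span ℤ (Set.range (basisOfFractionalIdeal K J)) := by
    rw [mem_span_basisOfFractionalIdeal]; exact ha
  rw [Algebra.traceForm_apply]
  clear ha
  induction ha' using Submodule.span_induction with
  | mem x hx =>
    obtain ⟨i, rfl⟩ := hx
    rw [mul_comm, trace_mul_dualVec]
    exact ⟨k i, by simp⟩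
  | zero => exact ⟨0, by simp⟩
  | add x y _ _ hx hy => rw [mul_add, map_add]; exact add_mem hx hy
  | smul n x _ hx => rw [mul_smul_comm, map_zsmul]; exact zsmul_mem hx n

theorem dualVec_injective (J : (FractionalIdeal (𝓞 K)⁰ K)ˣ) : Function.Injective (dualVec J) := by
  intro k l h
  funext i
  have := trace_mul_dualVec J i k
  rw [h, trace_mul_dualVec] at this
  exact_mod_cast this.symm

theorem exists_dualVec_eq (J : (FractionalIdeal (𝓞 K)⁰ K)ˣ) {ξ : K} (hξ : ξ ∈ dualIdeal J) :
    ∃ k, dualVec J k = ξ := by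
  rw [FractionalIdeal.mem_dual J.ne_zero] at hξ
  have hb : ∀ i, ∃ n : ℤ, (n : ℚ) = Algebra.trace ℚ K (ξ * basisOfFractionalIdeal K J i) := by
    intro i
    obtain ⟨n, hn⟩ := hξ (basisOfFractionalIdeal K J i) (by
      have : basisOfFractionalIdeal K J i ∈ Submodule.span ℤ (Set.range (basisOfFractionalIdeal K J)) :=
        Submodule.subset_span ⟨i, rfl⟩
      rw [mem_span_basisOfFractionalIdeal] at this
      exact this)
    exact ⟨n, by rw [← Algebra.traceForm_apply, ← hn]; simp⟩
  choose k hk using hb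
  refine ⟨k, ?_⟩
  rw [← (dualBas J).sum_repr ξ, dualVec]
  refine Finset.sum_congr rfl fun j _ => ?_
  congr 1
  rw [hk, dualBas, LinearMap.BilinForm.dualBasis_repr_apply, Algebra.traceForm_apply]

/-- The additive character of `K` attached to the trace form. -/
def eTr (x : K) : ℂ := cexp (2 * Real.pi * I * (Algebra.trace ℚ K x : ℚ))

theorem eTr_add (x y : K) : eTr (x + y) = eTr x * eTr y := by
  simp only [eTr, map_add, ← Complex.exp_add]
  push_cast
  ring_nf

theorem norm_eTr (x : K) : ‖eTr x‖ = 1 := by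
  have : 2 * Real.pi * I * ((Algebra.trace ℚ K x : ℚ) : ℂ) =
      ((2 * Real.pi * (Algebra.trace ℚ K x : ℚ) : ℝ) : ℂ) * I := by
    push_cast; ring
  rw [eTr, this, norm_exp_ofReal_mul_I]

theorem eTr_eq_one (J : (FractionalIdeal (𝓞 K)⁰ K)ˣ) {x ξ : K} (hx : x ∈ (J : FractionalIdeal (𝓞 K)⁰ K))
    (hξ : ξ ∈ dualIdeal J) : eTr (x * ξ) = 1 := by
  rw [FractionalIdeal.mem_dual J.ne_zero] at hξ
  obtain ⟨n, hn⟩ := hξ x hx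
  rw [Algebra.traceForm_apply, mul_comm] at hn
  rw [eTr, ← hn, Complex.exp_eq_one_iff]
  exact ⟨n, by simp; ring⟩

theorem covolume_eq (J : (FractionalIdeal (𝓞 K)⁰ K)ˣ) :
    volume.real (ZSpan.fundamentalDomain (fractionalIdealLatticeBasis K J)) =
      FractionalIdeal.absNorm (J : FractionalIdeal (𝓞 K)⁰ K) *
        ((2 : ℝ)⁻¹ ^ nrComplexPlaces K * √(DK K)) := by
  rw [Measure.real, volume_fundamentalDomain_fractionalIdealLatticeBasis,
    volume_fundamentalDomain_latticeBasis, ENNReal.toReal_mul, ENNReal.toReal_ofReal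
      (by exact_mod_cast FractionalIdeal.absNorm_nonneg _)]
  have h : ((‖discr K‖₊ : NNReal) : ℝ) = (DK K : ℝ) := by
    rw [coe_nnnorm, Int.norm_eq_abs, DK, Nat.cast_natAbs, Int.cast_abs]
  simp [h]

theorem trV_mul_dualVec (J : (FractionalIdeal (𝓞 K)⁰ K)ˣ) (k : Free.ChooseBasisIndex ℤ J → ℤ)
    (v : Free.ChooseBasisIndex ℤ J → ℝ) :
    trV ((fractionalIdealLatticeBasis K J).equivFun.symm v * mixedEmbedding K (dualVec J k)) =
      ∑ i, k i * v i := by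
  have hadd : ∀ x y : mixedSpace K, trV (x + y) = trV x + trV y := by
    intro x y
    simp only [trV, Prod.fst_add, Prod.snd_add, Pi.add_apply, Complex.add_re, mul_add,
      Finset.sum_add_distrib]
    ring
  have hsmul : ∀ (c : ℝ) (x : mixedSpace K), trV (c • x) = c * trV x := by
    intro c x
    simp only [trV, Prod.smul_fst, Prod.smul_snd, Pi.smul_apply, smul_eq_mul, Complex.real_smul,
      Complex.re_ofReal_mul, mul_add, Finset.mul_sum]
    congr 1
    exact Finset.sum_congr rfl fun _ _ => by ring
  let T : mixedSpace K →ₗ[ℝ] ℝ := ⟨⟨trV, hadd⟩, hsmul⟩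
  change T _ = _
  rw [Basis.equivFun_symm_apply, Finset.sum_mul, map_sum]
  refine Finset.sum_congr rfl fun i _ => ?_
  rw [smul_mul_assoc, map_smul, fractionalIdealLatticeBasis_apply, ← map_mul]
  change v i * trV _ = _
  rw [trV_mixedEmbedding, trace_mul_dualVec]
  push_cast
  ring

end Theta

section Theta

open MeasureTheory Module
open scoped Classical nonZeroDivisors
open NumberField.mixedEmbedding NumberField.InfinitePlace

variable {K : Type*} [Field K] [NumberField K]

theorem exists_pos_le (t : InfinitePlace K → ℝ) (ht : ∀ w, 0 < t w) :
    ∃ m, 0 < m ∧ ∀ w, m ≤ t w := by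
  obtain ⟨w, hw⟩ := Finite.exists_min t
  exact ⟨t w, ht w, hw⟩

theorem exp_sq_le (x : ℝ) (hx : 0 ≤ x) (N : ℕ) :
    Real.exp (-2 * x ^ 2) ≤ Real.exp 2 * N.factorial * ((1 + x) ^ N)⁻¹ := by
  have h1 := Real.pow_div_factorial_le_exp (1 + x) (by positivity) N
  rw [div_le_iff₀ (by positivity)] at h1
  rw [← div_eq_mul_inv, le_div_iff₀ (by positivity)]
  calc Real.exp (-2 * x ^ 2) * (1 + x) ^ N
      ≤ Real.exp (-2 * x ^ 2) * (Real.exp (1 + x) * N.factorial) := by gcongr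
    _ = Real.exp (-2 * x ^ 2 + (1 + x)) * N.factorial := by
      rw [Real.exp_add (-2 * x ^ 2)]; ring
    _ ≤ _ := by
      gcongr
      nlinarith [sq_nonneg (2 * x - 1)]

theorem mixGauss_basis_le {ι : Type*} [Fintype ι] (b : Basis ι ℝ (mixedSpace K))
    (S : Finset {w : InfinitePlace K // IsReal w}) {t : InfinitePlace K → ℝ} (ht : ∀ w, 0 < t w)
    (N : ℕ) : ∃ C, 0 ≤ C ∧ ∀ v : ι → ℝ,
      |mixGauss S t (b.equivFun.symm v)| ≤ C * ((1 + ‖v‖) ^ N)⁻¹ := by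
  obtain ⟨m, hm, hmt⟩ := exists_pos_le t ht
  obtain ⟨c, hc, hcb⟩ : ∃ c > 0, ∀ v : ι → ℝ, ‖v‖ ≤ c * ‖b.equivFun.symm v‖ := by
    set e := b.equivFun.toContinuousLinearEquiv
    obtain ⟨c, hc, h⟩ := (e : mixedSpace K →L[ℝ] (ι → ℝ)).bound
    refine ⟨c, hc, fun v => ?_⟩
    have := h (b.equivFun.symm v)
    have he : e (b.equivFun.symm v) = v := b.equivFun.apply_symm_apply v
    rwa [show (e : mixedSpace K →L[ℝ] (ι → ℝ)) (b.equivFun.symm v) = v from he] at this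
  refine ⟨Real.exp 2 * N.factorial * (1 + c / m) ^ N, by positivity, fun v => ?_⟩
  refine (abs_mixGauss_le S t _).trans ((exp_gauss_le hm.le hmt _).trans ?_)
  refine (exp_sq_le _ (by positivity) N).trans ?_
  rw [mul_assoc _ (_ ^ N) _]
  gcongr
  rw [← inv_inv ((1 + c / m) ^ N), ← mul_inv]
  refine inv_anti₀ (by positivity) ?_
  rw [inv_mul_le_iff₀ (by positivity), ← mul_pow]
  gcongr
  have h1 := hcb v
  have h2 : c / m * (m * ‖b.equivFun.symm v‖) = c * ‖b.equivFun.symm v‖ := by field_simp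
  have h3 : 0 ≤ c / m := by positivity
  have h4 : 0 ≤ m * ‖b.equivFun.symm v‖ := by positivity
  nlinarith

theorem expChar_neg_dual (J : (FractionalIdeal (𝓞 K)⁰ K)ˣ) (k : Free.ChooseBasisIndex ℤ J → ℤ)
    (v : Free.ChooseBasisIndex ℤ J → ℝ) :
    expChar (-k) v = cexp (-(2 * Real.pi * I *
      trV ((fractionalIdealLatticeBasis K J).equivFun.symm v * mixedEmbedding K (dualVec J k)))) := by
  rw [trV_mul_dualVec, expChar]
  push_cast
  simp [Finset.sum_neg_distrib]

theorem expChar_equivFun (J : (FractionalIdeal (𝓞 K)⁰ K)ˣ) (k : Free.ChooseBasisIndex ℤ J → ℤ)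
    (x : K) : expChar k ((fractionalIdealLatticeBasis K J).equivFun (mixedEmbedding K x)) =
      eTr (x * dualVec J k) := by
  have := trV_mul_dualVec J k ((fractionalIdealLatticeBasis K J).equivFun (mixedEmbedding K x))
  rw [LinearEquiv.symm_apply_apply, ← map_mul, trV_mixedEmbedding] at this
  rw [expChar, eTr]
  congr 2
  have h := congrArg (fun r : ℝ => (r : ℂ)) this
  push_cast at h ⊢
  exact h.symm

theorem summable_theta (J : (FractionalIdeal (𝓞 K)⁰ K)ˣ)
    (S : Finset {w : InfinitePlace K // IsReal w}) {t : InfinitePlace K → ℝ} (ht : ∀ w, 0 < t w)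
    {c : K → ℂ} {M : ℝ} (hc : ∀ α, ‖c α‖ ≤ M)
    (hJ : ∀ α, α ∉ (J : FractionalIdeal (𝓞 K)⁰ K) → c α = 0) :
    Summable fun α : K => c α * mixGauss S t (mixedEmbedding K α) := by
  obtain ⟨B, hB0, hB, hBm⟩ := exists_gauss_majorant J (nK K + 1) (by omega)
  obtain ⟨m, hm, hmt⟩ := exists_pos_le t ht
  have hM : 0 ≤ M := (norm_nonneg _).trans (hc 0)
  have h0 : Summable fun α : K => if α = 0 then (1 : ℝ) else 0 :=
    summable_of_ne_finset_zero (s := {0}) fun α hα => if_neg (by simpa using hα)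
  refine Summable.of_norm_bounded
    (((hB.mul_right ((m ^ (2 * (nK K + 1)))⁻¹)).add h0).mul_left M) fun α => ?_
  rw [norm_mul, Complex.norm_real, Real.norm_eq_abs]
  by_cases hα : α ∈ (J : FractionalIdeal (𝓞 K)⁰ K)
  · refine mul_le_mul (hc α) ?_ (abs_nonneg _) hM
    refine abs_mixGauss_embedding_le.trans ?_
    by_cases h : α = 0
    · have := hB0 0
      rw [h, if_pos rfl]
      have h1 : 0 ≤ B 0 * (m ^ (2 * (nK K + 1)))⁻¹ := by positivity
      simp only [map_zero, mul_zero]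
      norm_num
      exact h1
    · rw [if_neg h, add_zero]
      exact hBm α hα h t m hm hmt
  · rw [hJ α hα, norm_zero, zero_mul]
    have := hB0 α
    positivity

theorem basis_coord_sum (J : (FractionalIdeal (𝓞 K)⁰ K)ˣ) (m : Free.ChooseBasisIndex ℤ J → ℤ)
    (x : K) : (fractionalIdealLatticeBasis K J).equivFun.symm
        ((fractionalIdealLatticeBasis K J).equivFun (mixedEmbedding K x) + intVec m) =
      mixedEmbedding K (x + ((fractionalIdealBasis K J.1).equivFun.symm m : K)) := by
  rw [map_add, LinearEquiv.symm_apply_apply, map_add]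
  congr 1
  rw [Basis.equivFun_symm_apply, Basis.equivFun_symm_apply, AddSubmonoidClass.coe_finsetSum,
    map_sum]
  refine Finset.sum_congr rfl fun i _ => ?_
  rw [fractionalIdealLatticeBasis_apply, basisOfFractionalIdeal_apply, intVec,
    show ((m i • fractionalIdealBasis K J.1 i : J.1) : K) = m i • (fractionalIdealBasis K J.1 i : K)
      from rfl, map_zsmul, Int.cast_smul_eq_zsmul]

/-- Poisson summation for a Gaussian over a translate of a fractional ideal. -/
theorem tsum_mixGauss (J : (FractionalIdeal (𝓞 K)⁰ K)ˣ)
    (S : Finset {w : InfinitePlace K // IsReal w}) {t : InfinitePlace K → ℝ} (ht : ∀ w, 0 < t w)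
    (x : K) :
    ∑' β : (J : FractionalIdeal (𝓞 K)⁰ K), (mixGauss S t (mixedEmbedding K (x + β)) : ℂ) =
      mixEps S * (((FractionalIdeal.absNorm (J : FractionalIdeal (𝓞 K)⁰ K) : ℝ) * √(DK K))⁻¹ *
        ∏ w, (t w)⁻¹ ^ mult w : ℝ) *
      ∑' ξ : K, (if ξ ∈ dualIdeal J then
        eTr (x * ξ) * mixGauss S t⁻¹ (mixedEmbedding K ξ) else 0) := by
  set b := fractionalIdealLatticeBasis K J with hb
  set F : (Free.ChooseBasisIndex ℤ J → ℝ) → ℂ := fun v => mixGauss S t (b.equivFun.symm v) with hF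
  set c : ℂ := mixEps S * (((FractionalIdeal.absNorm (J : FractionalIdeal (𝓞 K)⁰ K) : ℝ) *
    √(DK K))⁻¹ * ∏ w, (t w)⁻¹ ^ mult w : ℝ) with hc
  have hFc : Continuous F := by
    have h1 := continuous_mixGauss (K := K) S t
    have h2 := b.equivFun.symm.toContinuousLinearEquiv.continuous
    exact Complex.continuous_ofReal.comp (h1.comp h2)
  obtain ⟨C, hC, hCb⟩ := mixGauss_basis_le b S ht (Fintype.card (Free.ChooseBasisIndex ℤ J) + 1)
  have hFb : ∀ v, ‖F v‖ ≤ C * ((1 + ‖v‖) ^ (Fintype.card (Free.ChooseBasisIndex ℤ J) + 1))⁻¹ := by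
    intro v
    simpa [hF] using hCb v
  have hFi : Integrable F := by
    have h := (integrable_one_add_norm (E := Free.ChooseBasisIndex ℤ J → ℝ) (μ := volume)
      (r := Fintype.card (Free.ChooseBasisIndex ℤ J) + 1) (by simp)).const_mul C
    refine h.mono' hFc.aestronglyMeasurable (.of_forall fun v => (hFb v).trans_eq ?_)
    rw [Real.rpow_neg (by positivity)]
    norm_cast
  have hcoef : ∀ k : Free.ChooseBasisIndex ℤ J → ℤ, ∫ v, expChar (-k) v * F v =
      c * mixGauss S t⁻¹ (mixedEmbedding K (dualVec J k)) := by
    intro k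
    simp_rw [expChar_neg_dual]
    rw [integral_comp_equivFun_symm b volume (fun u => cexp (-(2 * Real.pi * I *
      trV (u * mixedEmbedding K (dualVec J k)))) * mixGauss S t u),
      integral_char_mul_mixGauss S ht, covolume_eq, hc, Complex.real_smul]
    have hJ : (FractionalIdeal.absNorm (J : FractionalIdeal (𝓞 K)⁰ K) : ℝ) ≠ 0 := by
      exact_mod_cast (FractionalIdeal.absNorm_eq_zero_iff.not.2 J.ne_zero)
    push_cast
    field_simp
  have hdual : dualIdeal J ≠ 0 := FractionalIdeal.dual_ne_zero ℤ ℚ J.ne_zero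
  have hsum : Summable fun k : Free.ChooseBasisIndex ℤ J → ℤ => ∫ v, expChar (-k) v * F v := by
    simp_rw [hcoef]
    have h := summable_theta (Units.mk0 _ hdual) S (t := t⁻¹) (fun w => inv_pos.2 (ht w))
      (c := fun α => if α ∈ dualIdeal J then 1 else 0) (M := 1)
      (fun α => by split_ifs <;> simp) (fun α hα => if_neg hα)
    refine ((h.comp_injective (dualVec_injective J)).mul_left c).congr fun k => ?_
    simp only [Function.comp_apply, if_pos (dualVec_mem J k), one_mul]
  have hP := (hasSum_poisson hFc hC hFi hFb hsum (b.equivFun (mixedEmbedding K x))).tsum_eq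
  have hL : ∑' m, F (b.equivFun (mixedEmbedding K x) + intVec m) =
      ∑' β : (J : FractionalIdeal (𝓞 K)⁰ K), (mixGauss S t (mixedEmbedding K (x + β)) : ℂ) := by
    refine (Equiv.tsum_eq (fractionalIdealBasis K J.1).equivFun.symm.toEquiv _).symm.trans ?_ |>.symm
    refine tsum_congr fun m => ?_
    rw [hF]
    dsimp only
    rw [basis_coord_sum]
    rfl
  rw [← hL, ← hP, ← tsum_mul_left]
  simp_rw [hcoef, hb, expChar_equivFun]
  refine Eq.trans ?_ ((dualVec_injective J).tsum_eq ?_)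
  · refine tsum_congr fun k => ?_
    rw [if_pos (dualVec_mem J k)]
    ring
  · intro ξ hξ
    by_contra h
    refine hξ ?_
    dsimp only
    rw [if_neg fun hmem => h (exists_dualVec_eq J hmem), mul_zero]

end Theta

section Theta

open MeasureTheory Module
open scoped Classical nonZeroDivisors
open NumberField.mixedEmbedding NumberField.InfinitePlace

variable {K : Type*} [Field K] [NumberField K]

/-- A nonzero ideal as an invertible fractional ideal. -/
def unitIdeal (𝔪 : Ideal (𝓞 K)) (h : 𝔪 ≠ ⊥) : (FractionalIdeal (𝓞 K)⁰ K)ˣ :=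
  Units.mk0 (𝔪 : FractionalIdeal (𝓞 K)⁰ K) (FractionalIdeal.coeIdeal_ne_zero.2 h)

theorem mem_unitIdeal {𝔪 : Ideal (𝓞 K)} {h : 𝔪 ≠ ⊥} {x : K} :
    x ∈ (unitIdeal 𝔪 h : FractionalIdeal (𝓞 K)⁰ K) ↔ ∃ a ∈ 𝔪, (a : K) = x :=
  FractionalIdeal.mem_coeIdeal _

/-- The elements of an ideal, viewed inside the field. -/
def idealEquivUnitIdeal (𝔪 : Ideal (𝓞 K)) (h : 𝔪 ≠ ⊥) :
    𝔪 ≃ (unitIdeal 𝔪 h : FractionalIdeal (𝓞 K)⁰ K) :=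
  Equiv.ofBijective (fun a => ⟨(a.1 : K), mem_unitIdeal.2 ⟨a.1, a.2, rfl⟩⟩) (by
    constructor
    · intro a b hab
      exact Subtype.ext (RingOfIntegers.ext (Subtype.mk.inj hab))
    · rintro ⟨x, hx⟩
      obtain ⟨a, ha, rfl⟩ := mem_unitIdeal.1 hx
      exact ⟨⟨a, ha⟩, rfl⟩)

/-- Decomposition of a ring into cosets of an ideal. -/
def cosetEquiv {R : Type*} [CommRing R] (𝔪 : Ideal R) : (R ⧸ 𝔪) × 𝔪 ≃ R where
  toFun p := p.1.out + p.2
  invFun a := (Ideal.Quotient.mk 𝔪 a, ⟨a - (Ideal.Quotient.mk 𝔪 a).out, by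
    rw [← Ideal.Quotient.eq, Ideal.Quotient.mk_out]⟩)
  left_inv := by
    rintro ⟨x, β⟩
    have h : Ideal.Quotient.mk 𝔪 (x.out + β) = x := by
      rw [map_add, Ideal.Quotient.mk_out, Ideal.Quotient.eq_zero_iff_mem.2 β.2, add_zero]
    ext
    · exact h
    · change x.out + (β : R) - (Ideal.Quotient.mk 𝔪 (x.out + β)).out = β
      rw [h]; ring
  right_inv a := by simp

theorem tsum_cosets {𝔪 : Ideal (𝓞 K)} (h𝔪 : 𝔪 ≠ ⊥) {f : K → ℂ}
    (hsupp : ∀ α, α ∉ Set.range (fun a : 𝓞 K => (a : K)) → f α = 0) (hf : Summable f) :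
    ∑' α, f α = ∑' x : 𝓞 K ⧸ 𝔪, ∑' β : (unitIdeal 𝔪 h𝔪 : FractionalIdeal (𝓞 K)⁰ K),
      f ((x.out : 𝓞 K) + β) := by
  have hinj : Function.Injective fun a : 𝓞 K => (a : K) := RingOfIntegers.coe_injective
  rw [← hinj.tsum_eq (f := f) (fun α hα => by_contra fun h => hα (hsupp α h)),
    ← (cosetEquiv 𝔪).tsum_eq]
  have hs : Summable fun p : (𝓞 K ⧸ 𝔪) × 𝔪 => f ((cosetEquiv 𝔪 p : 𝓞 K) : K) :=
    (hf.comp_injective hinj).comp_injective (cosetEquiv 𝔪).injective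
  rw [hs.tsum_prod]
  refine tsum_congr fun x => ?_
  exact (idealEquivUnitIdeal 𝔪 h𝔪).tsum_eq (fun β : (unitIdeal 𝔪 h𝔪 : FractionalIdeal (𝓞 K)⁰ K) =>
    f ((x.out : 𝓞 K) + β))

/-- The finite Fourier transform of a function on `𝓞 K ⧸ 𝔪`, as a function on the dual of `𝔪`. -/
def phiHat (𝔪 : Ideal (𝓞 K)) (φ : K → ℂ) (ξ : K) : ℂ :=
  if ξ ∈ FractionalIdeal.dual ℤ ℚ (𝔪 : FractionalIdeal (𝓞 K)⁰ K) then
    ∑' x : 𝓞 K ⧸ 𝔪, φ (x.out : 𝓞 K) * eTr (((x.out : 𝓞 K) : K) * ξ) else 0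

/-- The theta series of a function on `K`. -/
def theta (c : K → ℂ) (S : Finset {w : InfinitePlace K // IsReal w}) (t : InfinitePlace K → ℝ) : ℂ :=
  ∑' α : K, c α * mixGauss S t (mixedEmbedding K α)

theorem theta_inversion {𝔪 : Ideal (𝓞 K)} (h𝔪 : 𝔪 ≠ ⊥)
    (S : Finset {w : InfinitePlace K // IsReal w}) {t : InfinitePlace K → ℝ} (ht : ∀ w, 0 < t w)
    {φ : K → ℂ} (hφ : ∀ α, ‖φ α‖ ≤ 1)
    (hsupp : ∀ α, α ∉ Set.range (fun a : 𝓞 K => (a : K)) → φ α = 0)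
    (hper : ∀ α, ∀ β ∈ 𝔪, φ (α + (β : 𝓞 K)) = φ α) :
    theta φ S t = mixEps S * (((Ideal.absNorm 𝔪 : ℝ) * √(DK K))⁻¹ *
        ∏ w, (t w)⁻¹ ^ mult w : ℝ) * theta (phiHat 𝔪 φ) S t⁻¹ := by
  have hfin : Finite (𝓞 K ⧸ 𝔪) := Ideal.finiteQuotientOfFreeOfNeBot 𝔪 h𝔪
  have : Fintype (𝓞 K ⧸ 𝔪) := Fintype.ofFinite _
  have hsum : Summable fun α : K => φ α * mixGauss S t (mixedEmbedding K α) := by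
    refine summable_theta 1 S ht hφ fun α hα => hsupp α ?_
    rintro ⟨a, rfl⟩
    exact hα ((FractionalIdeal.mem_one_iff _).2 ⟨a, rfl⟩)
  set J := unitIdeal 𝔪 h𝔪 with hJ
  have hdual : dualIdeal J ≠ 0 := FractionalIdeal.dual_ne_zero ℤ ℚ J.ne_zero
  have hsx : ∀ x : K, Summable fun ξ : K => (if ξ ∈ dualIdeal J then
      eTr (x * ξ) * (mixGauss S t⁻¹ (mixedEmbedding K ξ) : ℂ) else 0) := by
    intro x
    refine (summable_theta (Units.mk0 _ hdual) S (t := t⁻¹) (fun w => inv_pos.2 (ht w))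
      (c := fun ξ => if ξ ∈ dualIdeal J then eTr (x * ξ) else 0) (M := 1) (fun ξ => ?_)
      (fun ξ hξ => if_neg hξ)).congr fun ξ => ?_
    · split_ifs
      · exact (norm_eTr _).le
      · simp
    · split_ifs <;> simp
  rw [theta, tsum_cosets h𝔪 (fun α hα => by rw [hsupp α hα, zero_mul]) hsum]
  have h1 : ∀ x : 𝓞 K ⧸ 𝔪, ∑' β : (J : FractionalIdeal (𝓞 K)⁰ K),
      φ ((x.out : 𝓞 K) + β) * (mixGauss S t (mixedEmbedding K ((x.out : 𝓞 K) + β)) : ℂ) =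
      mixEps S * (((Ideal.absNorm 𝔪 : ℝ) * √(DK K))⁻¹ * ∏ w, (t w)⁻¹ ^ mult w : ℝ) *
      ∑' ξ : K, φ (x.out : 𝓞 K) * (if ξ ∈ dualIdeal J then
        eTr (((x.out : 𝓞 K) : K) * ξ) * mixGauss S t⁻¹ (mixedEmbedding K ξ) else 0) := by
    intro x
    have h2 : ∀ β : (J : FractionalIdeal (𝓞 K)⁰ K), φ ((x.out : 𝓞 K) + β) = φ (x.out : 𝓞 K) := by
      rintro ⟨β, hβ⟩
      obtain ⟨a, ha, rfl⟩ := mem_unitIdeal.1 hβ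
      exact hper _ a ha
    simp_rw [h2]
    rw [tsum_mul_left, tsum_mixGauss J S ht, tsum_mul_left]
    rw [hJ, unitIdeal, Units.val_mk0, FractionalIdeal.coeIdeal_absNorm]
    push_cast
    ring
  refine (tsum_congr h1).trans ?_
  rw [tsum_fintype, ← Finset.mul_sum, ← Summable.tsum_finsetSum fun x _ => (hsx _).mul_left _]
  congr 1
  refine tsum_congr fun ξ => ?_
  rw [phiHat, tsum_fintype]
  change _ = (if ξ ∈ dualIdeal J then _ else _) * _
  split_ifs
  · rw [Finset.sum_mul]
    exact Finset.sum_congr rfl fun x _ => by ring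
  · simp

theorem norm_phiHat_le {𝔣 𝔟 : Ideal (𝓞 K)} (h𝔣 : 𝔣 ≠ ⊥) (h𝔟 : 𝔟 ≠ ⊥) {φ : K → ℂ}
    (hφ : ∀ α, ‖φ α‖ ≤ 1) (hsupp : ∀ a : 𝓞 K, a ∉ 𝔟 → φ a = 0) (ξ : K) :
    ‖phiHat (𝔣 * 𝔟) φ ξ‖ ≤ Ideal.absNorm 𝔣 := by
  rw [phiHat]
  split_ifs with hξ
  swap
  · simp
  have h𝔪 : 𝔣 * 𝔟 ≠ ⊥ := mul_ne_zero h𝔣 h𝔟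
  have hfin : Finite (𝓞 K ⧸ (𝔣 * 𝔟)) := Ideal.finiteQuotientOfFreeOfNeBot _ h𝔪
  have hfinb : Finite (𝓞 K ⧸ 𝔟) := Ideal.finiteQuotientOfFreeOfNeBot _ h𝔟
  have : Fintype (𝓞 K ⧸ (𝔣 * 𝔟)) := Fintype.ofFinite _
  set f : (𝓞 K ⧸ (𝔣 * 𝔟)) →+* 𝓞 K ⧸ 𝔟 := Ideal.Quotient.factor (Ideal.mul_le_right : 𝔣 * 𝔟 ≤ 𝔟)
  have hcard : (Finset.univ.filter fun x => f x = 0).card = Ideal.absNorm 𝔣 := by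
    have h1 := AddSubgroup.card_eq_card_quotient_mul_card_addSubgroup f.toAddMonoidHom.ker
    have h2 : Nat.card ((𝓞 K ⧸ (𝔣 * 𝔟)) ⧸ f.toAddMonoidHom.ker) = Ideal.absNorm 𝔟 := by
      rw [Nat.card_congr (QuotientAddGroup.quotientKerEquivOfSurjective f.toAddMonoidHom
        (Ideal.Quotient.factor_surjective (Ideal.mul_le_right : 𝔣 * 𝔟 ≤ 𝔟))).toEquiv]
      rfl
    have h3 : Nat.card (𝓞 K ⧸ (𝔣 * 𝔟)) = Ideal.absNorm 𝔣 * Ideal.absNorm 𝔟 := by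
      rw [← map_mul]; rfl
    have h4 : Nat.card f.toAddMonoidHom.ker = (Finset.univ.filter fun x => f x = 0).card := by
      rw [Nat.card_eq_fintype_card, ← Fintype.card_subtype]
      exact Fintype.card_congr (Equiv.refl _)
    rw [h2, h3, h4, mul_comm] at h1
    exact (Nat.eq_of_mul_eq_mul_left (Nat.pos_of_ne_zero (Ideal.absNorm_eq_zero_iff.not.2 h𝔟)) h1).symm
  rw [tsum_fintype]
  refine (norm_sum_le _ _).trans ?_
  rw [← hcard, Finset.card_filter]
  push_cast
  refine Finset.sum_le_sum fun x _ => ?_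
  rw [norm_mul, norm_eTr, mul_one]
  split_ifs with h
  · exact hφ _
  · rw [hsupp, norm_zero]
    intro hx
    refine h ?_
    rw [← Ideal.Quotient.mk_out x]
    exact Ideal.Quotient.eq_zero_iff_mem.2 hx

end Theta

section Unfold

open MeasureTheory Module
open scoped Classical nonZeroDivisors
open NumberField.mixedEmbedding NumberField.InfinitePlace

variable {K : Type*} [Field K] [NumberField K]

/-- The product of the signs of `α` at the real places in `S`. -/
def sgnS (S : Finset {w : InfinitePlace K // IsReal w}) (α : K) : ℝ :=
  ∏ w ∈ S, (SignType.sign ((mixedEmbedding K α).1 w) : ℝ)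

omit [NumberField K] in
theorem sgnS_mul (S : Finset {w : InfinitePlace K // IsReal w}) (α β : K) :
    sgnS S (α * β) = sgnS S α * sgnS S β := by
  simp only [sgnS, map_mul, Prod.fst_mul, Pi.mul_apply, sign_mul, SignType.coe_mul,
    Finset.prod_mul_distrib]

omit [NumberField K] in
theorem sgnS_mul_self (S : Finset {w : InfinitePlace K // IsReal w}) {α : K} (hα : α ≠ 0) :
    sgnS S α * sgnS S α = 1 := by
  rw [sgnS, ← Finset.prod_mul_distrib]
  refine Finset.prod_eq_one fun w _ => ?_
  have h : (mixedEmbedding K α).1 w ≠ 0 := by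
    rw [mixedEmbedding_apply_isReal]
    simpa using hα
  rcases h.lt_or_gt with h | h
  · rw [sign_neg h]; simp
  · rw [sign_pos h]; simp

omit [NumberField K] in
theorem abs_sgnS (S : Finset {w : InfinitePlace K // IsReal w}) {α : K} (hα : α ≠ 0) :
    |sgnS S α| = 1 := by
  have := sgnS_mul_self S hα
  rcases mul_self_eq_one_iff.1 this with h | h <;> simp [h]

/-- The exponent of the archimedean factor at a place. -/
def placeExp (S : Finset {w : InfinitePlace K // IsReal w}) (w : InfinitePlace K) : ℕ :=
  if ∃ h : IsReal w, (⟨w, h⟩ : {w : InfinitePlace K // IsReal w}) ∈ S then 1 else 0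

omit [NumberField K] in
theorem placeExp_le_one (S : Finset {w : InfinitePlace K // IsReal w}) (w : InfinitePlace K) :
    placeExp S w ≤ 1 := by
  rw [placeExp]; split_ifs <;> simp

omit [NumberField K] in
theorem placeExp_isComplex (S : Finset {w : InfinitePlace K // IsReal w}) {w : InfinitePlace K}
    (hw : IsComplex w) : placeExp S w = 0 := by
  rw [placeExp, if_neg]
  rintro ⟨h, -⟩
  exact not_isReal_iff_isComplex.2 hw h

/-- The archimedean weight in logarithmic coordinates. -/
def logGauss (S : Finset {w : InfinitePlace K // IsReal w}) (y : InfinitePlace K → ℝ) : ℝ :=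
  ∏ w, Real.exp (placeExp S w * y w - Real.pi * mult w * Real.exp (2 * y w))

theorem logGauss_pos (S : Finset {w : InfinitePlace K // IsReal w}) (y : InfinitePlace K → ℝ) :
    0 < logGauss S y := Finset.prod_pos fun _ _ => Real.exp_pos _

/-- The logarithms of the absolute values of an element. -/
def logV (α : K) : InfinitePlace K → ℝ := fun w => Real.log (w α)

omit [NumberField K] in
theorem logV_mul {α β : K} (hα : α ≠ 0) (hβ : β ≠ 0) : logV (α * β) = logV α + logV β := by
  funext w
  simp only [logV, map_mul, Pi.add_apply]
  exact Real.log_mul (by simpa using hα) (by simpa using hβ)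

theorem realFac_mul_sign (p : Prop) [Decidable p] {t u : ℝ} (ht : 0 < t) (hu : u ≠ 0) :
    realFac p (t * u) = (if p then (SignType.sign u : ℝ) else 1) *
      Real.exp ((if p then (1 : ℕ) else 0 : ℕ) * (Real.log t + Real.log |u|) -
        Real.pi * Real.exp (2 * (Real.log t + Real.log |u|))) := by
  have h1 : Real.exp (Real.log t + Real.log |u|) = t * |u| := by
    rw [Real.exp_add, Real.exp_log ht, Real.exp_log (abs_pos.2 hu)]
  have h2 : Real.exp (2 * (Real.log t + Real.log |u|)) = (t * u) ^ 2 := by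
    rw [two_mul, Real.exp_add, h1, mul_pow, ← sq_abs u]; ring
  rw [realFac, sub_eq_add_neg, Real.exp_add, h2]
  split_ifs
  · rw [Nat.cast_one, one_mul, h1, ← mul_assoc]
    congr 1
    · rw [mul_left_comm, sign_mul_abs]
    · ring_nf
  · simp

theorem mixGauss_embedding (S : Finset {w : InfinitePlace K // IsReal w}) (y : InfinitePlace K → ℝ)
    {α : K} (hα : α ≠ 0) :
    mixGauss S (fun w => Real.exp (y w)) (mixedEmbedding K α) = sgnS S α * logGauss S (y + logV α) := by
  rw [mixGauss, logGauss, prod_eq_prod_mul_prod, sgnS, ← mul_assoc]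
  congr 1
  · have hS : ∏ w ∈ S, (SignType.sign ((mixedEmbedding K α).1 w) : ℝ) =
        ∏ w, if w ∈ S then (SignType.sign ((mixedEmbedding K α).1 w) : ℝ) else 1 :=
      (Finset.prod_ite_mem_eq S _).symm
    rw [hS, ← Finset.prod_mul_distrib]
    refine Finset.prod_congr rfl fun w _ => ?_
    have h : (mixedEmbedding K α).1 w ≠ 0 := by
      rw [mixedEmbedding_apply_isReal]
      simpa using hα
    rw [realFac_mul_sign _ (Real.exp_pos _) h, Real.log_exp]
    have h1 : Real.log |(mixedEmbedding K α).1 w| = logV α w.1 := by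
      rw [logV, mixedEmbedding_apply_isReal, ← Real.norm_eq_abs, norm_embedding_of_isReal]
    have h2 : placeExp S w.1 = if w ∈ S then 1 else 0 := by
      rw [placeExp]
      exact if_congr ⟨fun ⟨_, h⟩ => h, fun h => ⟨w.2, h⟩⟩ rfl rfl
    rw [h1, h2, mult_isReal, Pi.add_apply, Nat.cast_one, mul_one]
  · refine Finset.prod_congr rfl fun w _ => ?_
    rw [placeExp_isComplex S w.2, mult_isComplex, Pi.add_apply, logV,
      mixedEmbedding_apply_isComplex, norm_embedding_eq]
    have h0 : 0 < w.1 α := InfinitePlace.pos_iff.2 hα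
    have h1 : Real.exp (2 * (y w.1 + Real.log (w.1 α))) = (Real.exp (y w.1) * w.1 α) ^ 2 := by
      rw [two_mul, Real.exp_add, Real.exp_add, Real.exp_log h0, sq]
    rw [h1]
    congr 1
    push_cast
    ring

end Unfold

section Unfold

open MeasureTheory Module
open scoped Classical nonZeroDivisors
open NumberField.mixedEmbedding NumberField.InfinitePlace NumberField.Units
open NumberField.Units.dirichletUnitTheorem

variable {K : Type*} [Field K] [NumberField K]

theorem nK_pos : (0 : ℝ) < nK K := Nat.cast_pos.2 finrank_pos

theorem sum_mult_eq_nK : ∑ w : InfinitePlace K, (mult w : ℝ) = nK K := by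
  rw [nK, ← InfinitePlace.sum_mult_eq]
  push_cast
  rfl

omit [NumberField K] in
theorem mult_pos_real (w : InfinitePlace K) : (0 : ℝ) < mult w := Nat.cast_pos.2 mult_pos

/-- Coordinates on the space of logarithms of absolute values: the logarithmic space of units
and the logarithm of the norm. -/
def unitCoord (K : Type*) [Field K] [NumberField K] :
    (logSpace K × ℝ) ≃ₗ[ℝ] (InfinitePlace K → ℝ) where
  toFun p w := p.2 / nK K +
    (if hw : w = w₀ then -∑ v, p.1 v else p.1 ⟨w, hw⟩) / mult w
  invFun y := (fun w => mult w.1 * (y w.1 - (∑ v, mult v * y v) / nK K), ∑ v, mult v * y v)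
  map_add' p q := by
    funext w
    simp only [Prod.fst_add, Prod.snd_add, Pi.add_apply]
    split_ifs
    · rw [Finset.sum_add_distrib]; ring
    · ring
  map_smul' c p := by
    funext w
    simp only [Prod.smul_fst, Prod.smul_snd, Pi.smul_apply, smul_eq_mul, RingHom.id_apply]
    split_ifs
    · rw [← Finset.mul_sum]; ring
    · ring
  left_inv p := by
    have hn := (nK_pos (K := K)).ne'
    have h : ∑ v : InfinitePlace K, (mult v : ℝ) * (p.2 / nK K +
        (if hw : v = w₀ then -∑ v, p.1 v else p.1 ⟨v, hw⟩) / mult v) = p.2 := by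
      simp_rw [mul_add, mul_div_cancel₀ _ (mult_pos_real _).ne', Finset.sum_add_distrib,
        ← Finset.sum_mul, sum_mult_eq_nK, mul_div_cancel₀ _ hn]
      rw [Fintype.sum_eq_add_sum_subtype_ne _ w₀, dif_pos rfl]
      have : ∑ v : {w : InfinitePlace K // w ≠ w₀},
          (if hw : v.1 = w₀ then -∑ v, p.1 v else p.1 ⟨v.1, hw⟩) = ∑ v, p.1 v :=
        Finset.sum_congr rfl fun v _ => dif_neg v.2
      rw [this]
      ring
    refine Prod.ext ?_ h
    funext w
    dsimp only
    rw [h, dif_neg w.2]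
    have := (mult_pos_real w.1).ne'
    field_simp
    ring
  right_inv y := by
    funext w
    dsimp only
    have hn := (nK_pos (K := K)).ne'
    have hm := (mult_pos_real w).ne'
    split_ifs with hw
    · have h1 : ∑ v : {w : InfinitePlace K // w ≠ w₀},
          (mult v.1 : ℝ) * (y v.1 - (∑ v, mult v * y v) / nK K) =
          -(mult w * (y w - (∑ v, mult v * y v) / nK K)) := by
        have h0 : ∑ v : InfinitePlace K, (mult v : ℝ) * (y v - (∑ v, mult v * y v) / nK K) = 0 := by
          simp_rw [mul_sub, Finset.sum_sub_distrib, ← Finset.sum_mul, sum_mult_eq_nK,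
            mul_div_cancel₀ _ hn, sub_self]
        rw [Fintype.sum_eq_add_sum_subtype_ne _ w₀] at h0
        rw [hw]
        linarith
      rw [h1, neg_neg]
      field_simp
      ring
    · field_simp
      ring

theorem unitCoord_apply (p : logSpace K × ℝ) (w : InfinitePlace K) :
    unitCoord K p w = p.2 / nK K +
      (if hw : w = w₀ then -∑ v, p.1 v else p.1 ⟨w, hw⟩) / mult w := rfl

theorem sum_mult_unitCoord (p : logSpace K × ℝ) : ∑ w, mult w * unitCoord K p w = p.2 :=
  congrArg Prod.snd ((unitCoord K).left_inv p)

theorem unitCoord_logEmbedding (u : (𝓞 K)ˣ) :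
    unitCoord K (logEmbedding K (Additive.ofMul u), 0) = logV (u : K) := by
  funext w
  have hm := (mult_pos_real w).ne'
  rw [unitCoord_apply, zero_div, zero_add, logV]
  split_ifs with hw
  · rw [sum_logEmbedding_component, hw, neg_mul, neg_neg, mul_div_cancel_left₀]
    exact (mult_pos_real _).ne'
  · have := logEmbedding_component u ⟨w, hw⟩
    dsimp only
    rw [this, mul_div_cancel_left₀ _ hm]

theorem symm_logV_snd {α : K} (hα : α ≠ 0) :
    ((unitCoord K).symm (logV α)).2 = Real.log |(Algebra.norm ℚ α : ℝ)| := by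
  change ∑ v : InfinitePlace K, (mult v : ℝ) * logV α v = _
  have : |(Algebra.norm ℚ α : ℝ)| = ∏ w : InfinitePlace K, w α ^ mult w := by
    rw [prod_eq_abs_norm]; push_cast; rfl
  rw [this, Real.log_prod fun w _ => pow_ne_zero _ ((InfinitePlace.pos_iff.2 hα).ne')]
  exact Finset.sum_congr rfl fun w _ => by rw [Real.log_pow]; rfl

end Unfold

section Unfold

open MeasureTheory Module
open scoped Classical nonZeroDivisors
open NumberField.mixedEmbedding NumberField.InfinitePlace NumberField.Units
open NumberField.Units.dirichletUnitTheorem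

theorem image_exp_two_mul : (fun u : ℝ => Real.exp (2 * u)) '' Set.univ = Set.Ioi 0 := by
  rw [Set.image_univ]
  ext x
  constructor
  · rintro ⟨u, rfl⟩
    exact Real.exp_pos _
  · intro hx
    exact ⟨Real.log x / 2, by dsimp only; rw [mul_div_cancel₀ _ two_ne_zero, Real.exp_log hx]⟩

theorem hasDerivWithinAt_exp_two_mul (u : ℝ) :
    HasDerivWithinAt (fun u : ℝ => Real.exp (2 * u)) (2 * Real.exp (2 * u)) Set.univ u := by
  have := (((hasDerivAt_id u).const_mul 2).exp).hasDerivWithinAt (s := Set.univ)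
  refine this.congr_deriv ?_
  simp only [id, mul_one]
  ring

theorem injOn_exp_two_mul : Set.InjOn (fun u : ℝ => Real.exp (2 * u)) Set.univ := by
  intro a _ b _ h
  simpa using h

theorem expGauss_eq (c : ℂ) (b u : ℝ) :
    cexp (c * u - b * Real.exp (2 * u)) = |2 * Real.exp (2 * u)| •
      (1 / 2 * (((Real.exp (2 * u) : ℝ) : ℂ) ^ (c / 2 - 1) * cexp (-(b * Real.exp (2 * u))))) := by
  have h : ((Real.exp (2 * u) : ℝ) : ℂ) ^ (c / 2 - 1) = cexp (c * u) / Real.exp (2 * u) := by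
    rw [cpow_sub _ _ (by exact_mod_cast (Real.exp_pos _).ne'), cpow_one,
      cpow_def_of_ne_zero (by exact_mod_cast (Real.exp_pos _).ne'),
      ← ofReal_log (Real.exp_pos _).le, Real.log_exp]
    congr 2
    push_cast
    ring
  have h0 : ((Real.exp (2 * u) : ℝ) : ℂ) ≠ 0 := by exact_mod_cast (Real.exp_pos _).ne'
  rw [abs_of_pos (by positivity), h, real_smul, sub_eq_add_neg, Complex.exp_add]
  rw [ofReal_mul, ofReal_ofNat]
  field_simp

theorem integrable_expGauss {c : ℂ} {b : ℝ} (hc : 0 < c.re) (hb : 0 < b) :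
    Integrable fun u : ℝ => cexp (c * u - b * Real.exp (2 * u)) := by
  simp_rw [expGauss_eq]
  rw [← integrableOn_univ]
  refine (integrableOn_image_iff_integrableOn_abs_deriv_smul MeasurableSet.univ
    (fun u _ => hasDerivWithinAt_exp_two_mul u) injOn_exp_two_mul
    (fun x : ℝ => 1 / 2 * ((x : ℂ) ^ (c / 2 - 1) * cexp (-(b * x))))).1 ?_
  rw [image_exp_two_mul]
  refine Integrable.const_mul ?_ _
  have h1 := integrableOn_rpow_mul_exp_neg_mul_rpow (p := 1) (s := c.re / 2 - 1) (b := b)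
    (by linarith) one_pos hb
  refine h1.mono' ?_ ?_
  · refine ContinuousOn.aestronglyMeasurable (fun x hx => ?_) measurableSet_Ioi
    refine ContinuousAt.continuousWithinAt ?_
    refine ContinuousAt.mul ?_ (by fun_prop)
    exact continuousAt_ofReal_cpow_const _ _ (Or.inr (ne_of_gt hx))
  · refine (ae_restrict_iff' measurableSet_Ioi).2 (ae_of_all _ fun x hx => le_of_eq ?_)
    rw [norm_mul, norm_cpow_eq_rpow_re_of_pos hx, Complex.norm_exp, Real.rpow_one]
    simp

theorem integral_expGauss {c : ℂ} {b : ℝ} (hc : 0 < c.re) (hb : 0 < b) :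
    ∫ u : ℝ, cexp (c * u - b * Real.exp (2 * u)) = 1 / 2 * ((1 / b : ℂ) ^ (c / 2) * Gamma (c / 2)) := by
  simp_rw [expGauss_eq]
  rw [← setIntegral_univ, ← integral_image_eq_integral_abs_deriv_smul MeasurableSet.univ
    (fun u _ => hasDerivWithinAt_exp_two_mul u) injOn_exp_two_mul
    (fun x : ℝ => 1 / 2 * ((x : ℂ) ^ (c / 2 - 1) * cexp (-(b * x)))), image_exp_two_mul,
    integral_const_mul, integral_cpow_mul_exp_neg_mul_Ioi (by simpa using hc) hb]

variable {K : Type*} [Field K] [NumberField K]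

/-- The archimedean factor in the functional equation. -/
def gammaFac (S : Finset {w : InfinitePlace K // IsReal w}) (z : ℂ) : ℂ :=
  ∏ w : InfinitePlace K, 1 / 2 * ((1 / (Real.pi * mult w : ℝ) : ℂ) ^ ((placeExp S w + mult w * z) / 2) *
    Gamma ((placeExp S w + mult w * z) / 2))

/-- The integrand of the Mellin transform in logarithmic coordinates. -/
def logMellin (S : Finset {w : InfinitePlace K // IsReal w}) (z : ℂ) (p : logSpace K × ℝ) : ℂ :=
  logGauss S (unitCoord K p) * cexp (z * p.2)

theorem logMellin_eq (S : Finset {w : InfinitePlace K // IsReal w}) (z : ℂ) (p : logSpace K × ℝ) :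
    logMellin S z p = ∏ w, cexp ((placeExp S w + mult w * z) * (unitCoord K p w : ℝ) -
      (Real.pi * mult w : ℝ) * Real.exp (2 * unitCoord K p w)) := by
  have h : cexp (z * p.2) = ∏ w : InfinitePlace K, cexp (mult w * z * (unitCoord K p w : ℝ)) := by
    rw [← Complex.exp_sum, ← sum_mult_unitCoord]
    congr 1
    push_cast
    rw [Finset.mul_sum]
    exact Finset.sum_congr rfl fun w _ => by ring
  rw [logMellin, logGauss, h, ofReal_prod, ← Finset.prod_mul_distrib]
  refine Finset.prod_congr rfl fun w _ => ?_
  rw [ofReal_exp, ← Complex.exp_add]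
  congr 1
  push_cast
  ring

theorem norm_logMellin (S : Finset {w : InfinitePlace K // IsReal w}) (z : ℂ) (p : logSpace K × ℝ) :
    (‖logMellin S z p‖ : ℂ) = logMellin S z.re p := by
  rw [logMellin, logMellin, norm_mul, Complex.norm_exp, norm_real, Real.norm_of_nonneg (logGauss_pos _ _).le]
  push_cast
  simp

/-- The ratio of Haar measures in the two coordinate systems. -/
theorem exists_unitCoord_const (K : Type*) [Field K] [NumberField K] :
    ∃ κ : ℝ, 0 < κ ∧ (∀ f : (InfinitePlace K → ℝ) → ℂ, Integrable f →
      Integrable fun p => f (unitCoord K p)) ∧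
      ∀ f : (InfinitePlace K → ℝ) → ℂ, ∫ p, f (unitCoord K p) = κ * ∫ y, f y := by
  let e := (unitCoord K).toContinuousLinearEquiv
  let ν : Measure (InfinitePlace K → ℝ) := (volume : Measure (logSpace K × ℝ)).map e
  have hH : (volume : Measure (logSpace K × ℝ)).IsAddHaarMeasure := by
    rw [Measure.volume_eq_prod]; infer_instance
  have : ν.IsAddHaarMeasure := e.isAddHaarMeasure_map _
  obtain ⟨c, hc, h⟩ : ∃ c : NNReal, 0 < c ∧ ν = c • volume :=
    ⟨_, Measure.addHaarScalarFactor_pos_of_isAddHaarMeasure _ _,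
      Measure.isAddLeftInvariant_eq_smul ν volume⟩
  have hme : MeasurableEmbedding e := e.toHomeomorph.measurableEmbedding
  refine ⟨(c : ℝ), NNReal.coe_pos.2 hc, fun f hf => ?_, fun f => ?_⟩
  · have : Integrable f ν := by rw [h]; exact hf.smul_measure_nnreal
    exact (hme.integrable_map_iff (g := f)).1 this
  · have h1 : ∫ y, f y ∂ν = ∫ p, f (unitCoord K p) := hme.integral_map f
    rw [← h1, h, integral_smul_nnreal_measure, NNReal.smul_def, real_smul]

/-- The ratio of Haar measures in the two coordinate systems. -/
def unitCoordConst (K : Type*) [Field K] [NumberField K] : ℝ := (exists_unitCoord_const K).choose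

theorem unitCoordConst_pos : 0 < unitCoordConst K := (exists_unitCoord_const K).choose_spec.1

omit [NumberField K] in
theorem re_placeExp_pos (S : Finset {w : InfinitePlace K // IsReal w}) {z : ℂ} (hz : 0 < z.re)
    (w : InfinitePlace K) : 0 < ((placeExp S w : ℂ) + mult w * z).re := by
  have := mult_pos_real w
  simp only [add_re, natCast_re, mul_re, natCast_im, zero_mul, sub_zero]
  positivity

theorem integrable_logMellin (S : Finset {w : InfinitePlace K // IsReal w}) {z : ℂ} (hz : 0 < z.re) :
    Integrable (logMellin S z) := by
  simp_rw [funext (logMellin_eq S z)]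
  refine (exists_unitCoord_const K).choose_spec.2.1 (fun y => ∏ w : InfinitePlace K,
    cexp ((placeExp S w + mult w * z) * (y w : ℝ) - (Real.pi * mult w : ℝ) * Real.exp (2 * y w))) ?_
  exact Integrable.fintype_prod fun w => integrable_expGauss (re_placeExp_pos S hz w)
    (mul_pos Real.pi_pos (mult_pos_real w))

theorem integral_logMellin (S : Finset {w : InfinitePlace K // IsReal w}) {z : ℂ} (hz : 0 < z.re) :
    ∫ p, logMellin S z p = unitCoordConst K * gammaFac S z := by
  simp_rw [logMellin_eq S z]
  rw [(exists_unitCoord_const K).choose_spec.2.2 (fun y => ∏ w : InfinitePlace K,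
    cexp ((placeExp S w + mult w * z) * (y w : ℝ) - (Real.pi * mult w : ℝ) * Real.exp (2 * y w)))]
  congr 1
  rw [integral_fintype_prod_volume_eq_prod (fun (w : InfinitePlace K) (u : ℝ) =>
    cexp ((placeExp S w + mult w * z) * u - (Real.pi * mult w : ℝ) * Real.exp (2 * u)))]
  exact Finset.prod_congr rfl fun w _ => integral_expGauss (re_placeExp_pos S hz w)
    (mul_pos Real.pi_pos (mult_pos_real w))

theorem logMellin_add (S : Finset {w : InfinitePlace K // IsReal w}) (z : ℂ) (p : logSpace K × ℝ)
    {α : K} (hα : α ≠ 0) :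
    (sgnS S α * mixGauss S (fun w => Real.exp (unitCoord K p w)) (mixedEmbedding K α) : ℝ) *
      cexp (z * p.2) = ((|(Algebra.norm ℚ α : ℝ)| : ℝ) : ℂ) ^ (-z) *
        logMellin S z (p + (unitCoord K).symm (logV α)) := by
  have hN : (0 : ℝ) < |(Algebra.norm ℚ α : ℝ)| := by
    have : (Algebra.norm ℚ α) ≠ 0 := Algebra.norm_ne_zero_iff.2 hα
    positivity
  rw [mixGauss_embedding S _ hα, ← mul_assoc, sgnS_mul_self S hα, one_mul, logMellin, map_add,
    LinearEquiv.apply_symm_apply, mul_left_comm]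
  congr 1
  rw [Prod.snd_add, symm_logV_snd hα, cpow_def_of_ne_zero (by exact_mod_cast hN.ne'),
    ← ofReal_log hN.le, ← Complex.exp_add]
  congr 1
  push_cast
  ring

end Unfold

section Unfold

open MeasureTheory Module
open scoped Classical nonZeroDivisors Pointwise
open NumberField.mixedEmbedding NumberField.InfinitePlace NumberField.Units
open NumberField.Units.dirichletUnitTheorem

variable {K : Type*} [Field K] [NumberField K]

theorem exists_unit_domain (K : Type*) [Field K] [NumberField K] : ∃ D : Set (logSpace K),
    MeasurableSet D ∧ Bornology.IsBounded D ∧ IsAddFundamentalDomain (unitLattice K) D volume := by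
  let b := (basisUnitLattice K).ofZLatticeBasis ℝ
  exact ⟨ZSpan.fundamentalDomain b, ZSpan.fundamentalDomain_measurableSet b,
    ZSpan.fundamentalDomain_isBounded b, ZLattice.isAddFundamentalDomain (basisUnitLattice K) _⟩

theorem neg_isAddFundamentalDomain {D : Set (logSpace K)}
    (hD : IsAddFundamentalDomain (unitLattice K) D volume) :
    IsAddFundamentalDomain (unitLattice K) (-D) volume := by
  have := hD.preimage_of_equiv (f := fun x => -x)
    (Measure.measurePreserving_neg volume).quasiMeasurePreserving
    (e := fun g => -g) (neg_involutive.bijective) (fun g x => by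
      change -(((-g : unitLattice K) : logSpace K) + x) = (g : logSpace K) + -x
      push_cast
      abel)
  exact this

theorem hasSum_unitLattice {D : Set (logSpace K)}
    (hD : IsAddFundamentalDomain (unitLattice K) D volume) {F : logSpace K → ℂ}
    (hF : Integrable F) :
    HasSum (fun g : unitLattice K => ∫ h in D, F (h + g)) (∫ h, F h) := by
  have : VAddInvariantMeasure (unitLattice K) (logSpace K) volume :=
    (inferInstance : VAddInvariantMeasure (unitLattice K).toAddSubgroup (logSpace K) volume)
  have h1 : Measure.sum (fun g : unitLattice K => (volume : Measure (logSpace K)).restrict (g +ᵥ D)) =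
      volume := by
    exact hD.sum_restrict
  have h2 := hasSum_integral_measure (f := F)
    (μ := fun g : unitLattice K => (volume : Measure (logSpace K)).restrict (g +ᵥ D))
    (by rw [h1]; exact hF)
  rw [h1] at h2
  refine h2.congr_fun fun g => ?_
  refine Eq.trans ?_ ((measurePreserving_vadd g volume).setIntegral_image_emb
    (measurableEmbedding_const_vadd _) _ _).symm
  refine integral_congr_ae (ae_of_all _ fun h => ?_)
  change F (h + (g : logSpace K)) = F ((g : logSpace K) + h)
  rw [add_comm]

/-- A group as the product of a quotient set and the subgroup. -/
def quotientProdEquiv {G : Type*} [Group G] (s : Subgroup G) : G ≃ (G ⧸ s) × s where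
  toFun u := (u, ⟨(u : G ⧸ s).out⁻¹ * u, QuotientGroup.eq.1 (QuotientGroup.out_eq' _)⟩)
  invFun p := p.1.out * p.2
  left_inv u := mul_inv_cancel_left _ _
  right_inv p := by
    have h : ((p.1.out * p.2 : G) : G ⧸ s) = p.1 := by
      rw [QuotientGroup.mk_mul_of_mem _ p.2.2, QuotientGroup.out_eq']
    refine Prod.ext h (Subtype.ext ?_)
    dsimp only
    rw [h, inv_mul_cancel_left]

theorem hasSum_comp_quotient_mk {G : Type*} [Group G] (s : Subgroup G) [Finite s] {g : G ⧸ s → ℂ}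
    {a : ℂ} (hg : HasSum g a) : HasSum (fun u : G => g u) (Nat.card s * a) := by
  have h3 : HasSum (fun _ : s => (1 : ℂ)) (Nat.card s) := by
    have : Fintype s := Fintype.ofFinite _
    have := hasSum_fintype (fun _ : s => (1 : ℂ))
    simpa [Nat.card_eq_fintype_card] using this
  have h1 : Summable fun q => ‖g q‖ := hg.summable.norm
  have h2 : Summable fun _ : s => ‖(1 : ℂ)‖ := h3.summable.norm
  have h4 := HasSum.mul (f := g) (g := fun _ : s => (1 : ℂ)) hg h3
    (summable_mul_of_summable_norm (f := g) (g := fun _ : s => (1 : ℂ)) h1 h2)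
  have h5 : HasSum (fun u : G => g (u : G ⧸ s) * 1) (a * Nat.card s) :=
    (Equiv.hasSum_iff (quotientProdEquiv s) (f := fun p : (G ⧸ s) × s => g p.1 * 1)).2 h4
  simpa only [mul_one, mul_comm a] using h5

theorem hasSum_units {D : Set (logSpace K)}
    (hD : IsAddFundamentalDomain (unitLattice K) D volume) {F : logSpace K → ℂ}
    (hF : Integrable F) :
    HasSum (fun u : (𝓞 K)ˣ => ∫ h in D, F (h + logEmbedding K (Additive.ofMul u)))
      (torsionOrder K * ∫ h, F h) := by
  have h1 := hasSum_unitLattice hD hF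
  have h2 : HasSum (fun q : (𝓞 K)ˣ ⧸ torsion K =>
      ∫ h in D, F (h + (logEmbeddingEquiv K (Additive.ofMul q) : logSpace K))) (∫ h, F h) :=
    (Equiv.hasSum_iff (Additive.ofMul.trans (logEmbeddingEquiv K).toEquiv)).2 h1
  refine (hasSum_comp_quotient_mk (torsion K) h2).congr_fun fun u => ?_
  simp only [logEmbeddingEquiv_apply]

end Unfold

section Unfold

open MeasureTheory Module
open scoped Classical nonZeroDivisors Pointwise
open NumberField.mixedEmbedding NumberField.InfinitePlace NumberField.Units
open NumberField.Units.dirichletUnitTheorem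

variable {K : Type*} [Field K] [NumberField K]

/-- The measure on a cylinder over a set of logarithmic vectors. -/
def cylMeasure (D : Set (logSpace K)) : Measure (logSpace K × ℝ) :=
  (volume.restrict D).prod volume

theorem integrable_cylMeasure (D : Set (logSpace K)) {f : logSpace K × ℝ → ℂ} (hf : Integrable f) :
    Integrable f (cylMeasure D) := by
  have : cylMeasure D = (volume : Measure (logSpace K × ℝ)).restrict (D ×ˢ Set.univ) := by
    rw [cylMeasure, Measure.volume_eq_prod, ← Measure.prod_restrict, Measure.restrict_univ]
  rw [this]
  exact hf.restrict

/-- The Mellin integral over a cylinder, translated by the logarithmic vector of `α`. -/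
def cylMellin (S : Finset {w : InfinitePlace K // IsReal w}) (D : Set (logSpace K)) (z : ℂ) (α : K) : ℂ :=
  ∫ p, logMellin S z (p + (unitCoord K).symm (logV α)) ∂(cylMeasure D)

theorem integrable_logMellin_add (S : Finset {w : InfinitePlace K // IsReal w}) {z : ℂ}
    (hz : 0 < z.re) (q : logSpace K × ℝ) : Integrable fun p => logMellin S z (p + q) := by
  have : (volume : Measure (logSpace K × ℝ)).IsAddHaarMeasure := by
    rw [Measure.volume_eq_prod]; infer_instance
  exact (integrable_logMellin S hz).comp_add_right q

theorem hasSum_cylMellin (S : Finset {w : InfinitePlace K // IsReal w}) {D : Set (logSpace K)}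
    (hD : IsAddFundamentalDomain (unitLattice K) D volume) {z : ℂ} (hz : 0 < z.re) {α : K}
    (hα : α ≠ 0) :
    HasSum (fun u : (𝓞 K)ˣ => cylMellin S D z ((u : K) * α))
      (torsionOrder K * (unitCoordConst K * gammaFac S z)) := by
  have hH : (volume : Measure (logSpace K × ℝ)).IsAddHaarMeasure := by
    rw [Measure.volume_eq_prod]; infer_instance
  have hi := integrable_logMellin_add S hz ((unitCoord K).symm (logV α))
  have hi' := hi
  rw [Measure.volume_eq_prod] at hi'
  have h1 := hasSum_units hD hi'.integral_prod_left
  rw [← integral_prod _ hi', ← Measure.volume_eq_prod, integral_add_right_eq_self (logMellin S z),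
    integral_logMellin S hz] at h1
  refine h1.congr_fun fun u => ?_
  rw [cylMellin, cylMeasure, integral_prod _
    (integrable_cylMeasure D (integrable_logMellin_add S hz _))]
  refine integral_congr_ae (ae_of_all _ fun h => ?_)
  refine integral_congr_ae (ae_of_all _ fun τ => ?_)
  dsimp only
  rw [logV_mul (by simp) hα, map_add, ← unitCoord_logEmbedding, LinearEquiv.symm_apply_apply,
    ← add_assoc]
  simp

theorem norm_logMellin_real (S : Finset {w : InfinitePlace K // IsReal w}) (z : ℂ)
    (D : Set (logSpace K)) (α : K) :
    ((∫ p, ‖logMellin S z (p + (unitCoord K).symm (logV α))‖ ∂(cylMeasure D) : ℝ) : ℂ) =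
      cylMellin S D z.re α := by
  rw [← integral_complex_ofReal, cylMellin]
  simp_rw [norm_logMellin]

/-- The integral ideal `𝔞` with `(α) = 𝔞 J`. -/
theorem exists_ideal_of_mem (J : (FractionalIdeal (𝓞 K)⁰ K)ˣ) {α : K} (hα : α ≠ 0)
    (h : α ∈ (J : FractionalIdeal (𝓞 K)⁰ K)) :
    ∃ 𝔞 : NzIdeal K, FractionalIdeal.spanSingleton (𝓞 K)⁰ α =
      (𝔞.1 : FractionalIdeal (𝓞 K)⁰ K) * J := by
  have h1 : FractionalIdeal.spanSingleton (𝓞 K)⁰ α * (J⁻¹ : (FractionalIdeal (𝓞 K)⁰ K)ˣ) ≤ 1 := by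
    rw [← J.mul_inv]
    exact mul_le_mul_left (FractionalIdeal.spanSingleton_le_iff_mem.2 h) _
  obtain ⟨𝔞, h𝔞⟩ := FractionalIdeal.le_one_iff_exists_coeIdeal.1 h1
  have h2 : FractionalIdeal.spanSingleton (𝓞 K)⁰ α = (𝔞 : FractionalIdeal (𝓞 K)⁰ K) * J := by
    rw [h𝔞, mul_assoc, J.inv_mul, mul_one]
  refine ⟨⟨𝔞, fun h0 => ?_⟩, h2⟩
  rw [h0, FractionalIdeal.coeIdeal_bot, zero_mul, FractionalIdeal.spanSingleton_eq_zero_iff] at h2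
  exact hα h2

theorem ideal_eq_of_mul_eq (J : (FractionalIdeal (𝓞 K)⁰ K)ˣ) {𝔞 𝔟 : NzIdeal K}
    (h : (𝔞.1 : FractionalIdeal (𝓞 K)⁰ K) * J = (𝔟.1 : FractionalIdeal (𝓞 K)⁰ K) * J) : 𝔞 = 𝔟 := by
  refine Subtype.ext ?_
  have := congrArg (fun x : FractionalIdeal (𝓞 K)⁰ K => x * (J⁻¹ : (FractionalIdeal (𝓞 K)⁰ K)ˣ)) h
  simp only [mul_assoc, J.mul_inv, mul_one] at this
  exact FractionalIdeal.coeIdeal_injective this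

theorem mem_of_span_eq {J : (FractionalIdeal (𝓞 K)⁰ K)ˣ} {α : K} {𝔞 : Ideal (𝓞 K)}
    (h : FractionalIdeal.spanSingleton (𝓞 K)⁰ α = (𝔞 : FractionalIdeal (𝓞 K)⁰ K) * J) :
    α ∈ (J : FractionalIdeal (𝓞 K)⁰ K) := by
  have : FractionalIdeal.spanSingleton (𝓞 K)⁰ α ≤ (J : FractionalIdeal (𝓞 K)⁰ K) := by
    rw [h]
    calc _ ≤ 1 * (J : FractionalIdeal (𝓞 K)⁰ K) :=
          mul_le_mul_left FractionalIdeal.coeIdeal_le_one _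
      _ = _ := one_mul _
  exact FractionalIdeal.spanSingleton_le_iff_mem.1 this

theorem abs_norm_of_span_eq {J : (FractionalIdeal (𝓞 K)⁰ K)ˣ} {α : K} {𝔞 : Ideal (𝓞 K)}
    (h : FractionalIdeal.spanSingleton (𝓞 K)⁰ α = (𝔞 : FractionalIdeal (𝓞 K)⁰ K) * J) :
    |(Algebra.norm ℚ α : ℝ)| = Ideal.absNorm 𝔞 * (FractionalIdeal.absNorm (J : FractionalIdeal (𝓞 K)⁰ K) : ℝ) := by
  have := congrArg (fun I => (FractionalIdeal.absNorm I : ℝ)) h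
  simp only [FractionalIdeal.absNorm_span_singleton, map_mul, FractionalIdeal.coeIdeal_absNorm] at this
  push_cast at this
  exact this

theorem spanSingleton_unit_mul (u : (𝓞 K)ˣ) (α : K) :
    FractionalIdeal.spanSingleton (𝓞 K)⁰ ((u : K) * α) = FractionalIdeal.spanSingleton (𝓞 K)⁰ α := by
  refine le_antisymm ?_ ?_ <;> rw [FractionalIdeal.spanSingleton_le_iff_mem,
    FractionalIdeal.mem_spanSingleton]
  · exact ⟨u, by rw [Algebra.smul_def]⟩
  · refine ⟨(u⁻¹ : (𝓞 K)ˣ), ?_⟩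
    rw [Algebra.smul_def, ← mul_assoc, ← map_mul, Units.inv_mul, map_one, one_mul]

theorem exists_unit_of_span_eq {α β : K} (hα : α ≠ 0)
    (h : FractionalIdeal.spanSingleton (𝓞 K)⁰ α = FractionalIdeal.spanSingleton (𝓞 K)⁰ β) :
    ∃ u : (𝓞 K)ˣ, (u : K) * α = β := by
  have h1 : β ∈ FractionalIdeal.spanSingleton (𝓞 K)⁰ α := by
    rw [h]; exact FractionalIdeal.mem_spanSingleton_self _ _
  have h2 : α ∈ FractionalIdeal.spanSingleton (𝓞 K)⁰ β := by
    rw [← h]; exact FractionalIdeal.mem_spanSingleton_self _ _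
  obtain ⟨x, hx⟩ := (FractionalIdeal.mem_spanSingleton _).1 h1
  obtain ⟨y, hy⟩ := (FractionalIdeal.mem_spanSingleton _).1 h2
  rw [Algebra.smul_def] at hx hy
  have hyx : y * x = 1 := by
    apply FaithfulSMul.algebraMap_injective (𝓞 K) K
    rw [← hx, ← mul_assoc] at hy
    rw [map_mul, map_one]
    exact mul_right_cancel₀ hα (hy.trans (one_mul α).symm)
  exact ⟨⟨x, y, by rw [mul_comm, hyx], hyx⟩, hx⟩

end Unfold

section Unfold

open MeasureTheory Module
open scoped Classical nonZeroDivisors Pointwise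
open NumberField.mixedEmbedding NumberField.InfinitePlace NumberField.Units
open NumberField.Units.dirichletUnitTheorem

variable {K : Type*} [Field K] [NumberField K]

/-- The element `α` generates the fractional ideal `𝔞 J`. -/
def Generates (J : (FractionalIdeal (𝓞 K)⁰ K)ˣ) (𝔞 : NzIdeal K) (α : K) : Prop :=
  FractionalIdeal.spanSingleton (𝓞 K)⁰ α = (𝔞.1 : FractionalIdeal (𝓞 K)⁰ K) * J

theorem Generates.ne_zero {J : (FractionalIdeal (𝓞 K)⁰ K)ˣ} {𝔞 : NzIdeal K} {α : K}
    (h : Generates J 𝔞 α) : α ≠ 0 := by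
  rintro rfl
  rw [Generates, FractionalIdeal.spanSingleton_zero] at h
  have : (0 : FractionalIdeal (𝓞 K)⁰ K) ≠ 0 := by
    nth_rewrite 1 [h]
    exact mul_ne_zero (FractionalIdeal.coeIdeal_ne_zero.2 𝔞.2) J.ne_zero
  exact this rfl

/-- The ideal attached to a nonzero element of `J`. -/
def idealOf (J : (FractionalIdeal (𝓞 K)⁰ K)ˣ)
    (α : {α : K // α ≠ 0 ∧ α ∈ (J : FractionalIdeal (𝓞 K)⁰ K)}) : NzIdeal K :=
  (exists_ideal_of_mem J α.2.1 α.2.2).choose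

theorem generates_idealOf (J : (FractionalIdeal (𝓞 K)⁰ K)ˣ)
    (α : {α : K // α ≠ 0 ∧ α ∈ (J : FractionalIdeal (𝓞 K)⁰ K)}) : Generates J (idealOf J α) α :=
  (exists_ideal_of_mem J α.2.1 α.2.2).choose_spec

theorem idealOf_eq_iff (J : (FractionalIdeal (𝓞 K)⁰ K)ˣ)
    (α : {α : K // α ≠ 0 ∧ α ∈ (J : FractionalIdeal (𝓞 K)⁰ K)}) (𝔞 : NzIdeal K) :
    idealOf J α = 𝔞 ↔ Generates J 𝔞 α := by
  constructor
  · rintro rfl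
    exact generates_idealOf J α
  · exact fun h => ideal_eq_of_mul_eq J ((generates_idealOf J α).symm.trans h)

theorem Generates.unit_mul {J : (FractionalIdeal (𝓞 K)⁰ K)ˣ} {𝔞 : NzIdeal K} {α : K}
    (h : Generates J 𝔞 α) (u : (𝓞 K)ˣ) : Generates J 𝔞 ((u : K) * α) := by
  rw [Generates, spanSingleton_unit_mul]; exact h

theorem hasSum_fiber {E : Type*} [AddCommMonoid E] [TopologicalSpace E]
    {J : (FractionalIdeal (𝓞 K)⁰ K)ˣ} {f : K → E} {𝔞 : NzIdeal K} {a : E}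
    (h0 : (¬ ∃ α, Generates J 𝔞 α) → a = 0)
    (h1 : ∀ α, Generates J 𝔞 α → HasSum (fun u : (𝓞 K)ˣ => f ((u : K) * α)) a) :
    HasSum (fun x : {x : {α : K // α ≠ 0 ∧ α ∈ (J : FractionalIdeal (𝓞 K)⁰ K)} // idealOf J x = 𝔞} =>
      f x.1.1) a := by
  by_cases h : ∃ α, Generates J 𝔞 α
  · obtain ⟨α, hα⟩ := h
    let e : (𝓞 K)ˣ → {x : {α : K // α ≠ 0 ∧ α ∈ (J : FractionalIdeal (𝓞 K)⁰ K)} // idealOf J x = 𝔞} :=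
      fun u => ⟨⟨(u : K) * α, (hα.unit_mul u).ne_zero, mem_of_span_eq (hα.unit_mul u)⟩,
        (idealOf_eq_iff J _ 𝔞).2 (hα.unit_mul u)⟩
    have he : Function.Bijective e := by
      constructor
      · intro u v huv
        have h2 : (u : K) * α = (v : K) * α := congrArg (fun x => x.1.1) huv
        have h3 := mul_right_cancel₀ hα.ne_zero h2
        exact Units.ext (FaithfulSMul.algebraMap_injective (𝓞 K) K h3)
      · rintro ⟨x, hx⟩
        obtain ⟨u, hu⟩ := exists_unit_of_span_eq hα.ne_zero
          (hα.trans ((idealOf_eq_iff J x 𝔞).1 hx).symm)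
        exact ⟨u, Subtype.ext (Subtype.ext hu)⟩
    exact (Equiv.hasSum_iff (Equiv.ofBijective e he)).1 (h1 α hα)
  · rw [h0 h]
    have : IsEmpty {x : {α : K // α ≠ 0 ∧ α ∈ (J : FractionalIdeal (𝓞 K)⁰ K)} // idealOf J x = 𝔞} :=
      ⟨fun x => h ⟨_, (idealOf_eq_iff J x.1 𝔞).1 x.2⟩⟩
    exact hasSum_empty

theorem support_subset_of_ideals {E : Type*} [Zero E] (J : (FractionalIdeal (𝓞 K)⁰ K)ˣ) {f : K → E}
    (hf0 : f 0 = 0) (hf : ∀ α, α ∉ (J : FractionalIdeal (𝓞 K)⁰ K) → f α = 0) :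
    Function.support f ⊆ {α : K | α ≠ 0 ∧ α ∈ (J : FractionalIdeal (𝓞 K)⁰ K)} :=
  fun α hα => ⟨fun h => hα (h ▸ hf0), by_contra fun h => hα (hf α h)⟩

/-- Summability over the nonzero elements of a fractional ideal, organised by ideals. -/
theorem summable_of_ideals (J : (FractionalIdeal (𝓞 K)⁰ K)ˣ) {f : K → ℝ} (hf0 : f 0 = 0)
    (hf : ∀ α, α ∉ (J : FractionalIdeal (𝓞 K)⁰ K) → f α = 0) (hfn : ∀ α, 0 ≤ f α)
    {b : NzIdeal K → ℝ} (hb0 : ∀ 𝔞, (¬ ∃ α, Generates J 𝔞 α) → b 𝔞 = 0)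
    (hb : ∀ 𝔞 α, Generates J 𝔞 α → HasSum (fun u : (𝓞 K)ˣ => f ((u : K) * α)) (b 𝔞))
    (hbs : Summable b) : Summable f := by
  let β := {α : K // α ≠ 0 ∧ α ∈ (J : FractionalIdeal (𝓞 K)⁰ K)}
  let e := Equiv.sigmaFiberEquiv (idealOf J)
  have hfib := fun 𝔞 => hasSum_fiber (hb0 𝔞) (hb 𝔞)
  have hs1 : Summable fun x : Σ 𝔞 : NzIdeal K, {x : β // idealOf J x = 𝔞} => f x.2.1.1 := by
    refine (summable_sigma_of_nonneg fun _ => hfn _).2 ⟨fun 𝔞 => (hfib 𝔞).summable, ?_⟩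
    exact hbs.congr fun 𝔞 => (hfib 𝔞).tsum_eq.symm
  have hs2 : Summable fun x : β => f x.1 := e.summable_iff.1 hs1
  exact ((hasSum_subtype_iff_of_support_subset (support_subset_of_ideals J hf0 hf)).1
    hs2.hasSum).summable

/-- Summation over the nonzero elements of a fractional ideal, organised by ideals. -/
theorem tsum_of_ideals (J : (FractionalIdeal (𝓞 K)⁰ K)ˣ) {f : K → ℂ} (hf0 : f 0 = 0)
    (hf : ∀ α, α ∉ (J : FractionalIdeal (𝓞 K)⁰ K) → f α = 0) {a : NzIdeal K → ℂ}
    (ha0 : ∀ 𝔞, (¬ ∃ α, Generates J 𝔞 α) → a 𝔞 = 0)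
    (ha : ∀ 𝔞 α, Generates J 𝔞 α → HasSum (fun u : (𝓞 K)ˣ => f ((u : K) * α)) (a 𝔞))
    (hs : Summable f) : ∑' α, f α = ∑' 𝔞, a 𝔞 := by
  let β := {α : K // α ≠ 0 ∧ α ∈ (J : FractionalIdeal (𝓞 K)⁰ K)}
  let e := Equiv.sigmaFiberEquiv (idealOf J)
  have hfib := fun 𝔞 => hasSum_fiber (ha0 𝔞) (ha 𝔞)
  have h1 := (hasSum_subtype_iff_of_support_subset (support_subset_of_ideals J hf0 hf)).2 hs.hasSum
  have h2 : HasSum (fun x : Σ 𝔞 : NzIdeal K, {x : β // idealOf J x = 𝔞} => f x.2.1.1) (∑' α, f α) :=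
    e.hasSum_iff.2 h1
  exact (h2.sigma hfib).tsum_eq.symm

end Unfold

section Unfold

open MeasureTheory Module
open scoped Classical nonZeroDivisors Pointwise
open NumberField.mixedEmbedding NumberField.InfinitePlace NumberField.Units
open NumberField.Units.dirichletUnitTheorem

variable {K : Type*} [Field K] [NumberField K]

/-- Coefficient functions on a fractional ideal that are bounded and transform under units by
the sign character attached to `S`. -/
structure ThetaCoef (J : (FractionalIdeal (𝓞 K)⁰ K)ˣ) (S : Finset {w : InfinitePlace K // IsReal w})
    (M : ℝ) (c : K → ℂ) : Prop where
  supp : ∀ α, α ∉ (J : FractionalIdeal (𝓞 K)⁰ K) → c α = 0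
  bound : ∀ α, ‖c α‖ ≤ M
  unit : ∀ (u : (𝓞 K)ˣ) (α : K), c ((u : K) * α) = sgnS S (u : K) * c α

variable {J : (FractionalIdeal (𝓞 K)⁰ K)ˣ} {S : Finset {w : InfinitePlace K // IsReal w}}
  {M : ℝ} {c : K → ℂ}

/-- The function on ideals induced by a coefficient function. -/
def idealCoef (J : (FractionalIdeal (𝓞 K)⁰ K)ˣ) (S : Finset {w : InfinitePlace K // IsReal w})
    (c : K → ℂ) (𝔞 : NzIdeal K) : ℂ :=
  if h : ∃ α, Generates J 𝔞 α then c h.choose * sgnS S h.choose else 0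

theorem ThetaCoef.unit_mul_sgnS (hc : ThetaCoef J S M c) (u : (𝓞 K)ˣ) (α : K) :
    c ((u : K) * α) * sgnS S ((u : K) * α) = c α * sgnS S α := by
  have h := sgnS_mul_self S (α := (u : K)) (by simp)
  rw [hc.unit, sgnS_mul]
  have h' : (sgnS S (u : K) : ℂ) * sgnS S (u : K) = 1 := by exact_mod_cast h
  push_cast
  linear_combination (c α * sgnS S α) * h'

theorem idealCoef_eq (hc : ThetaCoef J S M c) {𝔞 : NzIdeal K} {α : K} (h : Generates J 𝔞 α) :
    idealCoef J S c 𝔞 = c α * sgnS S α := by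
  have h0 : ∃ α, Generates J 𝔞 α := ⟨α, h⟩
  rw [idealCoef, dif_pos h0]
  obtain ⟨u, hu⟩ := exists_unit_of_span_eq h.ne_zero (h.trans h0.choose_spec.symm)
  rw [← hu, hc.unit_mul_sgnS]

theorem norm_idealCoef_le (hc : ThetaCoef J S M c) (𝔞 : NzIdeal K) : ‖idealCoef J S c 𝔞‖ ≤ M := by
  by_cases h : ∃ α, Generates J 𝔞 α
  · obtain ⟨α, hα⟩ := h
    rw [idealCoef_eq hc hα, norm_mul, norm_real, Real.norm_eq_abs, abs_sgnS S hα.ne_zero, mul_one]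
    exact hc.bound α
  · rw [idealCoef, dif_neg h, norm_zero]
    exact (norm_nonneg _).trans (hc.bound 0)

/-- The partial Dirichlet series of a coefficient function. -/
def coefSer (J : (FractionalIdeal (𝓞 K)⁰ K)ˣ) (S : Finset {w : InfinitePlace K // IsReal w})
    (c : K → ℂ) (z : ℂ) : ℂ :=
  ∑' 𝔞 : NzIdeal K, idealCoef J S c 𝔞 *
    ((Ideal.absNorm 𝔞.1 * (FractionalIdeal.absNorm (J : FractionalIdeal (𝓞 K)⁰ K) : ℝ) : ℝ) : ℂ) ^ (-z)

theorem absNorm_unit_pos (J : (FractionalIdeal (𝓞 K)⁰ K)ˣ) :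
    (0 : ℝ) < (FractionalIdeal.absNorm (J : FractionalIdeal (𝓞 K)⁰ K) : ℝ) := by
  refine Rat.cast_pos.2 (lt_of_le_of_ne (FractionalIdeal.absNorm_nonneg _) ?_)
  exact fun h => J.ne_zero ((FractionalIdeal.absNorm_eq_zero_iff).1 h.symm)

theorem norm_pow_neg (J : (FractionalIdeal (𝓞 K)⁰ K)ˣ) (𝔞 : NzIdeal K) (z : ℂ) :
    ‖((Ideal.absNorm 𝔞.1 * (FractionalIdeal.absNorm (J : FractionalIdeal (𝓞 K)⁰ K) : ℝ) : ℝ) : ℂ) ^ (-z)‖ =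
      (Ideal.absNorm 𝔞.1 : ℝ) ^ (-z.re) *
        (FractionalIdeal.absNorm (J : FractionalIdeal (𝓞 K)⁰ K) : ℝ) ^ (-z.re) := by
  have h1 : (0 : ℝ) < Ideal.absNorm 𝔞.1 := Nat.cast_pos.2 𝔞.absNorm_pos
  rw [norm_cpow_eq_rpow_re_of_pos (mul_pos h1 (absNorm_unit_pos J)), neg_re,
    Real.mul_rpow h1.le (absNorm_unit_pos J).le]

/-- The summand of the theta series, weighted for the Mellin transform. -/
def mellinTerm (S : Finset {w : InfinitePlace K // IsReal w}) (c : K → ℂ) (z : ℂ) (α : K)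
    (p : logSpace K × ℝ) : ℂ :=
  if α = 0 then 0 else
    c α * mixGauss S (fun w => Real.exp (unitCoord K p w)) (mixedEmbedding K α) * cexp (z * p.2)

theorem mellinTerm_eq (z : ℂ) {α : K} (hα : α ≠ 0) (p : logSpace K × ℝ) :
    mellinTerm S c z α p = (c α * sgnS S α) * ((|(Algebra.norm ℚ α : ℝ)| : ℝ) : ℂ) ^ (-z) *
      logMellin S z (p + (unitCoord K).symm (logV α)) := by
  have h' : (sgnS S α : ℂ) * sgnS S α = 1 := by exact_mod_cast sgnS_mul_self S hα
  rw [mellinTerm, if_neg hα, mul_assoc _ (_ ^ _), ← logMellin_add S z p hα]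
  push_cast
  linear_combination (-c α * mixGauss S (fun w => Real.exp (unitCoord K p w)) (mixedEmbedding K α) *
    cexp (z * p.2)) * h'

theorem norm_mellinTerm (z : ℂ) {α : K} (hα : α ≠ 0) (p : logSpace K × ℝ) :
    ‖mellinTerm S c z α p‖ = ‖c α‖ * |(Algebra.norm ℚ α : ℝ)| ^ (-z.re) *
      ‖logMellin S z (p + (unitCoord K).symm (logV α))‖ := by
  have : (Algebra.norm ℚ α) ≠ 0 := Algebra.norm_ne_zero_iff.2 hα
  rw [mellinTerm_eq z hα, norm_mul, norm_mul, norm_mul, norm_real, Real.norm_eq_abs,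
    abs_sgnS S hα, mul_one, norm_cpow_eq_rpow_re_of_pos (by positivity), neg_re]

theorem integrable_mellinTerm (D : Set (logSpace K)) {z : ℂ} (hz : 0 < z.re) (α : K) :
    Integrable (mellinTerm S c z α) (cylMeasure D) := by
  by_cases hα : α = 0
  · have : mellinTerm S c z α = fun _ => 0 := by
      funext p; rw [mellinTerm, if_pos hα]
    rw [this]
    exact integrable_zero _ _ _
  · rw [funext (mellinTerm_eq z hα)]
    exact (integrable_cylMeasure D (integrable_logMellin_add S hz _)).const_mul _

theorem integral_mellinTerm (D : Set (logSpace K)) (z : ℂ) {α : K} (hα : α ≠ 0) :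
    ∫ p, mellinTerm S c z α p ∂(cylMeasure D) = (c α * sgnS S α) *
      ((|(Algebra.norm ℚ α : ℝ)| : ℝ) : ℂ) ^ (-z) * cylMellin S D z α := by
  simp_rw [mellinTerm_eq z hα]
  rw [integral_const_mul, cylMellin]

theorem integral_norm_mellinTerm (D : Set (logSpace K)) (z : ℂ) {α : K} (hα : α ≠ 0) :
    ((∫ p, ‖mellinTerm S c z α p‖ ∂(cylMeasure D) : ℝ) : ℂ) =
      (‖c α‖ * |(Algebra.norm ℚ α : ℝ)| ^ (-z.re) : ℝ) * cylMellin S D z.re α := by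
  simp_rw [norm_mellinTerm z hα]
  rw [integral_const_mul, ofReal_mul, norm_logMellin_real]

theorem abs_norm_unit_mul (u : (𝓞 K)ˣ) (α : K) :
    |(Algebra.norm ℚ ((u : K) * α) : ℝ)| = |(Algebra.norm ℚ α : ℝ)| := by
  rw [map_mul]
  push_cast
  rw [abs_mul]
  have : |(Algebra.norm ℚ (u : K) : ℝ)| = 1 := by
    have := (NumberField.isUnit_iff_norm (x := (u : 𝓞 K))).1 u.isUnit
    exact_mod_cast this
  rw [this, one_mul]

theorem summable_mellinTerm (hc : ThetaCoef J S M c) {D : Set (logSpace K)}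
    (hD : IsAddFundamentalDomain (unitLattice K) D volume) {z : ℂ} (hz : 1 < z.re) :
    Summable fun α : K => ∫ p, ‖mellinTerm S c z α p‖ ∂(cylMeasure D) := by
  have hz' : 0 < ((z.re : ℂ)).re := by rw [ofReal_re]; linarith
  let I : ℝ := ∫ p : logSpace K × ℝ, ‖logMellin S z p‖
  have hI : (I : ℂ) = unitCoordConst K * gammaFac S z.re := by
    rw [← integral_logMellin S hz', ← integral_complex_ofReal]
    simp_rw [norm_logMellin]
  refine summable_of_ideals J (b := fun 𝔞 => ‖idealCoef J S c 𝔞‖ *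
    ((Ideal.absNorm 𝔞.1 : ℝ) ^ (-z.re) *
      (FractionalIdeal.absNorm (J : FractionalIdeal (𝓞 K)⁰ K) : ℝ) ^ (-z.re)) *
        (torsionOrder K * I)) ?_ ?_ ?_ ?_ ?_ ?_
  · simp [mellinTerm]
  · intro α hα
    simp [mellinTerm, hc.supp α hα]
  · exact fun α => integral_nonneg fun _ => norm_nonneg _
  · intro 𝔞 h
    simp [idealCoef, dif_neg h]
  · intro 𝔞 α h
    have hα := h.ne_zero
    have hN : (0 : ℝ) < Ideal.absNorm 𝔞.1 := Nat.cast_pos.2 𝔞.absNorm_pos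
    rw [idealCoef_eq hc h, norm_mul, norm_real, Real.norm_eq_abs, abs_sgnS S hα, mul_one,
      ← Real.mul_rpow hN.le (absNorm_unit_pos J).le, ← abs_norm_of_span_eq h]
    have h1 := (hasSum_cylMellin S hD hz' hα).mul_left
      ((‖c α‖ * |(Algebra.norm ℚ α : ℝ)| ^ (-z.re) : ℝ) : ℂ)
    rw [← hI] at h1
    rw [← Complex.hasSum_ofReal]
    push_cast at h1 ⊢
    refine h1.congr_fun fun u => ?_
    rw [integral_norm_mellinTerm D z (mul_ne_zero (by simp) hα), abs_norm_unit_mul, hc.unit,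
      norm_mul, norm_real, Real.norm_eq_abs, abs_sgnS S (by simp), one_mul]
    push_cast
    rfl
  · refine Summable.mul_right _ ?_
    refine Summable.of_nonneg_of_le (fun 𝔞 => mul_nonneg (norm_nonneg _) (mul_nonneg
      (Real.rpow_nonneg (Nat.cast_nonneg _) _) (Real.rpow_nonneg (absNorm_unit_pos J).le _)))
      (fun 𝔞 => ?_)
      (((summable_norm_rpow (K := K) hz).mul_left M).mul_right
        ((FractionalIdeal.absNorm (J : FractionalIdeal (𝓞 K)⁰ K) : ℝ) ^ (-z.re)))
    rw [← mul_assoc]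
    have h2 := norm_idealCoef_le hc 𝔞
    have h3 : (0 : ℝ) ≤ (FractionalIdeal.absNorm (J : FractionalIdeal (𝓞 K)⁰ K) : ℝ) ^ (-z.re) :=
      Real.rpow_nonneg (absNorm_unit_pos J).le _
    gcongr

/-- Unfolding of the Mellin transform of a theta series. -/
theorem integral_tsum_mellinTerm (hc : ThetaCoef J S M c) {D : Set (logSpace K)}
    (hD : IsAddFundamentalDomain (unitLattice K) D volume) {z : ℂ} (hz : 1 < z.re) :
    ∫ p, ∑' α : K, mellinTerm S c z α p ∂(cylMeasure D) =
      torsionOrder K * (unitCoordConst K * gammaFac S z) * coefSer J S c z := by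
  have hz0 : 0 < z.re := by linarith
  have : Countable K := (Module.finBasis ℚ K).equivFun.toEquiv.countable_iff.2 inferInstance
  have h1 := hasSum_integral_of_summable_integral_norm (integrable_mellinTerm D hz0)
    (summable_mellinTerm hc hD hz)
  rw [← h1.tsum_eq, coefSer, ← tsum_mul_left]
  refine tsum_of_ideals J ?_ ?_ ?_ ?_ h1.summable
  · simp [mellinTerm]
  · intro α hα
    simp [mellinTerm, hc.supp α hα]
  · intro 𝔞 h
    simp [idealCoef, dif_neg h]
  · intro 𝔞 α h
    have hα := h.ne_zero
    have h2 := (hasSum_cylMellin S hD hz0 hα).mul_left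
      ((c α * sgnS S α) * ((|(Algebra.norm ℚ α : ℝ)| : ℝ) : ℂ) ^ (-z))
    rw [idealCoef_eq hc h, ← abs_norm_of_span_eq h, mul_comm]
    refine h2.congr_fun fun u => ?_
    rw [integral_mellinTerm D z (mul_ne_zero (by simp) hα), abs_norm_unit_mul, hc.unit_mul_sgnS]

end Unfold

section Mell

open MeasureTheory Module
open scoped Classical nonZeroDivisors Pointwise
open NumberField.mixedEmbedding NumberField.InfinitePlace NumberField.Units
open NumberField.Units.dirichletUnitTheorem

variable {K : Type*} [Field K] [NumberField K]

theorem mixGauss_zero (S : Finset {w : InfinitePlace K // IsReal w}) (t : InfinitePlace K → ℝ) :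
    mixGauss S t (0 : mixedSpace K) = if S = ∅ then 1 else 0 := by
  have h : ∀ w : {w : InfinitePlace K // IsReal w}, realFac (w ∈ S) (t w.1 * (0 : mixedSpace K).1 w)
      = if w ∈ S then 0 else 1 := fun w => by
    simp [realFac]
  rw [mixGauss, Finset.prod_congr rfl fun w _ => h w]
  have h2 : ∏ w : {w : InfinitePlace K // IsComplex w},
      Real.exp (-2 * Real.pi * (t w.1 * ‖(0 : mixedSpace K).2 w‖) ^ 2) = 1 := by simp
  rw [h2, mul_one]
  split_ifs with hS
  · simp [hS]
  · obtain ⟨w, hw⟩ := Finset.nonempty_iff_ne_empty.2 hS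
    exact Finset.prod_eq_zero (Finset.mem_univ w) (if_pos hw)

/-- The constant term of a theta series. -/
def thetaZero (c : K → ℂ) (S : Finset {w : InfinitePlace K // IsReal w}) : ℂ :=
  if S = ∅ then c 0 else 0

theorem term_zero (c : K → ℂ) (S : Finset {w : InfinitePlace K // IsReal w})
    (t : InfinitePlace K → ℝ) : c 0 * mixGauss S t (mixedEmbedding K 0) = thetaZero c S := by
  rw [map_zero, mixGauss_zero, thetaZero]
  split_ifs <;> simp

section

variable {J : (FractionalIdeal (𝓞 K)⁰ K)ˣ} {S : Finset {w : InfinitePlace K // IsReal w}}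
  {M : ℝ} {c : K → ℂ}

theorem norm_term_le (hc : ∀ α, ‖c α‖ ≤ M)
    (hJ : ∀ α, α ∉ (J : FractionalIdeal (𝓞 K)⁰ K) → c α = 0) {t : InfinitePlace K → ℝ} {b : ℝ} {α : K}
    (hb0 : 0 ≤ b) (hb : α ∈ (J : FractionalIdeal (𝓞 K)⁰ K) →
      Real.exp (-2 * ∑ w, (t w * normAtPlace w (mixedEmbedding K α)) ^ 2) ≤ b) :
    ‖c α * mixGauss S t (mixedEmbedding K α)‖ ≤ M * b := by
  have hM : 0 ≤ M := (norm_nonneg _).trans (hc 0)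
  rw [norm_mul, Complex.norm_real, Real.norm_eq_abs]
  by_cases hα : α ∈ (J : FractionalIdeal (𝓞 K)⁰ K)
  · exact mul_le_mul (hc α) (abs_mixGauss_embedding_le.trans (hb hα)) (abs_nonneg _) hM
  · rw [hJ α hα, norm_zero, zero_mul]
    positivity

theorem theta_sub_thetaZero (hc : ∀ α, ‖c α‖ ≤ M)
    (hJ : ∀ α, α ∉ (J : FractionalIdeal (𝓞 K)⁰ K) → c α = 0) {t : InfinitePlace K → ℝ}
    (ht : ∀ w, 0 < t w) : theta c S t - thetaZero c S =
      ∑' α : K, if α = 0 then 0 else c α * mixGauss S t (mixedEmbedding K α) := by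
  rw [theta, (summable_theta J S ht hc hJ).tsum_eq_add_tsum_ite 0, term_zero, add_sub_cancel_left]

theorem exists_theta_sub_le (J : (FractionalIdeal (𝓞 K)⁰ K)ˣ) (N : ℕ) (hN : nK K < 2 * N) (M : ℝ) :
    ∃ C : ℝ, ∀ (S : Finset {w : InfinitePlace K // IsReal w}) (c : K → ℂ), (∀ α, ‖c α‖ ≤ M) →
      (∀ α, α ∉ (J : FractionalIdeal (𝓞 K)⁰ K) → c α = 0) → ∀ (t : InfinitePlace K → ℝ) (m : ℝ),
        0 < m → (∀ w, m ≤ t w) → ‖theta c S t - thetaZero c S‖ ≤ C * (m ^ (2 * N))⁻¹ := by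
  obtain ⟨B, hB0, hB, hBm⟩ := exists_gauss_majorant J N hN
  refine ⟨M * ∑' α, B α, fun S c hc hJ t m hm hmt => ?_⟩
  rw [theta_sub_thetaZero hc hJ fun w => hm.trans_le (hmt w), mul_assoc, ← tsum_mul_right,
    ← tsum_mul_left]
  refine tsum_of_norm_bounded ((hB.mul_right _).mul_left M).hasSum fun α => ?_
  have h0 : 0 ≤ B α * (m ^ (2 * N))⁻¹ := mul_nonneg (hB0 α) (by positivity)
  have hM : 0 ≤ M := (norm_nonneg _).trans (hc 0)
  split_ifs with h
  · rw [norm_zero]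
    positivity
  · exact norm_term_le hc hJ h0 fun hα => hBm α hα h t m hm hmt

/-- The theta series in logarithmic coordinates. -/
def thetaLog (c : K → ℂ) (S : Finset {w : InfinitePlace K // IsReal w}) (p : logSpace K × ℝ) : ℂ :=
  theta c S fun w => Real.exp (unitCoord K p w)

theorem continuous_unitCoord : Continuous (unitCoord K) :=
  LinearMap.continuous_of_finiteDimensional (unitCoord K).toLinearMap

theorem continuous_mixGauss_left (S : Finset {w : InfinitePlace K // IsReal w}) (v : mixedSpace K) :
    Continuous fun t => mixGauss S t v := by
  unfold mixGauss realFac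
  refine (continuous_finsetProd _ fun w _ => ?_).mul (by fun_prop)
  split_ifs <;> fun_prop

theorem continuous_thetaLog (hc : ∀ α, ‖c α‖ ≤ M)
    (hJ : ∀ α, α ∉ (J : FractionalIdeal (𝓞 K)⁰ K) → c α = 0) : Continuous (thetaLog c S) := by
  obtain ⟨B, hB0, hB, hBm⟩ := exists_gauss_majorant J (nK K + 1) (by omega)
  have hM : 0 ≤ M := (norm_nonneg _).trans (hc 0)
  have h0 : Summable fun α : K => if α = 0 then (1 : ℝ) else 0 :=
    summable_of_ne_finset_zero (s := {0}) fun α hα => if_neg (by simpa using hα)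
  rw [continuous_iff_continuousAt]
  intro p
  obtain ⟨m, hm, hmt⟩ := exists_pos_le (K := K) (fun w => Real.exp (unitCoord K p w - 1))
    fun w => Real.exp_pos _
  have hcoord : ∀ w, Continuous fun q : logSpace K × ℝ => unitCoord K q w := fun w =>
    (continuous_apply w).comp continuous_unitCoord
  have hU : IsOpen {q : logSpace K × ℝ | ∀ w, unitCoord K p w - 1 < unitCoord K q w} := by
    simp only [Set.ofPred_forall]
    exact isOpen_iInter_of_finite fun w => isOpen_lt continuous_const (hcoord w)
  have hterm : ∀ α : K, Continuous fun q : logSpace K × ℝ =>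
      c α * mixGauss S (fun w => Real.exp (unitCoord K q w)) (mixedEmbedding K α) := fun α => by
    have h1 : Continuous fun q : logSpace K × ℝ => fun w => Real.exp (unitCoord K q w) :=
      continuous_pi fun w => Real.continuous_exp.comp (hcoord w)
    have h2 := (continuous_mixGauss_left S (mixedEmbedding K α)).comp h1
    exact continuous_const.mul (continuous_ofReal.comp h2)
  have hbound : ∀ (α : K) (q : logSpace K × ℝ), (∀ w, unitCoord K p w - 1 < unitCoord K q w) →
      ‖c α * mixGauss S (fun w => Real.exp (unitCoord K q w)) (mixedEmbedding K α)‖ ≤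
        M * (B α * (m ^ (2 * (nK K + 1)))⁻¹ + if α = 0 then (1 : ℝ) else 0) := fun α q hq => by
    have h1 : 0 ≤ B α * (m ^ (2 * (nK K + 1)))⁻¹ := mul_nonneg (hB0 α) (by positivity)
    refine norm_term_le hc hJ (add_nonneg h1 (by split_ifs <;> norm_num)) fun hα => ?_
    by_cases h : α = 0
    · rw [h, if_pos rfl]
      rw [h] at h1
      simp only [map_zero, mul_zero]
      norm_num
      exact h1
    · rw [if_neg h, add_zero]
      exact hBm α hα h _ m hm fun w => (hmt w).trans (Real.exp_le_exp.2 (hq w).le)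
  have hon := continuousOn_tsum (fun α => (hterm α).continuousOn)
    (((hB.mul_right ((m ^ (2 * (nK K + 1)))⁻¹)).add h0).mul_left M) fun α q hq => hbound α q hq
  exact hon.continuousAt (hU.mem_nhds fun w => sub_one_lt _)

end

end Mell

section Mell

open MeasureTheory Module
open scoped Classical nonZeroDivisors Pointwise
open NumberField.mixedEmbedding NumberField.InfinitePlace NumberField.Units
open NumberField.Units.dirichletUnitTheorem

variable {K : Type*} [Field K] [NumberField K]

/-- The theta series averaged over a domain for the units, as a function of the norm variable. -/
def thetaInt (D : Set (logSpace K)) (c : K → ℂ) (S : Finset {w : InfinitePlace K // IsReal w})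
    (x : ℝ) : ℂ :=
  ∫ h in D, thetaLog c S (h, Real.log x)

/-- The constant term of `thetaInt`. -/
def thetaIntZero (D : Set (logSpace K)) (c : K → ℂ)
    (S : Finset {w : InfinitePlace K // IsReal w}) : ℂ :=
  volume.real D • thetaZero c S

section

variable {J : (FractionalIdeal (𝓞 K)⁰ K)ˣ} {S : Finset {w : InfinitePlace K // IsReal w}}
  {M : ℝ} {c : K → ℂ} {D : Set (logSpace K)}

theorem continuous_integral_bounded {E : Type*} [NormedAddCommGroup E] [NormedSpace ℝ E]
    [FiniteDimensional ℝ E] [MeasurableSpace E] [BorelSpace E] {μ : Measure E}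
    [IsFiniteMeasureOnCompacts μ] {D : Set E} (hb : Bornology.IsBounded D) {F : E × ℝ → ℂ}
    (hF : Continuous F) : Continuous fun τ => ∫ h in D, F (h, τ) ∂μ := by
  obtain ⟨r, hr⟩ := hb.subset_closedBall 0
  have : ProperSpace E := FiniteDimensional.proper_real E
  have hfin : μ D ≠ ⊤ := ((measure_mono hr).trans_lt
    (isCompact_closedBall 0 r).measure_lt_top).ne
  rw [continuous_iff_continuousAt]
  intro τ₀
  obtain ⟨C, hC⟩ := ((isCompact_closedBall (0 : E) r).prod
    (isCompact_closedBall τ₀ 1)).exists_bound_of_continuousOn hF.continuousOn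
  refine continuousAt_of_dominated (bound := fun _ => C) ?_ ?_ ?_ ?_
  · exact Eventually.of_forall fun τ =>
      (hF.comp (Continuous.prodMk_left τ)).aestronglyMeasurable
  · filter_upwards [Metric.closedBall_mem_nhds τ₀ one_pos] with τ hτ
    have : ∀ᵐ h ∂(μ.restrict (Metric.closedBall (0 : E) r)), ‖F (h, τ)‖ ≤ C :=
      (ae_restrict_iff' Metric.isClosed_closedBall.measurableSet).2
        (ae_of_all _ fun h hh => hC (h, τ) ⟨hh, hτ⟩)
    exact ae_mono (Measure.restrict_mono hr le_rfl) this
  · exact integrableOn_const hfin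
  · exact ae_of_all _ fun h => (hF.comp (Continuous.prodMk_right h)).continuousAt

theorem locallyIntegrableOn_thetaInt (hb : Bornology.IsBounded D) (hc : ∀ α, ‖c α‖ ≤ M)
    (hJ : ∀ α, α ∉ (J : FractionalIdeal (𝓞 K)⁰ K) → c α = 0) :
    LocallyIntegrableOn (thetaInt D c S) (Set.Ioi 0) := by
  refine ContinuousOn.locallyIntegrableOn ?_ measurableSet_Ioi
  have h := continuous_integral_bounded (μ := volume) hb (continuous_thetaLog (S := S) hc hJ)
  exact h.comp_continuousOn (Real.continuousOn_log.mono fun x hx => (Set.mem_Ioi.1 hx).ne')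

theorem exists_abs_unitCoord_le (hb : Bornology.IsBounded D) :
    ∃ C : ℝ, ∀ h ∈ D, ∀ w, |unitCoord K (h, 0) w| ≤ C := by
  obtain ⟨r, hr⟩ := hb.subset_closedBall 0
  obtain ⟨C, hC⟩ := (isCompact_closedBall (0 : logSpace K) r).exists_bound_of_continuousOn
    (f := fun h => unitCoord K (h, 0))
    (continuous_unitCoord.comp (Continuous.prodMk_left 0)).continuousOn
  exact ⟨C, fun h hh w => (norm_le_pi_norm (unitCoord K (h, 0)) w).trans (hC h (hr hh))⟩

theorem unitCoord_mk (h : logSpace K) (τ : ℝ) (w : InfinitePlace K) :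
    unitCoord K (h, τ) w = unitCoord K (h, 0) w + τ / nK K := by
  rw [unitCoord_apply, unitCoord_apply]
  ring

theorem thetaInt_isBigO (hb : Bornology.IsBounded D) (hc : ∀ α, ‖c α‖ ≤ M)
    (hJ : ∀ α, α ∉ (J : FractionalIdeal (𝓞 K)⁰ K) → c α = 0) (r : ℝ) :
    (fun x => thetaInt D c S x - thetaIntZero D c S) =O[atTop] (· ^ r) := by
  obtain ⟨C, hC⟩ := exists_abs_unitCoord_le hb
  obtain ⟨n, hn⟩ := exists_nat_gt ((nK K) * (-r) / 2)
  set N := n + nK K + 1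
  obtain ⟨B, hB⟩ := exists_theta_sub_le J N (by omega) M
  have hnK := nK_pos (K := K)
  have hfin : volume D < ⊤ := hb.measure_lt_top
  have hB0 : 0 ≤ B := by
    have := (norm_nonneg _).trans (hB S c hc hJ 1 1 one_pos fun w => le_rfl)
    simpa using this
  refine Asymptotics.IsBigO.of_bound (B * Real.exp (2 * N * C) * volume.real D) ?_
  filter_upwards [eventually_ge_atTop 1] with x hx
  have hx0 : 0 < x := by linarith
  have hint : IntegrableOn (fun h => thetaLog c S (h, Real.log x)) D := by
    obtain ⟨r, hr⟩ := hb.subset_closedBall 0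
    exact ((((continuous_thetaLog (S := S) hc hJ).comp
      (Continuous.prodMk_left (Real.log x))).continuousOn).integrableOn_compact
        (isCompact_closedBall 0 r)).mono_set hr
  have hsub : thetaInt D c S x - thetaIntZero D c S =
      ∫ h in D, (thetaLog c S (h, Real.log x) - thetaZero c S) := by
    rw [integral_sub hint (integrableOn_const hfin.ne), setIntegral_const]
    rfl
  rw [hsub]
  have hle : ∀ h ∈ D, ‖thetaLog c S (h, Real.log x) - thetaZero c S‖ ≤
      B * Real.exp (2 * N * C) * ‖x ^ r‖ := by
    intro h hh
    refine (hB S c hc hJ _ (Real.exp (Real.log x / nK K - C)) (Real.exp_pos _) fun w => ?_).trans ?_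
    · rw [Real.exp_le_exp, unitCoord_mk]
      linarith [neg_le_of_abs_le (hC h hh w)]
    · rw [mul_assoc]
      refine mul_le_mul_of_nonneg_left ?_ hB0
      rw [← Real.exp_nat_mul, ← Real.exp_neg, Real.norm_of_nonneg (by positivity),
        Real.rpow_def_of_pos hx0, ← Real.exp_add, Real.exp_le_exp]
      have hl := Real.log_nonneg hx
      have h1 : -r ≤ 2 * N / nK K := by
        rw [le_div_iff₀ hnK]
        have : (n : ℝ) ≤ N := by simp only [N]; push_cast; linarith
        linarith
      have h2 : -(2 * N) * (Real.log x / nK K) = -(Real.log x * (2 * N / nK K)) := by ring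
      push_cast
      nlinarith [mul_le_mul_of_nonneg_left h1 hl]
  refine (norm_setIntegral_le_of_norm_le_const hfin hle).trans (le_of_eq ?_)
  ring

theorem thetaInt_inv {𝔪 : Ideal (𝓞 K)} (h𝔪 : 𝔪 ≠ ⊥)
    {φ : K → ℂ} (hφ : ∀ α, ‖φ α‖ ≤ 1)
    (hsupp : ∀ α, α ∉ Set.range (fun a : 𝓞 K => (a : K)) → φ α = 0)
    (hper : ∀ α, ∀ β ∈ 𝔪, φ (α + (β : 𝓞 K)) = φ α) {x : ℝ} (hx : 0 < x) :
    thetaInt D φ S (1 / x) = (mixEps S * (((Ideal.absNorm 𝔪 : ℝ) * √(DK K))⁻¹ : ℝ) * (x ^ (1 : ℝ) : ℝ)) •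
      thetaInt (-D) (phiHat 𝔪 φ) S x := by
  have hneg : thetaInt (-D) (phiHat 𝔪 φ) S x =
      ∫ h in D, thetaLog (phiHat 𝔪 φ) S (-h, Real.log x) := by
    have hmp := Measure.measurePreserving_neg (volume : Measure (logSpace K))
    have h := hmp.setIntegral_preimage_emb (MeasurableEquiv.neg _).measurableEmbedding
      (fun h => thetaLog (phiHat 𝔪 φ) S (h, Real.log x)) (-D)
    rw [show (Neg.neg ⁻¹' (-D) : Set (logSpace K)) = D by ext; simp] at h
    exact h.symm
  rw [hneg, thetaInt, smul_eq_mul, ← integral_const_mul]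
  refine integral_congr_ae (ae_of_all _ fun h => ?_)
  dsimp only
  rw [thetaLog, theta_inversion h𝔪 S (fun w => Real.exp_pos _) hφ hsupp hper, thetaLog]
  have h1 : (fun w => Real.exp (unitCoord K (h, Real.log (1 / x)) w))⁻¹ =
      fun w => Real.exp (unitCoord K (-h, Real.log x) w) := by
    funext w
    rw [Pi.inv_apply, ← Real.exp_neg, one_div, Real.log_inv, ← Pi.neg_apply, ← map_neg, Prod.neg_mk,
      neg_neg]
  have h2 : ∏ w, (Real.exp (unitCoord K (h, Real.log (1 / x)) w))⁻¹ ^ mult w = x := by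
    have h3 : ∀ w, (Real.exp (unitCoord K (h, Real.log (1 / x)) w))⁻¹ ^ mult w =
        Real.exp (-(mult w * unitCoord K (h, Real.log (1 / x)) w)) := fun w => by
      rw [← Real.exp_neg, ← Real.exp_nat_mul]; ring_nf
    simp_rw [h3]
    rw [← Real.exp_sum, Finset.sum_neg_distrib, sum_mult_unitCoord, one_div, Real.log_inv, neg_neg,
      Real.exp_log hx]
  rw [h1, h2, Real.rpow_one]
  push_cast
  ring

end

end Mell

section Mell

open MeasureTheory Module
open scoped Classical nonZeroDivisors Pointwise
open NumberField.mixedEmbedding NumberField.InfinitePlace NumberField.Units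
open NumberField.Units.dirichletUnitTheorem

variable {K : Type*} [Field K] [NumberField K]

theorem integrable_of_summable_integral_norm {α ι E : Type*} [MeasurableSpace α] {μ : Measure α}
    [Countable ι] [NormedAddCommGroup E] {F : ι → α → E} {G : α → E}
    (hF : ∀ i, Integrable (F i) μ) (hs : Summable fun i => ∫ a, ‖F i a‖ ∂μ)
    (hG : AEStronglyMeasurable G μ) (h : ∀ a, G a = ∑' i, F i a) : Integrable G μ := by
  refine ⟨hG, ?_⟩
  have h1 : ∀ a, ‖G a‖ₑ ≤ ∑' i, ‖F i a‖ₑ := fun a => by rw [h]; exact enorm_tsum_le_tsum_enorm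
  refine (lintegral_mono h1).trans_lt ?_
  rw [lintegral_tsum fun i => (hF i).1.enorm]
  have h2 : ∀ i, ∫⁻ a, ‖F i a‖ₑ ∂μ = ENNReal.ofReal (∫ a, ‖F i a‖ ∂μ) := fun i =>
    (ofReal_integral_norm_eq_lintegral_enorm (hF i)).symm
  simp_rw [h2]
  rw [← ENNReal.ofReal_tsum_of_nonneg (fun i => integral_nonneg fun _ => norm_nonneg _) hs]
  exact ENNReal.ofReal_lt_top

theorem mellin_eq_integral_exp (f : ℝ → ℂ) (z : ℂ) :
    mellin f z = ∫ τ : ℝ, cexp (z * τ) * f (Real.exp τ) := by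
  have h := integral_image_eq_integral_abs_deriv_smul (s := Set.univ) MeasurableSet.univ
    (fun x _ => (Real.hasDerivAt_exp x).hasDerivWithinAt) Real.exp_injective.injOn
    (fun x : ℝ => (x : ℂ) ^ (z - 1) • f x)
  rw [Set.image_univ, Real.range_exp, Measure.restrict_univ] at h
  rw [mellin, h]
  refine integral_congr_ae (ae_of_all _ fun τ => ?_)
  dsimp only
  rw [smul_eq_mul, Complex.real_smul, abs_of_pos (Real.exp_pos τ), ← mul_assoc]
  congr 1
  rw [cpow_def_of_ne_zero (by exact_mod_cast (Real.exp_pos τ).ne'), ← ofReal_log (Real.exp_pos τ).le,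
    Real.log_exp, ofReal_exp, ← Complex.exp_add]
  ring_nf

section

variable {J : (FractionalIdeal (𝓞 K)⁰ K)ˣ} {S : Finset {w : InfinitePlace K // IsReal w}}
  {M : ℝ} {c : K → ℂ} {D : Set (logSpace K)}

theorem tsum_mellinTerm (hc : ThetaCoef J S M c) (z : ℂ) (p : logSpace K × ℝ) :
    cexp (z * p.2) * (thetaLog c S p - thetaZero c S) = ∑' α, mellinTerm S c z α p := by
  rw [thetaLog, theta_sub_thetaZero hc.bound hc.supp fun w => Real.exp_pos _, ← tsum_mul_left]
  refine tsum_congr fun α => ?_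
  rw [mellinTerm]
  split_ifs
  · rw [mul_zero]
  · rw [mul_comm]

theorem mellin_thetaInt (hc : ThetaCoef J S M c) (hb : Bornology.IsBounded D)
    (hD : IsAddFundamentalDomain (unitLattice K) D volume) {z : ℂ} (hz : 1 < z.re) :
    mellin (fun x => thetaInt D c S x - thetaIntZero D c S) z =
      torsionOrder K * (unitCoordConst K * gammaFac S z) * coefSer J S c z := by
  have : Countable K := (Module.finBasis ℚ K).equivFun.toEquiv.countable_iff.2 inferInstance
  have hcont := continuous_thetaLog (S := S) hc.bound hc.supp
  have hfin : volume D < ⊤ := hb.measure_lt_top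
  have hint : ∀ τ, IntegrableOn (fun h => thetaLog c S (h, τ)) D := fun τ => by
    obtain ⟨r, hr⟩ := hb.subset_closedBall 0
    exact (((hcont.comp (Continuous.prodMk_left τ)).continuousOn).integrableOn_compact
        (isCompact_closedBall 0 r)).mono_set hr
  have hG : Integrable (fun p : logSpace K × ℝ => cexp (z * p.2) * (thetaLog c S p - thetaZero c S))
      (cylMeasure D) := by
    refine integrable_of_summable_integral_norm (integrable_mellinTerm D (zero_lt_one.trans hz))
      (summable_mellinTerm hc hD hz) ?_ (tsum_mellinTerm hc z)
    have h1 : Continuous fun p : logSpace K × ℝ => cexp (z * p.2) := by fun_prop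
    exact (h1.mul (hcont.sub continuous_const)).aestronglyMeasurable
  rw [← integral_tsum_mellinTerm hc hD hz, mellin_eq_integral_exp]
  simp_rw [← tsum_mellinTerm hc z]
  rw [cylMeasure] at hG ⊢
  rw [integral_prod_symm _ hG]
  refine integral_congr_ae (ae_of_all _ fun τ => ?_)
  dsimp only
  rw [integral_const_mul, integral_sub (hint τ) (integrableOn_const hfin.ne), setIntegral_const,
    thetaInt, Real.log_exp, thetaIntZero]

/-- The pair of averaged theta series attached to a periodic function on an ideal. -/
def fePair (hb : Bornology.IsBounded D) {𝔪 : Ideal (𝓞 K)} (h𝔪 : 𝔪 ≠ ⊥) {φ : K → ℂ}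
    {J' : (FractionalIdeal (𝓞 K)⁰ K)ˣ} (hc : ThetaCoef J S 1 φ) (hc' : ThetaCoef J' S M (phiHat 𝔪 φ))
    (hsupp : ∀ α, α ∉ Set.range (fun a : 𝓞 K => (a : K)) → φ α = 0)
    (hper : ∀ α, ∀ β ∈ 𝔪, φ (α + (β : 𝓞 K)) = φ α) : WeakFEPair ℂ where
  f := thetaInt D φ S
  g := thetaInt (-D) (phiHat 𝔪 φ) S
  k := 1
  ε := mixEps S * (((Ideal.absNorm 𝔪 : ℝ) * √(DK K))⁻¹ : ℝ)
  f₀ := thetaIntZero D φ S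
  g₀ := thetaIntZero (-D) (phiHat 𝔪 φ) S
  hf_int := locallyIntegrableOn_thetaInt hb hc.bound hc.supp
  hg_int := locallyIntegrableOn_thetaInt hb.neg hc'.bound hc'.supp
  hk := one_pos
  hε := by
    refine mul_ne_zero (norm_ne_zero_iff.1 (by rw [norm_mixEps]; exact one_ne_zero)) ?_
    refine ofReal_ne_zero.2 (inv_ne_zero (mul_ne_zero ?_ ?_))
    · exact_mod_cast (Ideal.absNorm_eq_zero_iff.not.2 h𝔪)
    · rw [Real.sqrt_ne_zero']
      exact_mod_cast Int.natAbs_pos.2 (NumberField.discr_ne_zero K)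
  h_feq x hx := thetaInt_inv h𝔪 hc.bound hsupp hper hx
  hf_top := thetaInt_isBigO hb hc.bound hc.supp
  hg_top := thetaInt_isBigO hb.neg hc'.bound hc'.supp

section

variable (hb : Bornology.IsBounded D) {𝔪 : Ideal (𝓞 K)} (h𝔪 : 𝔪 ≠ ⊥) {φ : K → ℂ}
    {J' : (FractionalIdeal (𝓞 K)⁰ K)ˣ} (hc : ThetaCoef J S 1 φ) (hc' : ThetaCoef J' S M (phiHat 𝔪 φ))
    (hsupp : ∀ α, α ∉ Set.range (fun a : 𝓞 K => (a : K)) → φ α = 0)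
    (hper : ∀ α, ∀ β ∈ 𝔪, φ (α + (β : 𝓞 K)) = φ α)

theorem fePair_Λ (hD : IsAddFundamentalDomain (unitLattice K) D volume) {z : ℂ} (hz : 1 < z.re) :
    (fePair hb h𝔪 hc hc' hsupp hper).Λ z =
      torsionOrder K * (unitCoordConst K * gammaFac S z) * coefSer J S φ z := by
  rw [← mellin_thetaInt hc hb hD hz]
  exact ((fePair hb h𝔪 hc hc' hsupp hper).hasMellin hz).2.symm

theorem fePair_symm_Λ (hD : IsAddFundamentalDomain (unitLattice K) D volume) {z : ℂ} (hz : 1 < z.re) :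
    (fePair hb h𝔪 hc hc' hsupp hper).symm.Λ z =
      torsionOrder K * (unitCoordConst K * gammaFac S z) * coefSer J' S (phiHat 𝔪 φ) z := by
  rw [← mellin_thetaInt hc' hb.neg (neg_isAddFundamentalDomain hD) hz]
  exact ((fePair hb h𝔪 hc hc' hsupp hper).symm.hasMellin hz).2.symm

end

end

end Mell

section Hat

open MeasureTheory Module
open scoped Classical nonZeroDivisors
open NumberField.InfinitePlace

variable {K : Type*} [Field K] [NumberField K]

theorem differentIdeal_ne_bot' : differentIdeal ℤ (𝓞 K) ≠ ⊥ := differentIdeal_ne_bot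

/-- The dual of an integral ideal with respect to the trace form. -/
def dualUnit (𝔪 : Ideal (𝓞 K)) (h𝔪 : 𝔪 ≠ ⊥) : (FractionalIdeal (𝓞 K)⁰ K)ˣ :=
  (unitIdeal (differentIdeal ℤ (𝓞 K) * 𝔪) (mul_ne_zero differentIdeal_ne_bot' h𝔪))⁻¹

theorem coe_dualUnit {𝔪 : Ideal (𝓞 K)} (h𝔪 : 𝔪 ≠ ⊥) :
    (dualUnit 𝔪 h𝔪 : FractionalIdeal (𝓞 K)⁰ K) =
      FractionalIdeal.dual ℤ ℚ (𝔪 : FractionalIdeal (𝓞 K)⁰ K) := by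
  rw [FractionalIdeal.dual_eq_mul_inv, dualUnit, Units.val_inv_eq_inv_val, unitIdeal, Units.val_mk0,
    FractionalIdeal.coeIdeal_mul, mul_inv, coeIdeal_differentIdeal (K := ℚ), inv_inv]

theorem absNorm_dualUnit {𝔪 : Ideal (𝓞 K)} (h𝔪 : 𝔪 ≠ ⊥) :
    (FractionalIdeal.absNorm (dualUnit 𝔪 h𝔪 : FractionalIdeal (𝓞 K)⁰ K) : ℝ) =
      ((DK K : ℝ) * Ideal.absNorm 𝔪)⁻¹ := by
  rw [dualUnit, Units.val_inv_eq_inv_val, unitIdeal, Units.val_mk0, map_inv₀,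
    FractionalIdeal.coeIdeal_absNorm, map_mul, absNorm_differentIdeal K]
  push_cast
  rfl

theorem absNorm_unitIdeal {𝔪 : Ideal (𝓞 K)} (h𝔪 : 𝔪 ≠ ⊥) :
    (FractionalIdeal.absNorm (unitIdeal 𝔪 h𝔪 : FractionalIdeal (𝓞 K)⁰ K) : ℝ) =
      Ideal.absNorm 𝔪 := by
  rw [unitIdeal, Units.val_mk0, FractionalIdeal.coeIdeal_absNorm]
  push_cast
  rfl

omit [NumberField K] in
theorem unit_mul_mem_iff (J : FractionalIdeal (𝓞 K)⁰ K) (u : (𝓞 K)ˣ) (ξ : K) :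
    (u : K) * ξ ∈ J ↔ ξ ∈ J := by
  have hmul : ∀ (v : (𝓞 K)ˣ) (η : K), η ∈ J → (v : K) * η ∈ J := fun v η h =>
    Submodule.smul_mem (J : Submodule (𝓞 K) K) (v : 𝓞 K) h
  refine ⟨fun h => ?_, hmul u ξ⟩
  have := hmul u⁻¹ _ h
  rwa [← mul_assoc, ← map_mul, ← Units.val_mul, inv_mul_cancel, Units.val_one, map_one, one_mul] at this

omit [NumberField K] in
theorem apply_out {𝔪 : Ideal (𝓞 K)} {F : K → ℂ} (hper : ∀ α, ∀ β ∈ 𝔪, F (α + (β : 𝓞 K)) = F α)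
    (a : 𝓞 K) : F ((Ideal.Quotient.mk 𝔪 a).out : 𝓞 K) = F a := by
  have h : (Ideal.Quotient.mk 𝔪 a).out - a ∈ 𝔪 := by
    rw [← Ideal.Quotient.eq]
    exact Quotient.out_eq _
  rw [← hper a _ h]
  congr 1
  push_cast
  ring

theorem eTr_periodic {𝔪 : Ideal (𝓞 K)} (h𝔪 : 𝔪 ≠ ⊥) {φ : K → ℂ}
    (hper : ∀ α, ∀ β ∈ 𝔪, φ (α + (β : 𝓞 K)) = φ α) {ξ : K}
    (hξ : ξ ∈ FractionalIdeal.dual ℤ ℚ (𝔪 : FractionalIdeal (𝓞 K)⁰ K)) (α : K) (β : 𝓞 K)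
    (hβ : β ∈ 𝔪) :
    φ (α + β) * eTr ((α + (β : 𝓞 K)) * ξ) = φ α * eTr (α * ξ) := by
  rw [hper α β hβ, add_mul, eTr_add, eTr_eq_one (unitIdeal 𝔪 h𝔪) (mem_unitIdeal.2 ⟨β, hβ, rfl⟩) hξ,
    mul_one]

theorem phiHat_unit_mul {𝔪 : Ideal (𝓞 K)} (h𝔪 : 𝔪 ≠ ⊥) {φ : K → ℂ}
    {S : Finset {w : InfinitePlace K // IsReal w}}
    (hper : ∀ α, ∀ β ∈ 𝔪, φ (α + (β : 𝓞 K)) = φ α)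
    (hunit : ∀ (u : (𝓞 K)ˣ) (α : K), φ ((u : K) * α) = sgnS S (u : K) * φ α) (u : (𝓞 K)ˣ) (ξ : K) :
    phiHat 𝔪 φ ((u : K) * ξ) = sgnS S (u : K) * phiHat 𝔪 φ ξ := by
  rw [phiHat, phiHat]
  have hiff := unit_mul_mem_iff (FractionalIdeal.dual ℤ ℚ (𝔪 : FractionalIdeal (𝓞 K)⁰ K)) u ξ
  by_cases hξ : ξ ∈ FractionalIdeal.dual ℤ ℚ (𝔪 : FractionalIdeal (𝓞 K)⁰ K)
  swap
  · rw [if_neg hξ, if_neg (hiff.not.2 hξ), mul_zero]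
  rw [if_pos hξ, if_pos (hiff.2 hξ), ← tsum_mul_left]
  have hu : IsUnit (Ideal.Quotient.mk 𝔪 (u : 𝓞 K)) := u.isUnit.map _
  rw [← (Units.mulLeft hu.unit).tsum_eq (fun x : 𝓞 K ⧸ 𝔪 => (sgnS S (u : K) : ℂ) *
    (φ (x.out : 𝓞 K) * eTr (((x.out : 𝓞 K) : K) * ξ)))]
  refine tsum_congr fun x => ?_
  have hx : Units.mulLeft hu.unit x = Ideal.Quotient.mk 𝔪 ((u : 𝓞 K) * x.out) := by
    rw [map_mul]
    change _ = _ * (Quotient.mk _ x.out)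
    rw [Quotient.out_eq]
    rfl
  have h1 := apply_out (F := fun α => φ α * eTr (α * ξ)) (eTr_periodic h𝔪 hper hξ)
    ((u : 𝓞 K) * x.out)
  have h2 : (sgnS S (u : K) : ℂ) * sgnS S (u : K) = 1 := by
    exact_mod_cast sgnS_mul_self S (α := (u : K)) (by simp)
  have hcoe : (((u : 𝓞 K) * x.out : 𝓞 K) : K) = (u : K) * ((x.out : 𝓞 K) : K) := rfl
  rw [hx, h1, hcoe, hunit, mul_left_comm (x.out : K), mul_assoc (u : K)]
  linear_combination (-φ (x.out : 𝓞 K) * eTr ((u : K) * ((x.out : K) * ξ))) * h2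

theorem thetaCoef_phiHat {𝔣 𝔟 : Ideal (𝓞 K)} (h𝔣 : 𝔣 ≠ ⊥) (h𝔟 : 𝔟 ≠ ⊥) {φ : K → ℂ}
    {S : Finset {w : InfinitePlace K // IsReal w}} (hc : ThetaCoef (unitIdeal 𝔟 h𝔟) S 1 φ)
    (hper : ∀ α, ∀ β ∈ 𝔣 * 𝔟, φ (α + (β : 𝓞 K)) = φ α) :
    ThetaCoef (dualUnit (𝔣 * 𝔟) (mul_ne_zero h𝔣 h𝔟)) S (Ideal.absNorm 𝔣) (phiHat (𝔣 * 𝔟) φ) where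
  supp ξ hξ := by
    rw [coe_dualUnit] at hξ
    rw [phiHat, if_neg hξ]
  bound := norm_phiHat_le h𝔣 h𝔟 hc.bound fun a ha => hc.supp _ fun h => by
    obtain ⟨b, hb, hba⟩ := mem_unitIdeal.1 h
    rw [RingOfIntegers.coe_injective hba] at hb
    exact ha hb
  unit := phiHat_unit_mul (mul_ne_zero h𝔣 h𝔟) hper hc.unit

end Hat

section Char

open scoped Classical nonZeroDivisors
open NumberField.mixedEmbedding NumberField.InfinitePlace

variable {K : Type*} [Field K] [NumberField K]

theorem totPos_of_forall_isReal {α : 𝓞 K}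
    (h : ∀ w : {w : InfinitePlace K // IsReal w}, 0 < embedding_of_isReal w.2 (α : K)) :
    TotPos K α := by
  intro φ
  have hr : ComplexEmbedding.IsReal (Complex.ofRealHom.comp φ) := by
    ext x
    simp
  have hw : IsReal (InfinitePlace.mk (Complex.ofRealHom.comp φ)) := ⟨_, hr, rfl⟩
  have h1 := h ⟨_, hw⟩
  have h2 := embedding_of_isReal_apply hw (α : K)
  rw [embedding_mk_eq_of_isReal hr] at h2
  have h3 : embedding_of_isReal hw (α : K) = φ (α : K) :=
    Complex.ofReal_injective h2
  rwa [h3] at h1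

omit [NumberField K] in
theorem embedding_of_isReal_ne_zero (w : {w : InfinitePlace K // IsReal w}) {α : K} (hα : α ≠ 0) :
    embedding_of_isReal w.2 α ≠ 0 :=
  (map_ne_zero _).2 hα

theorem exists_sign_eq (w₀ : {w : InfinitePlace K // IsReal w}) :
    ∃ γ : 𝓞 K, embedding_of_isReal w₀.2 (γ : K) < 0 ∧
      ∀ w : {w : InfinitePlace K // IsReal w}, w ≠ w₀ → 0 < embedding_of_isReal w.2 (γ : K) := by
  let z : (v : InfinitePlace K) → WithAbs v.1 := fun v => if v = w₀.1 then -1 else 1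
  obtain ⟨x, hx⟩ := Metric.denseRange_iff.1 (denseRange_algebraMap_pi K) z 1 one_pos
  have hdist : ∀ v : InfinitePlace K, v ((if v = w₀.1 then -1 else 1) - x) < 1 := by
    intro v
    have h := (dist_pi_lt_iff one_pos).1 hx v
    rw [dist_eq_norm] at h
    have h2 : v ((if v = w₀.1 then -1 else 1) - x) =
        ‖z v - algebraMap K ((v : InfinitePlace K) → WithAbs v.1) x v‖ := by
      dsimp only [z]
      split_ifs <;> rfl
    rwa [h2]
  have habs : ∀ w : {w : InfinitePlace K // IsReal w},
      |embedding_of_isReal w.2 ((if w = w₀ then -1 else 1) - x)| < 1 := by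
    intro w
    have h := hdist w.1
    rw [← norm_embedding_of_isReal w.2, Real.norm_eq_abs] at h
    simpa [Subtype.ext_iff] using h
  obtain ⟨a, b, hb, hab⟩ := IsFractionRing.div_surjective (A := 𝓞 K) x
  have hb0 : (b : K) ≠ 0 := by
    simpa using nonZeroDivisors.ne_zero hb
  have hmul : ∀ w : {w : InfinitePlace K // IsReal w},
      embedding_of_isReal w.2 ((a * b : 𝓞 K) : K) =
        embedding_of_isReal w.2 x * (embedding_of_isReal w.2 (b : K)) ^ 2 := by
    intro w
    rw [← map_pow, ← map_mul, ← hab]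
    congr 1
    push_cast
    field_simp
  have hsq : ∀ w : {w : InfinitePlace K // IsReal w}, 0 < (embedding_of_isReal w.2 (b : K)) ^ 2 :=
    fun w => sq_pos_of_ne_zero (embedding_of_isReal_ne_zero w hb0)
  refine ⟨a * b, ?_, fun w hw => ?_⟩
  · rw [hmul]
    have h := habs w₀
    rw [if_pos rfl, map_sub, map_neg, map_one, abs_lt] at h
    exact mul_neg_of_neg_of_pos (by linarith [h.1]) (hsq _)
  · rw [hmul]
    have h := habs w
    rw [if_neg hw, map_sub, map_one, abs_lt] at h
    exact mul_pos (by linarith [h.2]) (hsq _)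

theorem exists_sign_eq_sub_one_mem {𝔣 : Ideal (𝓞 K)} (h𝔣 : 𝔣 ≠ ⊥)
    (w₀ : {w : InfinitePlace K // IsReal w}) :
    ∃ κ : 𝓞 K, κ - 1 ∈ 𝔣 ∧ embedding_of_isReal w₀.2 (κ : K) < 0 ∧
      ∀ w : {w : InfinitePlace K // IsReal w}, w ≠ w₀ → 0 < embedding_of_isReal w.2 (κ : K) := by
  obtain ⟨γ, h1, h2⟩ := exists_sign_eq w₀
  obtain ⟨k, hk⟩ := exists_nat_gt (-(embedding_of_isReal w₀.2 (γ : K)))⁻¹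
  have hN : (1 : ℝ) ≤ Ideal.absNorm 𝔣 := by
    exact_mod_cast Nat.one_le_iff_ne_zero.2 (Ideal.absNorm_eq_zero_iff.not.2 h𝔣)
  have hform : ∀ w : {w : InfinitePlace K // IsReal w},
      embedding_of_isReal w.2 ((1 + (Ideal.absNorm 𝔣 : 𝓞 K) * (k * γ) : 𝓞 K) : K) =
        1 + Ideal.absNorm 𝔣 * (k * embedding_of_isReal w.2 (γ : K)) := by
    intro w
    push_cast
    simp
  refine ⟨1 + (Ideal.absNorm 𝔣 : 𝓞 K) * (k * γ), ?_, ?_, fun w hw => ?_⟩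
  · rw [add_sub_cancel_left]
    exact Ideal.mul_mem_right _ _ (Ideal.absNorm_mem 𝔣)
  · rw [hform]
    have h3 : 1 < k * -(embedding_of_isReal w₀.2 (γ : K)) := by
      rwa [inv_lt_iff_one_lt_mul₀ (by linarith)] at hk
    nlinarith
  · rw [hform]
    have := h2 w hw
    positivity

variable {𝔣 : Ideal (𝓞 K)} (χ : HeckeChar K 𝔣)

theorem HeckeChar.map_top : χ.toFun ⊤ = 1 := by
  have h1 : ‖χ.toFun ⊤‖ = 1 := χ.norm_one' _ (by
    rw [Ideal.isCoprime_iff_sup_eq, top_sup_eq])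
  have h2 : χ.toFun ⊤ * χ.toFun ⊤ = χ.toFun ⊤ := by rw [← χ.map_mul', Ideal.mul_top]
  exact mul_eq_left₀ (fun h => by simp [h] at h1) |>.1 h2

/-- A Hecke character as a monoid homomorphism on integral ideals. -/
def HeckeChar.hom : Ideal (𝓞 K) →* ℂ where
  toFun := χ.toFun
  map_one' := by rw [Ideal.one_eq_top, χ.map_top]
  map_mul' := χ.map_mul'

theorem HeckeChar.norm_le_one (𝔞 : Ideal (𝓞 K)) : ‖χ.hom 𝔞‖ ≤ 1 := by
  by_cases h : IsCoprime 𝔞 𝔣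
  · exact (χ.norm_one' 𝔞 h).le
  · exact (by simp [HeckeChar.hom, χ.eq_zero' 𝔞 h] : ‖χ.hom 𝔞‖ = 0).le.trans zero_le_one

theorem LSer_eq_idealSer (s : ℂ) : LSer χ s = idealSer χ.hom s := rfl

variable {χ}

theorem span_sq_eq_one {κ : 𝓞 K} (h0 : κ ≠ 0) (h1 : κ - 1 ∈ 𝔣) :
    χ.toFun (Ideal.span {κ}) * χ.toFun (Ideal.span {κ}) = 1 := by
  rw [← χ.map_mul', Ideal.span_singleton_mul_span_singleton]
  refine χ.ray_one' _ (totPos_of_forall_isReal fun w => ?_) ?_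
  · push_cast
    rw [map_mul]
    exact mul_self_pos.2 (embedding_of_isReal_ne_zero w (by simpa using h0))
  · have : κ * κ - 1 = (κ + 1) * (κ - 1) := by ring
    rw [this]
    exact Ideal.mul_mem_left _ _ h1

theorem span_eq_of_sign_eq {κ κ' : 𝓞 K} (h0 : κ' ≠ 0) (h1 : κ - 1 ∈ 𝔣) (h1' : κ' - 1 ∈ 𝔣)
    (hs : ∀ w : {w : InfinitePlace K // IsReal w},
      0 < embedding_of_isReal w.2 (κ : K) * embedding_of_isReal w.2 (κ' : K)) :
    χ.toFun (Ideal.span {κ}) = χ.toFun (Ideal.span {κ'}) := by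
  have h2 : χ.toFun (Ideal.span {κ}) * χ.toFun (Ideal.span {κ'}) = 1 := by
    rw [← χ.map_mul', Ideal.span_singleton_mul_span_singleton]
    refine χ.ray_one' _ (totPos_of_forall_isReal fun w => ?_) ?_
    · push_cast
      rw [map_mul]
      exact hs w
    · have : κ * κ' - 1 = κ' * (κ - 1) + (κ' - 1) := by ring
      rw [this]
      exact 𝔣.add_mem (Ideal.mul_mem_left _ _ h1) h1'
  exact mul_right_cancel₀ (right_ne_zero_of_mul_eq_one h2) (h2.trans (span_sq_eq_one h0 h1').symm)

omit [NumberField K] in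
theorem prod_sub_one_mem {ι : Type*} (s : Finset ι) {κ : ι → 𝓞 K} (h : ∀ i ∈ s, κ i - 1 ∈ 𝔣) :
    ∏ i ∈ s, κ i - 1 ∈ 𝔣 := by
  rw [← Ideal.Quotient.eq, map_prod, map_one]
  exact Finset.prod_eq_one fun i hi => by
    rw [← map_one (Ideal.Quotient.mk 𝔣)]
    exact Ideal.Quotient.eq.2 (h i hi)

variable (χ)

theorem exists_sgnS_eq (h𝔣 : 𝔣 ≠ ⊥) : ∃ S : Finset {w : InfinitePlace K // IsReal w},
    ∀ κ : 𝓞 K, κ ≠ 0 → κ - 1 ∈ 𝔣 → χ.toFun (Ideal.span {κ}) = sgnS S (κ : K) := by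
  choose κ hκ1 hκneg hκpos using exists_sign_eq_sub_one_mem (K := K) h𝔣
  have hκ0 : ∀ w, κ w ≠ 0 := fun w h => by
    have := hκneg w
    simp [h] at this
  refine ⟨Finset.univ.filter fun w => χ.toFun (Ideal.span {κ w}) ≠ 1, fun α hα hα1 => ?_⟩
  have hval : ∀ w, χ.toFun (Ideal.span {κ w}) =
      if χ.toFun (Ideal.span {κ w}) ≠ 1 then -1 else 1 := by
    intro w
    split_ifs with h
    · exact (mul_self_eq_one_iff.1 (span_sq_eq_one (hκ0 w) (hκ1 w))).resolve_left h
    · exact not_not.1 h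
  have hα' : (α : K) ≠ 0 := by simpa using hα
  set P := Finset.univ.filter fun w : {w : InfinitePlace K // IsReal w} =>
    embedding_of_isReal w.2 (α : K) < 0 with hP
  have hsign : ∀ w : {w : InfinitePlace K // IsReal w}, 0 < embedding_of_isReal w.2 (α : K) *
      embedding_of_isReal w.2 ((∏ v ∈ P, κ v : 𝓞 K) : K) := by
    intro w
    have hcoe : ((∏ v ∈ P, κ v : 𝓞 K) : K) = ∏ v ∈ P, (κ v : K) := map_prod (algebraMap (𝓞 K) K) _ _
    rw [hcoe, map_prod]
    by_cases hw : w ∈ P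
    · rw [← Finset.mul_prod_erase _ _ hw, ← mul_assoc]
      refine mul_pos (mul_pos_of_neg_of_neg (Finset.mem_filter.1 hw).2 (hκneg w))
        (Finset.prod_pos fun v hv => hκpos v w (Finset.ne_of_mem_erase hv).symm)
    · refine mul_pos ?_ (Finset.prod_pos fun v hv => hκpos v w fun h => hw (h ▸ hv))
      have h1 : ¬ embedding_of_isReal w.2 (α : K) < 0 := fun h => hw (by simp [hP, h])
      exact lt_of_le_of_ne (not_lt.1 h1) (embedding_of_isReal_ne_zero w hα').symm
  rw [span_eq_of_sign_eq (Finset.prod_ne_zero_iff.2 fun v _ => hκ0 v) hα1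
    (prod_sub_one_mem P fun v _ => hκ1 v) hsign]
  have h2 : χ.toFun (Ideal.span {∏ v ∈ P, κ v}) = ∏ v ∈ P, χ.toFun (Ideal.span {κ v}) := by
    rw [← Ideal.prod_span_singleton]
    exact map_prod χ.hom _ _
  rw [h2, sgnS, Finset.prod_congr rfl fun w _ => hval w, hP, Finset.prod_filter,
    Finset.prod_filter]
  push_cast
  refine Finset.prod_congr rfl fun w _ => ?_
  rw [mixedEmbedding_apply_isReal]
  have hne := embedding_of_isReal_ne_zero w hα'
  rcases lt_or_gt_of_ne hne with h | h
  · rw [if_pos h, sign_neg h]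
    split_ifs <;> simp
  · rw [if_neg h.not_gt, sign_pos h]
    simp

end Char

section Char

open scoped Classical nonZeroDivisors
open NumberField.mixedEmbedding NumberField.InfinitePlace

variable {K : Type*} [Field K] [NumberField K] {𝔣 : Ideal (𝓞 K)} {χ : HeckeChar K 𝔣}
  {S : Finset {w : InfinitePlace K // IsReal w}}

theorem HeckeChar.eq_one_of_top (h : 𝔣 = ⊤) (𝔞 : Ideal (𝓞 K)) : χ.toFun 𝔞 = 1 := by
  have hc : IsCoprime (⊥ : Ideal (𝓞 K)) 𝔣 := by
    rw [h, Ideal.isCoprime_iff_sup_eq, sup_top_eq]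
  have h1 := χ.norm_one' ⊥ hc
  have h2 : χ.toFun ⊥ * χ.toFun 𝔞 = χ.toFun ⊥ := by rw [← χ.map_mul', Ideal.bot_mul]
  exact mul_eq_left₀ (fun h => by simp [h] at h1) |>.1 h2

theorem eq_empty_of_top (h𝔣 : 𝔣 ≠ ⊥)
    (hS : ∀ κ : 𝓞 K, κ ≠ 0 → κ - 1 ∈ 𝔣 → χ.toFun (Ideal.span {κ}) = sgnS S (κ : K))
    (htriv : ∀ 𝔞, IsCoprime 𝔞 𝔣 → χ.toFun 𝔞 = 1) : S = ∅ := by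
  by_contra hne
  obtain ⟨w, hw⟩ := Finset.nonempty_iff_ne_empty.2 hne
  obtain ⟨κ, h1, h2, h3⟩ := exists_sign_eq_sub_one_mem h𝔣 w
  have hκ : κ ≠ 0 := fun h => by simp [h] at h2
  have hcop : IsCoprime (Ideal.span {κ}) 𝔣 := by
    rw [Ideal.isCoprime_iff_exists]
    exact ⟨κ, Ideal.mem_span_singleton_self κ, 1 - κ, by rw [← neg_sub]; exact 𝔣.neg_mem h1,
      by ring⟩
  have h4 := hS κ hκ h1
  rw [htriv _ hcop, sgnS, ← Finset.mul_prod_erase _ _ hw, mixedEmbedding_apply_isReal,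
    sign_neg h2, Finset.prod_eq_one fun v hv => by
      rw [mixedEmbedding_apply_isReal, sign_pos (h3 v (Finset.ne_of_mem_erase hv))]; simp] at h4
  norm_num at h4

omit [NumberField K] in
theorem abs_sgnS_le_one (S : Finset {w : InfinitePlace K // IsReal w}) (α : K) :
    |sgnS S α| ≤ 1 := by
  by_cases h : α = 0
  · rw [sgnS, Finset.abs_prod]
    exact Finset.prod_le_one (fun _ _ => abs_nonneg _) fun w _ => by simp [h]
  · exact (abs_sgnS S h).le

omit [NumberField K] in
theorem exists_mem_sub_one_mem {𝔞 : Ideal (𝓞 K)} (h𝔞 : 𝔞 ≠ ⊥) (h : IsCoprime 𝔞 𝔣) :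
    ∃ γ ∈ 𝔞, γ ≠ 0 ∧ γ - 1 ∈ 𝔣 := by
  obtain ⟨γ, hγ, δ, hδ, hsum⟩ := Ideal.isCoprime_iff_exists.1 h
  by_cases h0 : γ = 0
  · obtain ⟨x, hx, hx0⟩ := Submodule.exists_mem_ne_zero_of_ne_bot h𝔞
    rw [h0, zero_add] at hsum
    exact ⟨x, hx, hx0, by
      rw [(Ideal.eq_top_iff_one 𝔣).2 (hsum ▸ hδ)]
      trivial⟩
  · refine ⟨γ, hγ, h0, ?_⟩
    rw [← hsum, sub_add_cancel_left]
    exact 𝔣.neg_mem hδ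

theorem mul_eq_mul_of_twist {x x' c g g' a a' : ℂ} (h1 : x * c = g) (h2 : x' * c = g')
    (h3 : a' * g = a * g') (hg : g * g = 1) (hg' : g' * g' = 1) (hc : c ≠ 0) :
    x' * a' = x * a := by
  refine mul_right_cancel₀ hc ?_
  linear_combination a' * h2 - a * h1 + g' * g * h3 - g' * a' * hg + g * a * hg'

theorem char_mul_sgnS_congr
    (hS : ∀ κ : 𝓞 K, κ ≠ 0 → κ - 1 ∈ 𝔣 → χ.toFun (Ideal.span {κ}) = sgnS S (κ : K))
    {𝔞 𝔞' 𝔟 : Ideal (𝓞 K)} (h𝔟 : 𝔟 ≠ ⊥) {α α' : 𝓞 K} (hα : α ≠ 0) (hα' : α' ≠ 0)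
    (h : 𝔞 * 𝔟 = Ideal.span {α}) (h' : 𝔞' * 𝔟 = Ideal.span {α'}) (hd : α' - α ∈ 𝔣 * 𝔟) :
    χ.toFun 𝔞' * sgnS S (α' : K) = χ.toFun 𝔞 * sgnS S (α : K) := by
  have hsup : 𝔞 ⊔ 𝔣 = 𝔞' ⊔ 𝔣 := by
    refine mul_right_cancel₀ h𝔟 ?_
    rw [Ideal.sup_mul, Ideal.sup_mul, h, h']
    have hle : Ideal.span {α' - α} ≤ 𝔣 * 𝔟 := (Ideal.span_singleton_le_iff_mem _).2 hd
    apply le_antisymm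
    · refine sup_le ((Ideal.span_singleton_le_iff_mem _).2 ?_) le_sup_right
      have : α = α' - (α' - α) := by ring
      rw [this]
      exact Submodule.sub_mem _ (Ideal.mem_sup_left (Ideal.mem_span_singleton_self α'))
        (Ideal.mem_sup_right hd)
    · refine sup_le ((Ideal.span_singleton_le_iff_mem _).2 ?_) le_sup_right
      have : α' = α + (α' - α) := by ring
      rw [this]
      exact Submodule.add_mem _ (Ideal.mem_sup_left (Ideal.mem_span_singleton_self α))
        (Ideal.mem_sup_right hd)
  by_cases hc : IsCoprime 𝔞 𝔣
  swap
  · have hc' : ¬ IsCoprime 𝔞' 𝔣 := by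
      rwa [Ideal.isCoprime_iff_sup_eq, ← hsup, ← Ideal.isCoprime_iff_sup_eq]
    rw [χ.eq_zero' _ hc, χ.eq_zero' _ hc', zero_mul, zero_mul]
  have hspan : Ideal.span {α} ≠ ⊥ := by simpa using hα
  have h𝔞 : 𝔞 ≠ ⊥ := by
    rintro rfl
    exact hspan (by rw [← h, Ideal.bot_mul])
  obtain ⟨γ, hγ, hγ0, hγ1⟩ := exists_mem_sub_one_mem h𝔞 hc
  obtain ⟨𝔠, h𝔠⟩ := Ideal.dvd_span_singleton.2 hγ
  have hprod : Ideal.span {α' * γ} = Ideal.span {α} * (𝔞' * 𝔠) := by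
    rw [← Ideal.span_singleton_mul_span_singleton, ← h', h𝔠, ← h]
    ring
  obtain ⟨γ', hγ'⟩ : α ∣ α' * γ := by
    rw [← Ideal.span_singleton_le_span_singleton, hprod]
    exact Ideal.mul_le_left
  have hspan' : Ideal.span {γ'} = 𝔞' * 𝔠 := by
    refine mul_left_cancel₀ hspan ?_
    rw [← hprod, hγ', Ideal.span_singleton_mul_span_singleton]
  obtain ⟨𝔢, h𝔢⟩ := Ideal.dvd_span_singleton.2 hd
  have hdiff : Ideal.span {γ' - γ} = 𝔠 * 𝔣 * 𝔢 := by
    refine mul_left_cancel₀ hspan ?_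
    have : α * (γ' - γ) = γ * (α' - α) := by linear_combination -hγ'
    rw [Ideal.span_singleton_mul_span_singleton, this, ← Ideal.span_singleton_mul_span_singleton,
      h𝔢, h𝔠, ← h]
    ring
  have hγ'1 : γ' - 1 ∈ 𝔣 := by
    have h1 : γ' - γ ∈ 𝔣 := by
      rw [← Ideal.span_singleton_le_iff_mem, hdiff]
      exact Ideal.mul_le_left.trans Ideal.mul_le_right
    have : γ' - 1 = (γ' - γ) + (γ - 1) := by ring
    rw [this]
    exact 𝔣.add_mem h1 hγ1
  have hγ'0 : γ' ≠ 0 := by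
    rintro rfl
    rw [mul_zero] at hγ'
    exact mul_ne_zero hα' hγ0 hγ'
  have e1 := hS γ hγ0 hγ1
  have e2 := hS γ' hγ'0 hγ'1
  rw [h𝔠, χ.map_mul'] at e1
  rw [hspan', χ.map_mul'] at e2
  have cne : ∀ {x : 𝓞 K}, x ≠ 0 → (x : K) ≠ 0 := fun hx =>
    RingOfIntegers.coe_ne_zero_iff.2 hx
  have hχ𝔠 : χ.toFun 𝔠 ≠ 0 := by
    refine right_ne_zero_of_mul (a := χ.toFun 𝔞) ?_
    rw [e1]
    exact Complex.ofReal_ne_zero.2 (left_ne_zero_of_mul_eq_one (sgnS_mul_self S (cne hγ0)))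
  have e3 : (sgnS S (α' : K) * sgnS S (γ : K) : ℂ) = sgnS S (α : K) * sgnS S (γ' : K) := by
    have hK := congrArg (algebraMap (𝓞 K) K) hγ'
    rw [map_mul, map_mul] at hK
    rw [← Complex.ofReal_mul, ← Complex.ofReal_mul, ← sgnS_mul, ← sgnS_mul, hK]
  refine mul_eq_mul_of_twist e1 e2 e3 ?_ ?_ hχ𝔠
  · rw [← Complex.ofReal_mul, sgnS_mul_self S (cne hγ0), Complex.ofReal_one]
  · rw [← Complex.ofReal_mul, sgnS_mul_self S (cne hγ'0), Complex.ofReal_one]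

/-- The theta coefficient attached to a Hecke character and an integral ideal `𝔟`: for
`(α) = 𝔞𝔟` its value at `α` is `χ(𝔞)` times the sign character. -/
def heckePhi (χ : HeckeChar K 𝔣) (S : Finset {w : InfinitePlace K // IsReal w})
    (𝔟 : Ideal (𝓞 K)) (x : K) : ℂ :=
  if h : ∃ p : Ideal (𝓞 K) × 𝓞 K, ((p.2 : 𝓞 K) : K) = x ∧ p.1 * 𝔟 = Ideal.span {p.2} then
    χ.toFun h.choose.1 * sgnS S x else 0

theorem heckePhi_eq {𝔞 𝔟 : Ideal (𝓞 K)} (h𝔟 : 𝔟 ≠ ⊥) {α : 𝓞 K} (h : 𝔞 * 𝔟 = Ideal.span {α}) :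
    heckePhi χ S 𝔟 α = χ.toFun 𝔞 * sgnS S (α : K) := by
  have hex : ∃ p : Ideal (𝓞 K) × 𝓞 K, ((p.2 : 𝓞 K) : K) = α ∧ p.1 * 𝔟 = Ideal.span {p.2} :=
    ⟨(𝔞, α), rfl, h⟩
  rw [heckePhi, dif_pos hex]
  have h2 : hex.choose.1 = 𝔞 := by
    refine mul_right_cancel₀ h𝔟 ?_
    rw [h, hex.choose_spec.2, RingOfIntegers.coe_injective hex.choose_spec.1]
  rw [h2]

theorem heckePhi_eq_zero {𝔟 : Ideal (𝓞 K)} {x : K} (h : ∀ α ∈ 𝔟, ((α : 𝓞 K) : K) ≠ x) :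
    heckePhi χ S 𝔟 x = 0 := by
  rw [heckePhi, dif_neg]
  rintro ⟨⟨𝔞, α⟩, h1, h2⟩
  exact h α (Ideal.dvd_span_singleton.1 ⟨𝔞, by rw [← h2, mul_comm]⟩) h1

theorem exists_mul_eq_span {𝔟 : Ideal (𝓞 K)} {α : 𝓞 K} (h : α ∈ 𝔟) :
    ∃ 𝔞, 𝔞 * 𝔟 = Ideal.span {α} := by
  obtain ⟨𝔞, h𝔞⟩ := Ideal.dvd_span_singleton.2 h
  exact ⟨𝔞, by rw [h𝔞, mul_comm]⟩

theorem heckePhi_of_mem_mul (h𝔣 : 𝔣 ≠ ⊤) {𝔟 : Ideal (𝓞 K)} (h𝔟 : 𝔟 ≠ ⊥) {α : 𝓞 K}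
    (h : α ∈ 𝔣 * 𝔟) : heckePhi χ S 𝔟 α = 0 := by
  obtain ⟨𝔠, h𝔠⟩ := exists_mul_eq_span h
  rw [heckePhi_eq h𝔟 (𝔞 := 𝔠 * 𝔣) (by rw [mul_assoc, h𝔠]), χ.eq_zero', zero_mul]
  rw [Ideal.isCoprime_iff_sup_eq, sup_eq_right.2 Ideal.mul_le_right]
  exact h𝔣

variable (χ S)

theorem heckePhi_congr (h𝔣 : 𝔣 ≠ ⊥)
    (hS : ∀ κ : 𝓞 K, κ ≠ 0 → κ - 1 ∈ 𝔣 → χ.toFun (Ideal.span {κ}) = sgnS S (κ : K))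
    {𝔟 : Ideal (𝓞 K)} (h𝔟 : 𝔟 ≠ ⊥) {α α' : 𝓞 K} (hα : α ∈ 𝔟) (hα' : α' ∈ 𝔟)
    (hd : α' - α ∈ 𝔣 * 𝔟) : heckePhi χ S 𝔟 α' = heckePhi χ S 𝔟 α := by
  obtain ⟨𝔞, h𝔞⟩ := exists_mul_eq_span hα
  obtain ⟨𝔞', h𝔞'⟩ := exists_mul_eq_span hα'
  by_cases htop : 𝔣 = ⊤
  · have hS0 := eq_empty_of_top h𝔣 hS fun 𝔞 _ => χ.eq_one_of_top htop 𝔞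
    rw [heckePhi_eq h𝔟 h𝔞, heckePhi_eq h𝔟 h𝔞', χ.eq_one_of_top htop, χ.eq_one_of_top htop, hS0]
    rfl
  by_cases h0 : α = 0
  · rw [heckePhi_of_mem_mul htop h𝔟 (α := α) (by rw [h0]; exact Ideal.zero_mem _),
      heckePhi_of_mem_mul htop h𝔟 (α := α') (by rwa [h0, sub_zero] at hd)]
  by_cases h0' : α' = 0
  · rw [heckePhi_of_mem_mul htop h𝔟 (α := α') (by rw [h0']; exact Ideal.zero_mem _), heckePhi_of_mem_mul htop h𝔟]
    rw [h0', zero_sub] at hd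
    exact neg_mem_iff.1 hd
  rw [heckePhi_eq h𝔟 h𝔞, heckePhi_eq h𝔟 h𝔞']
  exact char_mul_sgnS_congr hS h𝔟 h0 h0' h𝔞 h𝔞' hd

theorem heckePhi_add (h𝔣 : 𝔣 ≠ ⊥)
    (hS : ∀ κ : 𝓞 K, κ ≠ 0 → κ - 1 ∈ 𝔣 → χ.toFun (Ideal.span {κ}) = sgnS S (κ : K))
    {𝔟 : Ideal (𝓞 K)} (h𝔟 : 𝔟 ≠ ⊥) (x : K) (β : 𝓞 K) (hβ : β ∈ 𝔣 * 𝔟) :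
    heckePhi χ S 𝔟 (x + β) = heckePhi χ S 𝔟 x := by
  have hβ' : β ∈ 𝔟 := Ideal.mul_le_right hβ
  by_cases hx : ∃ α ∈ 𝔟, ((α : 𝓞 K) : K) = x
  · obtain ⟨α, hα, rfl⟩ := hx
    have : ((α : K) + β) = ((α + β : 𝓞 K) : K) := by push_cast; rfl
    rw [this]
    exact heckePhi_congr χ S h𝔣 hS h𝔟 hα (𝔟.add_mem hα hβ') (by rwa [add_sub_cancel_left])
  · push Not at hx
    rw [heckePhi_eq_zero hx, heckePhi_eq_zero]
    intro α hα h
    refine hx (α - β) (𝔟.sub_mem hα hβ') ?_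
    change (α : K) - (β : K) = x
    rw [h, add_sub_cancel_right]

theorem thetaCoef_heckePhi {𝔟 : Ideal (𝓞 K)} (h𝔟 : 𝔟 ≠ ⊥) :
    ThetaCoef (unitIdeal 𝔟 h𝔟) S 1 (heckePhi χ S 𝔟) where
  supp x hx := heckePhi_eq_zero fun α hα h => hx (mem_unitIdeal.2 ⟨α, hα, h⟩)
  bound x := by
    rw [heckePhi]
    split_ifs with h
    · rw [norm_mul, Complex.norm_real, Real.norm_eq_abs]
      exact mul_le_one₀ (χ.norm_le_one _) (abs_nonneg _) (abs_sgnS_le_one S x)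
    · simp
  unit u x := by
    by_cases hx : ∃ α ∈ 𝔟, ((α : 𝓞 K) : K) = x
    · obtain ⟨α, hα, rfl⟩ := hx
      obtain ⟨𝔞, h𝔞⟩ := exists_mul_eq_span hα
      have h1 : ((u : K) * (α : K)) = (((u : 𝓞 K) * α : 𝓞 K) : K) := rfl
      have h2 : 𝔞 * 𝔟 = Ideal.span {(u : 𝓞 K) * α} := by
        rw [h𝔞, Ideal.span_singleton_mul_left_unit u.isUnit]
      rw [h1, heckePhi_eq h𝔟 h2, heckePhi_eq h𝔟 h𝔞, ← h1, sgnS_mul]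
      push_cast
      ring
    · push Not at hx
      rw [heckePhi_eq_zero hx, heckePhi_eq_zero, mul_zero]
      intro α hα h
      refine hx ((u⁻¹ : (𝓞 K)ˣ) * α) (𝔟.mul_mem_left _ hα) ?_
      have h1 : (((u⁻¹ : (𝓞 K)ˣ) : 𝓞 K) : K) * (u : K) = 1 := by
        rw [← map_mul, Units.inv_mul, map_one]
      change (((u⁻¹ : (𝓞 K)ˣ) : 𝓞 K) : K) * (α : K) = x
      rw [h, ← mul_assoc, h1, one_mul]

theorem generates_unitIdeal {𝔟 : Ideal (𝓞 K)} (h𝔟 : 𝔟 ≠ ⊥) (𝔞 : NzIdeal K) {α : 𝓞 K}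
    (h : 𝔞.1 * 𝔟 = Ideal.span {α}) : Generates (unitIdeal 𝔟 h𝔟) 𝔞 (α : K) := by
  rw [Generates, ← FractionalIdeal.coeIdeal_span_singleton, ← h, FractionalIdeal.coeIdeal_mul]
  rfl

theorem idealCoef_heckePhi {𝔟 : Ideal (𝓞 K)} (h𝔟 : 𝔟 ≠ ⊥) (𝔞 : NzIdeal K) :
    idealCoef (unitIdeal 𝔟 h𝔟) S (heckePhi χ S 𝔟) 𝔞 =
      if (𝔞.1 * 𝔟).IsPrincipal then χ.toFun 𝔞.1 else 0 := by
  split_ifs with h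
  · obtain ⟨α, hα⟩ := h
    have hα0 : α ≠ 0 := by
      rintro rfl
      rw [Ideal.submodule_span_eq, Ideal.span_singleton_eq_bot.2 rfl] at hα
      exact mul_ne_zero 𝔞.2 h𝔟 hα
    rw [idealCoef_eq (thetaCoef_heckePhi χ S h𝔟) (generates_unitIdeal h𝔟 𝔞 hα),
      heckePhi_eq h𝔟 hα, mul_assoc]
    have := sgnS_mul_self S (α := (α : K)) (by simpa using hα0)
    rw [← Complex.ofReal_mul, this, Complex.ofReal_one, mul_one]
  · rw [idealCoef, dif_neg]
    rintro ⟨x, hx⟩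
    have hx' := hx
    rw [Generates] at hx
    have h1 : FractionalIdeal.spanSingleton (𝓞 K)⁰ x = ((𝔞.1 * 𝔟 : Ideal (𝓞 K)) : FractionalIdeal (𝓞 K)⁰ K) := by
      rw [hx, FractionalIdeal.coeIdeal_mul]
      rfl
    have h2 : x ∈ ((𝔞.1 * 𝔟 : Ideal (𝓞 K)) : FractionalIdeal (𝓞 K)⁰ K) := by
      rw [← h1]
      exact FractionalIdeal.mem_spanSingleton_self _ x
    obtain ⟨α, -, rfl⟩ := (FractionalIdeal.mem_coeIdeal _).1 h2
    rw [← FractionalIdeal.coeIdeal_span_singleton, FractionalIdeal.coeIdeal_inj] at h1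
    exact h ⟨α, h1.symm⟩

end Char

section LFun

open MeasureTheory Module
open scoped Classical nonZeroDivisors
open NumberField.mixedEmbedding NumberField.InfinitePlace NumberField.Units
open NumberField.Units.dirichletUnitTheorem

variable {K : Type*} [Field K] [NumberField K] {𝔣 : Ideal (𝓞 K)}

/-- A choice of one nonzero integral ideal in each ideal class. -/
structure ClassFamily (K : Type*) [Field K] [NumberField K] where
  ideal : ClassGroup (𝓞 K) → Ideal (𝓞 K)
  ne_bot : ∀ C, ideal C ≠ ⊥
  mk0_eq : ∀ C, ClassGroup.mk0 ⟨ideal C, mem_nonZeroDivisors_of_ne_zero (ne_bot C)⟩ = C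

instance : Nonempty (ClassFamily K) := by
  choose b hb using ClassGroup.mk0_surjective (R := 𝓞 K)
  exact ⟨⟨fun C => b C, fun C => nonZeroDivisors.coe_ne_zero (b C), hb⟩⟩

theorem isPrincipal_mul_iff (b : ClassFamily K) (𝔞 : NzIdeal K) (C : ClassGroup (𝓞 K)) :
    (𝔞.1 * b.ideal C).IsPrincipal ↔
      C = (ClassGroup.mk0 ⟨𝔞.1, mem_nonZeroDivisors_of_ne_zero 𝔞.2⟩)⁻¹ := by
  rw [eq_comm, inv_eq_iff_mul_eq_one]
  conv_rhs => rw [← b.mk0_eq C]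
  rw [← map_mul, ClassGroup.mk0_eq_one_iff]
  rfl

variable (χ : HeckeChar K 𝔣) (S : Finset {w : InfinitePlace K // IsReal w})

theorem cpow_mul_coefSer {𝔟 : Ideal (𝓞 K)} (h𝔟 : 𝔟 ≠ ⊥) (z : ℂ) :
    (Ideal.absNorm 𝔟 : ℂ) ^ z * coefSer (unitIdeal 𝔟 h𝔟) S (heckePhi χ S 𝔟) z =
      ∑' 𝔞 : NzIdeal K, if (𝔞.1 * 𝔟).IsPrincipal then
        χ.hom 𝔞.1 * (Ideal.absNorm 𝔞.1 : ℂ) ^ (-z) else 0 := by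
  rw [coefSer, ← tsum_mul_left]
  refine tsum_congr fun 𝔞 => ?_
  rw [idealCoef_heckePhi, absNorm_unitIdeal]
  have hN : (0 : ℝ) < Ideal.absNorm 𝔟 := by
    exact_mod_cast NzIdeal.absNorm_pos ⟨𝔟, h𝔟⟩
  split_ifs with h
  · rw [Complex.ofReal_mul, Complex.mul_cpow_ofReal_nonneg (Nat.cast_nonneg _) hN.le,
      Complex.cpow_neg _ z, Complex.cpow_neg _ z]
    have h1 : ((Ideal.absNorm 𝔟 : ℝ) : ℂ) ^ z ≠ 0 := by
      rw [Ne, Complex.cpow_eq_zero_iff]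
      exact fun h => hN.ne' (by exact_mod_cast h.1)
    push_cast at h1 ⊢
    change _ * (χ.hom 𝔞.1 * _) = _
    field_simp
    rw [Complex.cpow_neg, div_eq_mul_inv]
  · rw [zero_mul, mul_zero]

theorem sum_classes (b : ClassFamily K) {z : ℂ} (hz : 1 < z.re) :
    ∑ C, (Ideal.absNorm (b.ideal C) : ℂ) ^ z *
      coefSer (unitIdeal (b.ideal C) (b.ne_bot C)) S (heckePhi χ S (b.ideal C)) z =
      idealSer χ.hom z := by
  have hsum := summable_norm_idealSer χ.norm_le_one hz
  simp_rw [cpow_mul_coefSer]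
  rw [← Summable.tsum_finsetSum fun C _ => ?_]
  · refine tsum_congr fun 𝔞 => ?_
    simp_rw [isPrincipal_mul_iff]
    rw [Finset.sum_ite_eq' Finset.univ, if_pos (Finset.mem_univ _)]
  · refine Summable.of_norm_bounded hsum fun 𝔞 => ?_
    split_ifs
    · exact le_rfl
    · rw [norm_zero]
      exact norm_nonneg _

/-- The inverse of the archimedean factor. -/
def invFac (z : ℂ) : ℂ := (gammaFac S z)⁻¹

omit [NumberField K] in
theorem gammaFac_const_ne_zero (w : InfinitePlace K) : (1 / (Real.pi * mult w : ℝ) : ℂ) ≠ 0 := by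
  have := mul_pos Real.pi_pos (mult_pos_real w)
  exact one_div_ne_zero (Complex.ofReal_ne_zero.2 this.ne')

theorem differentiable_invFac : Differentiable ℂ (invFac S) := by
  have h : invFac S = fun z => ∏ w : InfinitePlace K, (2 *
      ((1 / (Real.pi * mult w : ℝ) : ℂ) ^ (-(((placeExp S w : ℂ) + mult w * z) / 2)) *
      (Gamma (((placeExp S w : ℂ) + mult w * z) / 2))⁻¹)) := by
    ext z
    rw [invFac, gammaFac, ← Finset.prod_inv_distrib]
    refine Finset.prod_congr rfl fun w _ => ?_
    rw [mul_inv, mul_inv, Complex.cpow_neg]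
    norm_num
  rw [h]
  refine Differentiable.fun_finsetProd fun w _ => ?_
  refine (differentiable_const _).mul (Differentiable.mul ?_ ?_)
  · intro z
    exact DifferentiableAt.const_cpow (by fun_prop) (Or.inl (gammaFac_const_ne_zero w))
  · exact differentiable_one_div_Gamma.comp (by fun_prop)

theorem gammaFac_ne_zero {z : ℂ} (hz : 0 < z.re) : gammaFac S z ≠ 0 := by
  refine Finset.prod_ne_zero_iff.2 fun w _ => ?_
  refine mul_ne_zero (by norm_num) (mul_ne_zero ?_ (Gamma_ne_zero_of_re_pos ?_))
  · rw [Ne, Complex.cpow_eq_zero_iff]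
    exact fun h => gammaFac_const_ne_zero w h.1
  · simpa using half_pos (re_placeExp_pos S hz w)

theorem invFac_zero : invFac (∅ : Finset {w : InfinitePlace K // IsReal w}) 0 = 0 := by
  rw [invFac, gammaFac, inv_eq_zero]
  obtain ⟨w⟩ := (inferInstance : Nonempty (InfinitePlace K))
  refine Finset.prod_eq_zero (Finset.mem_univ w) ?_
  have : placeExp (∅ : Finset {w : InfinitePlace K // IsReal w}) w = 0 := by simp [placeExp]
  simp [this]

variable {D : Set (logSpace K)}

/-- The functional equation pair of a Hecke character and an ideal `𝔟`. -/
def heckePair (hb : Bornology.IsBounded D) (h𝔣 : 𝔣 ≠ ⊥)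
    (hS : ∀ κ : 𝓞 K, κ ≠ 0 → κ - 1 ∈ 𝔣 → χ.toFun (Ideal.span {κ}) = sgnS S (κ : K))
    {𝔟 : Ideal (𝓞 K)} (h𝔟 : 𝔟 ≠ ⊥) : WeakFEPair ℂ :=
  fePair hb (mul_ne_zero h𝔣 h𝔟) (thetaCoef_heckePhi χ S h𝔟)
    (thetaCoef_phiHat h𝔣 h𝔟 (thetaCoef_heckePhi χ S h𝔟) (heckePhi_add χ S h𝔣 hS h𝔟))
    (fun _ hα => heckePhi_eq_zero fun a _ h => hα ⟨a, h⟩) (heckePhi_add χ S h𝔣 hS h𝔟)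

end LFun

section LFun

open MeasureTheory Module
open scoped Classical nonZeroDivisors
open NumberField.mixedEmbedding NumberField.InfinitePlace NumberField.Units
open NumberField.Units.dirichletUnitTheorem

variable {K : Type*} [Field K] [NumberField K] {𝔣 : Ideal (𝓞 K)} (χ : HeckeChar K 𝔣)
  (S : Finset {w : InfinitePlace K // IsReal w}) (b : ClassFamily K) {D : Set (logSpace K)}
  (hb : Bornology.IsBounded D) (h𝔣 : 𝔣 ≠ ⊥)
  (hS : ∀ κ : 𝓞 K, κ ≠ 0 → κ - 1 ∈ 𝔣 → χ.toFun (Ideal.span {κ}) = sgnS S (κ : K))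

variable (K) in
/-- The constant relating the completed `L`-function to the theta integrals. -/
def heckeConst : ℂ := torsionOrder K * unitCoordConst K

variable (K) in
theorem heckeConst_ne_zero : heckeConst K ≠ 0 :=
  mul_ne_zero (Nat.cast_ne_zero.2 (torsionOrder_ne_zero K))
    (ofReal_ne_zero.2 unitCoordConst_pos.ne')

/-- The product of `z - 1` and the `L`-function of a Hecke character, as an entire function. -/
def heckeEntire (z : ℂ) : ℂ :=
  (heckeConst K)⁻¹ * (invFac S z * ∑ C, (Ideal.absNorm (b.ideal C) : ℂ) ^ z *
      ((z - 1) * (heckePair χ S hb h𝔣 hS (b.ne_bot C)).Λ₀ z +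
        (heckePair χ S hb h𝔣 hS (b.ne_bot C)).ε * (heckePair χ S hb h𝔣 hS (b.ne_bot C)).g₀) -
    (z - 1) * dslope (invFac S) 0 z * ∑ C, (Ideal.absNorm (b.ideal C) : ℂ) ^ z *
      (heckePair χ S hb h𝔣 hS (b.ne_bot C)).f₀)

theorem differentiable_absNorm_cpow {𝔟 : Ideal (𝓞 K)} (h𝔟 : 𝔟 ≠ ⊥) :
    Differentiable ℂ fun z : ℂ => (Ideal.absNorm 𝔟 : ℂ) ^ z := fun _ =>
  DifferentiableAt.const_cpow differentiableAt_id
    (Or.inl (Nat.cast_ne_zero.2 (Ideal.absNorm_eq_zero_iff.not.2 h𝔟)))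

theorem differentiable_heckeEntire : Differentiable ℂ (heckeEntire χ S b hb h𝔣 hS) := by
  have h1 : Differentiable ℂ (dslope (invFac S) 0) := differentiableOn_univ.1
    ((Complex.differentiableOn_dslope univ_mem).2 (differentiable_invFac S).differentiableOn)
  have h2 := differentiable_invFac S
  have h3 := fun C => differentiable_absNorm_cpow (b.ne_bot C)
  have h4 := fun C => (heckePair χ S hb h𝔣 hS (b.ne_bot C)).differentiable_Λ₀
  unfold heckeEntire
  fun_prop

theorem invFac_zero_mul (C : ClassGroup (𝓞 K)) :
    invFac S 0 * (heckePair χ S hb h𝔣 hS (b.ne_bot C)).f₀ = 0 := by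
  by_cases h : S = ∅
  · subst h
    rw [invFac_zero, zero_mul]
  · have : (heckePair χ S hb h𝔣 hS (b.ne_bot C)).f₀ = thetaIntZero D (heckePhi χ S (b.ideal C)) S :=
      rfl
    rw [this, thetaIntZero, thetaZero, if_neg h, smul_zero, mul_zero]

theorem heckeEntire_eq {z : ℂ} (h0 : z ≠ 0) (h1 : z ≠ 1) :
    heckeEntire χ S b hb h𝔣 hS z = (heckeConst K)⁻¹ * (invFac S z * (z - 1)) *
      ∑ C, (Ideal.absNorm (b.ideal C) : ℂ) ^ z * (heckePair χ S hb h𝔣 hS (b.ne_bot C)).Λ z := by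
  have alg : ∀ A i i₀ N Λ₀ f ε g : ℂ, i₀ * f = 0 →
      i * (N * ((z - 1) * Λ₀ + ε * g)) - (z - 1) * (z⁻¹ * (i - i₀)) * (N * f) =
      i * (z - 1) * (N * (Λ₀ - 1 / z * f - ε / (1 - z) * g)) := by
    intro A i i₀ N Λ₀ f ε g h
    have h2 : 1 - z ≠ 0 := sub_ne_zero.2 h1.symm
    field_simp
    linear_combination -(z - 1) ^ 2 * N * h
  rw [heckeEntire, mul_assoc (heckeConst K)⁻¹]
  congr 1
  rw [Finset.mul_sum, Finset.mul_sum, Finset.mul_sum, ← Finset.sum_sub_distrib]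
  refine Finset.sum_congr rfl fun C _ => ?_
  rw [dslope_of_ne _ h0, slope_def_field, sub_zero, div_eq_inv_mul]
  refine (alg 0 _ _ _ _ _ _ _ (invFac_zero_mul χ S b hb h𝔣 hS C)).trans ?_
  rw [WeakFEPair.Λ]
  have : ((heckePair χ S hb h𝔣 hS (b.ne_bot C)).k : ℂ) = 1 := ofReal_one
  rw [this]
  rfl

theorem heckeEntire_eq_idealSer (hD : IsAddFundamentalDomain (unitLattice K) D volume) {z : ℂ}
    (hz : 1 < z.re) : heckeEntire χ S b hb h𝔣 hS z = (z - 1) * idealSer χ.hom z := by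
  have h0 : z ≠ 0 := fun h => by simp [h] at hz; linarith
  have h1 : z ≠ 1 := fun h => by simp [h] at hz
  rw [heckeEntire_eq χ S b hb h𝔣 hS h0 h1, ← sum_classes χ S b hz, Finset.mul_sum, Finset.mul_sum]
  refine Finset.sum_congr rfl fun C _ => ?_
  have : (heckePair χ S hb h𝔣 hS (b.ne_bot C)).Λ z = _ := fePair_Λ _ _ _ _ _ _ hD hz
  rw [this]
  have hA := heckeConst_ne_zero K
  have hg := gammaFac_ne_zero S (zero_lt_one.trans hz)
  rw [heckeConst] at hA ⊢
  rw [invFac]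
  have alg : ∀ t u g N c : ℂ, t * u ≠ 0 → g ≠ 0 →
      (t * u)⁻¹ * (g⁻¹ * (z - 1)) * (N * (t * (u * g) * c)) = (z - 1) * (N * c) := by
    intro t u g N c h h'
    have ht := left_ne_zero_of_mul h
    have hu := right_ne_zero_of_mul h
    field_simp
  exact alg _ _ _ _ _ hA hg

theorem eq_of_generates_dualUnit {𝔞 : NzIdeal K} {C C' : ClassGroup (𝓞 K)} {α β : K}
    (hα : Generates (dualUnit (𝔣 * b.ideal C) (mul_ne_zero h𝔣 (b.ne_bot C))) 𝔞 α)
    (hβ : Generates (dualUnit (𝔣 * b.ideal C') (mul_ne_zero h𝔣 (b.ne_bot C'))) 𝔞 β) : C = C' := by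
  have key : ∀ {C : ClassGroup (𝓞 K)} {α : K},
      Generates (dualUnit (𝔣 * b.ideal C) (mul_ne_zero h𝔣 (b.ne_bot C))) 𝔞 α →
      FractionalIdeal.spanSingleton (𝓞 K)⁰ α * (b.ideal C : FractionalIdeal (𝓞 K)⁰ K) =
        𝔞.1 * ((differentIdeal ℤ (𝓞 K) * 𝔣 : Ideal (𝓞 K)) : FractionalIdeal (𝓞 K)⁰ K)⁻¹ := by
    intro C α h
    have h1 : (b.ideal C : FractionalIdeal (𝓞 K)⁰ K) ≠ 0 :=
      FractionalIdeal.coeIdeal_ne_zero.2 (b.ne_bot C)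
    rw [h, dualUnit, Units.val_inv_eq_inv_val, unitIdeal, Units.val_mk0, ← mul_assoc,
      FractionalIdeal.coeIdeal_mul, mul_inv, mul_assoc, mul_assoc, inv_mul_cancel₀ h1, mul_one]
  have h0 := hβ.ne_zero
  rw [← b.mk0_eq C, ← b.mk0_eq C', ClassGroup.mk0_eq_mk0_iff_exists_fraction_ring (K := K)]
  refine ⟨α / β, div_ne_zero hα.ne_zero h0, ?_⟩
  have h2 : FractionalIdeal.spanSingleton (𝓞 K)⁰ β ≠ 0 := by
    rwa [Ne, FractionalIdeal.spanSingleton_eq_zero_iff]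
  refine mul_left_cancel₀ h2 ?_
  rw [← mul_assoc, FractionalIdeal.spanSingleton_mul_spanSingleton, mul_div_cancel₀ _ h0]
  exact (key hα).trans (key hβ).symm

theorem norm_coefSer_le {J : (FractionalIdeal (𝓞 K)⁰ K)ˣ} {M : ℝ} {c : K → ℂ}
    (hc : ThetaCoef J S M c) {z : ℂ} (hz : 1 < z.re) :
    ‖coefSer J S c z‖ ≤ M * (FractionalIdeal.absNorm (J : FractionalIdeal (𝓞 K)⁰ K) : ℝ) ^ (-z.re) *
      ∑' 𝔞 : NzIdeal K, if ∃ α, Generates J 𝔞 α then (Ideal.absNorm 𝔞.1 : ℝ) ^ (-z.re) else 0 := by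
  have hs : Summable fun 𝔞 : NzIdeal K =>
      if ∃ α, Generates J 𝔞 α then (Ideal.absNorm 𝔞.1 : ℝ) ^ (-z.re) else 0 := by
    refine Summable.of_nonneg_of_le (fun 𝔞 => ?_) (fun 𝔞 => ?_) (summable_norm_rpow hz)
    · split_ifs <;> positivity
    · split_ifs
      · exact le_rfl
      · positivity
  rw [coefSer, ← tsum_mul_left]
  refine tsum_of_norm_bounded (hs.mul_left _).hasSum fun 𝔞 => ?_
  rw [norm_mul, norm_pow_neg]
  split_ifs with h
  · calc _ ≤ M * _ := mul_le_mul_of_nonneg_right (norm_idealCoef_le hc 𝔞)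
          (mul_nonneg (by positivity) (Real.rpow_nonneg (absNorm_unit_pos J).le _))
      _ = _ := by ring
  · rw [idealCoef, dif_neg h, norm_zero, zero_mul, mul_zero]

theorem sum_generates_le {σ : ℝ} (hσ : 1 < σ) :
    ∑ C, ∑' 𝔞 : NzIdeal K,
      (if ∃ α, Generates (dualUnit (𝔣 * b.ideal C) (mul_ne_zero h𝔣 (b.ne_bot C))) 𝔞 α then
        (Ideal.absNorm 𝔞.1 : ℝ) ^ (-σ) else 0) ≤ zetaR K σ := by
  have hs := summable_norm_rpow (K := K) hσ
  have hs' : ∀ C, Summable fun 𝔞 : NzIdeal K =>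
      (if ∃ α, Generates (dualUnit (𝔣 * b.ideal C) (mul_ne_zero h𝔣 (b.ne_bot C))) 𝔞 α then
        (Ideal.absNorm 𝔞.1 : ℝ) ^ (-σ) else 0) := by
    refine fun C => Summable.of_nonneg_of_le (fun 𝔞 => ?_) (fun 𝔞 => ?_) hs
    · split_ifs <;> positivity
    · split_ifs
      · exact le_rfl
      · positivity
  rw [← Summable.tsum_finsetSum fun C _ => hs' C]
  refine Summable.tsum_le_tsum (fun 𝔞 => ?_) (summable_sum fun C _ => hs' C) hs
  by_cases h : ∃ C, ∃ α, Generates (dualUnit (𝔣 * b.ideal C) (mul_ne_zero h𝔣 (b.ne_bot C))) 𝔞 α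
  · obtain ⟨C, α, hα⟩ := h
    rw [Finset.sum_eq_single C]
    · rw [if_pos ⟨α, hα⟩]
    · rintro C' - hC'
      rw [if_neg]
      rintro ⟨β, hβ⟩
      exact hC' (eq_of_generates_dualUnit b h𝔣 hβ hα)
    · exact fun h => (h (Finset.mem_univ C)).elim
  · rw [Finset.sum_eq_zero fun C _ => if_neg fun hC => h ⟨C, hC⟩]
    positivity

theorem norm_heckeEntire_left_le (hD : IsAddFundamentalDomain (unitLattice K) D volume) (y : ℝ) :
    ‖heckeEntire χ S b hb h𝔣 hS (-1 + y * I)‖ ≤ ‖(-2 + y * I : ℂ)‖ *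
      ‖gammaFac S (2 - y * I) * invFac S (-1 + y * I)‖ *
      ((DK K : ℝ) ^ (3 / 2 : ℝ) * (Ideal.absNorm 𝔣 : ℝ) ^ 2 * zetaR K 2) := by
  have h0 : (-1 + y * I : ℂ) ≠ 0 := fun h => by simpa using congrArg Complex.re h
  have h1 : (-1 + y * I : ℂ) ≠ 1 := fun h => by
    have := congrArg Complex.re h
    norm_num at this
  have hz : (2 - y * I : ℂ).re = 2 := by simp
  have hD0 : (0 : ℝ) < DK K := by exact_mod_cast Int.natAbs_pos.2 (NumberField.discr_ne_zero K)
  have hN𝔣 : (0 : ℝ) < Ideal.absNorm 𝔣 := by exact_mod_cast NzIdeal.absNorm_pos ⟨𝔣, h𝔣⟩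
  have term : ∀ C, ‖(Ideal.absNorm (b.ideal C) : ℂ) ^ (-1 + y * I : ℂ) *
      (heckePair χ S hb h𝔣 hS (b.ne_bot C)).Λ (-1 + y * I)‖ ≤
      ‖heckeConst K * gammaFac S (2 - y * I)‖ *
        ((DK K : ℝ) ^ (3 / 2 : ℝ) * (Ideal.absNorm 𝔣 : ℝ) ^ 2) *
      ∑' 𝔞 : NzIdeal K,
      (if ∃ α, Generates (dualUnit (𝔣 * b.ideal C) (mul_ne_zero h𝔣 (b.ne_bot C))) 𝔞 α then
        (Ideal.absNorm 𝔞.1 : ℝ) ^ (-2 : ℝ) else 0) := by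
    intro C
    have hN : (0 : ℝ) < Ideal.absNorm (b.ideal C) := by
      exact_mod_cast NzIdeal.absNorm_pos ⟨b.ideal C, b.ne_bot C⟩
    have e1 : (heckePair χ S hb h𝔣 hS (b.ne_bot C)).Λ (-1 + y * I) =
        (heckePair χ S hb h𝔣 hS (b.ne_bot C)).ε *
          (heckePair χ S hb h𝔣 hS (b.ne_bot C)).symm.Λ (2 - y * I) := by
      refine Eq.trans ?_ (WeakFEPair.functional_equation _ _)
      congr 1
      have : ((heckePair χ S hb h𝔣 hS (b.ne_bot C)).k : ℂ) = 1 := ofReal_one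
      rw [this]
      ring
    have e2 : (heckePair χ S hb h𝔣 hS (b.ne_bot C)).symm.Λ (2 - y * I) = _ :=
      fePair_symm_Λ _ _ _ _ _ _ hD (by rw [hz]; norm_num)
    have e3 : ‖(heckePair χ S hb h𝔣 hS (b.ne_bot C)).ε‖ =
        ((Ideal.absNorm (𝔣 * b.ideal C) : ℝ) * √(DK K))⁻¹ := by
      change ‖mixEps S * _‖ = _
      rw [norm_mul, norm_mixEps, one_mul, Complex.norm_real, Real.norm_of_nonneg (by positivity)]
    have e4 : ‖(Ideal.absNorm (b.ideal C) : ℂ) ^ (-1 + y * I : ℂ)‖ =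
        (Ideal.absNorm (b.ideal C) : ℝ)⁻¹ := by
      rw [norm_natCast_cpow_of_pos (by exact_mod_cast hN)]
      simp [Real.rpow_neg_one]
    have e5 := norm_coefSer_le S (thetaCoef_phiHat h𝔣 (b.ne_bot C) (thetaCoef_heckePhi χ S (b.ne_bot C))
      (heckePhi_add χ S h𝔣 hS (b.ne_bot C))) (z := 2 - y * I) (by rw [hz]; norm_num)
    rw [hz, absNorm_dualUnit, Real.inv_rpow (by positivity), Real.rpow_neg (by positivity), inv_inv,
      Real.rpow_two] at e5
    rw [e1, e2, norm_mul, norm_mul, e3, e4, ← mul_assoc _ _ (gammaFac S _), norm_mul]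
    refine (mul_le_mul_of_nonneg_left (mul_le_mul_of_nonneg_left
      (mul_le_mul_of_nonneg_left e5 (norm_nonneg _)) (by positivity)) (by positivity)).trans_eq ?_
    have hD1 : (DK K : ℝ) ^ (3 / 2 : ℝ) * √(DK K) = (DK K : ℝ) ^ 2 := by
      rw [Real.sqrt_eq_rpow, ← Real.rpow_add hD0]
      norm_num
    have hD2 : √(DK K : ℝ) ≠ 0 := (Real.sqrt_pos.2 hD0).ne'
    rw [map_mul, heckeConst]
    push_cast
    generalize (DK K : ℝ) ^ (3 / 2 : ℝ) = d at hD1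
    have alg : ∀ f n q A T D : ℝ, f ≠ 0 → n ≠ 0 → q ≠ 0 → d * q = D ^ 2 →
        n⁻¹ * ((f * n * q)⁻¹ * (A * (f * (D * (f * n)) ^ 2 * T))) = A * (d * f ^ 2) * T := by
      intro f n q A T D hf hn hq h
      field_simp
      linear_combination -A * T * h
    exact alg _ _ _ _ _ _ hN𝔣.ne' hN.ne' hD2 hD1
  have hsum := (norm_sum_le Finset.univ _).trans (Finset.sum_le_sum fun C _ => term C)
  rw [← Finset.mul_sum] at hsum
  have hsum' := hsum.trans (mul_le_mul_of_nonneg_left (sum_generates_le b h𝔣 one_lt_two)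
    (by positivity))
  rw [heckeEntire_eq χ S b hb h𝔣 hS h0 h1, norm_mul]
  refine (mul_le_mul_of_nonneg_left hsum' (norm_nonneg _)).trans_eq ?_
  have e : (-1 + y * I - 1 : ℂ) = -2 + y * I := by ring
  have hA := norm_ne_zero_iff.2 (heckeConst_ne_zero K)
  rw [e]
  simp only [norm_mul, norm_inv]
  field_simp

end LFun

section Growth

open MeasureTheory Set

theorem exists_norm_Λ₀_le (P : WeakFEPair ℂ) (a b : ℝ) :
    ∃ C, ∀ z : ℂ, a ≤ z.re → z.re ≤ b → ‖P.Λ₀ z‖ ≤ C := by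
  have hP := P.isStrongFEPair_toStrongFEPair
  have h1 : MellinConvergent P.f_modif a := (hP.hasMellin a).1
  have h2 : MellinConvergent P.f_modif b := (hP.hasMellin b).1
  refine ⟨_, fun z hz hz' => norm_integral_le_of_norm_le (h1.norm.add h2.norm) ?_⟩
  refine (ae_restrict_iff' measurableSet_Ioi).2 (ae_of_all _ fun t (ht : 0 < t) => ?_)
  simp only [Pi.add_apply, norm_smul, norm_cpow_eq_rpow_re_of_pos ht, sub_re, ofReal_re, one_re]
  rw [← add_mul]
  refine mul_le_mul_of_nonneg_right ?_ (norm_nonneg _)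
  rcases le_total t 1 with h | h
  · exact (Real.rpow_le_rpow_of_exponent_ge ht h (by linarith)).trans
      (le_add_of_nonneg_right (by positivity))
  · exact (Real.rpow_le_rpow_of_exponent_le h (by linarith)).trans
      (le_add_of_nonneg_left (by positivity))

theorem norm_sin_le (z : ℂ) : ‖sin z‖ ≤ Real.exp |z.im| := by
  rw [Complex.sin]
  have h1 : ‖cexp (-z * I)‖ ≤ Real.exp |z.im| := by
    rw [norm_exp]
    refine Real.exp_le_exp.2 ?_
    simpa using le_abs_self z.im
  have h2 : ‖cexp (z * I)‖ ≤ Real.exp |z.im| := by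
    rw [norm_exp]
    refine Real.exp_le_exp.2 ?_
    simpa using neg_le_abs z.im
  rw [norm_div, norm_mul, norm_I, mul_one, Complex.norm_ofNat]
  linarith [norm_sub_le (cexp (-z * I)) (cexp (z * I))]

theorem norm_Gamma_le {z : ℂ} (hz : 0 < z.re) : ‖Gamma z‖ ≤ Real.Gamma z.re := by
  rw [Gamma_eq_integral hz, GammaIntegral, Real.Gamma_eq_integral hz]
  refine norm_integral_le_of_norm_le (Real.GammaIntegral_convergent hz) ?_
  refine (ae_restrict_iff' measurableSet_Ioi).2 (ae_of_all _ fun t (ht : 0 < t) => ?_)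
  rw [norm_mul, norm_cpow_eq_rpow_re_of_pos ht, Complex.norm_real,
    Real.norm_of_nonneg (Real.exp_pos _).le]
  simp

theorem exists_norm_inv_Gamma_le : ∃ C, 0 ≤ C ∧ ∀ w : ℂ, -1 ≤ w.re → w.re ≤ 2 → 1 ≤ |w.im| →
    ‖(Gamma w)⁻¹‖ ≤ C * Real.exp (Real.pi * |w.im|) := by
  have hcont : ContinuousOn Real.Gamma (Set.Icc 1 4) := fun x hx =>
    (Real.differentiableAt_Gamma fun m => by
      have := hx.1
      have h : (0 : ℝ) ≤ m := Nat.cast_nonneg m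
      intro h'
      linarith).continuousAt.continuousWithinAt
  obtain ⟨C, hC⟩ := isCompact_Icc.exists_bound_of_continuousOn hcont
  have hC0 : 0 ≤ C := (norm_nonneg _).trans (hC 1 (by norm_num))
  refine ⟨C, hC0, fun w h1 h2 h3 => ?_⟩
  have e1 : ∀ x : ℝ, (x : ℂ) - w ≠ 0 := fun x h => by
    have := congrArg Complex.im h
    simp at this
    rw [this, abs_zero] at h3
    linarith
  have e2 : Gamma (3 - w) = (2 - w) * ((1 - w) * Gamma (1 - w)) := by
    have f1 := Gamma_add_one (2 - w) (by exact_mod_cast e1 2)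
    have f2 := Gamma_add_one (1 - w) (by exact_mod_cast e1 1)
    rw [show 1 - w + 1 = 2 - w by ring] at f2
    rw [show 2 - w + 1 = 3 - w by ring] at f1
    rw [f1, f2]
  have hn : ∀ x : ℝ, 1 ≤ ‖(x : ℂ) - w‖ := fun x =>
    h3.trans ((by simp : |w.im| = |((x : ℂ) - w).im|).trans_le (abs_im_le_norm _))
  have e3 : ‖Gamma (1 - w)‖ ≤ ‖Gamma (3 - w)‖ := by
    rw [e2, norm_mul, norm_mul, ← mul_assoc]
    refine le_mul_of_one_le_left (norm_nonneg _) (one_le_mul_of_one_le_of_one_le ?_ ?_)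
    · exact_mod_cast hn 2
    · exact_mod_cast hn 1
  have e4 : ‖Gamma (3 - w)‖ ≤ C := by
    have hre : (3 - w).re = 3 - w.re := by simp
    refine (norm_Gamma_le (by rw [hre]; linarith)).trans ?_
    rw [hre]
    exact (le_abs_self _).trans (hC _ ⟨by linarith, by linarith⟩)
  have e5 : (Gamma w)⁻¹ = Gamma (1 - w) * sin (Real.pi * w) / Real.pi := by
    have h := Gamma_mul_Gamma_one_sub w
    have hs : sin (Real.pi * w) ≠ 0 := by
      rw [Complex.sin_ne_zero_iff]
      intro k hk
      have := congrArg Complex.im hk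
      simp [Real.pi_ne_zero] at this
      rw [this, abs_zero] at h3
      linarith
    have hπ : (Real.pi : ℂ) ≠ 0 := ofReal_ne_zero.2 Real.pi_ne_zero
    have hG : Gamma w ≠ 0 := fun h' => by
      rw [h', zero_mul, eq_comm, div_eq_zero_iff] at h
      tauto
    rw [eq_div_iff hs] at h
    generalize sin (Real.pi * w) = s at h
    field_simp
    linear_combination -h
  rw [e5, norm_div, norm_mul, Complex.norm_real, Real.norm_of_nonneg Real.pi_pos.le]
  have e6 : ‖sin (Real.pi * w)‖ ≤ Real.exp (Real.pi * |w.im|) := by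
    refine (norm_sin_le _).trans_eq ?_
    simp [abs_mul, abs_of_pos Real.pi_pos]
  refine (div_le_self (by positivity) (by linarith [Real.pi_gt_three])).trans ?_
  exact mul_le_mul (e3.trans e4) e6 (norm_nonneg _) hC0

end Growth

section LFun

open MeasureTheory Module
open scoped Classical nonZeroDivisors
open NumberField.mixedEmbedding NumberField.InfinitePlace NumberField.Units
open NumberField.Units.dirichletUnitTheorem

variable {K : Type*} [Field K] [NumberField K] {𝔣 : Ideal (𝓞 K)} (χ : HeckeChar K 𝔣)
  (S : Finset {w : InfinitePlace K // IsReal w}) (b : ClassFamily K) {D : Set (logSpace K)}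
  (hb : Bornology.IsBounded D) (h𝔣 : 𝔣 ≠ ⊥)
  (hS : ∀ κ : 𝓞 K, κ ≠ 0 → κ - 1 ∈ 𝔣 → χ.toFun (Ideal.span {κ}) = sgnS S (κ : K))

omit [NumberField K] in
theorem re_gammaArg (w : InfinitePlace K) (z : ℂ) :
    (((placeExp S w : ℂ) + mult w * z) / 2).re = (placeExp S w + mult w * z.re) / 2 := by
  simp

omit [NumberField K] in
theorem im_gammaArg (w : InfinitePlace K) (z : ℂ) :
    (((placeExp S w : ℂ) + mult w * z) / 2).im = mult w * z.im / 2 := by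
  simp

omit [NumberField K] in
theorem placeExp_add_mult_le (w : InfinitePlace K) : placeExp S w + mult w ≤ 2 := by
  by_cases h : IsReal w
  · have := placeExp_le_one S w
    rw [mult, if_pos h]
    omega
  · rw [not_isReal_iff_isComplex] at h
    rw [placeExp_isComplex S h, mult]
    split_ifs <;> omega

theorem exists_norm_invFac_le : ∃ C B : ℝ, 0 ≤ C ∧ 0 ≤ B ∧ ∀ z : ℂ, -1 ≤ z.re → z.re ≤ 2 →
    2 ≤ |z.im| → ‖invFac S z‖ ≤ C * Real.exp (B * |z.im|) := by
  obtain ⟨C₀, hC₀, hΓ⟩ := exists_norm_inv_Gamma_le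
  let L : InfinitePlace K → ℝ := fun w => Real.exp (|Real.log (1 / (Real.pi * mult w))| * 2)
  refine ⟨∏ w : InfinitePlace K, 2 * (L w * C₀), ∑ w : InfinitePlace K, Real.pi * mult w / 2, ?_, ?_,
    fun z hz hz' hy => ?_⟩
  · exact Finset.prod_nonneg fun w _ => by positivity
  · exact Finset.sum_nonneg fun w _ => by positivity
  rw [Finset.sum_mul, Real.exp_sum, ← Finset.prod_mul_distrib, invFac, gammaFac,
    ← Finset.prod_inv_distrib, norm_prod]
  refine Finset.prod_le_prod (fun w _ => norm_nonneg _) fun w _ => ?_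
  have hm : (1 : ℝ) ≤ mult w := by exact_mod_cast one_le_mult
  have hp : (0 : ℝ) ≤ placeExp S w := Nat.cast_nonneg _
  have hpm : (placeExp S w : ℝ) + mult w ≤ 2 := by exact_mod_cast placeExp_add_mult_le S w
  have hc : 0 < 1 / (Real.pi * mult w : ℝ) := by positivity
  have hre1 : -1 ≤ ((placeExp S w : ℝ) + mult w * z.re) / 2 := by nlinarith
  have hre2 : ((placeExp S w : ℝ) + mult w * z.re) / 2 ≤ 2 := by nlinarith
  have h1 := hΓ (((placeExp S w : ℂ) + mult w * z) / 2) (by rw [re_gammaArg]; exact hre1)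
    (by rw [re_gammaArg]; exact hre2) (by
      rw [im_gammaArg, abs_div, abs_mul, Nat.abs_cast, abs_two]
      nlinarith)
  rw [im_gammaArg, abs_div, abs_mul, Nat.abs_cast, abs_two] at h1
  have h2 : ‖((1 / (Real.pi * mult w : ℝ) : ℂ) ^ (((placeExp S w : ℂ) + mult w * z) / 2))⁻¹‖ ≤
      L w := by
    have e : (1 / (Real.pi * mult w : ℝ) : ℂ) = ((1 / (Real.pi * mult w) : ℝ) : ℂ) := by push_cast; rfl
    rw [e, norm_inv, norm_cpow_eq_rpow_re_of_pos hc, re_gammaArg, Real.rpow_def_of_pos hc,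
      ← Real.exp_neg]
    refine Real.exp_le_exp.2 ((neg_le_abs _).trans ?_)
    rw [abs_mul]
    exact mul_le_mul_of_nonneg_left (abs_le.2 ⟨by linarith, hre2⟩) (abs_nonneg _)
  rw [mul_inv, mul_inv, norm_mul, norm_mul]
  have h3 := mul_le_mul h2 h1 (norm_nonneg _) (by positivity)
  have h4 : ‖(1 / 2 : ℂ)⁻¹‖ = 2 := by norm_num
  rw [h4]
  refine (mul_le_mul_of_nonneg_left h3 zero_le_two).trans_eq ?_
  rw [show Real.pi * (mult w * |z.im| / 2) = Real.pi * mult w / 2 * |z.im| by ring]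
  ring

theorem exists_norm_heckeEntire_le : ∃ C B : ℝ, 0 ≤ C ∧ 0 ≤ B ∧ ∀ z : ℂ, -1 ≤ z.re → z.re ≤ 2 →
    2 ≤ |z.im| → ‖heckeEntire χ S b hb h𝔣 hS z‖ ≤ C * Real.exp (B * |z.im|) := by
  obtain ⟨C, B, hC, hB, hinv⟩ := exists_norm_invFac_le S
  choose M hM using fun C => exists_norm_Λ₀_le (heckePair χ S hb h𝔣 hS (b.ne_bot C)) (-1) 2
  let P := fun C => heckePair χ S hb h𝔣 hS (b.ne_bot C)
  let T : ℝ := ∑ C, (Ideal.absNorm (b.ideal C) : ℝ) ^ (2 : ℝ) *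
    (|M C| + ‖(P C).ε * (P C).g₀‖ + ‖(P C).f₀‖)
  have hT : 0 ≤ T := Finset.sum_nonneg fun C _ => by positivity
  refine ⟨‖(heckeConst K)⁻¹‖ * ((C + ‖invFac S 0‖) * (2 * (2 * T))), B + 1, by positivity,
    by positivity, fun z hz hz' hy => ?_⟩
  have hinv' := hinv z hz hz' hy
  have hexp : 1 ≤ Real.exp (B * |z.im|) := Real.one_le_exp (by positivity)
  have hexp1 : 1 + |z.im| ≤ Real.exp |z.im| := by linarith [Real.add_one_le_exp |z.im|]
  have hz1 : ‖z - 1‖ ≤ 2 * Real.exp |z.im| := by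
    refine (norm_le_abs_re_add_abs_im _).trans ?_
    have : |(z - 1).re| ≤ 2 := by
      rw [sub_re, one_re]
      exact abs_le.2 ⟨by linarith, by linarith⟩
    rw [sub_im, one_im, sub_zero]
    linarith [abs_nonneg z.im]
  have hz0 : 1 ≤ ‖z‖ := by linarith [abs_im_le_norm z]
  have hne : z ≠ 0 := norm_ne_zero_iff.1 (by linarith)
  have hd : ‖dslope (invFac S) 0 z‖ ≤ (C + ‖invFac S 0‖) * Real.exp (B * |z.im|) := by
    rw [dslope_of_ne _ hne, slope_def_field, sub_zero, norm_div]
    refine (div_le_self (norm_nonneg _) hz0).trans ((norm_sub_le _ _).trans ?_)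
    nlinarith [norm_nonneg (invFac S 0)]
  have hi : ‖invFac S z‖ ≤ (C + ‖invFac S 0‖) * Real.exp (B * |z.im|) :=
    hinv'.trans (mul_le_mul_of_nonneg_right (le_add_of_nonneg_right (norm_nonneg _)) (by positivity))
  have hN : ∀ C, ‖(Ideal.absNorm (b.ideal C) : ℂ) ^ z‖ ≤
      (Ideal.absNorm (b.ideal C) : ℝ) ^ (2 : ℝ) := fun C => by
    have h : 0 < Ideal.absNorm (b.ideal C) := NzIdeal.absNorm_pos ⟨b.ideal C, b.ne_bot C⟩
    rw [norm_natCast_cpow_of_pos h]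
    exact Real.rpow_le_rpow_of_exponent_le (by exact_mod_cast h) hz'
  have hs1 : ‖∑ C, (Ideal.absNorm (b.ideal C) : ℂ) ^ z *
      ((z - 1) * (P C).Λ₀ z + (P C).ε * (P C).g₀)‖ ≤ 2 * Real.exp |z.im| * T := by
    rw [Finset.mul_sum]
    refine (norm_sum_le _ _).trans (Finset.sum_le_sum fun C _ => ?_)
    rw [norm_mul, mul_left_comm]
    refine mul_le_mul (hN C) ?_ (norm_nonneg _) (by positivity)
    have h1 : ‖(z - 1) * (P C).Λ₀ z‖ ≤ 2 * Real.exp |z.im| * |M C| := by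
      rw [norm_mul]
      exact mul_le_mul hz1 ((hM C z hz hz').trans (le_abs_self _)) (norm_nonneg _) (by positivity)
    have h2 := norm_add_le ((z - 1) * (P C).Λ₀ z) ((P C).ε * (P C).g₀)
    nlinarith [norm_nonneg ((P C).ε * (P C).g₀), norm_nonneg (P C).f₀, abs_nonneg z.im]
  have hs2 : ‖∑ C, (Ideal.absNorm (b.ideal C) : ℂ) ^ z * (P C).f₀‖ ≤ T := by
    refine (norm_sum_le _ _).trans (Finset.sum_le_sum fun C _ => ?_)
    rw [norm_mul]
    refine mul_le_mul (hN C) ?_ (norm_nonneg _) (by positivity)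
    exact le_add_of_nonneg_left (by positivity)
  have e : heckeEntire χ S b hb h𝔣 hS z = (heckeConst K)⁻¹ * (invFac S z *
      (∑ C, (Ideal.absNorm (b.ideal C) : ℂ) ^ z * ((z - 1) * (P C).Λ₀ z + (P C).ε * (P C).g₀)) -
      (z - 1) * dslope (invFac S) 0 z * ∑ C, (Ideal.absNorm (b.ideal C) : ℂ) ^ z * (P C).f₀) := rfl
  rw [e, norm_mul, add_mul B, Real.exp_add, one_mul, mul_assoc ‖(heckeConst K)⁻¹‖]
  refine mul_le_mul_of_nonneg_left ((norm_sub_le _ _).trans ?_) (norm_nonneg _)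
  rw [norm_mul, norm_mul, norm_mul (z - 1)]
  have k1 := mul_le_mul hi hs1 (norm_nonneg _) (by positivity)
  have k2 := mul_le_mul (mul_le_mul hz1 hd (norm_nonneg _) (by positivity)) hs2 (norm_nonneg _)
    (by positivity)
  linarith

end LFun

section LFun

open MeasureTheory Module
open scoped Classical nonZeroDivisors
open NumberField.mixedEmbedding NumberField.InfinitePlace NumberField.Units
open NumberField.Units.dirichletUnitTheorem

variable {K : Type*} [Field K] [NumberField K] {𝔣 : Ideal (𝓞 K)} (χ : HeckeChar K 𝔣)
  (S : Finset {w : InfinitePlace K // IsReal w})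

theorem phiHat_apply_zero {𝔪 : Ideal (𝓞 K)} (φ : K → ℂ) :
    phiHat 𝔪 φ 0 = ∑' x : 𝓞 K ⧸ 𝔪, φ (x.out : 𝓞 K) := by
  rw [phiHat, if_pos (FractionalIdeal.zero_mem _)]
  refine tsum_congr fun x => ?_
  rw [mul_zero, eTr]
  simp

theorem heckePhi_eq_mul {𝔟 𝔤 : Ideal (𝓞 K)} (h𝔟 : 𝔟 ≠ ⊥) (h𝔤 : 𝔤 ≠ ⊥) {α : 𝓞 K} (h : α ∈ 𝔤 * 𝔟) :
    heckePhi χ S 𝔟 α = χ.toFun 𝔤 * heckePhi χ S (𝔤 * 𝔟) α := by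
  obtain ⟨𝔠, h𝔠⟩ := exists_mul_eq_span h
  rw [heckePhi_eq (mul_ne_zero h𝔤 h𝔟) h𝔠, heckePhi_eq h𝔟 (𝔞 := 𝔠 * 𝔤) (by rw [mul_assoc, h𝔠]),
    χ.map_mul']
  ring

theorem phiHat_zero_eq_mul (h𝔣 : 𝔣 ≠ ⊥)
    (hS : ∀ κ : 𝓞 K, κ ≠ 0 → κ - 1 ∈ 𝔣 → χ.toFun (Ideal.span {κ}) = sgnS S (κ : K))
    {𝔟 𝔤 : Ideal (𝓞 K)} (h𝔟 : 𝔟 ≠ ⊥) (h𝔤 : 𝔤 ≠ ⊥) (hco : IsCoprime 𝔤 𝔣) :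
    phiHat (𝔣 * 𝔟) (heckePhi χ S 𝔟) 0 =
      χ.toFun 𝔤 * phiHat (𝔣 * (𝔤 * 𝔟)) (heckePhi χ S (𝔤 * 𝔟)) 0 := by
  have h𝔤𝔟 : 𝔤 * 𝔟 ≠ ⊥ := mul_ne_zero h𝔤 h𝔟
  have : Finite (𝓞 K ⧸ 𝔣 * 𝔟) := Ideal.finiteQuotientOfFreeOfNeBot _ (mul_ne_zero h𝔣 h𝔟)
  have : Finite (𝓞 K ⧸ 𝔣 * (𝔤 * 𝔟)) := Ideal.finiteQuotientOfFreeOfNeBot _ (mul_ne_zero h𝔣 h𝔤𝔟)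
  have := Fintype.ofFinite (𝓞 K ⧸ 𝔣 * 𝔟)
  have := Fintype.ofFinite (𝓞 K ⧸ 𝔣 * (𝔤 * 𝔟))
  have hper := heckePhi_add χ S h𝔣 hS h𝔟
  obtain ⟨g, hg, f, hf, hgf⟩ := Ideal.isCoprime_iff_exists.1 hco
  have hle : 𝔣 * (𝔤 * 𝔟) ≤ 𝔣 * 𝔟 := Ideal.mul_mono_right Ideal.mul_le_right
  have houtmem : ∀ {𝔪 : Ideal (𝓞 K)} (a : 𝓞 K), (Ideal.Quotient.mk 𝔪 a).out - a ∈ 𝔪 := fun a => by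
    rw [← Ideal.Quotient.eq]
    exact Quotient.out_eq _
  have hout : ∀ {𝔪 : Ideal (𝓞 K)} (x : 𝓞 K ⧸ 𝔪), Ideal.Quotient.mk 𝔪 x.out = x := fun x =>
    Quotient.out_eq x
  have hzero : ∀ {𝔠 : Ideal (𝓞 K)} {α : 𝓞 K}, α ∉ 𝔠 → heckePhi χ S 𝔠 α = 0 := fun h =>
    heckePhi_eq_zero fun β hβ hβα => h (RingOfIntegers.coe_injective hβα ▸ hβ)
  rw [phiHat_apply_zero, phiHat_apply_zero, tsum_fintype, tsum_fintype, Finset.mul_sum,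
    ← Finset.sum_filter_of_ne (p := fun x : 𝓞 K ⧸ 𝔣 * (𝔤 * 𝔟) => x.out ∈ 𝔤 * 𝔟) (s := Finset.univ)
      fun x _ hx => by
        by_contra h
        exact hx (by rw [hzero h, mul_zero])]
  symm
  refine Finset.sum_of_injOn (Ideal.Quotient.factor hle) ?_ (fun _ _ => Finset.mem_coe.2 (Finset.mem_univ _)) ?_ ?_
  · intro x hx y hy hxy
    have hx' : x.out ∈ 𝔤 * 𝔟 := by simpa using hx
    have hy' : y.out ∈ 𝔤 * 𝔟 := by simpa using hy
    rw [← hout x, ← hout y] at hxy ⊢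
    rw [Ideal.Quotient.factor_mk, Ideal.Quotient.factor_mk, Ideal.Quotient.eq] at hxy
    rw [Ideal.Quotient.eq]
    have e : x.out - y.out = f * (x.out - y.out) + g * (x.out - y.out) := by
      linear_combination (y.out - x.out) * hgf
    rw [e]
    refine Ideal.add_mem _ (Ideal.mul_mem_mul hf (Ideal.sub_mem _ hx' hy')) ?_
    have h := Ideal.mul_mem_mul hg hxy
    have h' : 𝔤 * (𝔣 * 𝔟) = 𝔣 * (𝔤 * 𝔟) := mul_left_comm _ _ _
    exact h'.le h
  · intro y _ hy
    by_contra h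
    have hyb : y.out ∈ 𝔟 := by
      by_contra h'
      exact h (hzero h')
    refine hy ⟨Ideal.Quotient.mk _ (g * y.out), ?_, ?_⟩
    · have h1 := Ideal.add_mem _ (Ideal.mul_le_right (houtmem (𝔪 := 𝔣 * (𝔤 * 𝔟)) (g * y.out)))
        (Ideal.mul_mem_mul hg hyb)
      rw [sub_add_cancel] at h1
      simpa using h1
    · rw [Ideal.Quotient.factor_mk]
      refine Eq.trans ?_ (hout y)
      rw [Ideal.Quotient.eq, ← neg_mem_iff]
      have e : -(g * y.out - y.out) = f * y.out := by linear_combination -y.out * hgf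
      rw [e]
      exact Ideal.mul_mem_mul hf hyb
  · intro x hx
    have hx' : x.out ∈ 𝔤 * 𝔟 := by simpa using hx
    rw [← heckePhi_eq_mul χ S h𝔟 h𝔤 hx', ← apply_out hper]
    congr 3
    rw [← Ideal.Quotient.factor_mk hle, hout]

/-- Multiplying all the ideals of a family by a fixed ideal. -/
def ClassFamily.mul (b : ClassFamily K) {𝔤 : Ideal (𝓞 K)} (h𝔤 : 𝔤 ≠ ⊥) : ClassFamily K where
  ideal C := 𝔤 * b.ideal ((ClassGroup.mk0 ⟨𝔤, mem_nonZeroDivisors_of_ne_zero h𝔤⟩)⁻¹ * C)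
  ne_bot C := mul_ne_zero h𝔤 (b.ne_bot _)
  mk0_eq C := by
    have h : (⟨𝔤 * b.ideal ((ClassGroup.mk0 ⟨𝔤, mem_nonZeroDivisors_of_ne_zero h𝔤⟩)⁻¹ * C),
        mem_nonZeroDivisors_of_ne_zero (mul_ne_zero h𝔤 (b.ne_bot _))⟩ : (Ideal (𝓞 K))⁰) =
        ⟨𝔤, mem_nonZeroDivisors_of_ne_zero h𝔤⟩ * ⟨_, mem_nonZeroDivisors_of_ne_zero (b.ne_bot _)⟩ :=
      rfl
    rw [h, map_mul, b.mk0_eq, mul_inv_cancel_left]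

variable (b : ClassFamily K) {D : Set (logSpace K)}
  (hb : Bornology.IsBounded D) (h𝔣 : 𝔣 ≠ ⊥)
  (hS : ∀ κ : 𝓞 K, κ ≠ 0 → κ - 1 ∈ 𝔣 → χ.toFun (Ideal.span {κ}) = sgnS S (κ : K))

theorem heckeEntire_family (b' : ClassFamily K)
    (hD : IsAddFundamentalDomain (unitLattice K) D volume) (z : ℂ) (hz : 1 ≤ z.re) :
    heckeEntire χ S b hb h𝔣 hS z = heckeEntire χ S b' hb h𝔣 hS z := by
  have h : Set.EqOn (heckeEntire χ S b hb h𝔣 hS) (heckeEntire χ S b' hb h𝔣 hS) {z | 1 < z.re} :=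
    fun z hz => by
      rw [heckeEntire_eq_idealSer χ S b hb h𝔣 hS hD hz, heckeEntire_eq_idealSer χ S b' hb h𝔣 hS hD hz]
  refine h.closure (differentiable_heckeEntire χ S b hb h𝔣 hS).continuous
    (differentiable_heckeEntire χ S b' hb h𝔣 hS).continuous ?_
  rw [closure_setOfPred_lt_re]
  exact hz

theorem heckeEntire_one :
    heckeEntire χ S b hb h𝔣 hS 1 = (heckeConst K)⁻¹ * invFac S 1 * mixEps S *
      (((Ideal.absNorm 𝔣 * √(DK K))⁻¹ * volume.real (-D) : ℝ) : ℂ) *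
      if S = ∅ then ∑ C, phiHat (𝔣 * b.ideal C) (heckePhi χ S (b.ideal C)) 0 else 0 := by
  have hterm : ∀ C, (Ideal.absNorm (b.ideal C) : ℂ) ^ (1 : ℂ) *
      ((1 - 1) * (heckePair χ S hb h𝔣 hS (b.ne_bot C)).Λ₀ 1 +
        (heckePair χ S hb h𝔣 hS (b.ne_bot C)).ε * (heckePair χ S hb h𝔣 hS (b.ne_bot C)).g₀) =
      mixEps S * (((Ideal.absNorm 𝔣 * √(DK K))⁻¹ * volume.real (-D) : ℝ) : ℂ) *
      if S = ∅ then phiHat (𝔣 * b.ideal C) (heckePhi χ S (b.ideal C)) 0 else 0 := fun C => by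
    have h1 : (heckePair χ S hb h𝔣 hS (b.ne_bot C)).ε =
      mixEps S * (((Ideal.absNorm (𝔣 * b.ideal C) : ℝ) * √(DK K))⁻¹ : ℝ) := rfl
    have h2 : (heckePair χ S hb h𝔣 hS (b.ne_bot C)).g₀ = volume.real (-D) •
      if S = ∅ then phiHat (𝔣 * b.ideal C) (heckePhi χ S (b.ideal C)) 0 else 0 := rfl
    have hN : (Ideal.absNorm (b.ideal C) : ℂ) ≠ 0 :=
      Nat.cast_ne_zero.2 (Ideal.absNorm_eq_zero_iff.not.2 (b.ne_bot C))
    rw [h1, h2, cpow_one, sub_self, zero_mul, zero_add, map_mul, real_smul]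
    generalize (if S = ∅ then phiHat (𝔣 * b.ideal C) (heckePhi χ S (b.ideal C)) 0 else 0) = T
    push_cast
    rw [mul_inv, mul_inv, mul_inv]
    field_simp
  rw [heckeEntire]
  simp_rw [hterm]
  rw [← Finset.mul_sum, sub_self, zero_mul, zero_mul, sub_zero]
  split_ifs
  · ring
  · simp

theorem heckeEntire_one_eq_zero (hD : IsAddFundamentalDomain (unitLattice K) D volume)
    {𝔤 : Ideal (𝓞 K)} (h𝔤 : 𝔤 ≠ ⊥) (hco : IsCoprime 𝔤 𝔣) (hχ : χ.toFun 𝔤 ≠ 1) :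
    heckeEntire χ S b hb h𝔣 hS 1 = 0 := by
  have h1 := heckeEntire_family χ S b hb h𝔣 hS (b.mul h𝔤) hD 1 le_rfl
  rw [heckeEntire_one, heckeEntire_one] at h1
  rw [heckeEntire_one]
  have hsum : ∑ C, phiHat (𝔣 * b.ideal C) (heckePhi χ S (b.ideal C)) 0 =
      χ.toFun 𝔤 * ∑ C, phiHat (𝔣 * (b.mul h𝔤).ideal C) (heckePhi χ S ((b.mul h𝔤).ideal C)) 0 := by
    rw [Finset.mul_sum, ← Equiv.sum_comp (Equiv.mulLeft
      (ClassGroup.mk0 ⟨𝔤, mem_nonZeroDivisors_of_ne_zero h𝔤⟩)⁻¹)]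
    exact Finset.sum_congr rfl fun C _ => phiHat_zero_eq_mul χ S h𝔣 hS (b.ne_bot _) h𝔤 hco
  split_ifs at h1 ⊢ with h
  · rw [hsum] at h1 ⊢
    generalize (∑ C, phiHat (𝔣 * (b.mul h𝔤).ideal C) (heckePhi χ S ((b.mul h𝔤).ideal C)) 0) = T
      at h1 ⊢
    rw [mul_left_comm] at h1 ⊢
    rw [← sub_eq_zero, ← sub_one_mul, mul_eq_zero, sub_eq_zero] at h1
    rw [h1.resolve_left hχ, mul_zero]
  · rw [mul_zero]

end LFun

section Gam

theorem norm_Gamma_conj (z : ℂ) : ‖Gamma ((starRingEnd ℂ) z)‖ = ‖Gamma z‖ := by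
  rw [Gamma_conj, Complex.norm_conj]

theorem norm_Gamma_half_sq (u : ℝ) :
    ‖Gamma (1 / 2 + u * I)‖ ^ 2 * Real.cosh (Real.pi * u) = Real.pi := by
  have h := Complex.Gamma_mul_Gamma_one_sub (1 / 2 + u * I)
  have h1 : (1 : ℂ) - (1 / 2 + u * I) = (starRingEnd ℂ) (1 / 2 + u * I) := by
    apply Complex.ext <;> simp; norm_num
  have h2 : sin (Real.pi * (1 / 2 + u * I)) = (Real.cosh (Real.pi * u) : ℂ) := by
    rw [show (Real.pi : ℂ) * (1 / 2 + u * I) = (Real.pi * u) * I + Real.pi / 2 by ring,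
      Complex.sin_add_pi_div_two, Complex.cos_mul_I]
    push_cast
    rfl
  rw [h1, h2] at h
  have h3 := congrArg norm h
  rw [norm_mul, norm_Gamma_conj, norm_div, Complex.norm_real, Complex.norm_real,
    Real.norm_of_nonneg Real.pi_pos.le, Real.norm_of_nonneg (Real.cosh_pos _).le] at h3
  rw [sq, h3, div_mul_cancel₀ _ (Real.cosh_pos _).ne']

theorem norm_Gamma_one_sq (u : ℝ) :
    ‖Gamma (1 + u * I)‖ ^ 2 * Real.sinh (Real.pi * u) = Real.pi * u := by
  rcases eq_or_ne u 0 with rfl | hu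
  · simp
  have hz : (u : ℂ) * I ≠ 0 := mul_ne_zero (ofReal_ne_zero.2 hu) I_ne_zero
  have h := Complex.Gamma_mul_Gamma_one_sub (u * I)
  have h1 : (1 : ℂ) - u * I = (starRingEnd ℂ) (1 + u * I) := by
    apply Complex.ext <;> simp
  have h2 : sin (Real.pi * (u * I)) = (Real.sinh (Real.pi * u) : ℂ) * I := by
    rw [← mul_assoc, Complex.sin_mul_I]
    push_cast
    rfl
  have hs : Real.sinh (Real.pi * u) ≠ 0 :=
    Real.sinh_ne_zero.2 (mul_ne_zero Real.pi_ne_zero hu)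
  have h3 : Gamma (1 + u * I) * Gamma ((starRingEnd ℂ) (1 + u * I)) =
      ((Real.pi * u / Real.sinh (Real.pi * u) : ℝ) : ℂ) := by
    rw [add_comm, Complex.Gamma_add_one _ hz, add_comm, mul_assoc, ← h1, h, h2]
    have hs' : (Real.sinh (Real.pi * u) : ℂ) ≠ 0 := ofReal_ne_zero.2 hs
    rw [ofReal_div, ofReal_mul]
    field_simp
  rw [Gamma_conj, Complex.mul_conj, Complex.normSq_eq_norm_sq, ofReal_inj] at h3
  rw [h3, div_mul_cancel₀ _ hs]

theorem norm_Gamma_half_sq_pos (u : ℝ) : 0 < ‖Gamma (1 / 2 + u * I)‖ ^ 2 := by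
  have h := norm_Gamma_half_sq u
  by_contra hc
  have h0 : ‖Gamma (1 / 2 + u * I)‖ ^ 2 = 0 := le_antisymm (not_lt.1 hc) (sq_nonneg _)
  rw [h0, zero_mul] at h
  exact Real.pi_ne_zero h.symm

theorem norm_Gamma_one_ratio (u : ℝ) :
    ‖Gamma (1 + u * I)‖ ^ 2 ≤ (1 / 2 + |u|) * ‖Gamma (1 / 2 + u * I)‖ ^ 2 := by
  wlog hu : 0 ≤ u generalizing u
  · have h := this (-u) (by linarith)
    rw [abs_neg] at h
    have e1 : (1 : ℂ) + (-u : ℝ) * I = (starRingEnd ℂ) (1 + u * I) := by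
      apply Complex.ext <;> simp
    have e2 : (1 / 2 : ℂ) + (-u : ℝ) * I = (starRingEnd ℂ) (1 / 2 + u * I) := by
      apply Complex.ext <;> simp
    rwa [e1, e2, norm_Gamma_conj, norm_Gamma_conj] at h
  rw [abs_of_nonneg hu]
  have h1 := norm_Gamma_half_sq u
  rcases hu.eq_or_lt with rfl | hu
  · simp only [mul_zero, Real.cosh_zero, mul_one] at h1
    rw [h1]
    simp only [ofReal_zero, zero_mul, add_zero, Gamma_one, norm_one]
    nlinarith [Real.pi_gt_three]
  have h2 := norm_Gamma_one_sq u
  have hx : 0 < Real.pi * u := mul_pos Real.pi_pos hu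
  have hs : 0 < Real.sinh (Real.pi * u) := Real.sinh_pos_iff.2 hx
  have hsx : Real.pi * u ≤ Real.sinh (Real.pi * u) := Real.self_le_sinh_iff.2 hx.le
  have he : Real.cosh (Real.pi * u) - Real.sinh (Real.pi * u) ≤ 1 := by
    rw [Real.cosh_sub_sinh]
    exact Real.exp_le_one_iff.2 (by linarith)
  have hG := norm_Gamma_half_sq_pos u
  generalize ‖Gamma (1 + u * I)‖ ^ 2 = A at *
  generalize ‖Gamma (1 / 2 + u * I)‖ ^ 2 = B at *
  refine le_of_mul_le_mul_right ?_ hs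
  have h3 : u * Real.cosh (Real.pi * u) ≤ (1 / 2 + u) * Real.sinh (Real.pi * u) := by
    nlinarith [Real.pi_gt_three]
  calc A * Real.sinh (Real.pi * u) = B * (u * Real.cosh (Real.pi * u)) := by
        rw [h2, mul_left_comm, h1, mul_comm]
    _ ≤ B * ((1 / 2 + u) * Real.sinh (Real.pi * u)) := mul_le_mul_of_nonneg_left h3 hG.le
    _ = (1 / 2 + u) * B * Real.sinh (Real.pi * u) := by ring

theorem norm_Gamma_half_ratio (u : ℝ) :
    |u| * ‖Gamma (1 / 2 + u * I)‖ ^ 2 ≤ ‖Gamma (1 + u * I)‖ ^ 2 := by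
  wlog hu : 0 ≤ u generalizing u
  · have h := this (-u) (by linarith)
    rw [abs_neg] at h
    have e1 : (1 : ℂ) + (-u : ℝ) * I = (starRingEnd ℂ) (1 + u * I) := by
      apply Complex.ext <;> simp
    have e2 : (1 / 2 : ℂ) + (-u : ℝ) * I = (starRingEnd ℂ) (1 / 2 + u * I) := by
      apply Complex.ext <;> simp
    rwa [e1, e2, norm_Gamma_conj, norm_Gamma_conj] at h
  rw [abs_of_nonneg hu]
  rcases hu.eq_or_lt with rfl | hu
  · rw [zero_mul]; positivity
  have h1 := norm_Gamma_half_sq u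
  have h2 := norm_Gamma_one_sq u
  have hx : 0 < Real.pi * u := mul_pos Real.pi_pos hu
  have hs : 0 < Real.sinh (Real.pi * u) := Real.sinh_pos_iff.2 hx
  have hsc : Real.sinh (Real.pi * u) ≤ Real.cosh (Real.pi * u) := (Real.sinh_lt_cosh _).le
  have hG := norm_Gamma_half_sq_pos u
  generalize ‖Gamma (1 + u * I)‖ ^ 2 = A at *
  generalize ‖Gamma (1 / 2 + u * I)‖ ^ 2 = B at *
  refine le_of_mul_le_mul_right ?_ hs
  calc u * B * Real.sinh (Real.pi * u) ≤ u * B * Real.cosh (Real.pi * u) :=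
        mul_le_mul_of_nonneg_left hsc (mul_nonneg hu.le hG.le)
    _ = A * Real.sinh (Real.pi * u) := by rw [h2, mul_assoc, h1, mul_comm]

theorem inv_Gamma_eq (s : ℂ) : (Gamma s)⁻¹ = s * (Gamma (s + 1))⁻¹ := by
  have := Complex.one_div_Gamma_eq_self_mul_one_div_Gamma_add_one s
  simpa only [one_div] using this

/-- The quotient of gamma factors at a complex place. -/
theorem norm_Gamma_quot_complex (y : ℝ) :
    ‖Gamma (2 - y * I)‖ * ‖(Gamma (-1 + y * I))⁻¹‖ ≤ (1 + |y|) ^ 3 := by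
  have e : (2 : ℂ) - y * I = (starRingEnd ℂ) (2 + y * I) := by
    apply Complex.ext <;> simp
  have hz : Gamma (2 + y * I) ≠ 0 := Complex.Gamma_ne_zero_of_re_pos (by simp)
  rw [inv_Gamma_eq (-1 + y * I), inv_Gamma_eq (-1 + y * I + 1), inv_Gamma_eq (-1 + y * I + 1 + 1),
    show (-1 : ℂ) + y * I + 1 + 1 + 1 = 2 + y * I by ring, e, norm_Gamma_conj, norm_mul, norm_mul,
    norm_mul, norm_inv]
  have hn : ∀ c : ℂ, ‖c‖ ≤ 1 → ‖c + y * I‖ ≤ 1 + |y| := fun c hc =>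
    (norm_add_le _ _).trans (by simpa using hc)
  have h1 := hn (-1) (by simp)
  have h2 := hn 0 (by simp)
  have h3 := hn 1 (by simp)
  rw [show (-1 : ℂ) + y * I + 1 = 0 + y * I by ring, show (0 : ℂ) + y * I + 1 = 1 + y * I by ring]
  rw [show ∀ a b c g : ℝ, g * (a * (b * (c * g⁻¹))) = g * g⁻¹ * (a * b * c) by intros; ring,
    mul_inv_cancel₀ (norm_ne_zero_iff.2 hz), one_mul, pow_three, ← mul_assoc]
  gcongr

theorem norm_half_add_sq_le (u : ℝ) : (1 / 4 + u ^ 2 : ℝ) ≤ (1 / 2 + |u|) ^ 2 := by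
  nlinarith [abs_nonneg u, sq_abs u]

/-- The quotient of gamma factors at an unramified real place. -/
theorem norm_Gamma_quot_even (u : ℝ) :
    (‖Gamma (1 - u * I)‖ * ‖(Gamma (-(1 / 2) + u * I))⁻¹‖) ^ 2 ≤ (1 / 2 + |u|) ^ 3 := by
  have e : (1 : ℂ) - u * I = (starRingEnd ℂ) (1 + u * I) := by
    apply Complex.ext <;> simp
  have hq : ‖-(1 / 2 : ℂ) + u * I‖ ^ 2 = 1 / 4 + u ^ 2 := by
    rw [← Complex.normSq_eq_norm_sq, Complex.normSq_apply]
    simp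
    ring
  rw [inv_Gamma_eq (-(1 / 2) + u * I), show -(1 / 2 : ℂ) + u * I + 1 = 1 / 2 + u * I by ring, e,
    norm_Gamma_conj, norm_mul, norm_inv, mul_pow, mul_pow, hq, inv_pow]
  have hG := norm_Gamma_half_sq_pos u
  have h1 := norm_Gamma_one_ratio u
  have h2 := norm_half_add_sq_le u
  generalize ‖Gamma (1 + u * I)‖ ^ 2 = A at *
  generalize ‖Gamma (1 / 2 + u * I)‖ ^ 2 = B at *
  have hp : 0 ≤ 1 / 2 + |u| := by positivity
  calc A * ((1 / 4 + u ^ 2) * B⁻¹) ≤ (1 / 2 + |u|) * B * ((1 / 2 + |u|) ^ 2 * B⁻¹) := by gcongr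
    _ = (1 / 2 + |u|) ^ 3 := by field_simp

/-- The quotient of gamma factors at a ramified real place. -/
theorem norm_Gamma_quot_odd (u : ℝ) :
    (‖Gamma (3 / 2 - u * I)‖ * ‖(Gamma (u * I))⁻¹‖) ^ 2 ≤ (1 / 2 + |u|) ^ 3 := by
  have e : (3 / 2 : ℂ) - u * I = (starRingEnd ℂ) (3 / 2 + u * I) := by
    rw [map_add, map_mul, conj_ofReal, conj_I, map_div₀, map_ofNat, map_ofNat]
    ring
  have hq : ‖(1 / 2 : ℂ) + u * I‖ ^ 2 = 1 / 4 + u ^ 2 := by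
    rw [← Complex.normSq_eq_norm_sq, Complex.normSq_apply]
    simp
    ring
  have hne : (1 / 2 : ℂ) + u * I ≠ 0 := fun h => by simpa using congrArg re h
  have hu : ‖(u : ℂ) * I‖ ^ 2 = |u| ^ 2 := by simp
  have hG' : 0 < ‖Gamma (1 + u * I)‖ ^ 2 :=
    pow_pos (norm_pos_iff.2 (Complex.Gamma_ne_zero_of_re_pos (by simp))) 2
  rw [inv_Gamma_eq (u * I), e, norm_Gamma_conj,
    show (3 / 2 : ℂ) + u * I = 1 / 2 + u * I + 1 by ring, Complex.Gamma_add_one _ hne, norm_mul,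
    norm_mul, norm_inv, mul_pow, mul_pow, mul_pow, hq, inv_pow, hu, add_comm _ (1 : ℂ)]
  have hB := norm_Gamma_half_sq_pos u
  have h1 := norm_Gamma_half_ratio u
  have h2 := norm_half_add_sq_le u
  generalize ‖Gamma (1 + u * I)‖ ^ 2 = A at *
  generalize ‖Gamma (1 / 2 + u * I)‖ ^ 2 = B at *
  have hp : 0 ≤ |u| := abs_nonneg u
  calc (1 / 4 + u ^ 2) * B * (|u| ^ 2 * A⁻¹) = (1 / 4 + u ^ 2) * |u| * (|u| * B) * A⁻¹ := by ring
    _ ≤ (1 / 2 + |u|) ^ 2 * (1 / 2 + |u|) * A * A⁻¹ := by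
      refine mul_le_mul_of_nonneg_right ?_ (inv_nonneg.2 hG'.le)
      exact mul_le_mul (mul_le_mul h2 (by linarith) hp (by positivity)) h1 (mul_nonneg hp hB.le)
        (by positivity)
    _ = (1 / 2 + |u|) ^ 3 := by field_simp

end Gam

section Gam

open NumberField.InfinitePlace

theorem le_rpow_of_sq_le_cube {x b : ℝ} (hb : 0 ≤ b) (h : x ^ 2 ≤ b ^ 3) :
    x ≤ b ^ (3 / 2 : ℝ) := by
  have h1 : (b ^ (3 / 2 : ℝ)) ^ 2 = b ^ 3 := by
    rw [← Real.rpow_natCast, ← Real.rpow_mul hb, ← Real.rpow_natCast]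
    norm_num
  exact le_of_sq_le_sq (h1 ▸ h) (Real.rpow_nonneg hb _)

variable {K : Type*} [Field K] [NumberField K] (S : Finset {w : InfinitePlace K // IsReal w})

omit [NumberField K] in
theorem norm_Gamma_quot_le (w : InfinitePlace K) (y : ℝ) :
    ‖Gamma (((placeExp S w : ℂ) + mult w * (2 - y * I)) / 2)‖ *
      ‖(Gamma (((placeExp S w : ℂ) + mult w * (-1 + y * I)) / 2))⁻¹‖ ≤
      (mult w * (1 + |y|) / 2) ^ (3 / 2 * mult w : ℝ) := by
  rcases isReal_or_isComplex w with hw | hw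
  · have hm : mult w = 1 := by rw [mult, if_pos hw]
    have hb : (1 / 2 + |y / 2|) = (1 * (1 + |y|) / 2 : ℝ) := by
      rw [abs_div, abs_two]; ring
    rw [hm]
    push_cast
    rw [mul_one, ← hb]
    refine le_rpow_of_sq_le_cube (by positivity) ?_
    rcases Nat.le_one_iff_eq_zero_or_eq_one.1 (placeExp_le_one S w) with h | h
    · rw [h]
      convert norm_Gamma_quot_even (y / 2) using 5 <;> push_cast <;> ring_nf
    · rw [h]
      convert norm_Gamma_quot_odd (y / 2) using 5 <;> push_cast <;> ring_nf
  · have hm : mult w = 2 := by rw [mult, if_neg (not_isReal_iff_isComplex.2 hw)]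
    rw [hm, placeExp_isComplex S hw]
    have h := norm_Gamma_quot_complex y
    convert h using 1
    · congr 4 <;> push_cast <;> ring_nf
    · push_cast
      rw [show (3 / 2 * 2 : ℝ) = (3 : ℕ) by norm_num, Real.rpow_natCast]
      ring

theorem norm_gammaFac_mul_invFac_le (y : ℝ) :
    ‖gammaFac S (2 - y * I) * invFac S (-1 + y * I)‖ ≤
      ((1 + |y|) / (2 * Real.pi)) ^ (3 / 2 * nK K : ℝ) := by
  have hp : (0 : ℝ) < (1 + |y|) / (2 * Real.pi) := by positivity
  rw [invFac, gammaFac, gammaFac, ← Finset.prod_inv_distrib, ← Finset.prod_mul_distrib, norm_prod,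
    ← sum_mult_eq_nK, Finset.mul_sum, Real.rpow_sum_of_pos hp]
  refine Finset.prod_le_prod (fun w _ => norm_nonneg _) fun w _ => ?_
  have hm := mult_pos_real w
  have hc : (0 : ℝ) < 1 / (Real.pi * mult w) := by positivity
  have hcp : ∀ z : ℂ, ‖(1 / (Real.pi * mult w : ℝ) : ℂ) ^ z‖ = (1 / (Real.pi * mult w)) ^ z.re :=
    fun z => by
      rw [← ofReal_one, ← ofReal_div, norm_cpow_eq_rpow_re_of_pos hc]
  rw [norm_mul, norm_inv, norm_mul, norm_mul, norm_mul, norm_mul, hcp, hcp, re_gammaArg,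
    re_gammaArg]
  have h := norm_Gamma_quot_le S w y
  rw [norm_inv] at h
  generalize ‖Gamma (((placeExp S w : ℂ) + mult w * (2 - y * I)) / 2)‖ = G₁ at *
  generalize ‖Gamma (((placeExp S w : ℂ) + mult w * (-1 + y * I)) / 2)‖ = G₂ at *
  have e : ((1 + |y|) / (2 * Real.pi)) ^ (3 / 2 * mult w : ℝ) =
      (1 / (Real.pi * mult w)) ^ (3 / 2 * mult w : ℝ) *
        (mult w * (1 + |y|) / 2) ^ (3 / 2 * mult w : ℝ) := by
    rw [← Real.mul_rpow hc.le (by positivity)]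
    congr 1
    field_simp
  have e2 : (1 / (Real.pi * mult w) : ℝ) ^ ((placeExp S w + mult w * (2 - y * I : ℂ).re) / 2 : ℝ) =
      (1 / (Real.pi * mult w)) ^ (3 / 2 * mult w : ℝ) *
        (1 / (Real.pi * mult w)) ^ ((placeExp S w + mult w * (-1 + y * I : ℂ).re) / 2 : ℝ) := by
    rw [← Real.rpow_add hc]
    congr 1
    simp
    ring
  rw [e, e2]
  have hne : (1 / (Real.pi * mult w) : ℝ) ^
      ((placeExp S w + mult w * (-1 + y * I : ℂ).re) / 2 : ℝ) ≠ 0 := (Real.rpow_pos_of_pos hc _).ne'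
  generalize (1 / (Real.pi * mult w) : ℝ) ^
    ((placeExp S w + mult w * (-1 + y * I : ℂ).re) / 2 : ℝ) = P at *
  have hQ : 0 ≤ (1 / (Real.pi * mult w) : ℝ) ^ (3 / 2 * mult w : ℝ) := Real.rpow_nonneg hc.le _
  generalize (1 / (Real.pi * mult w) : ℝ) ^ (3 / 2 * mult w : ℝ) = Q at *
  have hh : ‖(1 / 2 : ℂ)‖ ≠ 0 := by norm_num
  generalize ‖(1 / 2 : ℂ)‖ = H at *
  calc H * (Q * P * G₁) * (H * (P * G₂))⁻¹ = Q * (G₁ * G₂⁻¹) := by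
        rw [mul_inv, mul_inv]
        field_simp
    _ ≤ _ := mul_le_mul_of_nonneg_left h hQ

end Gam

section Strip

variable {K : Type*} [Field K] [NumberField K] {𝔣 : Ideal (𝓞 K)} (χ : HeckeChar K 𝔣)

/-- `f` continues `((z - 1) / (z + 2)) ^ d * L(z, χ)` to `-2 < Re z`, with the bounds on the
strip `-1 ≤ Re z ≤ 2` which come from the functional equation. -/
structure IsStripFun (d : ℕ) (f : ℂ → ℂ) : Prop where
  differentiableOn : DifferentiableOn ℂ f {z | -2 < z.re}
  eq_idealSer : ∀ z : ℂ, 1 < z.re → f z = ((z - 1) / (z + 2)) ^ d * idealSer χ.hom z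
  norm_left : ∀ y : ℝ, ‖f (-1 + y * I)‖ ≤ 2 ^ d * ((DK K : ℝ) ^ (3 / 2 : ℝ) *
    (Ideal.absNorm 𝔣 : ℝ) ^ 2 * zetaR K 2) * ((1 + |y|) / (2 * Real.pi)) ^ (3 / 2 * nK K : ℝ)
  growth : ∃ C B : ℝ, 0 ≤ C ∧ 0 ≤ B ∧ ∀ z : ℂ, -1 ≤ z.re → z.re ≤ 2 → 2 ≤ |z.im| →
    ‖f z‖ ≤ C * Real.exp (B * |z.im|)

theorem exists_entire (h𝔣 : 𝔣 ≠ ⊥) : ∃ H : ℂ → ℂ, Differentiable ℂ H ∧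
    (∀ z : ℂ, 1 < z.re → H z = (z - 1) * idealSer χ.hom z) ∧
    (¬ IsTrivialChar χ → H 1 = 0) ∧
    (∃ C B : ℝ, 0 ≤ C ∧ 0 ≤ B ∧ ∀ z : ℂ, -1 ≤ z.re → z.re ≤ 2 → 2 ≤ |z.im| →
      ‖H z‖ ≤ C * Real.exp (B * |z.im|)) ∧
    ∀ y : ℝ, ‖H (-1 + y * I)‖ ≤ ‖(-2 + y * I : ℂ)‖ *
      (((DK K : ℝ) ^ (3 / 2 : ℝ) * (Ideal.absNorm 𝔣 : ℝ) ^ 2 * zetaR K 2) *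
        ((1 + |y|) / (2 * Real.pi)) ^ (3 / 2 * nK K : ℝ)) := by
  obtain ⟨D, -, hb, hD⟩ := exists_unit_domain K
  obtain ⟨S, hS⟩ := exists_sgnS_eq χ h𝔣
  obtain ⟨b⟩ : Nonempty (ClassFamily K) := inferInstance
  refine ⟨heckeEntire χ S b hb h𝔣 hS, differentiable_heckeEntire χ S b hb h𝔣 hS,
    fun z hz => heckeEntire_eq_idealSer χ S b hb h𝔣 hS hD hz, fun h => ?_,
    exists_norm_heckeEntire_le χ S b hb h𝔣 hS, fun y => ?_⟩
  · rw [IsTrivialChar] at h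
    push Not at h
    obtain ⟨𝔤, hco, hχ⟩ := h
    refine heckeEntire_one_eq_zero χ S b hb h𝔣 hS hD (fun h0 => ?_) hco hχ
    rw [h0, Ideal.isCoprime_iff_sup_eq, bot_sup_eq] at hco
    exact hχ (HeckeChar.eq_one_of_top (χ := χ) hco 𝔤)
  · refine (norm_heckeEntire_left_le χ S b hb h𝔣 hS hD y).trans ?_
    have hζ : 0 ≤ zetaR K 2 := tsum_nonneg fun _ => by positivity
    rw [mul_assoc, mul_comm (‖gammaFac S (2 - y * I) * invFac S (-1 + y * I)‖)]
    gcongr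
    exact norm_gammaFac_mul_invFac_le S y

theorem exists_isStripFun_one (h𝔣 : 𝔣 ≠ ⊥) : ∃ f, IsStripFun χ 1 f := by
  obtain ⟨H, hH, hs, -, ⟨C, B, hC, hB, hg⟩, hl⟩ := exists_entire χ h𝔣
  have hre : ∀ z : ℂ, ‖z + 2‖⁻¹ ≤ 1 ∨ z.re < -1 := fun z => by
    refine (lt_or_ge z.re (-1)).symm.imp_left fun h => inv_le_one_of_one_le₀ ?_
    refine le_trans ?_ (re_le_norm _)
    simp only [add_re, re_ofNat]
    linarith
  refine ⟨fun z => H z / (z + 2), ⟨fun z hz => ?_, fun z hz => ?_, fun y => ?_,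
    C, B, hC, hB, fun z h1 h2 h3 => ?_⟩⟩
  · refine ((hH z).div ((differentiable_id z).add_const 2) fun h => ?_).differentiableWithinAt
    have := congrArg re h
    simp only [id, add_re, re_ofNat, zero_re] at this
    rw [Set.mem_ofPred_eq] at hz
    linarith
  · rw [hs z hz, pow_one]
    ring
  · have h2 : ‖(-2 + y * I : ℂ)‖ ≤ 2 * ‖-1 + y * I + 2‖ := by
      rw [show (-1 : ℂ) + y * I + 2 = 1 + y * I by ring]
      refine le_of_sq_le_sq ?_ (by positivity)
      rw [mul_pow, ← Complex.normSq_eq_norm_sq, ← Complex.normSq_eq_norm_sq,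
        Complex.normSq_apply, Complex.normSq_apply]
      simp
      nlinarith [sq_nonneg y]
    have hp : 0 < ‖-1 + y * I + 2‖ := by
      refine norm_pos_iff.2 fun h => ?_
      have := congrArg re h
      norm_num at this
    change ‖H (-1 + y * I) / (-1 + y * I + 2)‖ ≤ _
    have hζ : 0 ≤ zetaR K 2 := tsum_nonneg fun _ => by positivity
    rw [norm_div, div_le_iff₀ hp, pow_one]
    refine (hl y).trans ?_
    rw [mul_comm _ ‖-1 + y * I + 2‖, mul_assoc 2, ← mul_assoc _ (2 : ℝ),
      mul_comm _ (2 : ℝ)]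
    gcongr
  · rw [norm_div, div_eq_mul_inv]
    exact (mul_le_of_le_one_right (norm_nonneg _) ((hre z).resolve_right (by linarith))).trans
      (hg z h1 h2 h3)

theorem exists_isStripFun_zero (h𝔣 : 𝔣 ≠ ⊥) (hχ : ¬ IsTrivialChar χ) : ∃ f, IsStripFun χ 0 f := by
  obtain ⟨H, hH, hs, h0, ⟨C, B, hC, hB, hg⟩, hl⟩ := exists_entire χ h𝔣
  have hsl : ∀ z : ℂ, z ≠ 1 → dslope H 1 z = H z / (z - 1) := fun z hz => by
    rw [dslope_of_ne _ hz, slope_def_field, h0 hχ, sub_zero]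
  refine ⟨dslope H 1, ⟨?_, fun z hz => ?_, fun y => ?_, C, B, hC, hB, fun z h1 h2 h3 => ?_⟩⟩
  · refine (Complex.differentiableOn_dslope ?_).2 hH.differentiableOn
    exact (isOpen_lt continuous_const continuous_re).mem_nhds (by norm_num)
  · have hz1 : z - 1 ≠ 0 := fun h => by
      rw [sub_eq_zero.1 h, one_re] at hz
      exact lt_irrefl _ hz
    rw [hsl z (sub_ne_zero.1 hz1), hs z hz, pow_zero, one_mul, mul_div_cancel_left₀ _ hz1]
  · have hz : (-1 + y * I : ℂ) - 1 ≠ 0 := fun h => by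
      have := congrArg re h
      norm_num at this
    rw [hsl _ (sub_ne_zero.1 hz), norm_div, div_le_iff₀ (norm_pos_iff.2 hz), pow_zero, one_mul,
      show (-1 + y * I : ℂ) - 1 = -2 + y * I by ring, mul_comm _ ‖(-2 + y * I : ℂ)‖]
    exact hl y
  · have hz : z - 1 ≠ 0 := fun h => by
      rw [sub_eq_zero.1 h, one_im, abs_zero] at h3
      norm_num at h3
    rw [hsl _ (sub_ne_zero.1 hz), norm_div]
    refine (div_le_self (norm_nonneg _) ?_).trans (hg z h1 h2 h3)
    refine le_trans ?_ (abs_im_le_norm _)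
    rw [sub_im, one_im, sub_zero]
    linarith

end Strip

section Strip

variable {K : Type*} [Field K] [NumberField K] {𝔣 : Ideal (𝓞 K)} {χ : HeckeChar K 𝔣}

/-- The logarithm of the convexity bound for `L(z, χ)` on `Re z = -1`. -/
def leftLog (K : Type*) [Field K] [NumberField K] (𝔣 : Ideal (𝓞 K)) (d : ℕ) (T : ℝ) : ℝ :=
  d * Real.log 2 + 3 / 2 * Real.log (DK K) + 2 * Real.log (Ideal.absNorm 𝔣) +
    nK K * Real.log 2 + 3 / 2 * nK K * Real.log ((T + 3) / (2 * Real.pi))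

theorem DK_pos : (0 : ℝ) < DK K := by
  rw [DK]
  exact Nat.cast_pos.2 (Int.natAbs_pos.2 (NumberField.discr_ne_zero K))

theorem zetaR_two_le : zetaR K 2 ≤ 2 ^ nK K := by
  refine (zetaR_le (by norm_num)).trans_eq ?_
  norm_num

theorem add_three_mul_norm_ge (t y : ℝ) : 1 + |y| ≤ (|t| + 3) * ‖(1 + (y - t) * I : ℂ)‖ := by
  have h1 : 1 ≤ ‖(1 + (y - t) * I : ℂ)‖ := (le_of_eq (by simp)).trans (re_le_norm _)
  have h2 : |y - t| ≤ ‖(1 + (y - t) * I : ℂ)‖ := (le_of_eq (by simp)).trans (abs_im_le_norm _)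
  have h3 : |y| ≤ |t| + |y - t| := by
    simpa using abs_add_le t (y - t)
  nlinarith [abs_nonneg t]

theorem IsStripFun.norm_left_le {d : ℕ} {f : ℂ → ℂ} (hf : IsStripFun χ d f) (h𝔣 : 𝔣 ≠ ⊥)
    (t y : ℝ) : ‖f (-1 + y * I)‖ ≤ ‖(1 + (y - t) * I : ℂ)‖ ^ (3 / 2 * nK K : ℝ) *
      Real.exp (leftLog K 𝔣 d |t|) := by
  have hN : (0 : ℝ) < Ideal.absNorm 𝔣 :=
    Nat.cast_pos.2 (Nat.pos_of_ne_zero (Ideal.absNorm_eq_zero_iff.not.2 h𝔣))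
  have hD := DK_pos (K := K)
  have hT : 0 < (|t| + 3) / (2 * Real.pi) := by positivity
  have hexp : Real.exp (leftLog K 𝔣 d |t|) = 2 ^ d * ((DK K : ℝ) ^ (3 / 2 : ℝ) *
      (Ideal.absNorm 𝔣 : ℝ) ^ 2 * 2 ^ nK K) * ((|t| + 3) / (2 * Real.pi)) ^ (3 / 2 * nK K : ℝ) := by
    rw [leftLog, Real.exp_add, Real.exp_add, Real.exp_add, Real.exp_add, Real.exp_nat_mul,
      Real.exp_log two_pos, Real.exp_nat_mul, Real.exp_log two_pos, Real.rpow_def_of_pos hD,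
      Real.rpow_def_of_pos hT, mul_comm (Real.log (DK K)), mul_comm (Real.log ((|t| + 3) / _)),
      show (2 : ℝ) * Real.log (Ideal.absNorm 𝔣) = (2 : ℕ) * Real.log (Ideal.absNorm 𝔣) by norm_num,
      Real.exp_nat_mul, Real.exp_log hN]
    ring
  rw [hexp]
  refine (hf.norm_left y).trans ?_
  have h1 : (1 + |y|) / (2 * Real.pi) ≤
      ‖(1 + (y - t) * I : ℂ)‖ * ((|t| + 3) / (2 * Real.pi)) := by
    rw [mul_div_assoc', mul_comm _ (|t| + 3)]
    gcongr
    exact add_three_mul_norm_ge t y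
  rw [mul_comm (‖_‖ ^ _), mul_assoc _ (_ ^ (3 / 2 * nK K : ℝ)), mul_comm (_ ^ (3 / 2 * nK K : ℝ)),
    ← Real.mul_rpow (norm_nonneg _) hT.le]
  gcongr
  exact zetaR_two_le

theorem IsStripFun.norm_right_le {d : ℕ} {f : ℂ → ℂ} (hf : IsStripFun χ d f) (y : ℝ) :
    ‖f (2 + y * I)‖ ≤ 2 ^ nK K := by
  rw [hf.eq_idealSer _ (by simp), norm_mul, norm_pow, norm_div]
  have h1 : ‖(2 + y * I - 1 : ℂ)‖ / ‖(2 + y * I + 2 : ℂ)‖ ≤ 1 := by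
    refine div_le_one_of_le₀ (le_of_sq_le_sq ?_ (norm_nonneg _)) (norm_nonneg _)
    rw [← Complex.normSq_eq_norm_sq, ← Complex.normSq_eq_norm_sq, Complex.normSq_apply,
      Complex.normSq_apply]
    norm_num
  have h2 : ‖idealSer χ.hom (2 + y * I)‖ ≤ 2 ^ nK K := by
    refine (norm_idealSer_le χ.norm_le_one (by simp)).trans ?_
    rw [show (2 + y * I : ℂ).re = 2 by simp]
    exact zetaR_two_le
  exact (mul_le_of_le_one_left (norm_nonneg _) (pow_le_one₀ (by positivity) h1)).trans h2

theorem IsStripFun.norm_le {d : ℕ} {f : ℂ → ℂ} (hf : IsStripFun χ d f) (h𝔣 : 𝔣 ≠ ⊥) (t : ℝ)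
    {z : ℂ} (h1 : -1 ≤ z.re) (h2 : z.re ≤ 2) :
    ‖f z‖ ≤ ‖z - t * I + 2‖ ^ (3 / 2 * nK K : ℝ) *
      Real.exp ((2 - z.re) / 3 * leftLog K 𝔣 d |t| - (1 + z.re) / 3 * (2 * nK K * Real.log 2)) := by
  set A : ℝ := leftLog K 𝔣 d |t| with hA
  set B : ℝ := 2 * nK K * Real.log 2 with hB
  set e : ℝ := 3 / 2 * nK K with he
  have he0 : 0 ≤ e := by positivity
  set g : ℂ → ℂ := fun z => f z * (z - t * I + 2) ^ (-(e : ℂ)) *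
    exp (-((2 - z) / 3 * A - (1 + z) / 3 * B)) with hg
  have hre : ∀ z : ℂ, -1 ≤ z.re → 1 ≤ (z - t * I + 2).re := fun z hz => by
    simp only [add_re, sub_re, re_ofReal_mul, I_re, re_ofNat]
    linarith
  have hne : ∀ z : ℂ, -1 ≤ z.re → z - t * I + 2 ≠ 0 := fun z hz h => by
    have := hre z hz
    rw [h, zero_re] at this
    linarith
  have hexp : ∀ z : ℂ, ‖exp (-((2 - z) / 3 * A - (1 + z) / 3 * B))‖ =
      Real.exp (-((2 - z.re) / 3 * A - (1 + z.re) / 3 * B)) := fun z => by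
    rw [Complex.norm_exp]
    congr 1
    rw [neg_re, sub_re, re_mul_ofReal, re_mul_ofReal, div_ofNat_re, div_ofNat_re]
    simp
  have hnorm : ∀ z : ℂ, -1 ≤ z.re → ‖g z‖ = ‖f z‖ * (‖z - t * I + 2‖ ^ e)⁻¹ *
      Real.exp (-((2 - z.re) / 3 * A - (1 + z.re) / 3 * B)) := fun z hz => by
    rw [hg, norm_mul, norm_mul, hexp, ← ofReal_neg, norm_cpow_of_ne_zero (hne z hz), ofReal_im,
      ofReal_re, mul_zero, Real.exp_zero, div_one, Real.rpow_neg (norm_nonneg _)]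
  have hle1 : ∀ z : ℂ, -1 ≤ z.re → (‖z - t * I + 2‖ ^ e)⁻¹ ≤ 1 := fun z hz =>
    inv_le_one_of_one_le₀ (Real.one_le_rpow ((hre z hz).trans (re_le_norm _)) he0)
  have hmain : ‖g z‖ ≤ 1 := by
    refine PhragmenLindelof.vertical_strip (a := -1) (b := 2) ?_ ?_ ?_ ?_ h1 h2
    · refine DifferentiableOn.diffContOnCl fun w hw => ?_
      rw [closure_preimage_re, closure_Ioo (by norm_num)] at hw
      have hw1 : -1 ≤ w.re := hw.1
      have hw2 : -2 < w.re := by linarith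
      have hfw : DifferentiableAt ℂ f w :=
        (hf.differentiableOn w hw2).differentiableAt
          ((isOpen_lt continuous_const continuous_re).mem_nhds hw2)
      refine ((hfw.mul (DifferentiableAt.cpow_const ?_ ?_)).mul ?_).differentiableWithinAt
      · fun_prop
      · exact Or.inl (zero_lt_one.trans_le (hre w hw1))
      · fun_prop
    · obtain ⟨C, b, hC, hb, hgr⟩ := hf.growth
      refine ⟨1, by linarith [Real.pi_gt_three], b, ?_⟩
      refine Asymptotics.IsBigO.of_bound (C * Real.exp (|A| + |B|)) ?_
      rw [Filter.eventually_inf_principal]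
      have : ∀ᶠ w : ℂ in comap (fun w : ℂ => |w.im|) atTop, 2 ≤ |w.im| :=
        (eventually_ge_atTop 2).comap _
      filter_upwards [this] with w hw2 hw
      have hw1 : -1 ≤ w.re := hw.1.le
      have hw3 : w.re ≤ 2 := hw.2.le
      rw [hnorm w hw1, Real.norm_of_nonneg (Real.exp_pos _).le, mul_right_comm]
      have e1 : -((2 - w.re) / 3 * A - (1 + w.re) / 3 * B) ≤ |A| + |B| := by
        have a1 := neg_abs_le A
        have a2 := le_abs_self B
        have a3 := abs_nonneg A
        have a4 := abs_nonneg B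
        nlinarith
      have e2 : b * |w.im| ≤ b * Real.exp (1 * |w.im|) := by
        rw [one_mul]
        exact mul_le_mul_of_nonneg_left ((lt_add_one _).le.trans (Real.add_one_le_exp _)) hb
      calc _ ≤ C * Real.exp (b * |w.im|) * Real.exp (|A| + |B|) * 1 := by
            gcongr
            · exact hgr w hw1 hw3 hw2
            · exact hle1 w hw1
        _ ≤ _ := by
            rw [mul_one, mul_right_comm]
            gcongr
    · intro w hw
      have hw' : w = -1 + w.im * I := by
        apply Complex.ext <;> simp [hw]
      have h := hf.norm_left_le h𝔣 t w.im
      rw [hnorm w hw.ge, hw]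
      have e1 : w - t * I + 2 = 1 + (w.im - t) * I := by
        rw [hw']
        simp
        ring
      rw [← hw', ← e1] at h
      have hp : 0 < ‖w - t * I + 2‖ ^ e :=
        Real.rpow_pos_of_pos (norm_pos_iff.2 (hne w hw.ge)) _
      calc _ ≤ (‖w - t * I + 2‖ ^ e * Real.exp A) * (‖w - t * I + 2‖ ^ e)⁻¹ * Real.exp (-A) := by
            rw [show -((2 - -1) / 3 * A - (1 + -1) / 3 * B) = -A by ring]
            gcongr
        _ = 1 := by
            rw [mul_right_comm (‖w - t * I + 2‖ ^ e), mul_inv_cancel₀ hp.ne', one_mul,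
              ← Real.exp_add, add_neg_cancel, Real.exp_zero]
    · intro w hw
      have hw' : w = 2 + w.im * I := by
        apply Complex.ext <;> simp [hw]
      have hw1 : -1 ≤ w.re := by rw [hw]; norm_num
      have h := hf.norm_right_le w.im
      rw [← hw'] at h
      rw [hnorm w hw1, hw]
      have h4 : 4 ≤ ‖w - t * I + 2‖ := by
        refine le_trans (le_of_eq ?_) (re_le_norm _)
        simp [hw]
        norm_num
      have e3 : (4 : ℝ) ^ e = 2 ^ nK K * Real.exp B := by
        rw [hB, show (4 : ℝ) = 2 ^ (2 : ℝ) by norm_num, ← Real.rpow_mul two_pos.le,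
          ← Real.rpow_natCast, Real.rpow_def_of_pos two_pos, Real.rpow_def_of_pos two_pos,
          ← Real.exp_add]
        congr 1
        ring
      have h5 := Real.rpow_le_rpow (by norm_num) h4 he0
      rw [e3] at h5
      calc _ ≤ 2 ^ nK K * (2 ^ nK K * Real.exp B)⁻¹ * Real.exp B := by
            rw [show -((2 - 2) / 3 * A - (1 + 2) / 3 * B) = B by ring]
            gcongr
        _ = 1 := by
            field_simp
  rw [hnorm z h1] at hmain
  have hp : 0 < ‖z - t * I + 2‖ ^ e :=
    Real.rpow_pos_of_pos (norm_pos_iff.2 (hne z h1)) _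
  rw [Real.exp_neg, mul_assoc, ← mul_inv, mul_inv_le_iff₀ (by positivity), one_mul] at hmain
  exact hmain

end Strip

section Count

open Metric

variable {K : Type*} [Field K] [NumberField K] {𝔣 : Ideal (𝓞 K)} {χ : HeckeChar K 𝔣}

/-- The error terms in Jensen's formula on the disc of radius `2 + r` around `1 + r + it`. -/
def discError (K : Type*) [Field K] [NumberField K] (𝔣 : Ideal (𝓞 K)) (d : ℕ) (T r : ℝ) : ℝ :=
  2 * (nK K * (3 / 2 * Real.log 5 - 2 * Real.log 2) +
      (1 - r) / 3 * (leftLog K 𝔣 d T + 2 * nK K * Real.log 2)) / (Real.pi * (2 + r)) +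
    (leftLog K 𝔣 d T + 2 * nK K * Real.log 2) / 3 / 2 + (nK K + 3 * d) / (2 + r) ^ 2

theorem exp_neg_three_div_le {z : ℂ} {x : ℝ} (hx : 0 < x) (hz : x + 1 ≤ z.re) :
    Real.exp (-(3 / x)) ≤ ‖(z - 1) / (z + 2)‖ := by
  have h1 : x ≤ ‖z - 1‖ := by
    refine le_trans ?_ (re_le_norm _)
    rw [sub_re, one_re]
    linarith
  have h2 : 0 < ‖z + 2‖ := by
    refine lt_of_lt_of_le ?_ (re_le_norm _)
    rw [add_re, re_ofNat]
    linarith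
  have h3 : ‖z + 2‖ ≤ ‖z - 1‖ + 3 := by
    rw [show z + 2 = z - 1 + 3 by ring]
    exact (norm_add_le _ _).trans_eq (by simp)
  rw [Real.exp_neg, norm_div,
    inv_le_comm₀ (Real.exp_pos _) (div_pos (hx.trans_le h1) h2), inv_div]
  have h4 := Real.add_one_le_exp (3 / x)
  refine le_trans ?_ h4
  rw [div_le_iff₀ (by linarith)]
  have : 3 ≤ 3 / x * ‖z - 1‖ := by
    rw [div_mul_eq_mul_div, le_div_iff₀ hx]
    linarith
  linarith

theorem exp_neg_div_le_norm_idealSer {z : ℂ} {x : ℝ} (hx : 0 < x) (hz : x + 1 ≤ z.re) :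
    Real.exp (-(nK K / x)) ≤ ‖idealSer χ.hom z‖ := by
  have hz1 : 1 < z.re := by linarith
  have h1 := one_le_norm_idealSer_mul χ.norm_le_one hz1
  have h2 : zetaR K z.re ≤ Real.exp (nK K / x) := by
    refine (zetaR_le hz1).trans ?_
    rw [← mul_one_div (nK K : ℝ), Real.exp_nat_mul]
    have h4 : 1 / (z.re - 1) ≤ 1 / x := one_div_le_one_div_of_le hx (by linarith)
    have h5 : 0 ≤ 1 / (z.re - 1) := one_div_nonneg.2 (by linarith)
    refine pow_le_pow_left₀ (by linarith) ?_ _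
    linarith [Real.add_one_le_exp (1 / x)]
  rw [Real.exp_neg, inv_le_iff_one_le_mul₀ (Real.exp_pos _)]
  exact h1.trans (mul_le_mul_of_nonneg_left h2 (norm_nonneg _))

theorem IsStripFun.ne_zero {d : ℕ} {f : ℂ → ℂ} (hf : IsStripFun χ d f) {z : ℂ} (hz : 1 < z.re) :
    f z ≠ 0 := by
  have h := exp_neg_div_le_norm_idealSer (χ := χ) (z := z) (x := z.re - 1) (by linarith)
    (by linarith)
  have h' := exp_neg_three_div_le (z := z) (x := z.re - 1) (by linarith) (by linarith)
  rw [hf.eq_idealSer z hz]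
  exact mul_ne_zero (pow_ne_zero _ (norm_pos_iff.1 ((Real.exp_pos _).trans_le h')))
    (norm_pos_iff.1 ((Real.exp_pos _).trans_le h))

theorem IsStripFun.sum_discWeight_le {d : ℕ} {f : ℂ → ℂ} (hf : IsStripFun χ d f) (h𝔣 : 𝔣 ≠ ⊥)
    {r t : ℝ} (hr0 : 0 < r) (hr1 : r ≤ 1) (S : Finset ℂ) (m : ℂ → ℕ)
    (hS : ∀ w ∈ S, w ∈ ball ((1 + r : ℝ) + t * I : ℂ) (2 + r) ∧ f w = 0 ∧
      ZeroOrderAtLeast f w (m w)) :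
    ∑ w ∈ S, (m w : ℝ) * discWeight (2 + r) ((1 + r : ℝ) + t * I - w) ≤
      (deriv f ((1 + r : ℝ) + t * I) / f ((1 + r : ℝ) + t * I)).re + discError K 𝔣 d |t| r := by
  set c : ℂ := (1 + r : ℝ) + t * I with hc
  have hcre : c.re = 1 + r := by simp [hc]
  have hball : ∀ z ∈ ball c (2 + r), -1 < z.re ∧ ‖z - c‖ < 2 + r := fun z hz => by
    rw [mem_ball, dist_eq] at hz
    refine ⟨?_, hz⟩
    have := (abs_re_le_norm (z - c)).trans_lt hz
    rw [abs_lt, sub_re, hcre] at this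
    linarith
  have h := RTZ.sum_discWeight_le (f := f) (c := c) (R := 2 + r)
    (a := nK K * (3 / 2 * Real.log 5 - 2 * Real.log 2) +
      (1 - r) / 3 * (leftLog K 𝔣 d |t| + 2 * nK K * Real.log 2))
    (b := (leftLog K 𝔣 d |t| + 2 * nK K * Real.log 2) / 3) (κ := nK K + 3 * d)
    (by linarith) (by positivity) ?_ (hf.ne_zero (by linarith)) ?_ ?_ S m hS
  · refine h.trans_eq ?_
    rw [discError]
    ring
  · refine hf.differentiableOn.mono fun z hz => ?_
    have : -2 < z.re := by linarith [(hball z hz).1]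
    exact this
  · intro z hz hzc
    obtain ⟨h1, h2⟩ := hball z hz
    rw [hcre] at hzc ⊢
    refine (hf.norm_le h𝔣 t h1.le (by linarith)).trans ?_
    have h5 : ‖z - t * I + 2‖ ≤ 5 := by
      refine le_of_sq_le_sq ?_ (by norm_num)
      have h3 : ‖z - c‖ ^ 2 ≤ (2 + r) ^ 2 := by gcongr
      rw [← Complex.normSq_eq_norm_sq, Complex.normSq_apply] at h3 ⊢
      simp only [hc, sub_re, add_re, ofReal_re, re_ofReal_mul, I_re, mul_zero, add_zero, sub_im,
        add_im, ofReal_im, im_ofReal_mul, I_im, mul_one, zero_add, sub_zero, re_ofNat,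
        im_ofNat] at h3 ⊢
      nlinarith
    have h0 : 0 < ‖z - t * I + 2‖ := by
      refine lt_of_lt_of_le ?_ (re_le_norm _)
      simp only [add_re, sub_re, re_ofReal_mul, I_re, re_ofNat]
      linarith
    have h6 : ‖z - t * I + 2‖ ^ (3 / 2 * nK K : ℝ) ≤ Real.exp (3 / 2 * nK K * Real.log 5) := by
      refine (Real.rpow_le_rpow h0.le h5 (by positivity)).trans_eq ?_
      rw [Real.rpow_def_of_pos (by norm_num), mul_comm]
    refine (mul_le_mul_of_nonneg_right h6 (Real.exp_pos _).le).trans_eq ?_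
    rw [← Real.exp_add]
    congr 1
    ring
  · intro z hz hzc
    rw [hcre] at hzc ⊢
    have hx : 0 < z.re - (1 + r) := by linarith
    rw [hf.eq_idealSer z (by linarith), norm_mul, norm_pow, add_div, neg_add, Real.exp_add, mul_comm]
    refine mul_le_mul ?_ (exp_neg_div_le_norm_idealSer hx (by linarith)) (Real.exp_pos _).le
      (by positivity)
    rw [mul_div_right_comm, mul_comm, ← mul_neg, Real.exp_nat_mul]
    exact pow_le_pow_left₀ (Real.exp_pos _).le (exp_neg_three_div_le hx (by linarith)) _

theorem IsStripFun.exists_idealSer {d : ℕ} {f : ℂ → ℂ} (hf : IsStripFun χ d f) {s : ℂ}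
    (hs : 1 < s.re) : ∃ L : ℂ → ℂ, DifferentiableAt ℂ L s ∧
      (∀ z : ℂ, 1 < z.re → L z = idealSer χ.hom z) ∧
      deriv L s / L s = deriv f s / f s + d * (1 / (s + 2) - 1 / (s - 1)) := by
  have h1 : ∀ z : ℂ, 1 < z.re → z - 1 ≠ 0 := fun z hz h => by
    have := congrArg re h
    rw [sub_re, one_re, zero_re] at this
    linarith
  have h2 : ∀ z : ℂ, 1 < z.re → z + 2 ≠ 0 := fun z hz h => by
    have := congrArg re h
    rw [add_re, re_ofNat, zero_re] at this
    linarith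
  have hs2 : -2 < s.re := by linarith
  have hfs : DifferentiableAt ℂ f s := (hf.differentiableOn s hs2).differentiableAt
    ((isOpen_lt continuous_const continuous_re).mem_nhds hs2)
  have d1 : DifferentiableAt ℂ (fun z : ℂ => z + 2) s := by fun_prop
  have d2 : DifferentiableAt ℂ (fun z : ℂ => z - 1) s := by fun_prop
  have dq : DifferentiableAt ℂ (fun z : ℂ => (z + 2) / (z - 1)) s := d1.div d2 (h1 s hs)
  refine ⟨fun z => f z * ((z + 2) / (z - 1)) ^ d, hfs.mul (dq.pow d), fun z hz => ?_, ?_⟩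
  · have e1 := h1 z hz
    have e2 := h2 z hz
    change f z * ((z + 2) / (z - 1)) ^ d = _
    rw [hf.eq_idealSer z hz, mul_right_comm, ← mul_pow,
      div_mul_div_cancel₀ e2, div_self e1, one_pow, one_mul]
  · have hq : (s + 2) / (s - 1) ≠ 0 := div_ne_zero (h2 s hs) (h1 s hs)
    have e := logDeriv_mul (f := f) (g := fun z => ((z + 2) / (z - 1)) ^ d) s (hf.ne_zero hs)
      (pow_ne_zero d hq) hfs (dq.pow d)
    rw [logDeriv_fun_pow dq, logDeriv_div (f := fun z => z + 2) (g := fun z => z - 1) s (h2 s hs)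
      (h1 s hs) d1 d2] at e
    simpa [logDeriv_apply] using e

end Count

section Count

open Metric IsDedekindDomain

variable {K : Type*} [Field K] [NumberField K] {𝔣 : Ideal (𝓞 K)} {χ : HeckeChar K 𝔣}

variable (K) in
/-- The trivial character modulo the unit ideal. -/
def HeckeChar.one : HeckeChar K ⊤ where
  toFun _ := 1
  map_mul' _ _ := (mul_one 1).symm
  eq_zero' 𝔞 h := (h (by rw [Ideal.isCoprime_iff_sup_eq, sup_top_eq])).elim
  norm_one' _ _ := norm_one
  ray_one' _ _ _ := rfl

theorem neg_logDeriv_zeta_le {f : ℂ → ℂ} (hf : IsStripFun (HeckeChar.one K) 1 f) {r : ℝ}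
    (hr0 : 0 < r) (hr1 : r ≤ 1) :
    -(deriv f (1 + r : ℝ) / f (1 + r : ℝ)).re ≤ discError K ⊤ 1 0 r := by
  have h := hf.sum_discWeight_le top_ne_bot (t := 0) hr0 hr1 ∅ (fun _ => 0) (by simp)
  rw [Finset.sum_empty, abs_zero, ofReal_zero, zero_mul, add_zero] at h
  linarith

theorem IsStripFun.re_logDeriv_le {d : ℕ} {f : ℂ → ℂ} (hf : IsStripFun χ d f) {r t : ℝ}
    (hr0 : 0 < r) (hr1 : r ≤ 1) :
    (deriv f ((1 + r : ℝ) + t * I) / f ((1 + r : ℝ) + t * I)).re ≤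
      (1 + d) / r + discError K ⊤ 1 0 r := by
  have hcre : ((1 + r : ℝ) + t * I : ℂ).re = 1 + r := by simp
  obtain ⟨F, hF⟩ := exists_isStripFun_one (HeckeChar.one K) top_ne_bot
  obtain ⟨L, hL, hLs, hLd⟩ := hf.exists_idealSer (s := (1 + r : ℝ) + t * I) (by linarith)
  obtain ⟨Z, hZ, hZs, hZd⟩ := hF.exists_idealSer (s := (1 + r : ℝ))
    (by rw [ofReal_re]; linarith)
  have h := logDeriv_le χ.norm_le_one (s := (1 + r : ℝ) + t * I) (by linarith) hL
    (by rw [hcre]; exact hZ) hLs hZs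
  rw [hcre, hLd, hZd] at h
  have h0 := neg_logDeriv_zeta_le hF hr0 hr1
  have hpos : ∀ u : ℝ, 0 ≤ (1 / ((1 + r : ℝ) + u * I + 2 : ℂ)).re := fun u => by
    rw [one_div, inv_re]
    refine div_nonneg ?_ (normSq_nonneg _)
    simp
    linarith
  have hle : ∀ u : ℝ, (1 / ((1 + r : ℝ) + u * I - 1 : ℂ)).re ≤ 1 / r := fun u => by
    have hn : r ≤ ‖((1 + r : ℝ) + u * I - 1 : ℂ)‖ := by
      refine le_trans (le_of_eq ?_) (re_le_norm _)
      simp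
    refine (re_le_norm _).trans ?_
    rw [norm_div, norm_one]
    exact one_div_le_one_div_of_le hr0 hn
  have hp0 := hpos 0
  have hl0 := hle 0
  have hpt := hpos t
  have hlt := hle t
  rw [ofReal_zero, zero_mul, add_zero] at hp0 hl0
  rw [Nat.cast_one, one_mul, add_re, add_re, sub_re, ← ofReal_natCast, re_ofReal_mul, sub_re] at h
  have hd : (0 : ℝ) ≤ d := Nat.cast_nonneg d
  have e1 := mul_nonneg hd hpt
  have e2 := mul_le_mul_of_nonneg_left hlt hd
  rw [add_div, div_eq_mul_one_div (d : ℝ)]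
  linarith

theorem le_discWeight {r t : ℝ} (hr0 : 0 < r) (hr1 : r ≤ 1) {ρ : ℂ} (h1 : ρ.re < 1)
    (h : ‖1 + t * I - ρ‖ ≤ r) :
    1 / (2 * r) - 2 * r / (2 + r) ^ 2 ≤ discWeight (2 + r) ((1 + r : ℝ) + t * I - ρ) ∧
      ‖ρ - ((1 + r : ℝ) + t * I)‖ < 2 + r := by
  set w : ℂ := (1 + r : ℝ) + t * I - ρ with hw
  have hwr : w = (1 + t * I - ρ) + r := by
    rw [hw]; push_cast; ring
  have hnw : ‖w‖ ≤ 2 * r := by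
    rw [hwr]
    refine (norm_add_le _ _).trans ?_
    rw [Complex.norm_real, Real.norm_of_nonneg hr0.le]
    linarith
  refine ⟨?_, ?_⟩
  · have hre : r < w.re := by
      rw [hw]
      simp
      linarith
    have hsq : normSq w ≤ 2 * r * w.re := by
      have h2 : normSq (1 + t * I - ρ) ≤ r ^ 2 := by
        rw [Complex.normSq_eq_norm_sq]
        gcongr
      rw [Complex.normSq_apply] at h2 ⊢
      have e1 : w.re = (1 + t * I - ρ).re + r := by rw [hwr, add_re, ofReal_re]
      have e2 : w.im = (1 + t * I - ρ).im := by rw [hwr, add_im, ofReal_im, add_zero]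
      rw [e1, e2]
      nlinarith
    have hpos : 0 < normSq w := normSq_pos.2 fun h0 => by
      rw [h0, zero_re] at hre
      linarith
    rw [discWeight, inv_re]
    refine sub_le_sub ?_ ?_
    · rw [div_le_div_iff₀ (by positivity) hpos]
      linarith
    · gcongr
      exact (re_le_norm _).trans hnw
  · rw [← norm_neg, neg_sub, ← hw]
    linarith

theorem IsStripFun.sum_order_mul_le {d : ℕ} {f : ℂ → ℂ} (hf : IsStripFun χ d f) (h𝔣 : 𝔣 ≠ ⊥)
    {r t : ℝ} (hr0 : 0 < r) (hr1 : r ≤ 1) (S : Finset ℂ) (m : ℂ → ℕ)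
    (hS : ∀ ρ ∈ S, ρ.re < 1 ∧ ‖1 + t * I - ρ‖ ≤ r ∧ f ρ = 0 ∧ ZeroOrderAtLeast f ρ (m ρ)) :
    (∑ ρ ∈ S, (m ρ : ℝ)) * (1 / (2 * r) - 2 * r / (2 + r) ^ 2) ≤
      (1 + d) / r + discError K ⊤ 1 0 r + discError K 𝔣 d |t| r := by
  refine le_trans ?_ ((hf.sum_discWeight_le h𝔣 hr0 hr1 S m fun ρ hρ => ?_).trans
    (add_le_add_left (hf.re_logDeriv_le hr0 hr1) _))
  · rw [Finset.sum_mul]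
    refine Finset.sum_le_sum fun ρ hρ => ?_
    obtain ⟨h1, h2, -, -⟩ := hS ρ hρ
    exact mul_le_mul_of_nonneg_left (le_discWeight hr0 hr1 h1 h2).1 (Nat.cast_nonneg _)
  · obtain ⟨h1, h2, h3, h4⟩ := hS ρ hρ
    refine ⟨?_, h3, h4⟩
    rw [mem_ball, dist_eq]
    exact (le_discWeight hr0 hr1 h1 h2).2

end Count

section Count

variable {K : Type*} [Field K] [NumberField K] {𝔣 : Ideal (𝓞 K)}

theorem three_mul_log_five_le : 3 * Real.log 5 ≤ 7 * Real.log 2 := by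
  have h := Real.log_le_log (by norm_num) (show (5 : ℝ) ^ 3 ≤ 2 ^ 7 by norm_num)
  rw [Real.log_pow, Real.log_pow] at h
  exact_mod_cast h

theorem two_mul_log_two_le_log_five : 2 * Real.log 2 ≤ Real.log 5 := by
  have h := Real.log_le_log (by norm_num) (show (2 : ℝ) ^ 2 ≤ 5 by norm_num)
  rw [Real.log_pow] at h
  exact_mod_cast h

theorem nineteen_mul_log_two_le : 19 * Real.log 2 ≤ 12 * Real.log 3 := by
  have h := Real.log_le_log (by norm_num) (show (2 : ℝ) ^ 19 ≤ 3 ^ 12 by norm_num)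
  rw [Real.log_pow, Real.log_pow] at h
  exact_mod_cast h

theorem leftLog_le (d : ℕ) {T : ℝ} (hT : 0 ≤ T) : leftLog K 𝔣 d T + 2 * nK K * Real.log 2 ≤
    d * Real.log 2 + 3 / 2 * Real.log (DK K) + 2 * Real.log (Ideal.absNorm 𝔣) +
      3 / 2 * nK K * (Real.log (T + 3) + (Real.log 2 - Real.log 3)) := by
  have h6 : Real.log 2 + Real.log 3 ≤ Real.log (2 * Real.pi) := by
    rw [← Real.log_mul two_ne_zero three_ne_zero]
    exact Real.log_le_log (by norm_num) (by linarith [Real.pi_gt_three])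
  rw [leftLog, Real.log_div (by linarith) (by positivity)]
  have hn := nK_pos (K := K)
  nlinarith

theorem discError_mul_le (d : ℕ) {T r : ℝ} (hT : 0 ≤ T) (hr0 : 0 < r) (hr1 : r ≤ 1) :
    discError K 𝔣 d T r * (2 + r) ^ 2 ≤ 26 / 25 * (2 / 3) * nK K * (2 + r) +
      (2 * (1 - r) * (2 + r) / 9 + (2 + r) ^ 2 / 6) *
        (d * Real.log 2 + 3 / 2 * Real.log (DK K) + 2 * Real.log (Ideal.absNorm 𝔣) +
          3 / 2 * nK K * (Real.log (T + 3) + (Real.log 2 - Real.log 3))) + (nK K + 3 * d) := by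
  have hΛ := leftLog_le (K := K) (𝔣 := 𝔣) d hT
  have hn := nK_pos (K := K)
  have hd : (0 : ℝ) ≤ d := Nat.cast_nonneg d
  have h2 := Real.log_pos one_lt_two
  have h2' := Real.log_two_lt_d9
  have hT3 : Real.log 3 ≤ Real.log (T + 3) := Real.log_le_log (by norm_num) (by linarith)
  have hℓ := Real.log_natCast_nonneg (DK K)
  have hF := Real.log_natCast_nonneg (Ideal.absNorm 𝔣)
  have h5 := three_mul_log_five_le
  have h5' := two_mul_log_two_le_log_five
  have hn0 : 0 ≤ 3 / 2 * nK K * (Real.log (T + 3) + (Real.log 2 - Real.log 3)) :=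
    mul_nonneg (by positivity) (by linarith)
  have hΛ0 : 0 ≤ d * Real.log 2 + 3 / 2 * Real.log (DK K) + 2 * Real.log (Ideal.absNorm 𝔣) +
      3 / 2 * nK K * (Real.log (T + 3) + (Real.log 2 - Real.log 3)) := by positivity
  rw [discError]
  generalize d * Real.log 2 + 3 / 2 * Real.log (DK K) + 2 * Real.log (Ideal.absNorm 𝔣) +
      3 / 2 * nK K * (Real.log (T + 3) + (Real.log 2 - Real.log 3)) = B at *
  generalize leftLog K 𝔣 d T + 2 * nK K * Real.log 2 = A at *
  have hR : 0 < 2 + r := by linarith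
  have h1r : 0 ≤ (1 - r) / 3 := by linarith
  have hX0 : 0 ≤ nK K * (26 / 25) + (1 - r) / 3 * B := by positivity
  have hX : nK K * (3 / 2 * Real.log 5 - 2 * Real.log 2) + (1 - r) / 3 * A ≤
      nK K * (26 / 25) + (1 - r) / 3 * B := by
    gcongr
    linarith
  have hdiv : 2 * (nK K * (3 / 2 * Real.log 5 - 2 * Real.log 2) + (1 - r) / 3 * A) /
      (Real.pi * (2 + r)) ≤ 2 * (nK K * (26 / 25) + (1 - r) / 3 * B) / (3 * (2 + r)) := by
    gcongr
    exact Real.pi_gt_three.le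
  calc _ ≤ (2 * (nK K * (26 / 25) + (1 - r) / 3 * B) / (3 * (2 + r)) + B / 3 / 2 +
        (nK K + 3 * d) / (2 + r) ^ 2) * (2 + r) ^ 2 := by gcongr
    _ = _ := by
      field_simp
      ring

theorem quadratic_margins {r : ℝ} (hr0 : 0 < r) (hr1 : r ≤ 1) {P Q : ℝ}
    (hP : P = 4 + 4 * r - 3 * r ^ 2)
    (hQ : Q = 2 * (1 - r) * (2 + r) / 9 + (2 + r) ^ 2 / 6) :
    0 ≤ Q ∧ 0 ≤ 4 * P - 6 * Q ∧ 0 ≤ 2 * P - 4 * Q ∧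
      0 ≤ P * (209 / 50) - 2 * (2 * (26 / 25 * (2 / 3)) * (2 + r) + 2 + 21 / 10 * Q) ∧
      0 ≤ 4 * P * (1 + r) - 2 * (2 + r) ^ 2 - 2 * r * (Q + 3) := by
  subst hP hQ
  have h := mul_nonneg hr0.le (sub_nonneg.2 hr1)
  refine ⟨by nlinarith, by nlinarith, by nlinarith, by nlinarith, ?_⟩
  nlinarith [mul_nonneg (sq_nonneg r) (sub_nonneg.2 hr1)]

theorem count_le_of_mul_le {N r : ℝ} (d : ℕ) {T : ℝ} (hT : 0 ≤ T) (hr0 : 0 < r) (hr1 : r ≤ 1)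
    (h : N * (1 / (2 * r) - 2 * r / (2 + r) ^ 2) ≤
      (1 + d) / r + discError K ⊤ 1 0 r + discError K 𝔣 d T r) :
    N ≤ (4 * Real.log (DK K) + 2 * Real.log (Ideal.absNorm 𝔣) +
      2 * nK K * Real.log (T + 3) + 2 * nK K + 4 + 4 * d) * r + 4 + 4 * d := by
  have e1 := discError_mul_le (K := K) (𝔣 := 𝔣) d hT hr0 hr1
  have e0 := discError_mul_le (K := K) (𝔣 := ⊤) 1 le_rfl hr0 hr1
  rw [Ideal.absNorm_top, Nat.cast_one, Real.log_one, zero_add, mul_zero, one_mul, mul_one,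
    add_sub_cancel] at e0
  have hn := nK_pos (K := K)
  have hd : (0 : ℝ) ≤ d := Nat.cast_nonneg d
  have h2 := Real.log_pos one_lt_two
  have h2' := Real.log_two_lt_d9
  have h2'' := Real.log_two_gt_d9
  have h3 := nineteen_mul_log_two_le
  have hT3 : Real.log 3 ≤ Real.log (T + 3) := Real.log_le_log (by norm_num) (by linarith)
  have hℓ := Real.log_natCast_nonneg (DK K)
  have hF := Real.log_natCast_nonneg (Ideal.absNorm 𝔣)
  generalize Real.log (T + 3) = t at *
  generalize Real.log (DK K) = ℓ at *
  generalize Real.log (Ideal.absNorm 𝔣) = F at *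
  generalize Real.log 2 = a at *
  generalize Real.log 3 = c at *
  generalize discError K 𝔣 d T r = D₁ at *
  generalize discError K ⊤ 1 0 r = D₀ at *
  generalize (nK K : ℝ) = n at *
  generalize (d : ℝ) = d at *
  have hR : 0 < 2 + r := by linarith
  have hP : 0 < 4 + 4 * r - 3 * r ^ 2 := by nlinarith
  have hmul : N * (4 + 4 * r - 3 * r ^ 2) ≤
      2 * (1 + d) * (2 + r) ^ 2 + 2 * r * (D₀ * (2 + r) ^ 2 + D₁ * (2 + r) ^ 2) := by
    have h' := mul_le_mul_of_nonneg_right h (show 0 ≤ 2 * r * (2 + r) ^ 2 by positivity)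
    have l : N * (1 / (2 * r) - 2 * r / (2 + r) ^ 2) * (2 * r * (2 + r) ^ 2) =
        N * (4 + 4 * r - 3 * r ^ 2) := by
      field_simp
      ring
    have rr : ((1 + d) / r + D₀ + D₁) * (2 * r * (2 + r) ^ 2) =
        2 * (1 + d) * (2 + r) ^ 2 + 2 * r * (D₀ * (2 + r) ^ 2 + D₁ * (2 + r) ^ 2) := by
      field_simp
      ring
    rwa [l, rr] at h'
  refine le_of_mul_le_mul_right (hmul.trans ?_) hP
  set Q := 2 * (1 - r) * (2 + r) / 9 + (2 + r) ^ 2 / 6 with hQ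
  set P := 4 + 4 * r - 3 * r ^ 2 with hPd
  obtain ⟨q0, p1, p2, q3, q4⟩ := quadratic_margins hr0 hr1 hPd hQ
  have p3 : 0 ≤ P * (2 * c + 2) - 2 * (2 * (26 / 25 * (2 / 3)) * (2 + r) + 2 + 3 * (Q * a)) := by
    have b1 : P * (109 / 100) ≤ P * c := mul_le_mul_of_nonneg_left (by linarith) hP.le
    have b2 : Q * a ≤ Q * (7 / 10) := mul_le_mul_of_nonneg_left (by linarith) q0
    linarith
  have p4 : 0 ≤ 4 * P * (1 + r) - 2 * (2 + r) ^ 2 - 2 * r * (a * Q + 3) := by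
    have b2 : r * (Q * a) ≤ r * (Q * 1) := by gcongr; linarith
    linarith
  have p5 : 0 ≤ (2 * P - 3 * Q) * (t - c) := mul_nonneg (by linarith) (by linarith)
  have m1 := mul_nonneg (mul_nonneg hr0.le hℓ) p1
  have m2 := mul_nonneg (mul_nonneg hr0.le hF) p2
  have m3 := mul_nonneg (mul_nonneg hr0.le hn.le) (add_nonneg p3 p5)
  have m4 := mul_nonneg (add_nonneg zero_le_one hd) p4
  have m0 := mul_le_mul_of_nonneg_left (add_le_add e0 e1) (mul_nonneg zero_le_two hr0.le)
  linear_combination m0 + m1 + m2 + m3 + m4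

end Count

section Comparison

open IsDedekindDomain

theorem eq_of_eq_of_one_lt_re {F G : ℂ → ℂ} (hF : DifferentiableOn ℂ F {z | -2 < z.re ∧ z ≠ 1})
    (hG : DifferentiableOn ℂ G {z | -2 < z.re ∧ z ≠ 1}) (h : ∀ z, 1 < z.re → F z = G z)
    {z : ℂ} (hz : -2 < z.re) (hz1 : z.re < 1) : F z = G z := by
  obtain ⟨ε, hε, hεz⟩ : ∃ ε : ℝ, (ε = 1 ∨ ε = -1) ∧ z.re - 1 < ε * z.im := by
    rcases le_total 0 z.im with h0 | h0
    · exact ⟨1, .inl rfl, by linarith⟩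
    · exact ⟨-1, .inr rfl, by linarith⟩
  have hεε : ε * ε = 1 := by rcases hε with rfl | rfl <;> norm_num
  set V : Set ℂ := {w | -2 < w.re} ∩ {w | w.re - ε * w.im < 1} with hV
  have hVo : IsOpen V := (isOpen_lt continuous_const continuous_re).inter
    (isOpen_lt (by fun_prop) continuous_const)
  have hVc : IsPreconnected V := by
    refine ((convex_halfSpace_re_gt (-2)).inter ?_).isPreconnected
    exact convex_halfSpace_lt (f := fun w : ℂ => w.re - ε * w.im)
      ⟨fun x y => by simp only [add_re, add_im]; ring,
        fun c x => by simp only [real_smul, re_ofReal_mul, im_ofReal_mul, smul_eq_mul]; ring⟩ 1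
  have hVs : V ⊆ {z | -2 < z.re ∧ z ≠ 1} := fun w hw => ⟨hw.1, fun h1 => by
    have h2 : w.re - ε * w.im < 1 := hw.2
    rw [h1, one_re, one_im] at h2
    linarith⟩
  have h0 : (⟨2, 3 * ε⟩ : ℂ) ∈ V := ⟨show (-2 : ℝ) < 2 by norm_num,
    show 2 - ε * (3 * ε) < 1 by linarith⟩
  refine ((hF.mono hVs).analyticOnNhd hVo).eqOn_of_preconnected_of_eventuallyEq
    ((hG.mono hVs).analyticOnNhd hVo) hVc h0 ?_ ⟨hz, show z.re - ε * z.im < 1 by linarith⟩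
  filter_upwards [(isOpen_lt continuous_const continuous_re).mem_nhds
    (show (1 : ℝ) < (⟨2, 3 * ε⟩ : ℂ).re by norm_num)] with w hw using h w hw

variable {K : Type*} [Field K] [NumberField K] {𝔮 𝔣 : Ideal (𝓞 K)}

theorem isCoprime_of_forall_not_dvd (h𝔮 : 𝔮 ≠ ⊥) {𝔞 : Ideal (𝓞 K)}
    (h : ∀ P : HeightOneSpectrum (𝓞 K), P.asIdeal ∣ 𝔮 → ¬ P.asIdeal ∣ 𝔞) : IsCoprime 𝔞 𝔮 := by
  rw [Ideal.isCoprime_iff_sup_eq]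
  by_contra hne
  obtain ⟨M, hM, hle⟩ := Ideal.exists_le_maximal _ hne
  obtain ⟨h1, h2⟩ := sup_le_iff.1 hle
  exact h ⟨M, hM.isPrime, fun h0 => h𝔮 (le_bot_iff.1 (h0 ▸ h2))⟩ (Ideal.dvd_iff_le.2 h2)
    (Ideal.dvd_iff_le.2 h1)

omit [NumberField K] in
theorem not_isCoprime_of_dvd (P : HeightOneSpectrum (𝓞 K)) {𝔞 : Ideal (𝓞 K)}
    (h1 : P.asIdeal ∣ 𝔮) (h2 : P.asIdeal ∣ 𝔞) : ¬ IsCoprime 𝔞 𝔮 := fun h => by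
  rw [Ideal.isCoprime_iff_sup_eq] at h
  exact P.isPrime.ne_top (top_le_iff.1 (h ▸ sup_le (Ideal.le_of_dvd h2) (Ideal.le_of_dvd h1)))

variable {χ : HeckeChar K 𝔮} {χ' : HeckeChar K 𝔣}

theorem LSer_modulus_bot {χ : HeckeChar K (⊥ : Ideal (𝓞 K))} (s : ℂ) : LSer χ s = 1 := by
  rw [LSer, tsum_eq_single ⟨⊤, top_ne_bot⟩]
  · rw [χ.map_top, Ideal.absNorm_top, Nat.cast_one, one_cpow, one_mul]
  · rintro ⟨𝔞, h0⟩ hne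
    rw [χ.eq_zero', zero_mul]
    rw [Ideal.isCoprime_iff_sup_eq, sup_bot_eq]
    exact fun h => hne (Subtype.ext h)

theorem Induces.not_isTrivialChar (h : Induces χ' χ) (hχ : ¬ IsTrivialChar χ) :
    ¬ IsTrivialChar χ' := fun h' => hχ fun 𝔞 h𝔞 => by
  rw [h.2 𝔞 h𝔞]
  refine h' 𝔞 ?_
  rw [Ideal.isCoprime_iff_sup_eq] at h𝔞 ⊢
  exact top_le_iff.1 (h𝔞 ▸ sup_le_sup_left h.1 𝔞)

theorem Induces.exists_mul_eq (h : Induces χ' χ) (h𝔮 : 𝔮 ≠ ⊥) :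
    ∃ E : ℂ → ℂ, Differentiable ℂ E ∧ (∀ z, 0 < z.re → E z ≠ 0) ∧
      ∀ z, 1 < z.re → LSer χ z = E z * idealSer χ'.hom z := by
  classical
  set T := (Ideal.finite_factors h𝔮).toFinset with hT
  have hmem : ∀ P : HeightOneSpectrum (𝓞 K), P ∈ T ↔ P.asIdeal ∣ 𝔮 := fun P => by
    rw [hT, Set.Finite.mem_toFinset, Set.mem_ofPred_eq]
  have hN : ∀ P : HeightOneSpectrum (𝓞 K), Ideal.absNorm P.asIdeal ≠ 0 := fun P =>
    (zero_lt_one.trans (one_lt_absNorm P)).ne'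
  refine ⟨fun z => ∏ P ∈ T, (1 - χ'.hom P.asIdeal * (Ideal.absNorm P.asIdeal : ℂ) ^ (-z)),
    ?_, fun z hz => Finset.prod_ne_zero_iff.2 fun P _ h1 => ?_, fun z hz => ?_⟩
  · refine Differentiable.fun_finsetProd fun P _ => ?_
    refine (differentiable_const _).sub ((differentiable_const _).mul ?_)
    exact differentiable_neg.const_cpow (.inl (Nat.cast_ne_zero.2 (hN P)))
  · have h2 : ‖χ'.hom P.asIdeal * (Ideal.absNorm P.asIdeal : ℂ) ^ (-z)‖ < 1 := by
      rw [norm_mul, norm_natCast_cpow_of_pos (Nat.pos_of_ne_zero (hN P)), neg_re]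
      exact (mul_le_of_le_one_left (by positivity) (χ'.norm_le_one _)).trans_lt
        (rpow_neg_lt_one hz (one_lt_absNorm P))
    rw [← sub_eq_zero.1 h1, norm_one] at h2
    exact lt_irrefl _ h2
  · rw [LSer_eq_idealSer]
    refine idealSer_eq_prod_mul χ'.norm_le_one (g := χ.hom) T ?_ ?_ hz
    · rintro 𝔞 ⟨P, hP, hd⟩
      exact χ.eq_zero' _ (not_isCoprime_of_dvd P ((hmem P).1 hP) hd)
    · exact fun 𝔞 h𝔞 => h.2 𝔞 (isCoprime_of_forall_not_dvd h𝔮 fun P hP => h𝔞 P ((hmem P).2 hP))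

theorem exists_isStripFun (χ' : HeckeChar K 𝔣) (h : Induces χ' χ) (h𝔣 : 𝔣 ≠ ⊥) :
    ∃ (d : ℕ) (f : ℂ → ℂ), IsStripFun χ' d f ∧ delta χ = d := by
  by_cases hχ : IsTrivialChar χ
  · obtain ⟨f, hf⟩ := exists_isStripFun_one χ' h𝔣
    exact ⟨1, f, hf, by rw [delta, if_pos hχ, Nat.cast_one]⟩
  · obtain ⟨f, hf⟩ := exists_isStripFun_zero χ' h𝔣 (h.not_isTrivialChar hχ)
    exact ⟨0, f, hf, by rw [delta, if_neg hχ, Nat.cast_zero]⟩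

theorem zeroOrderAtLeast_of_mul_eq {L f E : ℂ → ℂ} {d : ℕ} (hE : Differentiable ℂ E)
    (hE0 : ∀ z, 0 < z.re → E z ≠ 0)
    (h : ∀ z : ℂ, -2 < z.re → z.re < 1 → L z * ((z - 1) / (z + 2)) ^ d = E z * f z)
    {ρ : ℂ} (h0 : 0 < ρ.re) (h1 : ρ.re < 1) {m : ℕ} (hm : ZeroOrderAtLeast L ρ m) :
    ZeroOrderAtLeast f ρ m := by
  obtain ⟨g, hg, hL⟩ := hm
  refine ⟨fun z => g z * ((z - 1) / (z + 2)) ^ d / E z, ?_, ?_⟩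
  · have h2 : ρ + 2 ≠ 0 := fun h => by
      have := congrArg re h
      rw [add_re, re_ofNat, zero_re] at this
      linarith
    have h3 : AnalyticAt ℂ (fun z : ℂ => (z - 1) / (z + 2)) ρ :=
      AnalyticAt.fun_div (by fun_prop) (by fun_prop) h2
    exact (hg.mul (h3.pow d)).div (hE.analyticAt ρ) (hE0 ρ h0)
  · filter_upwards [hL, (isOpen_lt continuous_const continuous_re).mem_nhds h0,
      (isOpen_lt continuous_re continuous_const).mem_nhds h1] with z hz hz0 hz1
    have hz0' : 0 < z.re := hz0
    have hE' := hE0 z hz0'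
    have := h z (by linarith) hz1
    rw [hz] at this
    field_simp at this ⊢
    linear_combination -this

end Comparison

/-- **Zeros in a circle, classical bound** (Lemma 2.5). For a Hecke character `χ`,
`s = σ + it` with `σ > 1`, and `0 < r ≤ 1`, the number `N_χ(r;s)` of non-trivial zeros
`ρ` of `L(s,χ)` with `|s - ρ| ≤ r`, counted with multiplicity, satisfies
`N_χ(r;s) ≤ {4 log D_K + 2 log N𝔣_χ + 2 n_K log(|t|+3) + 2 n_K + 4 + 4δ(χ)} r + 4 + 4δ(χ)`. -/
theorem zeros_in_circle_classical
    (K : Type) [Field K] [NumberField K] (𝔮 : Ideal (𝓞 K)) (χ : HeckeChar K 𝔮)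
    (L : ℂ → ℂ) (𝔣 : Ideal (𝓞 K)) (s : ℂ) (r : ℝ)
    (hL : IsLFun χ L) (h𝔣 : IsConductor χ 𝔣)
    (hσ : 1 < s.re) (hr0 : 0 < r) (hr1 : r ≤ 1) :
    ∀ (S : Finset ℂ) (m : ℂ → ℕ),
      (∀ ρ ∈ S, 0 < ρ.re ∧ ρ.re < 1 ∧ L ρ = 0 ∧ ‖s - ρ‖ ≤ r ∧
        ZeroOrderAtLeast L ρ (m ρ)) →
      (∑ ρ ∈ S, (m ρ : ℝ)) ≤
        (4 * Real.log (DK K : ℝ) + 2 * Real.log (Ideal.absNorm 𝔣 : ℝ) +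
          2 * (nK K : ℝ) * Real.log (|s.im| + 3) + 2 * (nK K : ℝ) + 4 + 4 * delta χ) * r +
          4 + 4 * delta χ := by
  intro S m hS
  have hLd : DifferentiableOn ℂ L {z | -2 < z.re ∧ z ≠ 1} := fun z hz =>
    (hL.1 z hz.2).differentiableWithinAt
  by_cases h𝔮 : 𝔮 = ⊥
  · subst h𝔮
    have hS0 : S = ∅ := Finset.eq_empty_of_forall_notMem fun ρ hρ => by
      obtain ⟨h0, h1, h2, -⟩ := hS ρ hρ
      have := eq_of_eq_of_one_lt_re hLd (differentiableOn_const (1 : ℂ))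
        (fun z hz => (hL.2 z hz).trans (LSer_modulus_bot z)) (by linarith) h1
      exact one_ne_zero (this.symm.trans h2)
    have hδ : 0 ≤ delta χ := by
      rw [delta]
      split_ifs <;> norm_num
    have h1 := Real.log_natCast_nonneg (DK K)
    have h2 := Real.log_natCast_nonneg (Ideal.absNorm 𝔣)
    have h3 : 0 ≤ Real.log (|s.im| + 3) := Real.log_nonneg (by linarith [abs_nonneg s.im])
    rw [hS0, Finset.sum_empty]
    positivity
  obtain ⟨⟨χ', hχ'⟩, -⟩ := h𝔣
  have h𝔣0 : 𝔣 ≠ ⊥ := fun h => h𝔮 (le_bot_iff.1 (h ▸ hχ'.1))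
  obtain ⟨d, f, hf, hd⟩ := exists_isStripFun χ' hχ' h𝔣0
  obtain ⟨E, hE, hE0, hLE⟩ := hχ'.exists_mul_eq h𝔮
  have hLf : ∀ z : ℂ, -2 < z.re → z.re < 1 → L z * ((z - 1) / (z + 2)) ^ d = E z * f z := by
    intro z hz hz1
    refine eq_of_eq_of_one_lt_re (F := fun z => L z * ((z - 1) / (z + 2)) ^ d)
      (G := fun z => E z * f z) ?_ ?_ (fun z hz => ?_) hz hz1
    · refine hLd.mul (DifferentiableOn.pow (DifferentiableOn.div (by fun_prop) (by fun_prop)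
        fun z hz h => ?_) d)
      have h1 := congrArg re h
      rw [add_re, re_ofNat, zero_re] at h1
      linarith [show -2 < z.re from hz.1]
    · exact hE.differentiableOn.mul (hf.differentiableOn.mono fun z hz => hz.1)
    · rw [hL.2 z hz, hLE z hz, hf.eq_idealSer z hz]
      ring
  rw [hd]
  refine count_le_of_mul_le d (abs_nonneg s.im) hr0 hr1
    (hf.sum_order_mul_le (t := s.im) h𝔣0 hr0 hr1 S m fun ρ hρ => ?_)
  obtain ⟨h0, h1, h2, h3, h4⟩ := hS ρ hρ
  refine ⟨h1, le_trans ?_ h3, ?_, zeroOrderAtLeast_of_mul_eq hE hE0 hLf h0 h1 h4⟩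
  · rw [norm_def, norm_def]
    refine Real.sqrt_le_sqrt ?_
    simp only [normSq_apply, sub_re, sub_im, add_re, add_im, one_re, one_im, re_ofReal_mul,
      im_ofReal_mul, I_re, I_im]
    nlinarith
  · have h5 := hLf ρ (by linarith) h1
    rw [h2, zero_mul] at h5
    exact (mul_eq_zero.1 h5.symm).resolve_left (hE0 ρ h0)

end RTZ
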